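/- Let A be a unital separable simple C*-algebra with TR(A) = 0 and a unique tracial state, and let α be an automorphism of A such that α^r is approximately inner for some integer r ≥ 1 and α^m is uniformly outer for every nonzero integer m. Then α has the tracial cyclic Rokhlin property. Moreover, if C is a unital simple C*-algebra with the SP-property containing A as a C*-subalgebra with the same unit, and u ∈ C is a unitary with u a u* = α(a) for all a ∈ A such that C is generated as a C*-algebra by A ∪ {u}, then TR(C) = 0. -/

import Mathlib

open Filter Topology

/-- A projection in a C*-algebra: a self-adjoint idempotent. -/
def IsProjection {A : Type*} [Mul A] [Star A] (p : A) : Prop :=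
  IsSelfAdjoint p ∧ IsIdempotentElem p

/-- A positive element of a C*-algebra (one of the standard equivalent definitions). -/
def IsPos {A : Type*} [Mul A] [Star A] (a : A) : Prop :=
  ∃ b : A, a = star b * b

/-- A central sequence: asymptotically commutes with every element. -/
def IsCentralSeq {A : Type*} [CStarAlgebra A] (x : ℕ → A) : Prop :=
  ∀ a : A, Tendsto (fun n => ‖x n * a - a * x n‖) atTop (nhds 0)

/-- An approximately inner map: on every finite set it is approximated by `a ↦ v* a v`
for unitaries `v`. -/
def ApproxInner {A : Type*} [CStarAlgebra A] (f : A → A) : Prop :=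
  ∀ (F : Finset A) (ε : ℝ), 0 < ε →
    ∃ v : A, v ∈ unitary A ∧ ∀ a ∈ F, ‖f a - star v * a * v‖ < ε

/-- Murray–von Neumann equivalence of projections. -/
def MvNEquiv {A : Type*} [CStarAlgebra A] (p q : A) : Prop :=
  ∃ w : A, star w * w = p ∧ w * star w = q

/-- `[a] ≤ [b]`: there is `x` with `a = x*x` and `xx*` in the closure of `bAb`. -/
def CuntzLE {A : Type*} [CStarAlgebra A] (a b : A) : Prop :=
  ∃ x : A, a = star x * x ∧ x * star x ∈ closure (Set.range fun c => b * c * b)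

/-- A simple C*-algebra: the only closed two-sided ideals are trivial. -/
def IsSimpleCStar (A : Type*) [CStarAlgebra A] : Prop :=
  ∀ I : TwoSidedIdeal A, IsClosed (I : Set A) →
    (I : Set A) = {0} ∨ (I : Set A) = Set.univ

/-- A tracial state on a unital C*-algebra. -/
def IsTracialState {A : Type*} [CStarAlgebra A] (τ : A →ₗ[ℂ] ℂ) : Prop :=
  (∀ a : A, ∃ r : ℝ, 0 ≤ r ∧ τ (star a * a) = (r : ℂ)) ∧
  τ 1 = 1 ∧ ∀ a b : A, τ (a * b) = τ (b * a)

/-- The SP-property: every hereditary subalgebra `\overline{aAa}` (`a` positive nonzero)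
contains a nonzero projection. -/
def SPProperty (A : Type*) [CStarAlgebra A] : Prop :=
  ∀ a : A, IsPos a → a ≠ 0 →
    ∃ p : A, IsProjection p ∧ p ≠ 0 ∧ p ∈ closure (Set.range fun c => a * c * a)

/-- Stable rank one: invertibles are dense. -/
def StableRankOne (A : Type*) [CStarAlgebra A] : Prop :=
  Dense {x : A | IsUnit x}

/-- The Fundamental Comparison Property. -/
def FundamentalComparison (A : Type*) [CStarAlgebra A] : Prop :=
  ∀ p q : A, IsProjection p → IsProjection q →
    (∀ τ : A →ₗ[ℂ] ℂ, IsTracialState τ → (τ p).re < (τ q).re) →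
    ∃ q' : A, IsProjection q' ∧ q' * q = q' ∧ q * q' = q' ∧ MvNEquiv p q'

/-- Tracial (topological) rank zero for a simple unital C*-algebra. -/
def TracialRankZero (A : Type*) [CStarAlgebra A] : Prop :=
  ∀ (F : Finset A) (ε : ℝ), 0 < ε → ∀ a : A, IsPos a → a ≠ 0 →
    ∃ (B : NonUnitalStarSubalgebra ℂ A) (p : A),
      FiniteDimensional ℂ B ∧ IsProjection p ∧ p ∈ B ∧
      (∀ b ∈ B, p * b = b ∧ b * p = b) ∧
      (∀ x ∈ F, ‖x * p - p * x‖ < ε) ∧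
      (∀ x ∈ F, ∃ b ∈ B, ‖p * x * p - b‖ < ε) ∧
      CuntzLE (1 - p) a

/-- The tracial Rokhlin property for an automorphism. -/
def TracialRokhlin {A : Type*} [CStarAlgebra A] (α : A ≃⋆ₐ[ℂ] A) : Prop :=
  ∀ (F : Finset A) (ε : ℝ), 0 < ε → ∀ n : ℕ, ∀ x : A, IsPos x → x ≠ 0 →
    ∃ e : Fin (n + 1) → A,
      (∀ j, IsProjection (e j)) ∧
      (∀ i j, i ≠ j → e i * e j = 0) ∧
      (∀ j : Fin (n + 1), (j : ℕ) < n → ‖α (e j) - e (j + 1)‖ < ε) ∧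
      (∀ j, ∀ a ∈ F, ‖e j * a - a * e j‖ < ε) ∧
      CuntzLE (1 - ∑ j, e j) x

/-- The tracial cyclic Rokhlin property for an automorphism: as the tracial
Rokhlin property, but with the cyclic condition `‖α(e n) - e 0‖ < ε` included
(in `Fin (n+1)`, `j + 1` wraps around, so `e (n + 1) = e 0`). -/
def TracialCyclicRokhlin {A : Type*} [CStarAlgebra A] (α : A ≃⋆ₐ[ℂ] A) : Prop :=
  ∀ (F : Finset A) (ε : ℝ), 0 < ε → ∀ n : ℕ, ∀ x : A, IsPos x → x ≠ 0 →
    ∃ e : Fin (n + 1) → A,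
      (∀ j, IsProjection (e j)) ∧
      (∀ i j, i ≠ j → e i * e j = 0) ∧
      (∀ j : Fin (n + 1), ‖α (e j) - e (j + 1)‖ < ε) ∧
      (∀ j, ∀ a ∈ F, ‖e j * a - a * e j‖ < ε) ∧
      CuntzLE (1 - ∑ j, e j) x

/-- Integer powers of an automorphism, as a function. -/
def autZPow {A : Type*} [CStarAlgebra A] (α : A ≃⋆ₐ[ℂ] A) (m : ℤ) : A → A :=
  if 0 ≤ m then (⇑α)^[m.toNat] else (⇑α.symm)^[(-m).toNat]

/-- A uniformly outer map. -/
def UniformlyOuter {A : Type*} [CStarAlgebra A] (f : A → A) : Prop :=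
  ∀ (a p : A), IsProjection p → ∀ ε : ℝ, 0 < ε →
    ∃ (n : ℕ) (q : Fin n → A),
      (∀ i, IsProjection (q i)) ∧ (∑ i, q i) = p ∧
      ∀ i, ‖q i * a * f (q i)‖ < ε

namespace RK
set_option linter.all false
section trace
variable {A : Type*} [CStarAlgebra A] [PartialOrder A] [StarOrderedRing A]

/-- real part of the trace -/
noncomputable def tr (τ : A →ₗ[ℂ] ℂ) (x : A) : ℝ := (τ x).re
/-- the 2-norm -/
noncomputable def n2 (τ : A →ₗ[ℂ] ℂ) (x : A) : ℝ := Real.sqrt (tr τ (star x * x))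

theorem isPos_iff {a : A} : IsPos a ↔ 0 ≤ a :=
  (CStarAlgebra.nonneg_iff_eq_star_mul_self (a := a)).symm

variable {τ : A →ₗ[ℂ] ℂ}

@[simp] theorem tr_add (x y : A) : tr τ (x + y) = tr τ x + tr τ y := by simp [tr]
@[simp] theorem tr_sub (x y : A) : tr τ (x - y) = tr τ x - tr τ y := by simp [tr]
@[simp] theorem tr_neg (x : A) : tr τ (-x) = - tr τ x := by simp [tr]
@[simp] theorem tr_zero : tr τ (0 : A) = 0 := by simp [tr]
theorem tr_smul (c : ℝ) (x : A) : tr τ (c • x) = c * tr τ x := by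
  have : c • x = (c : ℂ) • x := by simp
  rw [this]; simp [tr]
theorem tr_sum {ι : Type*} (s : Finset ι) (f : ι → A) :
    tr τ (∑ i ∈ s, f i) = ∑ i ∈ s, tr τ (f i) := by
  simp [tr]


theorem tr_one (hτ : IsTracialState τ) : tr τ (1 : A) = 1 := by simp [tr, hτ.2.1]
theorem tr_comm (hτ : IsTracialState τ) (x y : A) : tr τ (x * y) = tr τ (y * x) := by simp [tr, hτ.2.2 x y]
theorem tau_nonneg (hτ : IsTracialState τ) {x : A} (hx : 0 ≤ x) : 0 ≤ (τ x).re ∧ (τ x).im = 0 := by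
  obtain ⟨b, rfl⟩ := CStarAlgebra.nonneg_iff_eq_star_mul_self.1 hx
  obtain ⟨r, hr, h⟩ := hτ.1 b
  rw [h]; simpa using hr
theorem tr_nonneg (hτ : IsTracialState τ) {x : A} (hx : 0 ≤ x) : 0 ≤ tr τ x := (tau_nonneg hτ hx).1
theorem tr_mono (hτ : IsTracialState τ) {x y : A} (h : x ≤ y) : tr τ x ≤ tr τ y := by
  have := tr_nonneg hτ (sub_nonneg.2 h); rw [tr_sub] at this; linarith
theorem tau_sa (hτ : IsTracialState τ) {x : A} (hx : IsSelfAdjoint x) : (τ x).im = 0 := by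
  have e : x = x⁺ - x⁻ := (CFC.posPart_sub_negPart x hx).symm
  rw [e, map_sub]
  have h1 := (tau_nonneg hτ (CFC.posPart_nonneg x)).2
  have h2 := (tau_nonneg hτ (CFC.negPart_nonneg x)).2
  simp [h1, h2]
theorem tau_star (hτ : IsTracialState τ) (x : A) : τ (star x) = star (τ x) := by
  obtain ⟨a, b, ha, hb, rfl⟩ : ∃ a b : A, IsSelfAdjoint a ∧ IsSelfAdjoint b ∧
      x = a + Complex.I • b :=
    ⟨realPart x, imaginaryPart x, (realPart x).2, (imaginaryPart x).2,
      (realPart_add_I_smul_imaginaryPart x).symm⟩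
  have h1 := tau_sa hτ ha
  have h2 := tau_sa hτ hb
  simp only [star_add, star_smul, ha.star_eq, hb.star_eq, map_add, map_smul]
  apply Complex.ext <;> simp [h1, h2]
theorem tr_star (hτ : IsTracialState τ) (x : A) : tr τ (star x) = tr τ x := by simp [tr, tau_star hτ]

theorem tr_star_mul_nonneg (hτ : IsTracialState τ) (x : A) : 0 ≤ tr τ (star x * x) := tr_nonneg hτ (star_mul_self_nonneg x)

theorem n2_sq (hτ : IsTracialState τ) (x : A) : n2 τ x ^ 2 = tr τ (star x * x) :=
  Real.sq_sqrt (tr_star_mul_nonneg hτ x)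
theorem n2_nonneg (x : A) : 0 ≤ n2 τ x := Real.sqrt_nonneg _

theorem n2_star (hτ : IsTracialState τ) (x : A) : n2 τ (star x) = n2 τ x := by
  unfold n2; rw [star_star, tr_comm hτ]

theorem cs (hτ : IsTracialState τ) (x y : A) : |tr τ (star x * y)| ≤ n2 τ x * n2 τ y := by
  have key : ∀ s : ℝ, 0 ≤ (tr τ (star x * x)) * (s * s) + (2 * tr τ (star x * y)) * s
      + tr τ (star y * y) := by
    intro s
    have h := tr_star_mul_nonneg hτ (s • x + y)
    have e : star (s • x + y) * (s • x + y) =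
      (s * s) • (star x * x) + s • (star x * y) + s • (star y * x) + star y * y := by
      simp [add_mul, mul_add, smul_smul]; abel
    rw [e] at h
    simp only [tr_add, tr_smul] at h
    have e2 : tr τ (star y * x) = tr τ (star x * y) := by
      rw [← tr_star hτ (star x * y)]; simp
    rw [e2] at h; nlinarith
  have := discrim_le_zero key
  unfold discrim at this
  have h1 := n2_sq hτ x; have h2 := n2_sq hτ y
  rw [← h1, ← h2] at this
  apply abs_le_of_sq_le_sq' _ (mul_nonneg (n2_nonneg x) (n2_nonneg y)) |> abs_le.2
  nlinarith

theorem cs' (hτ : IsTracialState τ) (x y : A) : |tr τ (x * y)| ≤ n2 τ x * n2 τ y := by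
  have := cs hτ (star x) y; rwa [star_star, n2_star hτ] at this

theorem n2_add (hτ : IsTracialState τ) (x y : A) : n2 τ (x + y) ≤ n2 τ x + n2 τ y := by
  apply abs_le_of_sq_le_sq' _ (add_nonneg (n2_nonneg x) (n2_nonneg y)) |>.2
  have e : star (x + y) * (x + y) =
      (star x * x) + (star x * y) + (star y * x) + star y * y := by
      simp [add_mul, mul_add]; abel
  rw [n2_sq hτ, e]
  have e2 : tr τ (star y * x) = tr τ (star x * y) := by
      rw [← tr_star hτ (star x * y)]; simp
  have := (abs_le.1 (cs hτ x y)).2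
  have h1 := n2_sq hτ x; have h2 := n2_sq hτ y
  simp only [tr_add, e2]; nlinarith

theorem n2_neg (x : A) : n2 τ (-x) = n2 τ x := by simp [n2]
theorem n2_sub (hτ : IsTracialState τ) (x y : A) : n2 τ (x - y) ≤ n2 τ x + n2 τ y := by
  rw [sub_eq_add_neg, ← n2_neg y]; exact n2_add hτ _ _
theorem n2_sub_comm (x y : A) : n2 τ (x - y) = n2 τ (y - x) := by rw [← n2_neg, neg_sub]
theorem n2_tri (hτ : IsTracialState τ) (x y z : A) : n2 τ (x - z) ≤ n2 τ (x - y) + n2 τ (y - z) := by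
  have := n2_add hτ (x - y) (y - z); simpa using this

theorem n2_sum (hτ : IsTracialState τ) {ι : Type*} (s : Finset ι) (f : ι → A) :
    n2 τ (∑ i ∈ s, f i) ≤ ∑ i ∈ s, n2 τ (f i) := by
  classical
  induction s using Finset.induction_on with
  | empty => simp [n2]
  | insert a s ha ih => rw [Finset.sum_insert ha, Finset.sum_insert ha]
                        exact (n2_add hτ _ _).trans (by gcongr)

theorem conj_le (x a : A) (ha : 0 ≤ a) : star x * a * x ≤ ‖a‖ • (star x * x) := by
  have h := CStarAlgebra.star_left_conjugate_le_norm_smul (a := x) (b := a) (hb := IsSelfAdjoint.of_nonneg ha)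
  simpa using h

theorem n2_mul_left (hτ : IsTracialState τ) (x y : A) : n2 τ (x * y) ≤ ‖x‖ * n2 τ y := by
  apply abs_le_of_sq_le_sq' _ (mul_nonneg (norm_nonneg x) (n2_nonneg y)) |>.2
  rw [n2_sq hτ, mul_pow, n2_sq hτ]
  have h := tr_mono hτ (conj_le y (star x * x) (star_mul_self_nonneg x))
  rw [tr_smul, CStarRing.norm_star_mul_self] at h
  have e : star (x * y) * (x * y) = star y * (star x * x) * y := by simp [mul_assoc]
  rw [e]; nlinarith

theorem n2_mul_right (hτ : IsTracialState τ) (x y : A) : n2 τ (x * y) ≤ n2 τ x * ‖y‖ := by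
  rw [← n2_star hτ, star_mul, ← n2_star hτ x, ← norm_star y, mul_comm]
  exact n2_mul_left hτ _ _

theorem n2_one (hτ : IsTracialState τ) : n2 τ (1 : A) = 1 := by simp [n2, tr_one hτ]
theorem n2_le_norm (hτ : IsTracialState τ) (x : A) : n2 τ x ≤ ‖x‖ := by
  have := n2_mul_left hτ x 1; rwa [mul_one, n2_one hτ, mul_one] at this
theorem abs_tr_le_n2 (hτ : IsTracialState τ) (x : A) : |tr τ x| ≤ n2 τ x := by
  have := cs' hτ 1 x; rwa [one_mul, n2_one hτ, one_mul] at this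
theorem abs_tr_le (hτ : IsTracialState τ) (x : A) : |tr τ x| ≤ ‖x‖ := (abs_tr_le_n2 hτ x).trans (n2_le_norm hτ x)
theorem tr_diff (hτ : IsTracialState τ) (x y : A) : |tr τ x - tr τ y| ≤ ‖x - y‖ := by
  rw [← tr_sub]; exact abs_tr_le hτ _
/-- for y positive, |τ(xy)| ≤ ‖x‖τ(y) -/
theorem abs_tr_mul_le (hτ : IsTracialState τ) (x y : A) (hy : 0 ≤ y) : |tr τ (x * y)| ≤ ‖x‖ * tr τ y := by
  obtain ⟨b, rfl⟩ := CStarAlgebra.nonneg_iff_eq_star_mul_self.1 hy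
  have h := cs' hτ (b * x) (star b)
  rw [n2_star hτ] at h
  have h2 := n2_mul_right hτ b x
  have e : tr τ (x * (star b * b)) = tr τ (b * x * star b) := by
    rw [← mul_assoc, tr_comm hτ, mul_assoc]
  rw [e, ← n2_sq hτ]
  refine h.trans ?_
  have := n2_nonneg (τ := τ) b
  nlinarith
theorem tr_mul_nonneg (hτ : IsTracialState τ) {x y : A} (hx : 0 ≤ x) (hy : 0 ≤ y) : 0 ≤ tr τ (x * y) := by
  obtain ⟨b, rfl⟩ := CStarAlgebra.nonneg_iff_eq_star_mul_self.1 hy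
  rw [← mul_assoc, tr_comm hτ, ← mul_assoc]
  exact tr_nonneg hτ (star_right_conjugate_nonneg hx b)
theorem tr_mul_mono (hτ : IsTracialState τ) {x y z : A} (hx : 0 ≤ x) (hy : y ≤ z) : tr τ (x * y) ≤ tr τ (x * z) := by
  have := tr_mul_nonneg hτ hx (sub_nonneg.2 hy)
  rw [mul_sub, tr_sub] at this; linarith
theorem norm_tau_le (hτ : IsTracialState τ) (x : A) : ‖τ x‖ ≤ ‖x‖ := by
  obtain ⟨c, hc, h⟩ : ∃ c : ℂ, ‖c‖ = 1 ∧ (‖τ x‖ : ℂ) = c * τ x := by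
    by_cases h0 : τ x = 0
    · exact ⟨1, by simp, by simp [h0]⟩
    · refine ⟨(‖τ x‖ : ℂ) / τ x, ?_, ?_⟩
      · rw [norm_div]; simp [h0]
      · field_simp
  have h1 := (abs_le.1 (abs_tr_le hτ (c • x))).2
  rw [norm_smul, hc, one_mul] at h1
  have : tr τ (c • x) = ‖τ x‖ := by
    unfold tr; rw [map_smul, smul_eq_mul, ← h]; simp
  linarith

/-- faithfulness -/
theorem faithful (hτ : IsTracialState τ) (hs : IsSimpleCStar A) {x : A} (h : tr τ (star x * x) = 0) : x = 0 := by
  have h0 : n2 τ x = 0 := by simp [n2, h]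
  let I : TwoSidedIdeal A := TwoSidedIdeal.mk' {y | n2 τ y = 0} (by simp [n2])
    (fun {a b} ha hb => le_antisymm (by have := n2_add hτ a b; simp only [Set.mem_ofPred_eq] at ha hb; linarith) (n2_nonneg _))
    (fun {a} ha => by simpa [n2_neg] using ha)
    (fun {a b} hb => le_antisymm (by have := n2_mul_left hτ a b; simp only [Set.mem_ofPred_eq] at hb; rw [hb] at this; simpa using this) (n2_nonneg _))
    (fun {a b} ha => le_antisymm (by have := n2_mul_right hτ a b; simp only [Set.mem_ofPred_eq] at ha; rw [ha] at this; simpa using this) (n2_nonneg _))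
  have hI : (I : Set A) = {y | n2 τ y = 0} := by ext y; exact TwoSidedIdeal.mem_mk' _ _ _ _ _ _ _
  have hc : IsClosed (I : Set A) := by
    rw [hI]
    have hcont : Continuous (fun y : A => n2 τ y) := by
      have : LipschitzWith 1 (fun y : A => n2 τ y) := by
        apply LipschitzWith.of_le_add
        intro x y
        have h1 := n2_add hτ y (x - y)
        have h2 := n2_le_norm hτ (x - y)
        rw [dist_eq_norm]; simp at h1; linarith
      exact this.continuous
    exact isClosed_eq hcont continuous_const
  rcases hs I hc with h1 | h1
  · have : x ∈ (I : Set A) := by rw [hI]; exact h0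
    rw [h1] at this; simpa using this
  · have : (1 : A) ∈ (I : Set A) := by rw [h1]; trivial
    rw [hI] at this; simp [n2_one hτ] at this

theorem tr_pos (hτ : IsTracialState τ) (hs : IsSimpleCStar A) {x : A} (hx : 0 ≤ x) (h : x ≠ 0) : 0 < tr τ x := by
  rcases (tr_nonneg hτ hx).lt_or_eq with h1 | h1
  · exact h1
  · obtain ⟨b, rfl⟩ := CStarAlgebra.nonneg_iff_eq_star_mul_self.1 hx
    exfalso; apply h; rw [faithful hτ hs h1.symm]; simp
end trace
end RK

namespace RK
set_option linter.all false
section proj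
variable {A : Type*} [CStarAlgebra A] [PartialOrder A] [StarOrderedRing A]

theorem _root_.IsProjection.isp {p : A} (h : IsProjection p) : IsStarProjection p := ⟨h.2, h.1⟩
theorem mkp {p : A} (h : IsStarProjection p) : IsProjection p := ⟨h.2, h.1⟩
theorem mkp' {p : A} (h1 : star p = p) (h2 : p * p = p) : IsProjection p := ⟨h1, h2⟩
theorem _root_.IsProjection.st {p : A} (h : IsProjection p) : star p = p := h.1
theorem _root_.IsProjection.mm {p : A} (h : IsProjection p) : p * p = p := h.2
theorem _root_.IsProjection.ss {p : A} (h : IsProjection p) : star p * p = p := by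
  rw [h.st, h.mm]
theorem _root_.IsProjection.nonneg {p : A} (h : IsProjection p) : 0 ≤ p := by
  rw [← h.ss]; exact star_mul_self_nonneg p
theorem _root_.IsProjection.one_sub {p : A} (h : IsProjection p) : IsProjection (1 - p) :=
  mkp h.isp.one_sub
theorem _root_.IsProjection.le_one {p : A} (h : IsProjection p) : p ≤ 1 :=
  sub_nonneg.1 h.one_sub.nonneg
theorem _root_.IsProjection.norm_le {p : A} (h : IsProjection p) : ‖p‖ ≤ 1 := by
  have h1 : ‖p‖ = ‖p‖ * ‖p‖ := by conv_lhs => rw [← h.ss, CStarRing.norm_star_mul_self]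
  nlinarith [norm_nonneg p]
theorem proj_zero : IsProjection (0 : A) := mkp' (by simp) (by simp)
theorem proj_one : IsProjection (1 : A) := mkp' (by simp) (by simp)

theorem proj_map {B F : Type*} [CStarAlgebra B] (β : A →⋆ₐ[ℂ] B) {p : A} (h : IsProjection p) :
    IsProjection (β p) := ⟨by rw [IsSelfAdjoint, ← map_star, h.st], by
      rw [IsIdempotentElem, ← map_mul, h.mm]⟩

/-- sub-projection, in multiplicative form: `p q = p` -/
theorem mul_swap {p q : A} (hp : IsProjection p) (hq : IsProjection q) (h : p * q = p) :
    q * p = p := by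
  have := congrArg star h; rwa [star_mul, hp.st, hq.st] at this
theorem mul_swap0 {p q : A} (hp : IsProjection p) (hq : IsProjection q) (h : p * q = 0) :
    q * p = 0 := by
  have := congrArg star h; rwa [star_mul, hp.st, hq.st, star_zero] at this
theorem proj_sub {p q : A} (hp : IsProjection p) (hq : IsProjection q) (h : p * q = p) :
    IsProjection (q - p) := by
  have h' := mul_swap hp hq h
  refine mkp' (by simp [hp.st, hq.st]) ?_
  simp [mul_sub, sub_mul, h, h', hp.mm, hq.mm]
theorem proj_le {p q : A} (hp : IsProjection p) (hq : IsProjection q) (h : p * q = p) : p ≤ q :=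
  sub_nonneg.1 (proj_sub hp hq h).nonneg
theorem proj_add {p q : A} (hp : IsProjection p) (hq : IsProjection q) (h : p * q = 0) :
    IsProjection (p + q) := by
  have h' := mul_swap0 hp hq h
  refine mkp' (by simp [hp.st, hq.st]) ?_
  simp [mul_add, add_mul, h, h', hp.mm, hq.mm]
theorem proj_sum {ι : Type*} [DecidableEq ι] (s : Finset ι) (f : ι → A) (hf : ∀ i ∈ s, IsProjection (f i))
    (ho : ∀ i ∈ s, ∀ j ∈ s, i ≠ j → f i * f j = 0) : IsProjection (∑ i ∈ s, f i) := by
  induction s using Finset.induction_on with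
  | empty => simpa using proj_zero
  | insert a s ha ih =>
    rw [Finset.sum_insert ha]
    refine proj_add (hf _ (by simp)) (ih (fun i hi => hf i (by simp [hi])) (fun i hi j hj => ho i (by simp [hi]) j (by simp [hj]))) ?_
    rw [Finset.mul_sum]
    exact Finset.sum_eq_zero fun i hi => ho _ (by simp) _ (by simp [hi]) (by rintro rfl; exact ha hi)

theorem eq_zero_of_star_mul {x : A} (h : star x * x = 0) : x = 0 := by
  simpa using h

theorem nonneg_eq_zero {x y : A} (hx : 0 ≤ x) (hxy : x ≤ y) (h : y = 0) : x = 0 :=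
  le_antisymm (h ▸ hxy) hx

/-- `0 ≤ a ≤ c p` implies `p a = a` -/
theorem hered {a p : A} (hp : IsProjection p) (ha : 0 ≤ a) {c : ℝ} (h : a ≤ c • p) :
    p * a = a ∧ a * p = a := by
  obtain ⟨b, rfl⟩ := CStarAlgebra.nonneg_iff_eq_star_mul_self.1 ha
  have h1 := star_left_conjugate_le_conjugate h (1 - p)
  have h2 : star (1 - p) * (c • p) * (1 - p) = 0 := by
    simp [hp.st, sub_mul, hp.mm]
  have h3 : b * (1 - p) = 0 := by
    apply eq_zero_of_star_mul
    refine nonneg_eq_zero (star_mul_self_nonneg _) ?_ h2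
    convert h1 using 1
    simp [mul_assoc]
  have h4 : b * p = b := by rw [mul_sub, mul_one, sub_eq_zero] at h3; exact h3.symm
  have h5 : p * star b = star b := by
    have := congrArg star h4; simpa [hp.st] using this
  exact ⟨by rw [← mul_assoc, h5], by rw [mul_assoc, h4]⟩

theorem proj_le_mul {p q : A} (hp : IsProjection p) (hq : IsProjection q) (h : p ≤ q) :
    p * q = p ∧ q * p = p := (hered hq hp.nonneg (c := 1) (by simpa using h)).symm

theorem sum_orth {n : ℕ} {q : Fin n → A} {p : A} (hp : IsProjection p) (hq : ∀ i, IsProjection (q i))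
    (h : ∑ i, q i = p) : (∀ i, q i * p = q i) ∧ ∀ i j, i ≠ j → q i * q j = 0 := by
  have hle : ∀ i, q i ≤ p := fun i => by
    rw [← h]; exact Finset.single_le_sum (f := q) (fun j _ => (hq j).nonneg) (Finset.mem_univ i)
  have h1 : ∀ i, q i * p = q i := fun i => (proj_le_mul (hq i) hp (hle i)).1
  refine ⟨h1, fun i j hij => ?_⟩
  have h2 : ∑ k ∈ Finset.univ.erase i, q i * q k * q i = 0 := by
    have h3 : ∑ k, q i * q k * q i = q i := by
      rw [← Finset.sum_mul, ← Finset.mul_sum, h, h1, (hq i).mm]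
    rw [← Finset.add_sum_erase _ _ (Finset.mem_univ i), (hq i).mm, (hq i).mm] at h3
    simpa using h3
  have h4 : q i * q j * q i = 0 := by
    have hnn : ∀ k, 0 ≤ q i * q k * q i := fun k => by
      have := star_left_conjugate_nonneg (hq k).nonneg (q i); rwa [(hq i).st] at this
    exact (Finset.sum_eq_zero_iff_of_nonneg (fun k _ => hnn k)).1 h2 j (by simp [hij.symm])
  have h5 : q j * q i = 0 := by
    apply eq_zero_of_star_mul
    rw [star_mul, (hq i).st, (hq j).st, mul_assoc, ← mul_assoc (q j), (hq j).mm, ← mul_assoc, h4]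
  exact mul_swap0 (hq j) (hq i) h5

/-- near-projections are near projections -/
theorem nearproj {x : A} (hx : IsSelfAdjoint x) {δ : ℝ} (hδ : δ ≤ 1/8) (h : ‖x * x - x‖ ≤ δ) :
    ∃ p, IsProjection p ∧ ‖p - x‖ ≤ 2 * δ ∧ (∃ c, p = x * c * x) ∧
      (∀ y, Commute x y → Commute p y) ∧
      (∀ B : NonUnitalStarSubalgebra ℂ A, IsClosed (B : Set A) → x ∈ B → p ∈ B) := by
  set f : ℝ → ℝ := fun t => max 0 (min 1 (4 * t - 3/2)) with hf
  have hfc : Continuous f := by fun_prop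
  set g : ℝ → ℝ := fun t => f t / (max t (3/8)) ^ 2 with hg
  have hgc : Continuous g := by
    apply Continuous.div hfc (by fun_prop)
    intro t; have : (3/8 : ℝ) ≤ max t (3/8) := le_max_right _ _
    positivity
  have hfg : ∀ t, f t = t * g t * t := by
    intro t
    by_cases ht : 3/8 < t
    · simp only [hg]; rw [max_eq_left ht.le]; have : t ≠ 0 := by linarith
      field_simp
    · have : f t = 0 := by simp only [hf]; apply max_eq_left; push Not at ht
                           apply (min_le_right _ _).trans; linarith
      simp [hg, this]
  have hspec : ∀ t ∈ spectrum ℝ x, |t * t - t| ≤ δ := by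
    intro t ht
    have h1 := norm_apply_le_norm_cfc (fun t : ℝ => t * t - t) x ht (by fun_prop) hx
    rw [cfc_sub (fun t : ℝ => t * t) (fun t => t) x, cfc_mul (fun t : ℝ => t) (fun t => t) x, cfc_id' ℝ x] at h1
    exact h1.trans h
  have hcase : ∀ t ∈ spectrum ℝ x, (f t = 0 ∧ |t| ≤ 2 * δ) ∨ (f t = 1 ∧ |1 - t| ≤ 2 * δ) := by
    intro t ht
    have h1 := hspec t ht
    have h2 : |t| * |1 - t| ≤ δ := by
      have e : |t| * |1 - t| = |t * t - t| := by
        rw [← abs_mul, ← abs_neg]; congr 1; ring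
      rw [e]; exact h1
    rcases le_or_gt t (3/8) with h3 | h3
    · left
      refine ⟨?_, ?_⟩
      · simp only [hf]; apply max_eq_left; apply (min_le_right _ _).trans; linarith
      · have : (1/2 : ℝ) ≤ |1 - t| := by rw [abs_of_nonneg] <;> linarith
        nlinarith [abs_nonneg t]
    · right
      have h5 : 5/8 ≤ t := by
        by_contra hcon; push Not at hcon
        have := (abs_le.1 h1).1; nlinarith
      refine ⟨?_, ?_⟩
      · simp only [hf]; rw [min_eq_left (by linarith), max_eq_right zero_le_one]
      · have : (1/2 : ℝ) ≤ |t| := by rw [abs_of_nonneg] <;> linarith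
        nlinarith [abs_nonneg (1 - t)]
  have hδ0 : 0 ≤ δ := (norm_nonneg _).trans h
  refine ⟨cfc f x, ⟨cfc_predicate f x, ?_⟩, ?_, ⟨cfc g x, ?_⟩, fun y hy => hy.cfc_real f, fun B hB hxB => ?_⟩
  · rw [IsIdempotentElem, ← cfc_mul f f x]
    apply cfc_congr
    intro t ht
    rcases hcase t ht with h | h <;> simp [h.1]
  · nth_rewrite 2 [← cfc_id' ℝ x]
    rw [← cfc_sub f (fun t => t) x]
    apply norm_cfc_le (by linarith)
    intro t ht
    rcases hcase t ht with h | h <;> simp only [h.1, Real.norm_eq_abs]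
    · simpa using h.2
    · exact h.2
  · have e : f = fun t => t * g t * t := funext hfg
    rw [e, cfc_mul (fun t => t * g t) (fun t => t) x (by fun_prop), cfc_mul (fun t => t) g x (by fun_prop) hgc.continuousOn, cfc_id' ℝ x]
  · rw [← cfcₙ_eq_cfc (f := f) (a := x) (by fun_prop) (by simp [hf]; norm_num)]
    have : IsClosed (B : Set A) := hB
    exact cfcₙ_mem (𝕜' := ℂ) f hxB

/-- inverse square roots -/
theorem invsqrt {y : A} (hy : IsSelfAdjoint y) {c : ℝ} (hc : 0 < c) (h : algebraMap ℝ A c ≤ y) :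
    ∃ s : A, IsSelfAdjoint s ∧ s * y * s = 1 ∧ s * s * y = 1 ∧ (∀ z, Commute y z → Commute s z) ∧
      ∀ δ : ℝ, δ ≤ 1/2 → ‖y - 1‖ ≤ δ → ‖s - 1‖ ≤ δ := by
  have hsp : ∀ t ∈ spectrum ℝ y, c ≤ t := (algebraMap_le_iff_le_spectrum (R := ℝ) hy).1 h
  set f : ℝ → ℝ := fun t => (Real.sqrt t)⁻¹ with hf
  have hfc : ContinuousOn f (spectrum ℝ y) := by
    apply ContinuousOn.inv₀ (by fun_prop)
    intro t ht; have := hsp t ht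
    exact (Real.sqrt_pos.2 (hc.trans_le this)).ne'
  have hc1 : ∀ z, Commute y z → Commute (cfc f y) z := fun z hz => hz.cfc_real f
  have hss : cfc f y * cfc f y * y = 1 := by
    nth_rewrite 3 [← cfc_id' ℝ y]
    rw [← cfc_mul f f y, ← cfc_mul (fun t => f t * f t) (fun t => t) y (by fun_prop)]
    rw [← cfc_one (R := ℝ) (a := y)]
    apply cfc_congr
    intro t ht
    have : 0 < t := hc.trans_le (hsp t ht)
    have h2 := Real.mul_self_sqrt this.le
    have h3 := (Real.sqrt_pos.2 this).ne'
    simp only [hf]; field_simp; simpa [sq] using h2.symm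
  refine ⟨cfc f y, cfc_predicate f y, ?_, hss, hc1, ?_⟩
  · rw [(hc1 y (Commute.refl y)).eq, mul_assoc, ← hss]
    exact ((hc1 y (Commute.refl y)).mul_left (hc1 y (Commute.refl y))).eq.symm
  · intro δ hδ hn
    rw [← cfc_one (R := ℝ) (a := y), ← cfc_sub f 1 y hfc (by fun_prop)]
    apply norm_cfc_le ((norm_nonneg _).trans hn)
    intro t ht
    have h1 := norm_apply_le_norm_cfc (fun t : ℝ => t - 1) y ht (by fun_prop) hy
    rw [cfc_sub (fun t : ℝ => t) (fun t => 1) y, cfc_id' ℝ y, cfc_const_one ℝ y] at h1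
    have h2 : |t - 1| ≤ δ := h1.trans hn
    have h3 := abs_le.1 h2
    have ht0 : (1/2 : ℝ) ≤ t := by linarith
    have hs : (7/10 : ℝ) ≤ Real.sqrt t := Real.le_sqrt_of_sq_le (by norm_num; linarith)
    have hsq := Real.mul_self_sqrt (show 0 ≤ t by linarith)
    have e : f t - 1 = (1 - t) * (1 / (Real.sqrt t * (1 + Real.sqrt t))) := by
      simp only [hf]; 
      have : Real.sqrt t ≠ 0 := by linarith
      have : 1 + Real.sqrt t ≠ 0 := by linarith
      field_simp; nlinarith
    simp only [Pi.one_apply]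
    rw [e, Real.norm_eq_abs, abs_mul, abs_sub_comm, abs_of_nonneg (a := 1 / (Real.sqrt t * (1 + Real.sqrt t))) (by positivity)]
    have : 1 / (Real.sqrt t * (1 + Real.sqrt t)) ≤ 1 := by
      rw [div_le_one (by positivity)]; nlinarith
    calc |t - 1| * _ ≤ |t - 1| * 1 := by gcongr
      _ ≤ δ := by linarith

theorem sa_bounds {x : A} (hx : IsSelfAdjoint x) {δ : ℝ} (h : ‖x‖ ≤ δ) :
    x ≤ algebraMap ℝ A δ ∧ - algebraMap ℝ A δ ≤ x := by
  have hm : algebraMap ℝ A ‖x‖ ≤ algebraMap ℝ A δ := algebraMap_mono A h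
  exact ⟨hx.le_algebraMap_norm_self.trans hm, (neg_le_neg hm).trans hx.neg_algebraMap_norm_le_self⟩

theorem near_one_ge {y : A} (hy : IsSelfAdjoint y) {δ : ℝ} (h : ‖y - 1‖ ≤ δ) :
    algebraMap ℝ A (1 - δ) ≤ y := by
  have := (sa_bounds (hy.sub (IsSelfAdjoint.one A)) h).2
  rw [map_sub, map_one, sub_le_iff_le_add]
  rw [neg_le_iff_add_nonneg] at this
  rw [← sub_nonneg]; convert this using 1; abel

/-- near-unitaries are near unitaries -/
theorem near_unitary {X : A} {δ : ℝ} (hδ : δ ≤ 1/6) (h : ‖X - 1‖ ≤ δ) :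
    ∃ U ∈ unitary A, ‖U - 1‖ ≤ 6 * δ ∧ ∃ s : A, IsSelfAdjoint s ∧ U = X * s ∧
      ∀ z, Commute (star X * X) z → Commute s z := by
  have hδ0 : 0 ≤ δ := (norm_nonneg _).trans h
  have hX : ‖X‖ ≤ 1 + δ := by
    have := norm_add_le (X - 1) 1; rw [sub_add_cancel] at this
    by_cases hA : Nontrivial A
    · rw [norm_one] at this; linarith
    · rw [not_nontrivial_iff_subsingleton] at hA
      rw [Subsingleton.elim X 0, norm_zero]; linarith
  have h1 : ‖star X * X - 1‖ ≤ 5/2 * δ := by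
    have e : star X * X - 1 = star X * (X - 1) + star (X - 1) := by simp [mul_sub]
    rw [e]
    refine (norm_add_le _ _).trans ?_
    rw [norm_star]
    have := norm_mul_le (star X) (X - 1); rw [norm_star] at this
    nlinarith [norm_nonneg (X - 1), norm_nonneg X]
  have hsa : IsSelfAdjoint (star X * X) := IsSelfAdjoint.star_mul_self X
  obtain ⟨s, hs, h2, h3, h4, h5⟩ := invsqrt hsa (c := 1 - 5/2*δ) (by linarith) (near_one_ge hsa h1)
  have h6 := h5 _ (by linarith) h1
  have hU1 : star (X * s) * (X * s) = 1 := by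
    rw [star_mul, hs.star_eq, mul_assoc, ← mul_assoc (star X), ← mul_assoc, h2]
  -- invertibility gives unitarity
  have hXu : IsUnit X := by
    have hx1 : ‖(1:A) - X‖ < 1 := by rw [norm_sub_rev]; linarith
    have := (Units.oneSub (1 - X) hx1).isUnit
    simpa using this
  have hsu : IsUnit s := by
    have hc := (h4 _ (Commute.refl _)).eq
    refine ⟨⟨s, s * (star X * X), by rw [← mul_assoc, h3], ?_⟩, rfl⟩
    rw [h2]
  have hU2 : X * s * star (X * s) = 1 := by
    obtain ⟨v, hv⟩ := hXu.mul hsu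
    rw [← hv] at hU1 ⊢
    have : star (v : A) = ↑v⁻¹ := by
      calc star (v:A) = star (v:A) * (v * ↑v⁻¹) := by simp
        _ = _ := by rw [← mul_assoc, hU1, one_mul]
    rw [this]; simp
  refine ⟨X * s, (Unitary.mem_iff).2 ⟨hU1, hU2⟩, ?_, s, hs, rfl, h4⟩
  have e : X * s - 1 = X * (s - 1) + (X - 1) := by simp [mul_sub]
  rw [e]
  refine (norm_add_le _ _).trans ?_
  have := norm_mul_le X (s - 1)
  nlinarith [norm_nonneg (s - 1), norm_nonneg X]

/-- polar decomposition in a corner -/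
theorem near_pisom {x p : A} (hp : IsProjection p) (hx : x * p = x) {δ : ℝ} (hδ : δ ≤ 1/2)
    (h : ‖star x * x - p‖ ≤ δ) : ∃ w s : A, star w * w = p ∧ w = x * s ∧ w * p = w ∧ ‖w - x‖ ≤ ‖x‖ * δ ∧ 
      Commute s p := by
  set y := star x * x + (1 - p) with hy
  have hpx : p * star x = star x := by have := congrArg star hx; simpa [hp.st] using this
  have hsa : IsSelfAdjoint y := (IsSelfAdjoint.star_mul_self x).add hp.one_sub.1
  have h1 : ‖y - 1‖ ≤ δ := by convert h using 2; rw [hy]; abel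
  have hδ0 : 0 ≤ δ := (norm_nonneg _).trans h
  obtain ⟨s, hs, h2, h3, h4, h5⟩ := invsqrt hsa (c := 1 - δ) (by linarith) (near_one_ge hsa h1)
  have hyp : y * p = star x * x := by simp [hy, add_mul, sub_mul, hp.mm, mul_assoc, hx]
  have hpy : p * y = star x * x := by simp [hy, mul_add, mul_sub, hp.mm, ← mul_assoc, hpx]
  have hsp : Commute s p := h4 p (by rw [commute_iff_eq, hyp, hpy])
  refine ⟨x * s, s, ?_, rfl, ?_, ?_, hsp⟩
  · rw [star_mul, hs.star_eq, mul_assoc, ← mul_assoc (star x), ← hyp, mul_assoc, ← hsp.eq, ← mul_assoc,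
      ← mul_assoc, h2, one_mul]
  · rw [mul_assoc, hsp.eq, ← mul_assoc, hx]
  · have e : x * s - x = x * (s - 1) := by simp [mul_sub]
    rw [e]
    refine (norm_mul_le _ _).trans ?_
    gcongr
    exact h5 _ hδ h1
end proj
end RK

namespace RK
set_option linter.all false
section pert
variable {A : Type*} [CStarAlgebra A] [PartialOrder A] [StarOrderedRing A]

theorem fam_unitary {ι : Type*} [DecidableEq ι] (s : Finset ι) {p q : ι → A}
    (hp : ∀ i ∈ s, IsProjection (p i)) (hq : ∀ i ∈ s, IsProjection (q i))
    (hpo : ∀ i ∈ s, ∀ j ∈ s, i ≠ j → p i * p j = 0) (hqo : ∀ i ∈ s, ∀ j ∈ s, i ≠ j → q i * q j = 0)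
    {δ : ℝ} (hd : ∀ i ∈ s, ‖p i - q i‖ ≤ δ) (hδ : 2 * s.card * δ ≤ 1/6) :
    ∃ U ∈ unitary A, ‖U - 1‖ ≤ 12 * s.card * δ ∧ ∀ i ∈ s, U * p i = q i * U := by
  have hP := proj_sum s p hp hpo
  have hQ := proj_sum s q hq hqo
  have hpP : ∀ i ∈ s, (∑ j ∈ s, p j) * p i = p i := by
    intro i hi
    rw [Finset.sum_mul, Finset.sum_eq_single_of_mem i hi, (hp i hi).mm]
    intro j hj hji; exact hpo j hj i hi hji
  have hqQ : ∀ i ∈ s, q i * (∑ j ∈ s, q j) = q i := by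
    intro i hi
    rw [Finset.mul_sum, Finset.sum_eq_single_of_mem i hi, (hq i hi).mm]
    intro j hj hji; exact hqo i hi j hj hji.symm
  set P := ∑ j ∈ s, p j with hPd
  set Q := ∑ j ∈ s, q j with hQd
  set X := ∑ i ∈ s, q i * p i + (1 - Q) * (1 - P) with hX
  have hXp : ∀ i ∈ s, X * p i = q i * p i := by
    intro i hi
    have h0 : (1 - P) * p i = 0 := by rw [sub_mul, one_mul, hpP i hi, sub_self]
    rw [hX, add_mul, Finset.sum_mul, Finset.sum_eq_single_of_mem i hi, mul_assoc, (hp i hi).mm, mul_assoc, h0]; simp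
    intro j hj hji; rw [mul_assoc, hpo j hj i hi hji, mul_zero]
  have hqX : ∀ i ∈ s, q i * X = q i * p i := by
    intro i hi
    have h0 : q i * (1 - Q) = 0 := by rw [mul_sub, mul_one, hqQ i hi, sub_self]
    rw [hX, mul_add, Finset.mul_sum, Finset.sum_eq_single_of_mem i hi, ← mul_assoc, (hq i hi).mm, ← mul_assoc, h0]; simp
    intro j hj hji; rw [← mul_assoc, hqo i hi j hj hji.symm, zero_mul]
  have hcard : ∀ f : ι → A, (∀ i ∈ s, ‖f i‖ ≤ δ) → ‖∑ i ∈ s, f i‖ ≤ s.card * δ := by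
    intro f hf
    refine (norm_sum_le _ _).trans ((Finset.sum_le_sum hf).trans ?_)
    simp
  have hn : ‖X - 1‖ ≤ 2 * s.card * δ := by
    have e : X - 1 = ∑ i ∈ s, (q i - p i) * p i + (P - Q) * (1 - P) := by
      have : ∑ i ∈ s, (q i - p i) * p i = ∑ i ∈ s, q i * p i - P := by
        rw [hPd, ← Finset.sum_sub_distrib]
        exact Finset.sum_congr rfl fun i hi => by rw [sub_mul, (hp i hi).mm]
      rw [this, hX]
      have h2 := hP.mm
      simp only [sub_mul, mul_sub, mul_one, one_mul, h2]; abel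
    rw [e]
    refine (norm_add_le _ _).trans ?_
    have h1 : ‖∑ i ∈ s, (q i - p i) * p i‖ ≤ s.card * δ := by
      apply hcard; intro i hi
      refine (norm_mul_le _ _).trans ?_
      have := hd i hi; rw [norm_sub_rev] at this
      nlinarith [norm_nonneg (q i - p i), (hp i hi).norm_le, norm_nonneg (p i)]
    have h2 : ‖P - Q‖ ≤ s.card * δ := by
      rw [hPd, hQd, ← Finset.sum_sub_distrib]; exact hcard _ hd
    have h3 : ‖(P - Q) * (1 - P)‖ ≤ s.card * δ := by
      refine (norm_mul_le _ _).trans ?_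
      nlinarith [norm_nonneg (P - Q), hP.one_sub.norm_le]
    linarith
  obtain ⟨U, hU, hU1, t, ht, hUt, hc⟩ := near_unitary hδ hn
  refine ⟨U, hU, by linarith, fun i hi => ?_⟩
  have h1 : star X * q i = p i * star X := by
    have := congrArg star ((hqX i hi).trans (hXp i hi).symm)
    simpa [(hp i hi).st, (hq i hi).st] using this
  have h2 : Commute t (p i) := by
    apply hc
    rw [commute_iff_eq, mul_assoc, hXp i hi, ← hqX i hi, ← mul_assoc, h1, mul_assoc]
  rw [hUt, mul_assoc, h2.eq, ← mul_assoc, hXp i hi, ← hqX i hi, mul_assoc]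

theorem close_unitary {p q : A} (hp : IsProjection p) (hq : IsProjection q) {δ : ℝ} (hδ : δ ≤ 1/12)
    (h : ‖p - q‖ ≤ δ) : ∃ U ∈ unitary A, ‖U - 1‖ ≤ 12 * δ ∧ U * p = q * U := by
  obtain ⟨U, h1, h2, h3⟩ := fam_unitary (Finset.univ : Finset Unit) (p := fun _ => p) (q := fun _ => q)
    (fun _ _ => hp) (fun _ _ => hq) (by simp) (by simp) (δ := δ) (fun _ _ => h) (by simp; linarith)
  exact ⟨U, h1, by simpa using h2, h3 () (by simp)⟩

theorem nmul_le {x y : A} {a b : ℝ} (hx : ‖x‖ ≤ a) (hy : ‖y‖ ≤ b) : ‖x * y‖ ≤ a * b :=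
  (norm_mul_le _ _).trans (mul_le_mul hx hy (norm_nonneg _) ((norm_nonneg _).trans hx))

/-- compress `q` near `p`: a projection below `p` close to `q` -/
theorem near_sub {p q : A} (hp : IsProjection p) (hq : IsProjection q) {δ : ℝ} (hδ : δ ≤ 1/8)
    (h : ‖q - p * q‖ ≤ δ) : ∃ q', IsProjection q' ∧ q' * p = q' ∧ p * q' = q' ∧ ‖q' - q‖ ≤ 4 * δ := by
  have h1 : ‖q - q * p‖ ≤ δ := by
    rw [← norm_star]; simpa [hp.st, hq.st] using h
  have hδ0 : 0 ≤ δ := (norm_nonneg _).trans h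
  have hx : IsSelfAdjoint (p * q * p) := by
    rw [IsSelfAdjoint, star_mul, star_mul, hp.st, hq.st, mul_assoc]
  have h2 : ‖p * q * p * (p * q * p) - p * q * p‖ ≤ δ := by
    have e : p * q * p * (p * q * p) - p * q * p = -(p * q) * ((q - p * q) * p) := by
      have := hp.mm; have := hq.mm
      simp only [mul_sub, sub_mul, neg_mul, mul_assoc, neg_sub, sub_neg_eq_add]
      rw [← mul_assoc q q p, hq.mm, ← mul_assoc p p (q * p), hp.mm]; abel
    rw [e]
    have a1 : ‖-(p * q)‖ ≤ 1 * 1 := by rw [norm_neg]; exact nmul_le hp.norm_le hq.norm_le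
    have := nmul_le a1 (nmul_le h hp.norm_le)
    linarith
  obtain ⟨r, hr, hr1, ⟨c, hc⟩, -, -⟩ := nearproj hx hδ h2
  refine ⟨r, hr, ?_, ?_, ?_⟩
  · rw [hc]; simp only [mul_assoc, hp.mm]
  · rw [hc]; simp only [← mul_assoc, hp.mm]
  · have e : r - q = (r - p * q * p) + (-(q - p * q) * p) + (-(q - q * p)) := by
      simp only [neg_sub, sub_mul]; abel
    rw [e]
    have a1 : ‖-(q - p * q) * p‖ ≤ δ * 1 := nmul_le (by rw [norm_neg]; exact h) hp.norm_le
    have a2 : ‖-(q - q * p)‖ ≤ δ := by rw [norm_neg]; exact h1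
    have := norm_add₃_le (a := r - p * q * p) (b := -(q - p * q) * p) (c := -(q - q * p))
    linarith

theorem near_sub_unitary {p q : A} (hp : IsProjection p) (hq : IsProjection q) {δ : ℝ} (hδ : δ ≤ 1/48)
    (h : ‖q - p * q‖ ≤ δ) : ∃ U ∈ unitary A, ‖U - 1‖ ≤ 48 * δ ∧ p * (U * q * star U) = U * q * star U := by
  obtain ⟨q', h1, h2, h3, h4⟩ := near_sub hp hq (by linarith) h
  rw [norm_sub_rev] at h4
  obtain ⟨U, hU, hU1, hU2⟩ := close_unitary hq h1 (by linarith) h4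
  refine ⟨U, hU, by linarith, ?_⟩
  rw [hU2, ← mul_assoc, ← mul_assoc, h3]

/-- almost orthogonal families -/
theorem orth_family (N : ℕ) : ∀ ε : ℝ, 0 < ε → ∃ δ > 0, ∀ p : ℕ → A, (∀ i, IsProjection (p i)) →
    (∀ i ≤ N, ∀ j ≤ N, i ≠ j → ‖p i * p j‖ ≤ δ) →
    ∃ q : ℕ → A, (∀ i, IsProjection (q i)) ∧ q 0 = p 0 ∧ (∀ i ≤ N, ∀ j ≤ N, i ≠ j → q i * q j = 0) ∧
      ∀ i ≤ N, ‖q i - p i‖ ≤ ε := by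
  induction N with
  | zero =>
    intro ε hε
    exact ⟨1, one_pos, fun p hp _ => ⟨p, hp, rfl, fun i hi j hj h => by omega, fun i _ => by simp [hε.le]⟩⟩
  | succ N ih =>
    intro ε hε
    set η := min (ε / 4) (1/8) with hη
    have hη0 : 0 < η := by positivity
    set ε' := min ε (η / (2 * (N + 1))) with hε'
    have hε'0 : 0 < ε' := by positivity
    obtain ⟨δ, hδ, H⟩ := ih ε' hε'0
    refine ⟨min δ (η / (2 * (N + 1))), by positivity, fun p hp ho => ?_⟩
    obtain ⟨q, hq, hq0, hqo, hqn⟩ := H p hp (fun i hi j hj hij => (ho i (by omega) j (by omega) hij).trans (min_le_left _ _))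
    have hQ : IsProjection (∑ i ∈ Finset.range (N + 1), q i) := by
      apply proj_sum _ _ (fun i _ => hq i)
      intro i hi j hj hij
      exact hqo i (by simpa [Nat.lt_succ_iff] using hi) j (by simpa [Nat.lt_succ_iff] using hj) hij
    have hQq : ∀ i ≤ N, q i * (∑ i ∈ Finset.range (N + 1), q i) = q i := by
      intro i hi
      rw [Finset.mul_sum, Finset.sum_eq_single_of_mem i (by simp; omega), (hq i).mm]
      intro j hj hji
      exact hqo i hi j (by simpa [Nat.lt_succ_iff] using hj) hji.symm
    set Q := ∑ i ∈ Finset.range (N + 1), q i with hQd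
    have hQp : ‖Q * p (N+1)‖ ≤ η := by
      rw [hQd, Finset.sum_mul]
      refine (norm_sum_le _ _).trans ?_
      have : ∀ i ∈ Finset.range (N + 1), ‖q i * p (N+1)‖ ≤ η / (N + 1) := by
        intro i hi
        have hi' : i ≤ N := by simpa [Nat.lt_succ_iff] using hi
        have e : q i * p (N+1) = (q i - p i) * p (N+1) + p i * p (N+1) := by simp [sub_mul]
        rw [e]
        have a1 := nmul_le ((hqn i hi').trans (min_le_right ε _)) (hp (N+1)).norm_le
        have a2 := (ho i (by omega) (N+1) le_rfl (by omega)).trans (min_le_right _ _)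
        have a3 := norm_add_le ((q i - p i) * p (N+1)) (p i * p (N+1))
        have : η / (2 * (N+1)) + η / (2 * (N+1)) = η / (N+1) := by field_simp; ring
        linarith
      refine (Finset.sum_le_sum this).trans ?_
      simp; field_simp; exact le_rfl
    have hh : ‖p (N+1) - (1 - Q) * p (N+1)‖ ≤ η := by
      convert hQp using 2; simp [sub_mul]
    obtain ⟨r, hr, hr1, hr2, hr3⟩ := near_sub hQ.one_sub (hp (N+1)) (min_le_right _ _) hh
    refine ⟨fun i => if i = N + 1 then r else q i, ?_, ?_, ?_, ?_⟩
    · intro i; dsimp only; split_ifs; exacts [hr, hq i]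
    · simp [hq0]
    · have hqr : ∀ i ≤ N, q i * r = 0 := by
        intro i hi
        rw [← hr2, ← mul_assoc, mul_sub, mul_one, hQq i hi, sub_self, zero_mul]
      intro i hi j hj hij
      dsimp only
      split_ifs with h1 h2 h2
      · omega
      · exact mul_swap0 (hq j) hr (hqr j (by omega))
      · exact hqr i (by omega)
      · exact hqo i (by omega) j (by omega) hij
    · intro i hi
      dsimp only
      split_ifs with h1
      · subst h1
        refine hr3.trans ?_
        have := min_le_left (ε/4) (1/8); rw [← hη] at this; linarith
      · exact (hqn i (by omega)).trans (min_le_left _ _)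
end pert

section fd
variable {A : Type*} [CStarAlgebra A] [PartialOrder A] [StarOrderedRing A]

theorem fd_closed (B : NonUnitalStarSubalgebra ℂ A) [FiniteDimensional ℂ B] : IsClosed (B : Set A) := by
  have : FiniteDimensional ℂ B.toSubmodule := ‹_›
  exact B.toSubmodule.closed_of_finiteDimensional

theorem fd_spec_fin (B : NonUnitalStarSubalgebra ℂ A) [FiniteDimensional ℂ B] {b : A} (hb : b ∈ B) :
    (spectrum ℝ b).Finite := by
  have hmem : ∀ P : Polynomial ℂ, Polynomial.aeval b P * b ∈ B := by
    intro P
    induction P using Polynomial.induction_on' with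
    | add p q hp hq => rw [map_add, add_mul]; exact add_mem hp hq
    | monomial n a =>
      rw [Polynomial.aeval_monomial, mul_assoc, ← pow_succ, ← Algebra.smul_def]
      apply SMulMemClass.smul_mem
      induction n with
      | zero => simpa using hb
      | succ n ih => rw [pow_succ]; exact mul_mem ih hb
  let L : Polynomial ℂ →ₗ[ℂ] B :=
    { toFun := fun P => ⟨Polynomial.aeval b P * b, hmem P⟩
      map_add' := fun p q => by ext; simp [add_mul]
      map_smul' := fun c p => by ext; simp }
  have hL : ¬ Function.Injective L := fun h => by
    have := Module.Finite.of_injective L h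
    exact Polynomial.not_finite this
  obtain ⟨P, hP0, hP⟩ : ∃ P : Polynomial ℂ, P ≠ 0 ∧ Polynomial.aeval b P * b = 0 := by
    rw [injective_iff_map_eq_zero] at hL
    push Not at hL
    obtain ⟨P, h1, h2⟩ := hL
    exact ⟨P, h2, congrArg Subtype.val h1⟩
  have hsub : spectrum ℂ b ⊆ {z | z ∈ (P * Polynomial.X).roots} := by
    intro z hz
    have h1 := spectrum.subset_polynomial_aeval b (P * Polynomial.X) ⟨z, hz, rfl⟩
    rw [map_mul, Polynomial.aeval_X, hP] at h1
    have hnt : Nontrivial A := by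
      by_contra hcon
      rw [not_nontrivial_iff_subsingleton] at hcon
      exact absurd hz (by rw [spectrum.of_subsingleton]; simp)
    rw [spectrum.zero_eq] at h1
    show z ∈ (P * Polynomial.X).roots
    rw [Polynomial.mem_roots (mul_ne_zero hP0 Polynomial.X_ne_zero)]
    exact h1
  have hfin : (spectrum ℂ b).Finite := by
    refine Set.Finite.subset ?_ hsub
    exact (P * Polynomial.X).roots.toFinset.finite_toSet.subset (fun z hz => by
      have hz' : z ∈ (P * Polynomial.X).roots := hz
      simpa using hz')
  rw [← spectrum.preimage_algebraMap ℂ]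
  exact hfin.preimage (Set.injOn_of_injective (algebraMap ℝ ℂ).injective)

theorem fd_cont (B : NonUnitalStarSubalgebra ℂ A) [FiniteDimensional ℂ B] {b : A} (hb : b ∈ B)
    (f : ℝ → ℝ) : ContinuousOn f (spectrum ℝ b) := (fd_spec_fin B hb).continuousOn f

theorem fd_cfc_mem (B : NonUnitalStarSubalgebra ℂ A) [FiniteDimensional ℂ B] {b : A} (hb : b ∈ B)
    {f : ℝ → ℝ} (hf : f 0 = 0) : cfc f b ∈ B := by
  rw [← cfcₙ_eq_cfc (f := f) (a := b) ?_ hf]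
  · have : IsClosed (B : Set A) := fd_closed B
    exact cfcₙ_mem (𝕜' := ℂ) f hb
  · rw [quasispectrum_eq_spectrum_union_zero]
    exact ((fd_spec_fin B hb).union (Set.finite_singleton 0)).continuousOn f

/-- spectral projection -/
theorem fd_specproj (B : NonUnitalStarSubalgebra ℂ A) [FiniteDimensional ℂ B] {b : A} (hb : b ∈ B)
    (hsa : IsSelfAdjoint b) (S : Set ℝ) [DecidablePred (· ∈ S)] :
    IsProjection (cfc (fun t : ℝ => if t ∈ S then (1:ℝ) else 0) b) := by
  refine ⟨cfc_predicate _ b, ?_⟩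
  rw [IsIdempotentElem, ← cfc_mul _ _ b (fd_cont B hb _) (fd_cont B hb _)]
  apply cfc_congr
  intro t ht
  dsimp only; split_ifs <;> simp
end fd
end RK

namespace RK
set_option linter.all false

structure MUS (A : Type*) [CStarAlgebra A] (ι : Type) [Fintype ι] [DecidableEq ι] where
  v : ι → A
  r : ι → ι
  π : ι → A
  pp : ∀ x, IsProjection (π x)
  h1 : ∀ x, star (v x) * v x = π (r x)
  h2 : ∀ x y, x ≠ y → star (v x) * v y = 0

namespace MUS
section
variable {A : Type*} [CStarAlgebra A] {ι : Type} [Fintype ι] [DecidableEq ι] (m : MUS A ι)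

noncomputable def Sp : Submodule ℂ A := Submodule.span ℂ {z | ∃ x y, m.r x = m.r y ∧ z = m.v x * star (m.v y)}
noncomputable def unit : A := ∑ x, m.v x * star (m.v x)
end
section
variable {A : Type*} [CStarAlgebra A] [PartialOrder A] [StarOrderedRing A] {ι : Type} [Fintype ι] [DecidableEq ι] (m : MUS A ι)

theorem vpi (x : ι) : m.v x * m.π (m.r x) = m.v x := by
  have h : star (m.v x - m.v x * m.π (m.r x)) * (m.v x - m.v x * m.π (m.r x)) = 0 := by
    simp only [star_sub, star_mul, (m.pp _).st, sub_mul, mul_sub]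
    have h1 := m.h1 x
    have h2 := (m.pp (m.r x)).mm
    simp only [mul_assoc]
    rw [← mul_assoc (star (m.v x)) (m.v x), h1, h2, h2]; simp
  have := CStarRing.star_mul_self_eq_zero_iff _ |>.1 h
  exact (sub_eq_zero.1 this).symm

theorem pivs (x : ι) : m.π (m.r x) * star (m.v x) = star (m.v x) := by
  have := congrArg star (m.vpi x); simpa [(m.pp _).st] using this

theorem proj (x : ι) : IsProjection (m.v x * star (m.v x)) := by
  refine mkp' (by simp) ?_
  rw [mul_assoc, ← mul_assoc (star (m.v x)), m.h1, m.pivs]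

theorem svv (x y : ι) : star (m.v x) * m.v y = if x = y then m.π (m.r x) else 0 := by
  split_ifs with h
  · subst h; exact m.h1 x
  · exact m.h2 x y h

theorem unit_proj : IsProjection m.unit := by
  refine proj_sum _ _ (fun x _ => m.proj x) ?_
  intro x _ y _ hxy
  rw [mul_assoc, ← mul_assoc (star (m.v x)), m.h2 x y hxy]; simp

theorem unit_v (x : ι) : m.unit * m.v x = m.v x := by
  rw [unit, Finset.sum_mul, Finset.sum_eq_single_of_mem x (Finset.mem_univ x)]
  · rw [mul_assoc, m.h1, m.vpi]
  · intro y _ hy; rw [mul_assoc, m.h2 y x hy, mul_zero]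

theorem vs_unit (x : ι) : star (m.v x) * m.unit = star (m.v x) := by
  have := congrArg star (m.unit_v x); simpa [m.unit_proj.st] using this

theorem unit_mem : m.unit ∈ m.Sp :=
  Submodule.sum_mem _ fun x _ => Submodule.subset_span ⟨x, x, rfl, rfl⟩

theorem vv_mem {x y : ι} (h : m.r x = m.r y) : m.v x * star (m.v y) ∈ m.Sp := Submodule.subset_span ⟨x, y, h, rfl⟩

theorem unit_mul {b : A} (hb : b ∈ m.Sp) : m.unit * b = b := by
  induction hb using Submodule.span_induction with
  | mem z hz => obtain ⟨x, y, -, rfl⟩ := hz; rw [← mul_assoc, m.unit_v]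
  | zero => simp
  | add a b _ _ ha hb => rw [mul_add, ha, hb]
  | smul c a _ ha => rw [mul_smul_comm, ha]

theorem mul_unit {b : A} (hb : b ∈ m.Sp) : b * m.unit = b := by
  induction hb using Submodule.span_induction with
  | mem z hz => obtain ⟨x, y, -, rfl⟩ := hz; rw [mul_assoc, m.vs_unit]
  | zero => simp
  | add a b _ _ ha hb => rw [add_mul, ha, hb]
  | smul c a _ ha => rw [smul_mul_assoc, ha]

theorem star_mem {b : A} (hb : b ∈ m.Sp) : star b ∈ m.Sp := by
  induction hb using Submodule.span_induction with
  | mem z hz => obtain ⟨x, y, h, rfl⟩ := hz; rw [star_mul, star_star]; exact m.vv_mem h.symm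
  | zero => simp
  | add a b _ _ ha hb => rw [star_add]; exact add_mem ha hb
  | smul c a _ ha => rw [star_smul]; exact Submodule.smul_mem _ _ ha

theorem mul_mem {a b : A} (ha : a ∈ m.Sp) (hb : b ∈ m.Sp) : a * b ∈ m.Sp := by
  induction ha using Submodule.span_induction with
  | mem z hz =>
    obtain ⟨x, y, h, rfl⟩ := hz
    induction hb using Submodule.span_induction with
    | mem z hz =>
      obtain ⟨x', y', h', rfl⟩ := hz
      by_cases hh : y = x'
      · subst hh
        rw [mul_assoc, ← mul_assoc (star (m.v y)), m.h1, h', m.pivs]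
        exact m.vv_mem (h.trans h')
      · rw [mul_assoc, ← mul_assoc (star (m.v y)), m.h2 _ _ hh]; simp
    | zero => simp
    | add a b _ _ ha hb => rw [mul_add]; exact add_mem ha hb
    | smul c a _ ha => rw [mul_smul_comm]; exact Submodule.smul_mem _ _ ha
  | zero => simp
  | add a b _ _ ha hb => rw [add_mul]; exact add_mem ha hb
  | smul c a _ ha => rw [smul_mul_assoc]; exact Submodule.smul_mem _ _ ha

noncomputable def alg : NonUnitalStarSubalgebra ℂ A where
  carrier := m.Sp
  add_mem' := fun ha hb => add_mem ha hb
  zero_mem' := m.Sp.zero_mem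
  mul_mem' := fun ha hb => m.mul_mem ha hb
  smul_mem' := fun c _ ha => m.Sp.smul_mem c ha
  star_mem' := fun ha => m.star_mem ha

theorem mem_alg {a : A} : a ∈ m.alg ↔ a ∈ m.Sp := Iff.rfl

theorem fd : FiniteDimensional ℂ m.alg := by
  have : FiniteDimensional ℂ m.Sp := by
    apply FiniteDimensional.span_of_finite
    refine Set.Finite.subset (Set.finite_range fun z : ι × ι => m.v z.1 * star (m.v z.2)) ?_
    rintro z ⟨x, y, -, rfl⟩; exact ⟨(x, y), rfl⟩
  exact this

theorem v_norm (x : ι) : ‖m.v x‖ ≤ 1 := by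
  have h := CStarRing.norm_star_mul_self (x := m.v x)
  have h2 : ‖m.π (m.r x)‖ ≤ 1 := by
    have e := (m.pp (m.r x)).ss
    have := CStarRing.norm_star_mul_self (x := m.π (m.r x))
    rw [e] at this
    nlinarith [norm_nonneg (m.π (m.r x))]
  rw [m.h1] at h
  nlinarith [norm_nonneg (m.v x)]
end
end MUS

section fdmus
variable {A : Type*} [CStarAlgebra A] [PartialOrder A] [StarOrderedRing A]

/-- a family of orthogonal nonzero projections in B has at most dim B members -/
theorem orth_card (B : NonUnitalStarSubalgebra ℂ A) [FiniteDimensional ℂ B] {n : ℕ} (e : Fin n → A)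
    (hB : ∀ i, e i ∈ B) (hp : ∀ i, IsProjection (e i)) (h0 : ∀ i, e i ≠ 0)
    (ho : ∀ i j, i ≠ j → e i * e j = 0) : n ≤ Module.finrank ℂ B := by
  have hli : LinearIndependent ℂ (fun i => (⟨e i, hB i⟩ : B)) := by
    rw [Fintype.linearIndependent_iff]
    intro g hg i
    have h := congrArg (fun b : B => e i * (b : A)) hg
    simp only [AddSubmonoidClass.coe_finset_sum, SetLike.val_smul, ZeroMemClass.coe_zero, mul_zero, Finset.mul_sum] at h
    rw [Finset.sum_eq_single_of_mem i (Finset.mem_univ i)] at h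
    · rw [mul_smul_comm, (hp i).mm] at h
      exact (smul_eq_zero.1 h).resolve_right (h0 i)
    · intro j _ hj; rw [mul_smul_comm, ho i j hj.symm, smul_zero]
  simpa using hli.fintype_card_le_finrank

theorem max_orth (B : NonUnitalStarSubalgebra ℂ A) [FiniteDimensional ℂ B] {P : A} (hP : IsProjection P) (hPB : P ∈ B)
    (hu : ∀ b ∈ B, P * b = b ∧ b * P = b) :
    ∃ n, ∃ e : Fin n → A, (∀ i, e i ∈ B) ∧ (∀ i, IsProjection (e i)) ∧ (∀ i, e i ≠ 0) ∧
    (∀ i j, i ≠ j → e i * e j = 0) ∧ ∑ i, e i = P ∧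
    ∀ i, ∀ f ∈ B, IsProjection f → f * e i = f → f = 0 ∨ f = e i := by
  classical
  let S : Set ℕ := {n | ∃ e : Fin n → A, (∀ i, e i ∈ B) ∧ (∀ i, IsProjection (e i)) ∧ (∀ i, e i ≠ 0) ∧
    (∀ i j, i ≠ j → e i * e j = 0)}
  have hS0 : S.Nonempty := ⟨0, Fin.elim0, fun i => i.elim0, fun i => i.elim0, fun i => i.elim0, fun i => i.elim0⟩
  have hSb : BddAbove S := ⟨Module.finrank ℂ B, by rintro n ⟨e, h1, h2, h3, h4⟩; exact orth_card B e h1 h2 h3 h4⟩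
  have hex : ∃ n ∈ S, ∀ k ∈ S, k ≤ n := ⟨sSup S, Nat.sSup_mem hS0 hSb, fun k hk => le_csSup hSb hk⟩
  obtain ⟨n, ⟨e, h1, h2, h3, h4⟩, hnm⟩ := hex
  -- no larger family
  have hmax : ∀ f : A, ∀ g : Fin n → A, (∀ i, g i ∈ B) → (∀ i, IsProjection (g i)) → (∀ i, g i ≠ 0) →
      (∀ i j, i ≠ j → g i * g j = 0) → f ∈ B → IsProjection f → f ≠ 0 → (∀ i, f * g i = 0) → False := by
    intro f g a1 a2 a3 a4 b1 b2 b3 b4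
    have : n + 1 ∈ S := by
      refine ⟨Fin.cons f g, ?_, ?_, ?_, ?_⟩
      · intro i; refine Fin.cases ?_ ?_ i <;> simp [*]
      · intro i; refine Fin.cases ?_ ?_ i <;> simp [*]
      · intro i; refine Fin.cases ?_ ?_ i <;> simp [*]
      · intro i j
        refine Fin.cases ?_ ?_ i <;> refine Fin.cases ?_ ?_ j
        · simp
        · intro j _; simpa using b4 j
        · intro j _; simpa using mul_swap0 b2 (a2 j) (b4 j)
        · intro j i hij; simpa using a4 i j (by simpa using hij)
    have := hnm _ this
    omega
  have hsum := proj_sum Finset.univ e (fun i _ => h2 i) (fun i _ j _ => h4 i j)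
  refine ⟨n, e, h1, h2, h3, h4, ?_, ?_⟩
  · by_contra hne
    have hmem : ∑ i, e i ∈ B := sum_mem fun i _ => h1 i
    have hs := hu _ hmem
    refine hmax (P - ∑ i, e i) e h1 h2 h3 h4 (sub_mem hPB hmem) (proj_sub hsum hP hs.2) (sub_ne_zero.2 (Ne.symm hne)) ?_
    intro i
    rw [sub_mul, (hu _ (h1 i)).1, Finset.sum_mul, Finset.sum_eq_single_of_mem i (Finset.mem_univ i), (h2 i).mm, sub_self]
    intro j _ hj; exact h4 j i hj
  · intro i f hf hfp hfe
    by_contra hcon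
    push Not at hcon
    obtain ⟨hf0, hfe'⟩ := hcon
    have hef := mul_swap hfp (h2 i) hfe
    refine hmax f (Function.update e i (e i - f)) ?_ ?_ ?_ ?_ hf hfp hf0 ?_
    · intro j; by_cases h : j = i
      · subst h; simpa using sub_mem (h1 _) hf
      · simp [h, h1]
    · intro j; by_cases h : j = i
      · subst h; simpa using proj_sub hfp (h2 _) hfe
      · simp [h, h2]
    · intro j; by_cases h : j = i
      · subst h; simpa using sub_ne_zero.2 (Ne.symm hfe')
      · simp [h, h3]
    · intro j k hjk
      have hz : ∀ j, j ≠ i → f * e j = 0 := fun j hj => by rw [← hfe, mul_assoc, h4 i j hj.symm, mul_zero]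
      have hz' : ∀ j, j ≠ i → e j * f = 0 := fun j hj => mul_swap0 hfp (h2 j) (hz j hj)
      by_cases h : j = i
      · subst h; rw [Function.update_self, Function.update_of_ne hjk.symm, sub_mul, h4 _ _ hjk, hz _ hjk.symm, sub_zero]
      · by_cases h' : k = i
        · subst h'; rw [Function.update_self, Function.update_of_ne hjk, mul_sub, h4 _ _ hjk, hz' _ hjk, sub_zero]
        · simp [h, h', h4 _ _ hjk]
    · intro j; by_cases h : j = i
      · subst h; simp [mul_sub, hfe, hfp.mm]
      · rw [Function.update_of_ne h, ← hfe, mul_assoc, h4 i j (Ne.symm h), mul_zero]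
end fdmus
end RK

namespace RK
set_option linter.all false
section fdmus
variable {A : Type*} [CStarAlgebra A] [PartialOrder A] [StarOrderedRing A]

/-- selfadjoint elements of a minimal corner are scalar -/
theorem min_sa (B : NonUnitalStarSubalgebra ℂ A) [FiniteDimensional ℂ B] {e : A} (he : IsProjection e)
    (hmin : ∀ f ∈ B, IsProjection f → f * e = f → f = 0 ∨ f = e) {b : A} (hb : b ∈ B) (hsa : IsSelfAdjoint b)
    (hbe : b * e = b) : ∃ c : ℝ, b = c • e := by
  classical
  by_cases h0 : b = 0
  · exact ⟨0, by simp [h0]⟩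
  have hex : ∃ l ∈ spectrum ℝ b, l ≠ 0 := by
    by_contra hcon
    push Not at hcon
    apply h0
    rw [← cfc_id ℝ b, ← cfc_zero ℝ b]
    exact cfc_congr fun t ht => by simpa using hcon t ht
  obtain ⟨l, hl, hl0⟩ := hex
  have hc : ∀ f : ℝ → ℝ, ContinuousOn f (spectrum ℝ b) := fd_cont B hb
  set f := cfc (fun t : ℝ => if t ∈ ({l} : Set ℝ) then (1:ℝ) else 0) b with hf
  have hfp : IsProjection f := fd_specproj B hb hsa {l}
  have hfB : f ∈ B := fd_cfc_mem B hb (by simp [Ne.symm hl0])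
  have hbf : b * f = l • f := by
    conv_lhs => rw [← cfc_id ℝ b, hf]
    rw [cfc_id ℝ b, ← cfc_const_mul l _ b (hc _)]
    conv_lhs => rw [← cfc_id ℝ b]
    rw [cfc_id ℝ b]
    conv_lhs => lhs; rw [← cfc_id' ℝ b]
    rw [← cfc_mul _ _ b (hc _) (hc _)]
    apply cfc_congr
    intro t _
    by_cases ht : t = l
    · simp [ht]
    · simp [ht]
  have hfne : f ≠ 0 := by
    intro h
    have h2 := cfc_map_spectrum (R := ℝ) (fun t : ℝ => if t ∈ ({l} : Set ℝ) then (1:ℝ) else 0) b hsa (hc _)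
    rw [← hf, h] at h2
    have : (1:ℝ) ∈ spectrum ℝ (0 : A) := by rw [h2]; exact ⟨l, hl, by simp⟩
    have hnt : Nontrivial A := ⟨b, 0, h0⟩
    rw [spectrum.zero_eq] at this
    simp at this
  have hfb : f * b = l • f := by
    have := congrArg star hbf
    simpa [hfp.st, hsa.star_eq] using this
  have hfe : f * e = f := by
    have : f = l⁻¹ • (f * b) := by rw [hfb, smul_smul, inv_mul_cancel₀ hl0, one_smul]
    rw [this, smul_mul_assoc, mul_assoc, hbe]
  rcases hmin f hfB hfp hfe with h | h
  · exact absurd h hfne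
  · exact ⟨l, by rw [h] at hbf; rw [← hbf, hbe]⟩

theorem min_scalar (B : NonUnitalStarSubalgebra ℂ A) [FiniteDimensional ℂ B] {e : A} (he : IsProjection e) (heB : e ∈ B)
    (hmin : ∀ f ∈ B, IsProjection f → f * e = f → f = 0 ∨ f = e) {b : A} (hb : b ∈ B)
    (hbe : e * b * e = b) : ∃ c : ℂ, b = c • e := by
  have hbe1 : b * e = b := by rw [← hbe, mul_assoc, he.mm]
  have hbe2 : e * b = b := by rw [← hbe, ← mul_assoc, ← mul_assoc, he.mm]
  have hse1 : star b * e = star b := by have := congrArg star hbe2; simpa [he.st] using this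
  have hsb : star b ∈ B := star_mem hb
  obtain ⟨c, hc⟩ := min_sa B he hmin (b := b + star b) (add_mem hb hsb) (IsSelfAdjoint.add_star_self b)
    (by rw [add_mul, hbe1, hse1])
  obtain ⟨d, hd⟩ := min_sa B he hmin (b := Complex.I • (b - star b)) (SMulMemClass.smul_mem _ (sub_mem hb hsb))
    (by rw [IsSelfAdjoint, star_smul, star_sub, star_star]; simp [smul_sub]; abel)
    (by rw [smul_mul_assoc, sub_mul, hbe1, hse1])
  refine ⟨((c : ℂ) - Complex.I * d) / 2, ?_⟩
  have hd' : b - star b = -(Complex.I * d) • e := by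
    have : b - star b = (-Complex.I) • (Complex.I • (b - star b)) := by rw [smul_smul]; simp
    rw [this, hd, ← Complex.coe_smul, smul_smul]; ring_nf
  have hc' : b + star b = (c : ℂ) • e := by rw [hc, ← Complex.coe_smul]
  have : b = (1/2 : ℂ) • ((b + star b) + (b - star b)) := by
    rw [add_add_sub_cancel, ← two_smul ℂ b, smul_smul]; norm_num
  rw [this, hd', hc', ← add_smul, smul_smul]; congr 1; ring

theorem sub_pisom {v e : A} (he : IsProjection e) (h : star v * v = e) : v * e = v := by
  have h0 : star (v - v * e) * (v - v * e) = 0 := by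
    simp only [star_sub, star_mul, he.st, sub_mul, mul_sub, mul_assoc]
    rw [← mul_assoc (star v) v, h, he.mm, he.mm]; simp
  exact (sub_eq_zero.1 (eq_zero_of_star_mul h0)).symm

theorem pisom_proj {v e : A} (he : IsProjection e) (h : star v * v = e) : IsProjection (v * star v) := by
  refine mkp' (by simp) ?_
  rw [mul_assoc, ← mul_assoc (star v), h, ← mul_assoc, sub_pisom he h]

theorem min_equiv (B : NonUnitalStarSubalgebra ℂ A) [FiniteDimensional ℂ B] {e f : A} (he : IsProjection e)
    (hf : IsProjection f) (heB : e ∈ B) (hfB : f ∈ B)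
    (hmin : ∀ g ∈ B, IsProjection g → g * e = g → g = 0 ∨ g = e)
    (hmin' : ∀ g ∈ B, IsProjection g → g * f = g → g = 0 ∨ g = f) {b : A} (hb : b ∈ B) (h0 : e * b * f ≠ 0) :
    ∃ v ∈ B, star v * v = f ∧ v * star v = e := by
  set d := e * b * f with hd
  have hdB : d ∈ B := mul_mem (mul_mem heB hb) hfB
  have hdf : d * f = d := by rw [hd, mul_assoc, hf.mm]
  have hed : e * d = d := by rw [hd, ← mul_assoc, ← mul_assoc, he.mm]
  obtain ⟨c, hc⟩ := min_sa B hf hmin' (b := star d * d) (mul_mem (star_mem hdB) hdB) (IsSelfAdjoint.star_mul_self d)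
    (by rw [mul_assoc, hdf])
  have hf0 : f ≠ 0 := by rintro rfl; simp [hd] at h0
  have hcn : ‖d‖ * ‖d‖ = |c| * ‖f‖ := by rw [← CStarRing.norm_star_mul_self, hc, norm_smul, Real.norm_eq_abs]
  have hcpos : 0 < c := by
    have h1 : 0 ≤ star d * d := star_mul_self_nonneg d
    have hcne : c ≠ 0 := by rintro rfl; rw [zero_smul] at hc; exact h0 (eq_zero_of_star_mul hc)
    rcases lt_or_gt_of_ne hcne with h | h
    · exfalso
      rw [hc] at h1
      have h2 : c • f ≤ 0 := smul_nonpos_of_nonpos_of_nonneg h.le hf.nonneg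
      have h3 := le_antisymm h2 h1
      exact hf0 ((smul_eq_zero.1 h3).resolve_left hcne)
    · exact h
  set s : ℝ := (Real.sqrt c)⁻¹ with hs
  have hss : s * s * c = 1 := by
    rw [hs]; have := Real.mul_self_sqrt hcpos.le; have h3 := Real.sqrt_pos.2 hcpos; field_simp; nlinarith
  have hv : star (s • d) * (s • d) = f := by
    rw [star_smul, smul_mul_smul_comm, hc, smul_smul]; simp [hss]
  have hvB : s • d ∈ B := by rw [← Complex.coe_smul]; exact SMulMemClass.smul_mem _ hdB
  refine ⟨s • d, hvB, hv, ?_⟩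
  have hp := pisom_proj hf hv
  rcases hmin _ (mul_mem hvB (star_mem hvB)) hp (by
    rw [mul_assoc]; congr 1; have := congrArg star hed; rw [star_mul, he.st] at this
    rw [star_smul, smul_mul_assoc, this]) with h | h
  · exfalso
    have h1 : star (star (s • d)) * star (s • d) = 0 := by rw [star_star]; exact h
    have h2 := eq_zero_of_star_mul h1
    rw [h2, zero_mul] at hv
    exact hf0 hv.symm
  · exact h

theorem fd_mus (B : NonUnitalStarSubalgebra ℂ A) [FiniteDimensional ℂ B] {P : A} (hP : IsProjection P) (hPB : P ∈ B)
    (hu : ∀ b ∈ B, P * b = b ∧ b * P = b) :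
    ∃ n, ∃ m : MUS A (Fin n), (∀ x, m.v x ∈ B) ∧ m.unit = P ∧ (∀ b, b ∈ m.Sp ↔ b ∈ B) ∧
      (∀ x, m.π (m.r x) ≠ 0) ∧
      (∀ b ∈ B, ∀ x y, m.r x = m.r y → ∃ c : ℂ, star (m.v x) * b * m.v y = c • m.π (m.r x)) := by
  classical
  obtain ⟨n, e, eB, ep, e0, eo, esum, emin⟩ := max_orth B hP hPB hu
  let R : Setoid (Fin n) :=
    { r := fun x y => ∃ v ∈ B, star v * v = e y ∧ v * star v = e x
      iseqv := by
        refine ⟨fun x => ⟨e x, eB x, (ep x).ss, by rw [(ep x).st, (ep x).mm]⟩, ?_, ?_⟩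
        · rintro x y ⟨v, h1, h2, h3⟩; exact ⟨star v, star_mem h1, by rwa [star_star], by rwa [star_star]⟩
        · rintro x y z ⟨v, h1, h2, h3⟩ ⟨w, k1, k2, k3⟩
          refine ⟨v * w, mul_mem h1 k1, ?_, ?_⟩
          · rw [star_mul, mul_assoc, ← mul_assoc (star v), h2, ← k3, mul_assoc w, k2, sub_pisom (ep z) k2, k2]
          · rw [star_mul, mul_assoc, ← mul_assoc w, k3, ← mul_assoc, sub_pisom (ep y) h2, h3] }
  let r : Fin n → Fin n := fun x => (Quotient.mk R x).out
  have hr : ∀ x, ∃ v ∈ B, star v * v = e (r x) ∧ v * star v = e x := fun x =>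
    R.symm (Quotient.mk_out x)
  choose v vB v1 v2 using hr
  have hre : ∀ x y, (∃ v ∈ B, star v * v = e y ∧ v * star v = e x) → r x = r y := by
    intro x y h
    show (Quotient.mk R x).out = (Quotient.mk R y).out
    rw [Quotient.sound (s := R) h]
  have vs : ∀ x, star (v x) * e x = star (v x) := by
    intro x; rw [← v2 x, ← mul_assoc, v1 x]
    have := congrArg star (sub_pisom (ep _) (v1 x)); simpa [(ep _).st] using this
  have ev : ∀ x, e x * v x = v x := by
    intro x; have := congrArg star (vs x); simpa [(ep _).st] using this
  let m : MUS A (Fin n) :=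
    { v := v, r := r, π := e, pp := ep, h1 := v1,
      h2 := fun x y hxy => by
        rw [← vs x, ← ev y, mul_assoc, ← mul_assoc (e x), eo x y hxy]; simp }
  have key : ∀ b ∈ B, ∀ x y, r x = r y → ∃ c : ℂ, star (v x) * b * v y = c • e (r x) := by
    intro b hb x y hxy
    apply min_scalar B (ep _) (eB _) (emin _) (mul_mem (mul_mem (star_mem (vB x)) hb) (vB y))
    have h1 : e (r x) * star (v x) = star (v x) := by
      have := congrArg star (sub_pisom (ep _) (v1 x)); simpa [(ep _).st] using this
    have h2 : v y * e (r x) = v y := by rw [hxy]; exact sub_pisom (ep _) (v1 y)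
    rw [mul_assoc, mul_assoc, h2, ← mul_assoc, ← mul_assoc, h1]
  refine ⟨n, m, vB, ?_, ?_, fun x => e0 _, key⟩
  · rw [← esum]; exact Finset.sum_congr rfl fun x _ => v2 x
  · intro b
    constructor
    · intro hb
      have : m.Sp ≤ B.toSubmodule := by
        refine Submodule.span_le.2 ?_
        rintro z ⟨x, y, -, rfl⟩
        show v x * star (v y) ∈ B
        exact mul_mem (vB x) (star_mem (vB y))
      exact this hb
    · intro hb
      have hbs : b = ∑ x, ∑ y, e x * b * e y := by
        have := hu b hb
        conv_lhs => rw [← this.1, ← this.2, ← esum]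
        rw [Finset.sum_mul]
        refine Finset.sum_congr rfl fun x _ => ?_
        rw [Finset.mul_sum, Finset.mul_sum]
        exact Finset.sum_congr rfl fun y _ => by rw [mul_assoc]
      rw [hbs]
      refine Submodule.sum_mem _ fun x _ => Submodule.sum_mem _ fun y _ => ?_
      by_cases h0 : e x * b * e y = 0
      · rw [h0]; exact zero_mem _
      · have hxy := hre x y (min_equiv B (ep x) (ep y) (eB x) (eB y) (emin x) (emin y) hb h0)
        obtain ⟨c, hc⟩ := key b hb x y hxy
        have : e x * b * e y = c • (v x * star (v y)) := by
          rw [← v2 x, ← v2 y]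
          have : v x * star (v x) * b * (v y * star (v y)) = v x * (star (v x) * b * v y) * star (v y) := by
            simp only [mul_assoc]
          rw [this, hc, mul_smul_comm, smul_mul_assoc, sub_pisom (ep _) (v1 x)]
        rw [this]
        exact Submodule.smul_mem _ _ (m.vv_mem hxy)
end fdmus
end RK

namespace RK
set_option linter.all false

structure Good {A : Type*} [CStarAlgebra A] (τ : A →ₗ[ℂ] ℂ) : Prop where
  htr : IsTracialState τ
  simple : IsSimpleCStar A
  tr0 : TracialRankZero A
  uniq : ∀ σ : A →ₗ[ℂ] ℂ, IsTracialState σ → σ = τ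

/-- all positive powers uniformly outer -/
def PUO {A : Type*} [CStarAlgebra A] (β : A ≃⋆ₐ[ℂ] A) : Prop := ∀ j : ℕ, 1 ≤ j → UniformlyOuter (⇑(β ^ j))

section aut
variable {A : Type*} [CStarAlgebra A] [PartialOrder A] [StarOrderedRing A] {τ : A →ₗ[ℂ] ℂ}

theorem nA (β : A ≃⋆ₐ[ℂ] A) (x : A) : ‖β x‖ = ‖x‖ := StarAlgEquiv.norm_map β x
theorem aut_proj (β : A ≃⋆ₐ[ℂ] A) {p : A} (h : IsProjection p) : IsProjection (β p) :=
  mkp' (by rw [← map_star, h.st]) (by rw [← map_mul, h.mm])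
theorem aut_nonneg (β : A ≃⋆ₐ[ℂ] A) {x : A} (h : 0 ≤ x) : 0 ≤ β x := by
  obtain ⟨b, rfl⟩ := CStarAlgebra.nonneg_iff_eq_star_mul_self.1 h
  rw [map_mul, map_star]; exact star_mul_self_nonneg _
theorem aut_mono (β : A ≃⋆ₐ[ℂ] A) {x y : A} (h : x ≤ y) : β x ≤ β y := by
  rw [← sub_nonneg, ← map_sub]; exact aut_nonneg β (sub_nonneg.2 h)
theorem pow_add_apply (β : A ≃⋆ₐ[ℂ] A) (i j : ℕ) (x : A) : (β ^ (i + j)) x = (β ^ i) ((β ^ j) x) := by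
  rw [pow_add]; rfl
theorem pow_succ_apply (β : A ≃⋆ₐ[ℂ] A) (i : ℕ) (x : A) : (β ^ (i + 1)) x = β ((β ^ i) x) := by
  rw [pow_succ']; rfl

theorem Good.tau_inv (G : Good τ) (β : A ≃⋆ₐ[ℂ] A) (x : A) : τ (β x) = τ x := by
  have : IsTracialState (τ.comp (β : A →ₗ[ℂ] A)) := by
    refine ⟨fun a => ?_, ?_, fun a b => ?_⟩
    · obtain ⟨r, h1, h2⟩ := G.htr.1 (β a)
      exact ⟨r, h1, by rw [← h2]; show τ (β (star a * a)) = _; rw [map_mul, map_star]⟩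
    · simpa using G.htr.2.1
    · simpa using G.htr.2.2 (β a) (β b)
  have h := G.uniq _ this
  exact congrArg (fun f : A →ₗ[ℂ] ℂ => f x) h
theorem Good.inv (G : Good τ) (β : A ≃⋆ₐ[ℂ] A) (x : A) : tr τ (β x) = tr τ x := by simp only [tr, G.tau_inv β x]
theorem Good.n2inv (G : Good τ) (β : A ≃⋆ₐ[ℂ] A) (x : A) : n2 τ (β x) = n2 τ x := by
  simp only [n2]; rw [← map_star, ← map_mul, G.inv]

theorem cut_norm (β : A ≃⋆ₐ[ℂ] A) {q q' a : A} (hq : IsProjection q) (hq' : IsProjection q') (h : q' * q = q') :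
    ‖q' * a * β q'‖ ≤ ‖q * a * β q‖ := by
  have h2 := mul_swap hq' hq h
  have e : q' * a * β q' = q' * ((q * a * β q) * β q') := by
    have e2 : β q * β q' = β q' := by rw [← map_mul, h2]
    simp only [mul_assoc]
    rw [e2, ← mul_assoc q' q, h]
  rw [e]
  have := nmul_le hq'.norm_le (nmul_le (le_refl ‖q * a * β q‖) (aut_proj β hq').norm_le)
  linarith

theorem uo_star {β : A ≃⋆ₐ[ℂ] A} (hU : PUO β) (L : List (A × ℕ)) (hL : ∀ z ∈ L, 1 ≤ z.2) {ε : ℝ} (hε : 0 < ε) :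
    ∀ p : A, IsProjection p → ∃ (n : ℕ) (q : Fin n → A), (∀ i, IsProjection (q i)) ∧ ∑ i, q i = p ∧
      ∀ i, ∀ z ∈ L, ‖q i * z.1 * (β ^ z.2) (q i)‖ < ε := by
  induction L with
  | nil => intro p hp; exact ⟨1, fun _ => p, fun _ => hp, by simp, by simp⟩
  | cons z L ih =>
    intro p hp
    obtain ⟨n, q, q1, q2, q3⟩ := hU z.2 (hL z (by simp)) z.1 p hp ε hε
    have ih' := ih (fun w hw => hL w (by simp [hw]))
    choose k s s1 s2 s3 using fun i => ih' (q i) (q1 i)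
    refine ⟨∑ i, k i, fun x => s (finSigmaFinEquiv.symm x).1 (finSigmaFinEquiv.symm x).2, fun x => s1 _ _, ?_, ?_⟩
    · rw [finSigmaFinEquiv.symm.sum_comp (fun y : (i : Fin n) × Fin (k i) => s y.1 y.2), Fintype.sum_sigma]
      simp only [s2, q2]
    · intro x w hw
      rcases List.mem_cons.1 hw with rfl | hw
      · exact (cut_norm _ (q1 _) (s1 _ _) ((sum_orth (q1 _) (s1 _) (s2 _)).1 _)).trans_lt (q3 _)
      · exact s3 _ _ w hw

/-- trace bound for almost orthogonal translates -/
theorem small_tr (G : Good τ) (β : A ≃⋆ₐ[ℂ] A) {q : A} (hq : IsProjection q) (N : ℕ) {ε : ℝ} (hε : 0 ≤ ε)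
    (h : ∀ j, 1 ≤ j → j ≤ N → ‖q * (β ^ j) q‖ ≤ ε) : (N + 1) * tr τ q ≤ 1 + (N + 1)^2 * ε := by
  have ht := G.htr
  set S := ∑ i ∈ Finset.range (N+1), (β ^ i) q with hS
  have hSt : tr τ S = (N + 1) * tr τ q := by
    rw [hS, tr_sum]; simp [-StarAlgEquiv.coe_pow, G.inv]
  have hSsa : star S = S := by rw [hS, star_sum]; exact Finset.sum_congr rfl fun i _ => (aut_proj _ hq).st
  have hb : ∀ i ∈ Finset.range (N+1), ∀ j ∈ Finset.range (N+1),
      tr τ ((β ^ i) q * (β ^ j) q) ≤ (if i = j then tr τ q else 0) + ε := by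
    intro i hi j hj
    simp only [Finset.mem_range] at hi hj
    rcases lt_trichotomy i j with hij | hij | hij
    · obtain ⟨d, rfl⟩ := Nat.exists_eq_add_of_lt hij
      rw [if_neg (by omega), add_assoc, pow_add_apply, ← map_mul, G.inv]
      have := (abs_le.1 ((abs_tr_le ht _).trans (h (d+1) (by omega) (by omega)))).2
      linarith
    · subst hij
      rw [if_pos rfl, ← map_mul, hq.mm, G.inv]; linarith
    · obtain ⟨d, rfl⟩ := Nat.exists_eq_add_of_lt hij
      rw [if_neg (by omega), tr_comm ht, add_assoc, pow_add_apply, ← map_mul, G.inv]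
      have := (abs_le.1 ((abs_tr_le ht _).trans (h (d+1) (by omega) (by omega)))).2
      linarith
  have hSS : tr τ (S * S) ≤ tr τ S + (N+1)^2 * ε := by
    rw [hS, Finset.sum_mul, tr_sum]
    have : ∀ i ∈ Finset.range (N+1), tr τ ((β ^ i) q * S) ≤ tr τ q + (N+1) * ε := by
      intro i hi
      rw [hS, Finset.mul_sum, tr_sum]
      refine (Finset.sum_le_sum (hb i hi)).trans ?_
      rw [Finset.sum_add_distrib, Finset.sum_ite_eq, if_pos hi]; simp
    rw [← hS]
    refine (Finset.sum_le_sum this).trans ?_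
    rw [hSt]; simp; ring_nf; rfl
  have h1 : n2 τ S ^ 2 = tr τ (S * S) := by rw [n2_sq ht, hSsa]
  have h2 := abs_tr_le_n2 ht S
  have h3 : 0 ≤ tr τ S := by rw [hSt]; have := tr_nonneg ht hq.nonneg; positivity
  rw [abs_of_nonneg h3] at h2
  have h4 : tr τ S ^ 2 ≤ tr τ S + (N+1)^2 * ε := by nlinarith
  rw [← hSt]
  have h5 : 0 ≤ ((N:ℝ)+1)^2 * ε := by positivity
  by_contra hcon
  push Not at hcon
  nlinarith

theorem small_sub (G : Good τ) {β : A ≃⋆ₐ[ℂ] A} (hU : PUO β) {q : A} (hq : IsProjection q) (h0 : q ≠ 0) {δ : ℝ} (hδ : 0 < δ) :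
    ∃ q', IsProjection q' ∧ q' ≠ 0 ∧ q' * q = q' ∧ q * q' = q' ∧ tr τ q' < δ := by
  obtain ⟨N, hN⟩ := exists_nat_gt (2 / δ)
  have hN1 : (0:ℝ) < (N:ℝ) + 1 := by positivity
  obtain ⟨n, s, s1, s2, s3⟩ := uo_star hU ((List.range N).map fun j => ((1:A), j+1)) (by simp) 
    (ε := 1/((N:ℝ)+1)^2) (by positivity) q hq
  have hex : ∃ i, s i ≠ 0 := by
    by_contra hcon; push Not at hcon
    apply h0; rw [← s2]; simp [hcon]
  obtain ⟨i, hi⟩ := hex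
  have hor := (sum_orth hq s1 s2).1 i
  refine ⟨s i, s1 i, hi, hor, mul_swap (s1 i) hq hor, ?_⟩
  have := small_tr G β (s1 i) N (ε := 1/((N:ℝ)+1)^2) (by positivity) (by
    intro j hj hjN
    have := s3 i (1, j) (by
      simp only [List.mem_map, List.mem_range]; exact ⟨j-1, by omega, by simp; omega⟩)
    simpa using this.le)
  rw [mul_one_div, div_self (by positivity)] at this
  have h2 : (2:ℝ) < δ * N := by rw [div_lt_iff₀ hδ] at hN; linarith
  nlinarith

/-- projection form of Cuntz subequivalence to a projection -/
theorem cuntz_proj {e a : A} (he : IsProjection e) (ha : IsProjection a) (h : CuntzLE e a) :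
    ∃ x, star x * x = e ∧ a * x = x := by
  obtain ⟨x, h1, h2⟩ := h
  have hcl : IsClosed {z : A | a * z = z} := isClosed_eq (by fun_prop) continuous_id
  have h3 : a * (x * star x) = x * star x := by
    have : closure (Set.range fun c => a * c * a) ⊆ {z : A | a * z = z} := by
      refine closure_minimal ?_ hcl
      rintro z ⟨c, rfl⟩
      show a * (a * c * a) = a * c * a
      simp only [← mul_assoc, ha.mm]
    exact this h2
  refine ⟨x, h1.symm, ?_⟩
  have h4 : (a * x - x) * star (a * x - x) = 0 := by
    have e1 : (a * x - x) * star (a * x - x) = (a * (x * star x) - x * star x) * (a - 1) := by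
      simp only [star_sub, star_mul, ha.st, sub_mul, mul_sub, mul_one, mul_assoc]
    rw [e1, h3]; simp
  have h5 : star (star (a * x - x)) * star (a * x - x) = 0 := by rwa [star_star]
  have := eq_zero_of_star_mul h5
  exact sub_eq_zero.1 (star_eq_zero.1 this)

/-- tracial rank zero with matrix units and small trace -/
theorem tr0_mus (G : Good τ) {β : A ≃⋆ₐ[ℂ] A} (hU : PUO β) (F : Finset A) {ε δ : ℝ} (hε : 0 < ε) (hδ : 0 < δ)
    {a : A} (ha : IsProjection a) (ha0 : a ≠ 0) :
    ∃ n, ∃ m : MUS A (Fin n), (∀ x ∈ F, ‖x * m.unit - m.unit * x‖ < ε) ∧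
      (∀ x ∈ F, ∃ b ∈ m.Sp, ‖m.unit * x * m.unit - b‖ < ε) ∧ 1 - tr τ m.unit < δ ∧
      (∃ x, star x * x = 1 - m.unit ∧ a * x = x) ∧
      (∀ x, m.π (m.r x) ≠ 0) ∧
      (∀ b ∈ m.Sp, ∀ x y, m.r x = m.r y → ∃ c : ℂ, star (m.v x) * b * m.v y = c • m.π (m.r x)) ∧
      ∀ x, m.v x ∈ m.Sp := by
  obtain ⟨a', a1, a2, a3, a4, a5⟩ := small_sub G hU ha ha0 hδ
  obtain ⟨B, P, hfd, hP, hPB, hu, f1, f2, f3⟩ := G.tr0 F ε hε a' (isPos_iff.2 a1.nonneg) a2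
  obtain ⟨n, m, m1, m2, m3, m4, m5⟩ := fd_mus B hP hPB hu
  refine ⟨n, m, ?_, ?_, ?_, ?_, m4, ?_, fun x => (m3 _).2 (m1 x)⟩
  · rw [m2]; exact f1
  · rw [m2]; intro x hx; obtain ⟨b, hb, h⟩ := f2 x hx; exact ⟨b, (m3 b).2 hb, h⟩
  · obtain ⟨x, h1, h2⟩ := cuntz_proj hP.one_sub a1 f3
    have h3 : tr τ (1 - P) = tr τ (x * star x) := by rw [← h1, tr_comm G.htr]
    have h4 : tr τ (x * star x) ≤ tr τ a' := by
      have hxp := pisom_proj hP.one_sub h1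
      have := proj_le hxp a1 (by rw [mul_assoc]; congr 1; have := congrArg star h2; simpa [a1.st] using this)
      exact tr_mono G.htr this
    rw [tr_sub, tr_one G.htr] at h3
    rw [m2]; linarith
  · obtain ⟨x, h1, h2⟩ := cuntz_proj hP.one_sub a1 f3
    exact ⟨x, by rw [m2, h1], by rw [← h2, ← mul_assoc, a4]⟩
  · intro b hb; exact m5 b ((m3 b).1 hb)
end aut
end RK

namespace RK
set_option linter.all false

section cz
variable {A : Type*} [CStarAlgebra A] [PartialOrder A] [StarOrderedRing A] {τ : A →ₗ[ℂ] ℂ}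

theorem conj_mono (x : A) {a b : A} (h : a ≤ b) : star x * a * x ≤ star x * b * x :=
  star_left_conjugate_le_conjugate h x

theorem sub_pisom' {w q : A} (h : q * w = w) (hq : star q = q) : star w * q = star w := by
  have := congrArg star h
  rwa [star_mul, hq] at this

theorem cuntz_via {g a : A} (hg : IsProjection g) (ha : star a = a) {c : ℝ} (hc : 0 < c)
    (h : c • g ≤ g * (a * a) * g) : ∃ y, star y * y = g ∧ ∀ z, ∃ c, y * z * star y = a * c * a := by
  have hg2 := hg.one_sub
  set H := g * (a * a) * g + (1 - g) with hH
  have hsa : IsSelfAdjoint H := by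
    rw [IsSelfAdjoint, hH]; simp only [star_add, star_mul, star_sub, star_one, hg.st, ha, mul_assoc]
  have hge : algebraMap ℝ A (min c 1) ≤ H := by
    have h1 : algebraMap ℝ A (min c 1) = (min c 1) • g + (min c 1) • (1 - g) := by
      rw [← smul_add, Algebra.algebraMap_eq_smul_one]; congr 1; abel
    rw [h1, hH]
    refine add_le_add (le_trans (smul_le_smul_of_nonneg_right (min_le_left _ _) hg.nonneg) h) ?_
    calc (min c 1) • (1 - g) ≤ (1:ℝ) • (1 - g) := smul_le_smul_of_nonneg_right (min_le_right _ _) hg2.nonneg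
      _ = 1 - g := one_smul _ _
  obtain ⟨s, s1, s2, s3, s4, -⟩ := invsqrt hsa (lt_min hc one_pos) hge
  have e1 : g * H = g * (a * a) * g := by
    rw [hH]; simp only [mul_add, mul_sub, mul_one, ← mul_assoc, hg.mm]; abel
  have e2 : H * g = g * (a * a) * g := by
    rw [hH]; simp only [add_mul, sub_mul, one_mul, mul_assoc, hg.mm]; abel
  have hcg : s * g = g * s := s4 g (by rw [Commute, SemiconjBy, e1, e2])
  have st : star (a * g * s) = s * g * a := by
    simp only [star_mul, s1.star_eq, hg.st, ha, mul_assoc]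
  refine ⟨a * g * s, ?_, fun z => ⟨g * s * z * s * g, ?_⟩⟩
  · rw [st]
    have : s * g * a * (a * g * s) = s * (g * (a * a) * g) * s := by simp only [mul_assoc]
    rw [this, ← e1, ← mul_assoc, hcg, mul_assoc, mul_assoc, ← mul_assoc s, s2, mul_one]
  · rw [st]; simp only [mul_assoc]

theorem cuntz_of {g a e : A} (hg : IsProjection g) (ha : star a = a) {c : ℝ} (hc : 0 < c)
    (h : c • g ≤ g * (a * a) * g) (hx : ∃ x, star x * x = e ∧ g * x = x) : CuntzLE e a := by
  obtain ⟨y, y1, y2⟩ := cuntz_via hg ha hc h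
  obtain ⟨x, x1, x2⟩ := hx
  refine ⟨y * x, ?_, ?_⟩
  · rw [star_mul, mul_assoc, ← mul_assoc (star y), y1, x2, x1]
  · apply subset_closure
    obtain ⟨c, hc⟩ := y2 (x * star x)
    exact ⟨c, by show a * c * a = _; rw [← hc]; simp only [star_mul, mul_assoc]⟩

theorem sym_mem (m : NonUnitalStarSubalgebra ℂ A) {b h : A} (hb : b ∈ m) (hh : star h = h) {ε : ℝ} (hd : ‖h - b‖ < ε) :
    ∃ b' ∈ m, IsSelfAdjoint b' ∧ ‖h - b'‖ < ε := by
  refine ⟨(1/2 : ℂ) • (b + star b), SMulMemClass.smul_mem _ (add_mem hb (star_mem hb)), ?_, ?_⟩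
  · rw [IsSelfAdjoint, star_smul, star_add, star_star, add_comm]; simp
  · have e : h - (1/2 : ℂ) • (b + star b) = (1/2:ℂ) • ((h - b) + star (h - b)) := by
      rw [star_sub, hh]
      have : h = (1/2:ℂ) • (h + h) := by rw [← two_smul ℂ h, smul_smul]; norm_num
      conv_lhs => rw [this]
      rw [← smul_sub]; congr 1; abel
    rw [e, norm_smul]
    have := norm_add_le (h - b) (star (h - b))
    rw [norm_star] at this
    have h2 : ‖(1/2:ℂ)‖ = 1/2 := by norm_num
    rw [h2]; linarith

theorem proj_ne (G : Good τ) : (1 : A) ≠ 0 := by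
  intro h
  have := tr_one G.htr
  rw [h, tr_zero] at this; exact zero_ne_one this

theorem specproj (G : Good τ) {β : A ≃⋆ₐ[ℂ] A} (hU : PUO β) {h : A} (hh : star h = h) (hp : 0 < tr τ h) :
    ∃ g : A, ∃ c : ℝ, 0 < c ∧ IsProjection g ∧ g ≠ 0 ∧ c • g ≤ g * h * g := by
  set T := tr τ h with hT
  have ht := G.htr
  have hn : 0 < ‖h‖ + 1 := by positivity
  obtain ⟨n, m, m1, m2, m3, -, -, -, -⟩ := tr0_mus G hU {h} (ε := T/16) (δ := T/(16 * (‖h‖+1))) (by linarith)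
    (by positivity) proj_one (proj_ne G)
  have hP := m.unit_proj
  set P := m.unit
  obtain ⟨b0, hb0, hb1⟩ := m2 h (by simp)
  obtain ⟨b, hb, hbs, hbd⟩ := sym_mem m.alg (b := b0) hb0 (h := P * h * P) (by simp [hP.st, hh, mul_assoc]) hb1
  haveI := m.fd
  have t1 : |tr τ (h * (1 - P))| ≤ T/16 := by
    refine (abs_tr_mul_le ht _ _ hP.one_sub.nonneg).trans ?_
    rw [tr_sub, tr_one ht]
    have : ‖h‖ * (1 - tr τ P) ≤ (‖h‖ + 1) * (T/(16 * (‖h‖+1))) := by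
      apply mul_le_mul (by linarith) m3.le _ hn.le
      have := tr_nonneg ht hP.one_sub.nonneg; rw [tr_sub, tr_one ht] at this; exact this
    refine this.trans (le_of_eq ?_); field_simp
  have t2 : tr τ (P * h * P) = T - tr τ (h * (1 - P)) := by
    rw [tr_comm ht, ← mul_assoc, hP.mm, tr_comm ht, mul_sub, mul_one, tr_sub]; ring
  have t3 := tr_diff ht (P * h * P) b
  have t4 : T/2 < tr τ b := by
    have := abs_le.1 t1; have := abs_le.1 t3; linarith
  haveI : Nontrivial A := ⟨1, 0, proj_ne G⟩
  set f : ℝ → ℝ := fun t => if t ∈ Set.Ioi (T/4) then (1:ℝ) else 0 with hf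
  classical
  set g := cfc f b with hg
  have hgp : IsProjection g := fd_specproj m.alg hb hbs (Set.Ioi (T/4))
  have cont : ∀ f : ℝ → ℝ, ContinuousOn f (spectrum ℝ b) := fd_cont m.alg hb
  have hgm : g ∈ m.alg := fd_cfc_mem m.alg hb (by simp [hf]; linarith)
  have hPg : P * g = g := m.unit_mul hgm
  have hgP : g * P = g := m.mul_unit hgm
  have l1 : b - algebraMap ℝ A (T/4) ≤ ‖b‖ • g := by
    have e1 : b - algebraMap ℝ A (T/4) = cfc (fun t : ℝ => t - T/4) b := by
      rw [cfc_sub (fun t : ℝ => t) (fun _ => T/4) b (cont _) (cont _), cfc_id' ℝ b, cfc_const _ b]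
    rw [e1, hg, ← cfc_smul _ _ _ (cont _)]
    apply cfc_mono _ (cont _) (cont _)
    intro t htt
    have : t ≤ ‖b‖ := (le_abs_self t).trans (spectrum.norm_le_norm_of_mem htt)
    simp only [hf, Set.mem_Ioi, smul_eq_mul]
    split_ifs with h
    · linarith
    · linarith
  have l2 : (T/4) • g ≤ g * b * g := by
    have e1 : g * b * g = cfc (fun t : ℝ => f t * t * f t) b := by
      rw [cfc_mul (fun t => f t * t) f b (cont _) (cont _), cfc_mul f (fun t => t) b (cont _) (cont _), cfc_id' ℝ b]
    rw [e1, hg, ← cfc_smul _ _ _ (cont _)]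
    apply cfc_mono _ (cont _) (cont _)
    intro t htt
    simp only [hf, Set.mem_Ioi, smul_eq_mul]
    split_ifs with h <;> simp; exact h.le
  refine ⟨g, T/8, by linarith, hgp, ?_, ?_⟩
  · intro h0
    have := tr_mono ht l1
    rw [h0, smul_zero, tr_zero, tr_sub, Algebra.algebraMap_eq_smul_one, tr_smul, tr_one ht] at this
    linarith
  · have hd : IsSelfAdjoint (P * h * P - b) := by
      rw [IsSelfAdjoint, star_sub, hbs.star_eq]; simp [hP.st, hh, mul_assoc]
    have l3 := (sa_bounds hd hbd.le).2
    have l4 := conj_mono g l3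
    have e3 : star g * (P * h * P - b) * g = g * h * g - g * b * g := by
      rw [hgp.st, mul_sub, sub_mul]; congr 1
      rw [← mul_assoc, ← mul_assoc, hgP, mul_assoc, hPg]
    have e4 : star g * (-algebraMap ℝ A (T/16)) * g = -((T/16) • g) := by
      rw [Algebra.algebraMap_eq_smul_one, hgp.st, mul_neg, neg_mul, mul_smul_comm, smul_mul_assoc, mul_one, hgp.mm]
    rw [e3, e4] at l4
    have l5 : (T/8) • g ≤ (T/4) • g - (T/16) • g := by
      rw [← sub_smul]; exact smul_le_smul_of_nonneg_right (by linarith) hgp.nonneg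
    calc (T/8) • g ≤ (T/4) • g - (T/16) • g := l5
      _ ≤ g * b * g + (g * h * g - g * b * g) := by rw [sub_eq_add_neg]; exact add_le_add l2 l4
      _ = g * h * g := by abel

theorem cuntz_A (G : Good τ) {β : A ≃⋆ₐ[ℂ] A} (hU : PUO β) {a : A} (ha : 0 ≤ a) (h0 : a ≠ 0) :
    ∃ g : A, IsProjection g ∧ g ≠ 0 ∧ ∀ e, (∃ x, star x * x = e ∧ g * x = x) → CuntzLE e a := by
  have hs : star a = a := (IsSelfAdjoint.of_nonneg ha).star_eq
  have hp : 0 < tr τ (a * a) := by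
    have h1 := tr_star_mul_nonneg G.htr a
    rw [hs] at h1
    refine lt_of_le_of_ne h1 fun h => h0 (faithful G.htr G.simple (by rw [hs]; exact h.symm))
  obtain ⟨g, c, hc, g1, g2, g3⟩ := specproj G hU (by rw [star_mul, hs]) hp
  exact ⟨g, g1, g2, fun e he => cuntz_of g1 hs hc g3 he⟩
end cz

section state
variable {A : Type*} [CStarAlgebra A] [PartialOrder A] [StarOrderedRing A] {τ : A →ₗ[ℂ] ℂ}

theorem pos_bound (φ : A →ₗ[ℂ] ℂ) (hφ : ∀ a : A, ∃ r : ℝ, 0 ≤ r ∧ φ (star a * a) = r) (h1 : φ 1 = 1) (a : A) :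
    ‖φ a‖ ≤ 2 * ‖a‖ := by
  have pos : ∀ x : A, 0 ≤ x → ∃ r : ℝ, 0 ≤ r ∧ φ x = r := by
    intro x hx
    obtain ⟨b, rfl⟩ := CStarAlgebra.nonneg_iff_eq_star_mul_self.1 hx
    exact hφ b
  have key : ∀ x : A, IsSelfAdjoint x → ‖φ x‖ ≤ ‖x‖ := by
    intro x hx
    obtain ⟨u, l⟩ := sa_bounds hx le_rfl
    obtain ⟨r, r0, r1⟩ := pos _ (sub_nonneg.2 u)
    obtain ⟨s, s0, s1⟩ := pos _ (sub_nonneg.2 l)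
    have e : φ (algebraMap ℝ A ‖x‖) = (‖x‖ : ℂ) := by
      rw [Algebra.algebraMap_eq_smul_one, ← Complex.coe_smul, map_smul, h1]; simp
    rw [map_sub, e] at r1
    rw [map_sub, map_neg, e] at s1
    have : φ x = ((‖x‖ - r : ℝ) : ℂ) := by push_cast; rw [← r1]; ring
    rw [this] at s1 ⊢
    rw [Complex.norm_real, Real.norm_eq_abs]
    have s2 : (‖x‖ - r) + ‖x‖ = s := by
      have := congrArg Complex.re s1; simpa using this
    rw [abs_le]; constructor <;> linarith
  have hd := realPart_add_I_smul_imaginaryPart a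
  have b1 : ‖(realPart a : A)‖ ≤ ‖a‖ := realPart.norm_le a
  have b2 : ‖(imaginaryPart a : A)‖ ≤ ‖a‖ := imaginaryPart.norm_le a
  calc ‖φ a‖ = ‖φ (realPart a : A) + Complex.I * φ (imaginaryPart a : A)‖ := by
        conv_lhs => rw [← hd]
        rw [map_add, map_smul, smul_eq_mul]
    _ ≤ ‖φ (realPart a : A)‖ + ‖Complex.I * φ (imaginaryPart a : A)‖ := norm_add_le _ _
    _ ≤ 2 * ‖a‖ := by
        rw [norm_mul, Complex.norm_I, one_mul]
        have := key _ (realPart a).2; have := key _ (imaginaryPart a).2; linarith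

theorem stateq (huniq : ∀ σ : A →ₗ[ℂ] ℂ, IsTracialState σ → σ = τ) (y : A) {ε : ℝ} (hε : 0 < ε) :
    ∃ Y : Finset A, ∃ δ > 0, ∀ φ : A →ₗ[ℂ] ℂ, (∀ a : A, ∃ r : ℝ, 0 ≤ r ∧ φ (star a * a) = r) → φ 1 = 1 →
      (∀ a ∈ Y, ∀ b ∈ Y, |(φ (a * b)).re - (φ (b * a)).re| < δ) → |(φ y).re - tr τ y| < ε := by
  classical
  by_contra hcon
  push Not at hcon
  have hc : ∀ i : Finset A × ℕ, ∃ φ : A →ₗ[ℂ] ℂ, (∀ a : A, ∃ r : ℝ, 0 ≤ r ∧ φ (star a * a) = r) ∧ φ 1 = 1 ∧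
      (∀ a ∈ i.1, ∀ b ∈ i.1, |(φ (a * b)).re - (φ (b * a)).re| < 1/((i.2:ℝ)+1)) ∧ ε ≤ |(φ y).re - tr τ y| :=
    fun i => by
      obtain ⟨φ, a, b, c, d⟩ := hcon i.1 (1/((i.2:ℝ)+1)) (by positivity)
      exact ⟨φ, a, b, c, d⟩
  choose φ f1 f2 f3 f4 using hc
  let U : Ultrafilter (Finset A × ℕ) := Ultrafilter.of atTop
  have hU : (U : Filter (Finset A × ℕ)) ≤ atTop := Ultrafilter.of_le _
  have lim : ∀ a : A, ∃ z : ℂ, Tendsto (fun i => φ i a) U (𝓝 z) := by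
    intro a
    have hk : IsCompact (Metric.closedBall (0:ℂ) (2 * ‖a‖)) := isCompact_closedBall _ _
    have := hk.ultrafilter_le_nhds (U.map fun i => φ i a) (by
      rw [Ultrafilter.coe_map, Filter.le_principal_iff]
      exact Filter.mem_map.2 (Filter.univ_mem' fun i => by
        simpa using pos_bound (φ i) (f1 i) (f2 i) a))
    obtain ⟨z, -, hz⟩ := this
    exact ⟨z, hz⟩
  choose ψ hψ using lim
  let Ψ : A →ₗ[ℂ] ℂ :=
    { toFun := ψ
      map_add' := fun a b => tendsto_nhds_unique (hψ (a + b)) (by simpa using (hψ a).add (hψ b))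
      map_smul' := fun c a => tendsto_nhds_unique (hψ (c • a)) (by simpa using (hψ a).const_mul c) }
  have hre : ∀ a b : A, (ψ (a * b)).re = (ψ (b * a)).re := by
    intro a b
    have t1 : Tendsto (fun i => (φ i (a * b)).re - (φ i (b * a)).re) U (𝓝 ((ψ (a*b)).re - (ψ (b * a)).re)) :=
      ((Complex.continuous_re.tendsto _).comp (hψ _)).sub ((Complex.continuous_re.tendsto _).comp (hψ _))
    have t2 : Tendsto (fun i : Finset A × ℕ => 1/((i.2:ℝ)+1)) U (𝓝 0) :=
      (tendsto_one_div_add_atTop_nhds_zero_nat.comp (tendsto_snd.mono_left (by rw [prod_atTop_atTop_eq]))).mono_left hU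
    have t3 : Tendsto (fun i => (φ i (a * b)).re - (φ i (b * a)).re) U (𝓝 0) := by
      refine squeeze_zero_norm' ?_ t2
      refine hU ?_
      filter_upwards [eventually_ge_atTop (({a, b} : Finset A), 0)] with i hi
      have h1 : ({a, b} : Finset A) ⊆ i.1 := hi.1
      exact (f3 i a (h1 (by simp)) b (h1 (by simp))).le
    have := tendsto_nhds_unique t1 t3
    linarith
  have hT : IsTracialState Ψ := by
    refine ⟨fun a => ?_, ?_, fun a b => ?_⟩
    · have t1 := hψ (star a * a)
      refine ⟨(ψ (star a * a)).re, ?_, ?_⟩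
      · refine ge_of_tendsto ((Complex.continuous_re.tendsto _).comp t1) (Eventually.of_forall fun i => ?_)
        obtain ⟨r, r0, r1⟩ := f1 i a
        simp [r1, r0]
      · have : (ψ (star a * a)).im = 0 := by
          refine tendsto_nhds_unique ((Complex.continuous_im.tendsto _).comp t1) ?_
          refine tendsto_const_nhds.congr fun i => ?_
          obtain ⟨r, r0, r1⟩ := f1 i a
          simp [r1]
        exact Complex.ext (by simp [Ψ]) (by simp [Ψ, this])
    · exact tendsto_nhds_unique (hψ 1) (by simp only [f2]; exact tendsto_const_nhds)
    · refine Complex.ext (hre a b) ?_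
      have := hre (Complex.I • a) b
      rw [smul_mul_assoc, mul_smul_comm] at this
      have e : ∀ z : A, ψ (Complex.I • z) = Complex.I * ψ z := fun z => Ψ.map_smul Complex.I z
      rw [e, e] at this
      simpa [Ψ] using this
  have := huniq Ψ hT
  have e : ψ y = τ y := congrArg (fun f : A →ₗ[ℂ] ℂ => f y) this
  have t := (Complex.continuous_re.tendsto _).comp (hψ y)
  have t2 : Tendsto (fun i => |(φ i y).re - tr τ y|) U (𝓝 |(ψ y).re - tr τ y|) := (t.sub_const _).abs
  have := ge_of_tendsto t2 (Eventually.of_forall f4)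
  rw [e] at this; simp [tr] at this; linarith

theorem stateq' (G : Good τ) (y : A) {ε : ℝ} (hε : 0 < ε) :
    ∃ Y : Finset A, ∃ δ > 0, ∀ X : A, 0 ≤ X → 0 < tr τ X →
      (∀ a ∈ Y, ∀ b ∈ Y, |tr τ (a * (b * X - X * b))| < δ * tr τ X) →
      |tr τ (y * X) - tr τ y * tr τ X| ≤ ε * tr τ X := by
  obtain ⟨Y, δ, hδ, h⟩ := stateq G.uniq y hε
  refine ⟨Y, δ, hδ, fun X hX ht hc => ?_⟩
  have hτ := G.htr
  set t := tr τ X with htd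
  let φ : A →ₗ[ℂ] ℂ := ((t : ℂ)⁻¹) • τ.comp (LinearMap.mulRight ℂ X)
  have hφ : ∀ a, φ a = (t:ℂ)⁻¹ * τ (a * X) := fun a => rfl
  have hφr : ∀ a, (φ a).re = t⁻¹ * tr τ (a * X) := fun a => by
    rw [hφ, ← Complex.ofReal_inv, Complex.re_ofReal_mul]; rfl
  have htau : τ X = (t : ℂ) := Complex.ext rfl (by simpa using (tau_nonneg hτ hX).2)
  have := h φ (fun a => by
    obtain ⟨s, rfl⟩ := CStarAlgebra.nonneg_iff_eq_star_mul_self.1 hX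
    have e : τ (star a * a * (star s * s)) = τ (star (a * star s) * (a * star s)) := by
      rw [star_mul, star_star, hτ.2.2 (star a * a), hτ.2.2 (s * star a)]
      rw [hτ.2.2 (a * star s)]; rw [← hτ.2.2 (star a * a)]
      rw [mul_assoc s, hτ.2.2 s]; simp only [mul_assoc]
    obtain ⟨r, r0, r1⟩ := hτ.1 (a * star s)
    refine ⟨t⁻¹ * r, by positivity, ?_⟩
    rw [hφ, e, r1]; simp) (by rw [hφ, one_mul, htau]; exact inv_mul_cancel₀ (by exact_mod_cast ht.ne')) (fun a ha b hb => by
      rw [hφr, hφr, ← mul_sub, abs_mul, abs_of_pos (inv_pos.2 ht)]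
      have e : tr τ (a * b * X) - tr τ (b * a * X) = tr τ (a * (b * X - X * b)) := by
        rw [mul_sub, tr_sub]; congr 1
        · rw [mul_assoc]
        · rw [mul_assoc, tr_comm hτ, mul_assoc]
      rw [e, inv_mul_lt_iff₀ ht, mul_comm]; exact hc a ha b hb)
  rw [hφr] at this
  have e : tr τ (y * X) - tr τ y * t = t * (t⁻¹ * tr τ (y * X) - tr τ y) := by
    field_simp
  rw [e, abs_mul, abs_of_pos ht, mul_comm]
  exact mul_le_mul_of_nonneg_right this.le ht.le

theorem mix (G : Good τ) (y : A) {ε : ℝ} (hε : 0 < ε) :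
    ∃ Y : Finset A, ∃ δ > 0, ∀ X : A, 0 ≤ X → X ≤ 1 → (∀ b ∈ Y, ‖b * X - X * b‖ < δ) →
      |tr τ (y * X) - tr τ y * tr τ X| ≤ ε := by
  obtain ⟨Y, δ, hδ, h⟩ := stateq' G y hε
  have hτ := G.htr
  set s := ε / (2 * ‖y‖ + 1) with hs
  have hy : 0 ≤ ‖y‖ := norm_nonneg _
  have hs0 : 0 < s := by positivity
  set K := 1 + ∑ a ∈ Y, ‖a‖ with hK
  have hK0 : 0 < K := by positivity
  refine ⟨Y, δ * s / K, by positivity, fun X hX hX1 hc => ?_⟩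
  have ht0 := tr_nonneg hτ hX
  have ht1 := tr_mono hτ hX1
  rw [tr_one hτ] at ht1
  rcases lt_or_ge (tr τ X) s with hlt | hge
  · have h1 := abs_tr_mul_le hτ y X hX
    have h2 := abs_tr_le hτ y
    have h3 : |tr τ y * tr τ X| ≤ ‖y‖ * tr τ X := by
      rw [abs_mul, abs_of_nonneg ht0]; exact mul_le_mul_of_nonneg_right h2 ht0
    have h4 : (2 * ‖y‖ + 1) * s = ε := by rw [hs]; field_simp
    have := abs_sub (tr τ (y * X)) (tr τ y * tr τ X)
    nlinarith
  · refine (h X hX (hs0.trans_le hge) fun a ha b hb => ?_).trans (by nlinarith)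
    have h1 := abs_tr_le hτ (a * (b * X - X * b))
    have h2 : ‖a‖ < K := by
      have := Finset.single_le_sum (f := fun a : A => ‖a‖) (fun _ _ => norm_nonneg _) ha
      linarith
    have h3 := hc b hb
    calc _ ≤ ‖a * (b * X - X * b)‖ := h1
      _ ≤ ‖a‖ * ‖b * X - X * b‖ := norm_mul_le _ _
      _ ≤ K * ‖b * X - X * b‖ := mul_le_mul_of_nonneg_right h2.le (norm_nonneg _)
      _ < K * (δ * s / K) := mul_lt_mul_of_pos_left h3 hK0
      _ = δ * s := by field_simp
      _ ≤ δ * tr τ X := mul_le_mul_of_nonneg_left hge hδ.le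
end state
end RK

namespace RK
set_option linter.all false

section cmp
variable {A : Type*} [CStarAlgebra A] [PartialOrder A] [StarOrderedRing A] {τ : A →ₗ[ℂ] ℂ}

theorem tr_cont (hτ : IsTracialState τ) : Continuous (tr τ) := by
  refine continuous_iff_continuousAt.2 fun x => ?_
  rw [ContinuousAt, tendsto_iff_norm_sub_tendsto_zero]
  refine squeeze_zero (fun _ => norm_nonneg _) (fun y => ?_) (tendsto_iff_norm_sub_tendsto_zero.1 tendsto_id)
  exact tr_diff hτ y x

/-- partial isometry in a finite dimensional algebra from a nonzero element -/
theorem fd_polar (B : NonUnitalStarSubalgebra ℂ A) [FiniteDimensional ℂ B] {x : A} (hx : x ∈ B) (h0 : x ≠ 0) :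
    ∃ u ∈ B, ∃ c, u = x * c ∧ (∃ f, IsProjection f ∧ f ≠ 0 ∧ star u * u = f ∧ ∃ d, f = d * x) := by
  have hb : star x * x ∈ B := mul_mem (star_mem hx) hx
  have hsa : IsSelfAdjoint (star x * x) := .star_mul_self x
  set b := star x * x with hbd
  have cont : ∀ f : ℝ → ℝ, ContinuousOn f (spectrum ℝ b) := fd_cont B hb
  set h : ℝ → ℝ := fun t => if 0 < t then (Real.sqrt t)⁻¹ else 0 with hh
  have hpos : ∀ t ∈ spectrum ℝ b, 0 ≤ t := fun t ht => spectrum_nonneg_of_nonneg (star_mul_self_nonneg x) ht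
  set s := cfc h b with hs
  have hss : star s = s := (cfc_predicate h b : IsSelfAdjoint _).star_eq
  have hsB : s ∈ B := fd_cfc_mem B hb (by simp [hh])
  set f : ℝ → ℝ := fun t => if t ∈ Set.Ioi (0:ℝ) then (1:ℝ) else 0 with hf
  classical
  have hfp : IsProjection (cfc f b) := by
    convert fd_specproj B hb hsa (Set.Ioi (0:ℝ))
  have e1 : s * b * s = cfc f b := by
    have : s * b * s = cfc (fun t : ℝ => h t * t * h t) b := by
      rw [cfc_mul (fun t => h t * t) h b (cont _) (cont _), cfc_mul h (fun t => t) b (cont _) (cont _), cfc_id' ℝ b]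
    rw [this]
    apply cfc_congr
    intro t ht
    simp only [hh, hf, Set.mem_Ioi]
    split_ifs with h1
    · have := Real.mul_self_sqrt h1.le
      have h2 : 0 < Real.sqrt t := Real.sqrt_pos.2 h1
      field_simp; rw [sq, this]
    · simp
  have e2 : b * cfc f b = b := by
    have : b * cfc f b = cfc (fun t : ℝ => t * f t) b := by
      rw [cfc_mul (fun t => t) f b (cont _) (cont _), cfc_id' ℝ b]
    rw [this]
    conv_rhs => rw [← cfc_id' ℝ b]
    apply cfc_congr
    intro t ht
    simp only [hf, Set.mem_Ioi]
    split_ifs with h1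
    · simp
    · have := hpos t ht; have : t = 0 := le_antisymm (not_lt.1 h1) this
      simp [this]
  have e3 : s * b = b * s := by
    exact (Commute.refl b).cfc_real h
  refine ⟨x * s, mul_mem hx hsB, s, rfl, cfc f b, hfp, ?_, ?_, s * s * star x, ?_⟩
  · intro h0'
    rw [h0', mul_zero] at e2
    exact h0 (eq_zero_of_star_mul e2.symm)
  · rw [star_mul, hss, ← e1, hbd]; simp only [mul_assoc]
  · rw [← e1, mul_assoc (s * s), ← hbd, mul_assoc s s, e3, ← mul_assoc]
    rw [e3]

theorem fd_max (hτ : IsTracialState τ) (hs : IsSimpleCStar A) (B : NonUnitalStarSubalgebra ℂ A) [FiniteDimensional ℂ B] {p q : A} (hp : IsProjection p)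
    (hq : IsProjection q) (hpB : p ∈ B) (hqB : q ∈ B) :
    ∃ w ∈ B, IsProjection (star w * w) ∧ w * p = w ∧ q * w = w ∧
      ∀ b ∈ B, (q - w * star w) * b * (p - star w * w) = 0 := by
  let K : Set B := {w | (w:A) * star (w:A) * w = w ∧ (w:A) * p = w ∧ q * (w:A) = w}
  have hcl : IsClosed K := by
    refine IsClosed.inter ?_ (IsClosed.inter ?_ ?_) <;> apply isClosed_eq <;> fun_prop
  have hbd : Bornology.IsBounded K := by
    refine (Metric.isBounded_closedBall (x := (0:B)) (r := 1)).subset fun w hw => ?_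
    have hw2 : (w:A) * star (w:A) * w = w := hw.1
    have : IsProjection (star (w:A) * w) := mkp' (by simp) (by
      have : star (w:A) * w * (star (w:A) * w) = star (w:A) * ((w:A) * star (w:A) * w) := by simp only [mul_assoc]
      rw [this, hw2])
    have h3 := this.norm_le
    rw [CStarRing.norm_star_mul_self] at h3
    rw [mem_closedBall_zero_iff]
    have : ‖w‖ = ‖(w:A)‖ := rfl
    rw [this]
    nlinarith [norm_nonneg (w:A)]
  haveI : ProperSpace B := FiniteDimensional.proper ℂ B
  have hK : IsCompact K := Metric.isCompact_of_isClosed_isBounded hcl hbd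
  obtain ⟨w, hw, hmax⟩ := hK.exists_isMaxOn ⟨0, by simp [K]⟩
    (f := fun w : B => tr τ (star (w:A) * w)) ((tr_cont hτ).comp (by fun_prop)).continuousOn
  obtain ⟨w1, w2, w3⟩ := hw
  have hwB := w.2
  have hP : IsProjection (star (w:A) * w) := mkp' (by simp) (by
      have : star (w:A) * w * (star (w:A) * w) = star (w:A) * ((w:A) * star (w:A) * w) := by simp only [mul_assoc]
      rw [this, w1])
  refine ⟨w, hwB, hP, w2, w3, ?_⟩
  intro b hb
  by_contra hne
  set x := (q - (w:A) * star (w:A)) * b * (p - star (w:A) * w) with hx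
  have hxB : x ∈ B := mul_mem (mul_mem (sub_mem hqB (mul_mem hwB (star_mem hwB))) hb) (sub_mem hpB (mul_mem (star_mem hwB) hwB))
  obtain ⟨u, huB, c, hu, f, f1, f2, f3, d, f4⟩ := fd_polar B hxB hne
  have w4 : p * star (w:A) = star (w:A) := by have := congrArg star w2; simpa [hp.st] using this
  have w5 : star (w:A) * q = star (w:A) := by have := congrArg star w3; simpa [hq.st] using this
  have w6 : star (w:A) * w * star (w:A) = star (w:A) := by have := congrArg star w1; simpa [mul_assoc] using this
  have x1 : q * x = x := by
    have : q * (q - (w:A) * star (w:A)) = q - (w:A) * star (w:A) := by rw [mul_sub, hq.mm, ← mul_assoc q, w3]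
    rw [hx, ← mul_assoc, ← mul_assoc, this]
  have x2 : star (w:A) * x = 0 := by
    have : star (w:A) * (q - (w:A) * star (w:A)) = 0 := by rw [mul_sub, w5, ← mul_assoc, w6, sub_self]
    rw [hx, ← mul_assoc, ← mul_assoc, this]; simp
  have x3 : x * p = x := by
    have : (p - star (w:A) * w) * p = p - star (w:A) * w := by rw [sub_mul, hp.mm, mul_assoc (star (w:A)), w2]
    rw [hx, mul_assoc, this]
  have x4 : x * star (w:A) = 0 := by
    have : (p - star (w:A) * w) * star (w:A) = 0 := by rw [sub_mul, w4, w6, sub_self]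
    rw [hx, mul_assoc, this]; simp
  have fp : f * p = f := by rw [f4, mul_assoc, x3]
  have fw : f * star (w:A) = 0 := by rw [f4, mul_assoc, x4]; simp
  have uf : u * f = u := sub_pisom f1 f3
  have up : u * p = u := by rw [← uf, mul_assoc, fp]
  have uw : u * star (w:A) = 0 := by rw [← uf, mul_assoc, fw]; simp
  have qu : q * u = u := by rw [hu, ← mul_assoc, x1]
  have wu : star (w:A) * u = 0 := by rw [hu, ← mul_assoc, x2]; simp
  have wu' : star u * (w:A) = 0 := by have := congrArg star wu; simpa using this
  have uw' : (w:A) * star u = 0 := by have := congrArg star uw; simpa using this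
  have hmem : (⟨(w:A) + u, add_mem hwB huB⟩ : B) ∈ K := by
    refine ⟨?_, ?_, ?_⟩
    · show ((w:A) + u) * star ((w:A) + u) * ((w:A) + u) = (w:A) + u
      have : star ((w:A) + u) * ((w:A) + u) = star (w:A) * w + f := by
        rw [star_add, add_mul, mul_add, mul_add, wu, wu', f3]; simp
      rw [mul_assoc, this, add_mul, mul_add, mul_add, ← mul_assoc, w1, uf, ← mul_assoc u, uw]
      have : (w:A) * f = 0 := by have := congrArg star fw; simpa [f1.st] using this
      rw [this]; simp
    · show ((w:A) + u) * p = _; rw [add_mul, w2, up]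
    · show q * ((w:A) + u) = _; rw [mul_add, w3, qu]
  have := hmax hmem
  simp only [Set.mem_ofPred_eq] at this
  have e : star ((w:A) + u) * ((w:A) + u) = star (w:A) * w + f := by
        rw [star_add, add_mul, mul_add, mul_add, wu, wu', f3]; simp
  rw [e, tr_add] at this
  have := tr_pos hτ hs f1.nonneg f2
  linarith

theorem fd_cmp (hτ : IsTracialState τ) (hs : IsSimpleCStar A) {n : ℕ} (m : MUS A (Fin n))
    (hsc : ∀ b ∈ m.Sp, ∀ x y, m.r x = m.r y → ∃ c : ℂ, star (m.v x) * b * m.v y = c • m.π (m.r x))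
    {p q : A} (hp : IsProjection p) (hq : IsProjection q) (hpB : p ∈ m.Sp) (hqB : q ∈ m.Sp) :
    (∃ w, star w * w = p ∧ q * w = w) ∨
    ∃ z, IsProjection z ∧ z ≠ 0 ∧ (∀ b ∈ m.Sp, b * z = z * b) ∧ z * m.unit = z ∧ tr τ (q * z) ≤ tr τ (p * z) := by
  classical
  haveI := m.fd
  obtain ⟨w, hwB, w1, w2, w3, w4⟩ := fd_max hτ hs m.alg hp hq hpB hqB
  by_cases h0 : p - star w * w = 0
  · left; exact ⟨w, (sub_eq_zero.1 h0).symm, w3⟩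
  right
  have hwB' : w ∈ m.Sp := hwB
  set p' := p - star w * w with hp'
  set q' := q - w * star w with hq'
  have hp'p : IsProjection p' := proj_sub w1 hp (by rw [mul_assoc, w2])
  have hp'B : p' ∈ m.Sp := sub_mem hpB (m.mul_mem (m.star_mem hwB') hwB')
  let T : Finset (Fin n) := Finset.univ.filter fun x => ∃ y, m.r y = m.r x ∧ p' * m.v y ≠ 0
  have hT : ∀ x y, m.r x = m.r y → (x ∈ T ↔ y ∈ T) := by
    intro x y h; simp only [T, Finset.mem_filter, Finset.mem_univ, true_and, h]
  set z := ∑ x ∈ T, m.v x * star (m.v x) with hz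
  have zv : ∀ x, z * m.v x = if x ∈ T then m.v x else 0 := by
    intro x
    rw [hz, Finset.sum_mul]
    have : ∀ y ∈ T, m.v y * star (m.v y) * m.v x = if y = x then m.v x else 0 := by
      intro y _
      rw [mul_assoc, m.svv]; split_ifs with h
      · subst h; exact m.vpi y
      · simp
    rw [Finset.sum_congr rfl this, Finset.sum_ite_eq']
  have hzp : IsProjection z := by
    refine proj_sum T _ (fun x _ => m.proj x) fun x _ y _ h => ?_
    rw [mul_assoc, ← mul_assoc (star _), m.svv, if_neg h]; simp
  have vz : ∀ x, star (m.v x) * z = if x ∈ T then star (m.v x) else 0 := by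
    intro x
    have := congrArg star (zv x)
    rw [star_mul, hzp.st] at this
    rw [this]; split_ifs <;> simp
  have hzc : ∀ b ∈ m.Sp, b * z = z * b := by
    intro b hb
    induction hb using Submodule.span_induction with
    | mem c hc =>
      obtain ⟨x, y, h, rfl⟩ := hc
      rw [mul_assoc, vz, ← mul_assoc, zv]
      by_cases hx : x ∈ T
      · rw [if_pos hx, if_pos ((hT x y h).1 hx)]
      · rw [if_neg hx, if_neg (fun hy => hx ((hT x y h).2 hy))]; simp
    | zero => simp
    | add a b _ _ ha hb => rw [add_mul, mul_add, ha, hb]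
    | smul c a _ ha => rw [smul_mul_assoc, mul_smul_comm, ha]
  have hzP : z * m.unit = z := by
    rw [hz, Finset.sum_mul]
    exact Finset.sum_congr rfl fun x _ => by rw [mul_assoc, m.vs_unit]
  have hzp' : p' * z = p' := by
    have h1 : p' * z = p' * m.unit := by
      rw [hz, MUS.unit, Finset.mul_sum, Finset.mul_sum]
      refine Finset.sum_subset (Finset.subset_univ _) fun x _ hx => ?_
      have : p' * m.v x = 0 := by
        by_contra hne
        exact hx (by simp only [T, Finset.mem_filter, Finset.mem_univ, true_and]; exact ⟨x, rfl, hne⟩)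
      rw [← mul_assoc, this, zero_mul]
    rw [h1, m.mul_unit hp'B]
  have hqz : q' * z = 0 := by
    rw [hz, Finset.mul_sum]
    refine Finset.sum_eq_zero fun x hx => ?_
    simp only [T, Finset.mem_filter, Finset.mem_univ, true_and] at hx
    obtain ⟨y, hy, hne⟩ := hx
    have h1 := w4 _ (m.vv_mem hy.symm)
    obtain ⟨c, hc⟩ := hsc p' hp'B y y rfl
    have h2 : (c • (q' * m.v x) : A) = 0 := by
      have : q' * (m.v x * star (m.v y)) * p' * m.v y = q' * m.v x * (star (m.v y) * p' * m.v y) := by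
        simp only [mul_assoc]
      rw [h1, zero_mul, hc, hy, mul_smul_comm, mul_assoc, m.vpi] at this
      exact this.symm
    have hc0 : c ≠ 0 := by
      intro h0
      rw [h0, zero_smul] at hc
      apply hne
      apply eq_zero_of_star_mul
      rw [star_mul, hp'p.st, mul_assoc, ← mul_assoc p', hp'p.mm, ← mul_assoc, hc]
    rw [← mul_assoc, (smul_eq_zero.1 h2).resolve_left hc0, zero_mul]
  refine ⟨z, hzp, ?_, hzc, hzP, ?_⟩
  · intro h; rw [h, mul_zero] at hzp'; exact h0 hzp'.symm
  · have e1 : q * z = w * star w * z := by rw [← sub_eq_zero, ← sub_mul]; exact hqz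
    have e2 : p * z = star w * w * z + p' := by rw [← hzp', hp', ← add_mul]; congr 1; abel
    have e3 : tr τ (w * star w * z) = tr τ (star w * w * z) := by
      rw [mul_assoc, tr_comm hτ, mul_assoc, mul_assoc, ← hzc w hwB']
    rw [e1, e2, e3, tr_add]
    have := tr_nonneg hτ hp'p.nonneg; linarith

/-- splitting an almost commuting projection -/
theorem split_proj {P p b : A} (hP : IsProjection P) (hp : IsProjection p) (B : NonUnitalStarSubalgebra ℂ A)
    (hBc : IsClosed (B : Set A)) (hBu : ∀ b ∈ B, P * b = b ∧ b * P = b) {ε : ℝ} (hε : ε ≤ 1/100)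
    (h1 : ‖p * P - P * p‖ < ε) (hb : b ∈ B) (h2 : ‖P * p * P - b‖ < ε) :
    ∃ p1 p2, IsProjection p1 ∧ IsProjection p2 ∧ p1 ∈ B ∧ p1 * p2 = 0 ∧ (1 - P) * p2 = p2 ∧
      ‖P * p * P - p1‖ ≤ 12 * ε ∧ ‖p - (p1 + p2)‖ ≤ 20 * ε := by
  have hε0 : 0 < ε := (norm_nonneg _).trans_lt h1
  obtain ⟨b', hb', bs, bd⟩ := sym_mem B hb (h := P * p * P) (by simp [hP.st, hp.st, mul_assoc]) h2
  have nP := hP.norm_le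
  have np := hp.norm_le
  have nx : ‖P * p * P‖ ≤ 1 := by
    have := nmul_le (nmul_le nP np) nP; linarith
  have hsq : ∀ Q : A, IsProjection Q → ‖p * Q - Q * p‖ < ε → ‖Q * p * Q * (Q * p * Q) - Q * p * Q‖ ≤ ε := by
    intro Q hQ hc
    have e : Q * p * Q * (Q * p * Q) - Q * p * Q = Q * (p * ((Q * p - p * Q) * Q)) := by
      simp only [mul_sub, sub_mul]
      congr 1
      · simp only [mul_assoc]; rw [← mul_assoc Q Q, hQ.mm]
      · simp only [mul_assoc, hQ.mm]; rw [← mul_assoc p p, hp.mm]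
    rw [e]
    have hc' : ‖Q * p - p * Q‖ ≤ ε := by rw [norm_sub_rev]; exact hc.le
    have := nmul_le hQ.norm_le (nmul_le np (nmul_le hc' hQ.norm_le)); linarith
  have hb2 : ‖b' * b' - b'‖ ≤ 5 * ε := by
    have e : b' * b' - b' = (P * p * P * (P * p * P) - P * p * P) - (P * p * P - b') * (P * p * P) - b' * (P * p * P - b') + (P * p * P - b') := by
      noncomm_ring
    have nb : ‖b'‖ ≤ 1 + ε := by
      have := norm_sub_norm_le b' (P * p * P); rw [norm_sub_rev] at this; linarith
    have a1 := hsq P hP h1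
    have a2 := nmul_le bd.le nx
    have a3 := nmul_le nb bd.le
    rw [e]
    have := norm_add_le ((P * p * P * (P * p * P) - P * p * P) - (P * p * P - b') * (P * p * P) - b' * (P * p * P - b')) (P * p * P - b')
    have := norm_sub_le ((P * p * P * (P * p * P) - P * p * P) - (P * p * P - b') * (P * p * P)) (b' * (P * p * P - b'))
    have := norm_sub_le (P * p * P * (P * p * P) - P * p * P) ((P * p * P - b') * (P * p * P))
    nlinarith
  obtain ⟨p1, a1, a2, -, -, a3⟩ := nearproj bs (δ := 5 * ε) (by linarith) hb2
  set Q := 1 - P with hQd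
  have hQ : IsProjection Q := hP.one_sub
  have hcQ : ‖p * Q - Q * p‖ < ε := by
    have : p * Q - Q * p = -(p * P - P * p) := by rw [hQd]; noncomm_ring
    rw [this, norm_neg]; exact h1
  have hQs : IsSelfAdjoint (Q * p * Q) := by rw [IsSelfAdjoint]; simp [hQ.st, hp.st, mul_assoc]
  obtain ⟨p2, c1, c2, ⟨c, c3⟩, -, -⟩ := nearproj hQs (δ := ε) (by linarith) (hsq Q hQ hcQ)
  have hp1B := a3 B hBc hb'
  have hQp2 : Q * p2 = p2 := by
    rw [c3]; simp only [← mul_assoc, hQ.mm]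
  have hPQ : P * Q = 0 := by rw [hQd, mul_sub, hP.mm]; simp
  have d1 : ‖P * p * P - p1‖ ≤ 12 * ε := by
    have : P * p * P - p1 = (P * p * P - b') - (p1 - b') := by abel
    rw [this]; have := norm_sub_le (P * p * P - b') (p1 - b'); linarith
  refine ⟨p1, p2, a1, c1, hp1B, ?_, hQp2, d1, ?_⟩
  · rw [← hQp2, ← (hBu p1 hp1B).2, mul_assoc, ← mul_assoc P, hPQ]; simp
  · have e : p - (p1 + p2) = (P * p * P - p1) - (p2 - Q * p * Q) - (P * ((P * p - p * P) * Q)) * 1 + Q * ((p * P - P * p) * P) + (2:ℝ) • (P * ((P * p - p * P) * Q)) := by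
      have h1 : Q * P = 0 := by rw [hQd, sub_mul, hP.mm]; simp
      have h2 : P * ((P * p - p * P) * Q) = P * p * Q := by
        rw [sub_mul, mul_assoc p, hPQ, mul_zero, sub_zero, ← mul_assoc, ← mul_assoc, hP.mm]
      have h3 : Q * ((p * P - P * p) * P) = Q * p * P := by
        rw [sub_mul (p * P) (P * p) P, mul_sub Q, mul_assoc p P P, hP.mm, ← mul_assoc Q (P * p) P, ← mul_assoc Q P p, h1, zero_mul, zero_mul, sub_zero, mul_assoc]
      rw [h2, h3, two_smul, mul_one]
      have : p = (P + Q) * p * (P + Q) := by rw [hQd]; simp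
      conv_lhs => rw [this]
      simp only [add_mul, mul_add]; abel
    rw [e]
    have k1 : ‖P * ((P * p - p * P) * Q)‖ ≤ ε := by
      have := nmul_le nP (nmul_le (b := 1) (show ‖P * p - p * P‖ ≤ ε by rw [norm_sub_rev]; exact h1.le) hQ.norm_le); linarith
    have k2 : ‖Q * ((p * P - P * p) * P)‖ ≤ ε := by
      have := nmul_le hQ.norm_le (nmul_le h1.le nP); linarith
    rw [mul_one]
    have k3 : ‖(2:ℝ) • (P * ((P * p - p * P) * Q))‖ ≤ 2 * ε := by
      rw [norm_smul]; norm_num; linarith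
    have j1 := norm_add_le ((P * p * P - p1) - (p2 - Q * p * Q) - (P * ((P * p - p * P) * Q)) + Q * ((p * P - P * p) * P)) ((2:ℝ) • (P * ((P * p - p * P) * Q)))
    have j2 := norm_add_le ((P * p * P - p1) - (p2 - Q * p * Q) - (P * ((P * p - p * P) * Q))) (Q * ((p * P - P * p) * P))
    have j3 := norm_sub_le ((P * p * P - p1) - (p2 - Q * p * Q)) (P * ((P * p - p * P) * Q))
    have j4 := norm_sub_le (P * p * P - p1) (p2 - Q * p * Q)
    linarith

theorem cmp (G : Good τ) {β : A ≃⋆ₐ[ℂ] A} (hU : PUO β) {p q : A} (hp : IsProjection p) (hq : IsProjection q)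
    (h : tr τ p < tr τ q) : ∃ w, star w * w = p ∧ q * w = w := by
  classical
  have hτ := G.htr
  set d := tr τ q - tr τ p with hd
  have hd0 : 0 < d := by linarith
  have hd1 : d ≤ 1 := by
    have := tr_nonneg hτ hp.nonneg; have := tr_mono hτ hq.le_one; rw [tr_one hτ] at this; linarith
  have hq0 : q ≠ 0 := by
    intro h0; rw [h0, tr_zero] at h; have := tr_nonneg hτ hp.nonneg; linarith
  obtain ⟨a0, a1, a2, a3, a4, a5⟩ := small_sub G hU hq hq0 (δ := d/4) (by linarith)
  set q0 := q - a0 with hq0d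
  have hq0p : IsProjection q0 := proj_sub a1 hq a3
  obtain ⟨Y1, δ1, hδ1, s1⟩ := stateq' G p (ε := d/8) (by linarith)
  obtain ⟨Y2, δ2, hδ2, s2⟩ := stateq' G q0 (ε := d/8) (by linarith)
  set K := 1 + ∑ a ∈ Y1 ∪ Y2, ‖a‖ with hK
  have hK0 : 0 < K := by positivity
  have hKa : ∀ a ∈ Y1 ∪ Y2, ‖a‖ < K := by
    intro a ha
    have := Finset.single_le_sum (f := fun a : A => ‖a‖) (fun _ _ => norm_nonneg _) ha
    linarith
  obtain ⟨ε, he0, he1, he2, he3⟩ : ∃ ε : ℝ, 0 < ε ∧ ε ≤ d/240 ∧ 4 * K * ε < δ1 ∧ 4 * K * ε < δ2 := by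
    refine ⟨min (d/240) (min (δ1/(8*K)) (δ2/(8*K))), by positivity, min_le_left _ _, ?_, ?_⟩
    · have : min (d/240) (min (δ1/(8*K)) (δ2/(8*K))) ≤ δ1/(8*K) := (min_le_right _ _).trans (min_le_left _ _)
      calc _ ≤ 4 * K * (δ1/(8*K)) := by gcongr
        _ = δ1/2 := by field_simp; norm_num
        _ < δ1 := by linarith
    · have : min (d/240) (min (δ1/(8*K)) (δ2/(8*K))) ≤ δ2/(8*K) := (min_le_right _ _).trans (min_le_right _ _)
      calc _ ≤ 4 * K * (δ2/(8*K)) := by gcongr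
        _ = δ2/2 := by field_simp; norm_num
        _ < δ2 := by linarith
  obtain ⟨n, m, m1, m2, -, ⟨x, x1, x2⟩, -, m4, -⟩ := tr0_mus G hU ({p, q0} ∪ (Y1 ∪ Y2)) he0 one_pos a1 a2
  set P := m.unit with hPd
  have hP : IsProjection P := m.unit_proj
  haveI := m.fd
  have hcl := fd_closed m.alg
  have hBu : ∀ b ∈ m.alg, P * b = b ∧ b * P = b := fun b hb => ⟨m.unit_mul hb, m.mul_unit hb⟩
  obtain ⟨bp, bp1, bp2⟩ := m2 p (by simp)
  obtain ⟨bq, bq1, bq2⟩ := m2 q0 (by simp)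
  obtain ⟨p1, p2, pa, pb, pc, pd, pe, pf, pg⟩ := split_proj hP hp m.alg hcl hBu (by linarith) (m1 p (by simp)) bp1 bp2
  obtain ⟨q1, q2, qa, qb, qc, qd, qe, qf, qg⟩ := split_proj hP hq0p m.alg hcl hBu (by linarith) (m1 q0 (by simp)) bq1 bq2
  rcases fd_cmp hτ G.simple m m4 pa qa pc qc with ⟨w1, w1a, w1b⟩ | ⟨z, z1, z2, z3, z4, z5⟩
  · have hpp : IsProjection (p1 + p2) := proj_add pa pb pd
    have hqq : IsProjection (q1 + q2) := proj_add qa qb qd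
    obtain ⟨U, U1, -, U2⟩ := close_unitary hp hpp (δ := 20 * ε) (by linarith) pg
    obtain ⟨V, V1, -, V2⟩ := close_unitary hq0p hqq (δ := 20 * ε) (by linarith) qg
    have hw1 : (q1 + q2) * w1 = w1 := by
      rw [← w1b, ← mul_assoc, add_mul, qa.mm, mul_swap0 qa qb qd]; simp
    set W1 := star V * w1 with hW1
    have VV : V * star V = 1 := (Unitary.mem_iff.1 V1).2
    have VV' : star V * V = 1 := (Unitary.mem_iff.1 V1).1
    have UU' : star U * U = 1 := (Unitary.mem_iff.1 U1).1
    have k1 : q0 * W1 = W1 := by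
      have : q0 * star V = star V * (q1 + q2) := by
        calc q0 * star V = star V * (V * q0) * star V := by rw [← mul_assoc, VV', one_mul]
          _ = star V * (q1 + q2) * (V * star V) := by rw [V2]; simp only [mul_assoc]
          _ = _ := by rw [VV, mul_one]
      rw [hW1, ← mul_assoc, this, mul_assoc, hw1]
    have k2 : star W1 * W1 = p1 := by
      rw [hW1, star_mul, star_star, mul_assoc, ← mul_assoc V, VV, one_mul, w1a]
    set W2 := x * p2 with hW2
    have k3 : a0 * W2 = W2 := by rw [hW2, ← mul_assoc, x2]
    have k4 : star W2 * W2 = p2 := by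
      rw [hW2, star_mul, pb.st, mul_assoc, ← mul_assoc (star x), x1, pe, pb.mm]
    have hqa : q0 * a0 = 0 := by rw [hq0d, sub_mul, a4, a1.mm]; simp
    have k5 : star W1 * W2 = 0 := by
      rw [← sub_pisom' k1 hq0p.st, ← k3, mul_assoc, ← mul_assoc q0, hqa]; simp
    have k6 : star W2 * W1 = 0 := by have := congrArg star k5; simpa using this
    refine ⟨(W1 + W2) * U, ?_, ?_⟩
    · rw [star_mul, mul_assoc, ← mul_assoc (star (W1 + W2)), star_add, add_mul, mul_add, mul_add, k2, k4, k5, k6,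
        add_zero, zero_add, ← U2, ← mul_assoc, UU', one_mul]
    · have e1 : q * q0 = q0 := by rw [hq0d, mul_sub, hq.mm, a4]
      have e2 : q * W1 = W1 := by rw [← k1, ← mul_assoc, e1]
      have e3 : q * W2 = W2 := by rw [← k3, ← mul_assoc, a4]
      rw [← mul_assoc, mul_add, e2, e3]
  · exfalso
    have tz : 0 < tr τ z := tr_pos hτ G.simple z1.nonneg z2
    have z4' : P * z = z := mul_swap z1 hP z4
    have comm : ∀ δ, 4 * K * ε < δ → ∀ a ∈ Y1 ∪ Y2, ∀ b ∈ Y1 ∪ Y2, |tr τ (a * (b * z - z * b))| < δ * tr τ z := by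
      intro δ hδ a ha b hb
      obtain ⟨b', hb', hbd⟩ := m2 b (Finset.mem_union_right _ hb)
      have hbc := m1 b (Finset.mem_union_right _ hb)
      set e := P * b * P - b' with he
      set c := b * P - P * b with hc
      have id : b * z - z * b = (e + c) * z - z * (e - c) := by
        have i1 : b * z = P * b * P * z + c * z := by
          rw [hc, sub_mul, mul_assoc b, z4', mul_assoc (P * b), z4']; abel
        have i2 : z * b = z * (P * b * P) - z * c := by
          rw [hc, mul_sub, ← mul_assoc z P b, z4, ← mul_assoc, ← mul_assoc, z4, mul_assoc z b P]; abel
        have i3 := z3 b' hb'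
        rw [i1, i2, he]; simp only [add_mul, mul_add, mul_sub, sub_mul, i3]; abel
      have b1 : ‖e + c‖ ≤ 2 * ε := by have := norm_add_le e c; linarith
      have b2 : ‖e - c‖ ≤ 2 * ε := by have := norm_sub_le e c; linarith
      have k1 : |tr τ (a * (e + c) * z)| ≤ K * (2 * ε) * tr τ z :=
        (abs_tr_mul_le hτ _ _ z1.nonneg).trans (mul_le_mul_of_nonneg_right (nmul_le (hKa a ha).le b1) tz.le)
      have k2 : |tr τ ((e - c) * a * z)| ≤ (2 * ε) * K * tr τ z :=
        (abs_tr_mul_le hτ _ _ z1.nonneg).trans (mul_le_mul_of_nonneg_right (nmul_le b2 (hKa a ha).le) tz.le)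
      have k3 : tr τ (a * (b * z - z * b)) = tr τ (a * (e + c) * z) - tr τ ((e - c) * a * z) := by
        rw [id, mul_sub, tr_sub, ← mul_assoc, ← mul_assoc, tr_comm hτ (a * z), mul_assoc (e - c)]
      rw [k3]
      have := abs_sub (tr τ (a * (e + c) * z)) (tr τ ((e - c) * a * z))
      have : 4 * K * ε * tr τ z < δ * tr τ z := mul_lt_mul_of_pos_right hδ tz
      linarith
    have t1 := s1 z z1.nonneg tz fun a ha b hb => comm δ1 he2 a (Finset.mem_union_left _ ha) b (Finset.mem_union_left _ hb)
    have t2 := s2 z z1.nonneg tz fun a ha b hb => comm δ2 he3 a (Finset.mem_union_right _ ha) b (Finset.mem_union_right _ hb)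
    have cut : ∀ y y1 : A, ‖P * y * P - y1‖ ≤ 12 * ε → |tr τ (y * z) - tr τ (y1 * z)| ≤ 12 * ε * tr τ z := by
      intro y y1 hy
      have : tr τ (y * z) = tr τ (P * y * P * z) := by
        rw [mul_assoc (P * y), z4', tr_comm hτ (P * y), ← mul_assoc, z4, tr_comm hτ]
      rw [this, ← tr_sub, ← sub_mul]
      exact (abs_tr_mul_le hτ _ _ z1.nonneg).trans (mul_le_mul_of_nonneg_right hy tz.le)
    have c1 := abs_le.1 (cut p p1 pf)
    have c2 := abs_le.1 (cut q0 q1 qf)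
    have t1 := abs_le.1 t1
    have t2 := abs_le.1 t2
    have hq0t : tr τ q0 > tr τ p + 3/4 * d := by rw [hq0d, tr_sub]; linarith
    have : (tr τ p + 3/4 * d) * tr τ z < tr τ q0 * tr τ z := mul_lt_mul_of_pos_right hq0t tz
    have : ε * tr τ z ≤ d/240 * tr τ z := mul_le_mul_of_nonneg_right he1 tz.le
    nlinarith
end cmp
end RK

namespace RK
set_option linter.all false

theorem coloring {ι : Type*} [DecidableEq ι] (N : ℕ) (hN : 1 ≤ N) (w : ι → ι → ℝ) (hw : ∀ x y, 0 ≤ w x y) (s : Finset ι) :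
    ∃ f : ι → Fin N, (N:ℝ) * ∑ x ∈ s, ∑ y ∈ s, (if x ≠ y ∧ f x = f y then w x y else 0) ≤ ∑ x ∈ s, ∑ y ∈ s, w x y := by
  haveI : NeZero N := ⟨by omega⟩
  induction s using Finset.induction_on with
  | empty => exact ⟨fun _ => 0, by simp⟩
  | insert a s ha ih =>
    obtain ⟨f, hf⟩ := ih
    let g : Fin N → ℝ := fun c => ∑ y ∈ s, if f y = c then (w a y + w y a) else 0
    have hg : ∑ c, g c = ∑ y ∈ s, (w a y + w y a) := by
      simp only [g]; rw [Finset.sum_comm]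
      refine Finset.sum_congr rfl fun y _ => ?_
      rw [Finset.sum_ite_eq]; simp
    obtain ⟨c, -, hc⟩ : ∃ c ∈ (Finset.univ : Finset (Fin N)), g c ≤ (∑ y ∈ s, (w a y + w y a)) / N := by
      apply Finset.exists_le_of_sum_le ⟨0, Finset.mem_univ _⟩
      rw [hg]; simp; rw [mul_div_cancel₀]; exact_mod_cast (by omega : N ≠ 0)
    have hne : ∀ y ∈ s, y ≠ a := fun y hy h => ha (h ▸ hy)
    refine ⟨Function.update f a c, ?_⟩
    have hfs : ∀ y ∈ s, Function.update f a c y = f y := fun y hy => Function.update_of_ne (hne y hy) _ _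
    rw [Finset.sum_insert ha, Finset.sum_insert ha, Finset.sum_insert ha, Finset.sum_insert ha]
    have e1 : ∑ x ∈ s, ∑ y ∈ insert a s, (if x ≠ y ∧ Function.update f a c x = Function.update f a c y then w x y else 0)
        = ∑ x ∈ s, (if f x = c then w x a else 0) + ∑ x ∈ s, ∑ y ∈ s, (if x ≠ y ∧ f x = f y then w x y else 0) := by
      rw [← Finset.sum_add_distrib]
      refine Finset.sum_congr rfl fun x hx => ?_
      rw [Finset.sum_insert ha, hfs x hx, Function.update_self]
      congr 1
      · simp [hne x hx]
      · exact Finset.sum_congr rfl fun y hy => by rw [hfs y hy]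
    have e2 : ∑ y ∈ s, (if a ≠ y ∧ Function.update f a c a = Function.update f a c y then w a y else 0)
        = ∑ y ∈ s, (if f y = c then w a y else 0) := by
      refine Finset.sum_congr rfl fun y hy => ?_
      rw [hfs y hy, Function.update_self]
      simp [(hne y hy).symm, eq_comm]
    have e3 : ∑ x ∈ s, ∑ y ∈ insert a s, w x y = ∑ x ∈ s, w x a + ∑ x ∈ s, ∑ y ∈ s, w x y := by
      rw [← Finset.sum_add_distrib]
      exact Finset.sum_congr rfl fun x hx => by rw [Finset.sum_insert ha]
    rw [e1, e2, e3]
    have e4 : g c = ∑ y ∈ s, (if f y = c then w a y else 0) + ∑ x ∈ s, (if f x = c then w x a else 0) := by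
      rw [← Finset.sum_add_distrib]
      refine Finset.sum_congr rfl fun y _ => ?_
      split_ifs <;> simp
    have hNp : (0:ℝ) < N := by exact_mod_cast hN
    rw [le_div_iff₀ hNp, Finset.sum_add_distrib] at hc
    have := hw a a
    simp only [ne_eq, not_true_eq_false, false_and, if_false, zero_add]
    nlinarith

namespace MUS
section
variable {A : Type*} [CStarAlgebra A] [PartialOrder A] [StarOrderedRing A] {ι : Type} [Fintype ι] [DecidableEq ι] (m : MUS A ι)

noncomputable def amp (Q : ι → A) : A := ∑ x, m.v x * Q (m.r x) * star (m.v x)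

theorem amp_v {Q : ι → A} (hQ : ∀ k, m.π k * Q k = Q k) (h2 : ∀ k, Q k * m.π k = Q k) (a : ι) : m.amp Q * m.v a = m.v a * Q (m.r a) := by
  rw [amp, Finset.sum_mul, Finset.sum_eq_single a]
  · rw [mul_assoc, m.h1, mul_assoc, h2]
  · intro x _ hx; rw [mul_assoc, m.h2 x a hx, mul_zero]
  · simp
theorem v_amp {Q : ι → A} (hQ : ∀ k, m.π k * Q k = Q k) (a : ι) : star (m.v a) * m.amp Q = Q (m.r a) * star (m.v a) := by
  rw [amp, Finset.mul_sum, Finset.sum_eq_single a]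
  · rw [← mul_assoc, ← mul_assoc, m.h1, hQ]
  · intro x _ hx; rw [← mul_assoc, ← mul_assoc, m.h2 a x hx.symm, zero_mul, zero_mul]
  · simp
theorem amp_mul {Q Q' : ι → A} (hQ' : ∀ k, m.π k * Q' k = Q' k) :
    m.amp Q * m.amp Q' = m.amp fun k => Q k * Q' k := by
  have e1 : m.amp Q = ∑ x, m.v x * Q (m.r x) * star (m.v x) := rfl
  have e2 : (m.amp fun k => Q k * Q' k) = ∑ x, m.v x * (Q (m.r x) * Q' (m.r x)) * star (m.v x) := rfl
  rw [e1, e2, Finset.sum_mul]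
  refine Finset.sum_congr rfl fun x _ => ?_
  rw [mul_assoc, m.v_amp hQ']; simp only [mul_assoc]
theorem amp_star {Q : ι → A} (h : ∀ k, star (Q k) = Q k) : star (m.amp Q) = m.amp Q := by
  simp only [amp, star_sum, star_mul, star_star, h, mul_assoc]
theorem amp_proj {Q : ι → A} (hQ : ∀ k, m.π k * Q k = Q k) (hp : ∀ k, IsProjection (Q k)) : IsProjection (m.amp Q) :=
  mkp' (m.amp_star fun k => (hp k).st) (by rw [m.amp_mul hQ]; simp only [(hp _).mm])
theorem amp_comm {Q : ι → A} (hQ : ∀ k, m.π k * Q k = Q k) (h2 : ∀ k, Q k * m.π k = Q k) {b : A} (hb : b ∈ m.Sp) :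
    b * m.amp Q = m.amp Q * b := by
  induction hb using Submodule.span_induction with
  | mem c hc =>
    obtain ⟨x, y, h, rfl⟩ := hc
    rw [mul_assoc, m.v_amp hQ, ← mul_assoc, ← mul_assoc, m.amp_v hQ h2, h]
  | zero => simp
  | add a b _ _ ha hb => rw [add_mul, mul_add, ha, hb]
  | smul c a _ ha => rw [smul_mul_assoc, mul_smul_comm, ha]
theorem amp_unit (Q : ι → A) : m.amp Q * m.unit = m.amp Q := by
  rw [amp, Finset.sum_mul]
  exact Finset.sum_congr rfl fun x _ => by rw [mul_assoc, m.vs_unit]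
theorem unit_amp (Q : ι → A) : m.unit * m.amp Q = m.amp Q := by
  rw [amp, Finset.mul_sum]
  exact Finset.sum_congr rfl fun x _ => by rw [← mul_assoc, ← mul_assoc, m.unit_v]
theorem amp_pi : m.amp m.π = m.unit := by
  rw [amp, unit]; exact Finset.sum_congr rfl fun x _ => by rw [m.vpi]
theorem amp_sum {κ : Type*} (s : Finset κ) (Q : κ → ι → A) : ∑ i ∈ s, m.amp (Q i) = m.amp fun k => ∑ i ∈ s, Q i k := by
  simp only [amp]; rw [Finset.sum_comm]
  exact Finset.sum_congr rfl fun x _ => by rw [Finset.mul_sum, Finset.sum_mul]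
end
end MUS

section
variable {A : Type*} [CStarAlgebra A] [PartialOrder A] [StarOrderedRing A] {τ : A →ₗ[ℂ] ℂ}

theorem comm_id {P b b' G : A} (h1 : P * G = G) (h2 : G * P = G) (h3 : b' * G = G * b') :
    b * G - G * b = ((P * b * P - b') + (b * P - P * b)) * G - G * ((P * b * P - b') - (b * P - P * b)) := by
  have i1 : b * G = P * b * P * G + (b * P - P * b) * G := by
    rw [sub_mul, mul_assoc b, h1, mul_assoc (P * b), h1]; abel
  have i2 : G * b = G * (P * b * P) - G * (b * P - P * b) := by
    rw [mul_sub, ← mul_assoc G P b, h2, ← mul_assoc, ← mul_assoc, h2, mul_assoc G b P]; abel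
  rw [i1, i2]; simp only [add_mul, mul_add, mul_sub, sub_mul, h3]; abel

theorem comm_norm {P b b' G : A} (h1 : P * G = G) (h2 : G * P = G) (h3 : b' * G = G * b') (hG : ‖G‖ ≤ 1) {ε : ℝ}
    (h4 : ‖b * P - P * b‖ < ε) (h5 : ‖P * b * P - b'‖ < ε) : ‖b * G - G * b‖ ≤ 4 * ε := by
  rw [comm_id h1 h2 h3]
  have b1 : ‖(P * b * P - b') + (b * P - P * b)‖ ≤ 2 * ε := by have := norm_add_le (P * b * P - b') (b * P - P * b); linarith
  have b2 : ‖(P * b * P - b') - (b * P - P * b)‖ ≤ 2 * ε := by have := norm_sub_le (P * b * P - b') (b * P - P * b); linarith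
  refine (norm_sub_le _ _).trans ?_
  have := nmul_le b1 hG; have := nmul_le hG b2
  linarith

theorem two_norm_G (G : Good τ) {β : A ≃⋆ₐ[ℂ] A} (hU : PUO β) {ρ : ℝ} (hρ : 0 < ρ) (n' : ℕ) :
    ∃ c > 0, ∀ (Y : Finset A) (δ : ℝ), 0 < δ → ∃ g, IsProjection g ∧ (∀ y ∈ Y, ‖y * g - g * y‖ < δ) ∧ c ≤ tr τ g ∧
      ∑ j ∈ Finset.Ico 1 n', tr τ (g * (β ^ j) g) ≤ ρ * tr τ g := by
  classical
  have hτ := G.htr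
  obtain ⟨N, hN⟩ := exists_nat_gt (8 * ((n':ℝ) + 1) / ρ)
  have hNp : (0:ℝ) < N := lt_trans (by positivity) hN
  have hN1 : 1 ≤ N := by exact_mod_cast hNp
  refine ⟨1/(4*N), by positivity, fun Y δ hδ => ?_⟩
  obtain ⟨n, m, m1, m2, m3, -, -, -, -⟩ := tr0_mus G hU Y (ε := δ/8) (δ := 1/2) (by linarith) (by norm_num) proj_one (proj_ne G)
  set η : ℝ := 1/(N * (n * n + 1)) with hη
  have hη0 : 0 < η := by positivity
  let L : List (A × ℕ) := ((Finset.univ ×ˢ Finset.univ ×ˢ Finset.Ico 1 n' : Finset (Fin n × Fin n × ℕ)).image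
    fun z => (star (m.v z.1) * (β ^ z.2.2) (m.v z.2.1), z.2.2)).toList
  have hL : ∀ z ∈ L, 1 ≤ z.2 := by
    intro z hz
    simp only [L, Finset.mem_toList, Finset.mem_image, Finset.mem_product, Finset.mem_Ico] at hz
    obtain ⟨w, hw, rfl⟩ := hz
    exact hw.2.2.1
  have hLm : ∀ x y j, j ∈ Finset.Ico 1 n' → (star (m.v x) * (β ^ j) (m.v y), j) ∈ L := by
    intro x y j hj
    simp only [L, Finset.mem_toList, Finset.mem_image, Finset.mem_product]
    exact ⟨(x, y, j), ⟨Finset.mem_univ _, Finset.mem_univ _, hj⟩, rfl⟩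
  choose k q q1 q2 q3 using fun x : Fin n => uo_star hU L hL hη0 (m.π x) (m.pp x)
  let S := (x : Fin n) × Fin (k x)
  let Q : S → Fin n → A := fun s x => if h : x = s.1 then q s.1 s.2 else 0
  have Qs : ∀ s : S, Q s s.1 = q s.1 s.2 := fun s => by simp [Q]
  have Qn : ∀ (s : S) x, x ≠ s.1 → Q s x = 0 := fun s x h => by simp [Q, h]
  have qpi : ∀ x i, q x i * m.π x = q x i := fun x i => (sum_orth (m.pp x) (q1 x) (q2 x)).1 i
  have hQp : ∀ s x, IsProjection (Q s x) := by
    intro s x; by_cases h : x = s.1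
    · subst h; rw [Qs]; exact q1 _ _
    · rw [Qn s x h]; exact proj_zero
  have hQr : ∀ s x, Q s x * m.π x = Q s x := by
    intro s x; by_cases h : x = s.1
    · subst h; rw [Qs]; exact qpi _ _
    · rw [Qn s x h, zero_mul]
  have hQl : ∀ s x, m.π x * Q s x = Q s x := fun s x => mul_swap (hQp s x) (m.pp x) (hQr s x)
  have hQo : ∀ s t x, s ≠ t → Q s x * Q t x = 0 := by
    intro s t x hst
    by_cases h : x = s.1
    · by_cases h' : x = t.1
      · obtain ⟨a, i⟩ := s
        obtain ⟨b, j⟩ := t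
        simp only at h h'
        subst h; subst h'
        rw [Qs ⟨x, i⟩, Qs ⟨x, j⟩]
        exact (sum_orth (m.pp x) (q1 x) (q2 x)).2 i j fun hij => hst (by rw [hij])
      · rw [Qn t x h', mul_zero]
    · rw [Qn s x h, zero_mul]
  have hQsum : ∀ x, ∑ s, Q s x = m.π x := by
    intro x
    rw [Fintype.sum_sigma, Finset.sum_eq_single x]
    · rw [← q2 x]; exact Finset.sum_congr rfl fun i _ => Qs ⟨x, i⟩
    · intro y _ hy; exact Finset.sum_eq_zero fun i _ => Qn ⟨y, i⟩ x hy.symm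
    · simp
  let g : S → A := fun s => m.amp (Q s)
  have gp : ∀ s, IsProjection (g s) := fun s => m.amp_proj (hQl s) (hQp s)
  have go : ∀ s t, s ≠ t → g s * g t = 0 := by
    intro s t h
    simp only [g]
    rw [m.amp_mul (hQl t)]
    simp only [hQo s t _ h]; simp [MUS.amp]
  have gsum : ∑ s, g s = m.unit := by
    simp only [g]; rw [m.amp_sum]; simp only [hQsum]; exact m.amp_pi
  -- diagonal terms
  have gdiag : ∀ s, ∀ j ∈ Finset.Ico 1 n', tr τ (g s * (β ^ j) (g s)) ≤ (n * n * η) * tr τ (g s) := by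
    intro s j hj
    have e1 : ‖g s * (β ^ j) (g s)‖ ≤ n * n * η := by
      have e : g s * (β ^ j) (g s) = ∑ x, ∑ y, m.v x * (Q s (m.r x) * (star (m.v x) * (β ^ j) (m.v y)) * (β ^ j) (Q s (m.r y))) * (β ^ j) (star (m.v y)) := by
        simp only [g, MUS.amp]; rw [Finset.sum_mul]
        refine Finset.sum_congr rfl fun x _ => ?_
        rw [map_sum, Finset.mul_sum]
        refine Finset.sum_congr rfl fun y _ => ?_
        simp only [map_mul, mul_assoc]
      rw [e]
      have b1 : ∀ x y, ‖m.v x * (Q s (m.r x) * (star (m.v x) * (β ^ j) (m.v y)) * (β ^ j) (Q s (m.r y))) * (β ^ j) (star (m.v y))‖ ≤ η := by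
        intro x y
        have : ‖Q s (m.r x) * (star (m.v x) * (β ^ j) (m.v y)) * (β ^ j) (Q s (m.r y))‖ ≤ η := by
          by_cases hx : m.r x = s.1
          · by_cases hy : m.r y = s.1
            · rw [hx, hy, Qs]; exact (q3 s.1 s.2 _ (hLm x y j hj)).le
            · rw [Qn s _ hy, map_zero, mul_zero, norm_zero]; exact hη0.le
          · rw [Qn s _ hx, zero_mul, zero_mul, norm_zero]; exact hη0.le
        have h2 : ‖(β ^ j) (star (m.v y))‖ ≤ 1 := by rw [nA, norm_star]; exact m.v_norm y
        have := nmul_le (nmul_le (m.v_norm x) this) h2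
        linarith
      refine (norm_sum_le _ _).trans ?_
      refine (Finset.sum_le_sum fun x _ => (norm_sum_le _ _).trans (Finset.sum_le_sum fun y _ => b1 x y)).trans ?_
      simp; ring_nf; rfl
    have e2 : tr τ (g s * (β ^ j) (g s)) = tr τ (g s * (β ^ j) (g s) * g s) := by
      rw [tr_comm hτ (g s * (β ^ j) (g s)), ← mul_assoc, (gp s).mm]
    rw [e2]
    exact (le_abs_self _).trans ((abs_tr_mul_le hτ _ _ (gp s).nonneg).trans
      (mul_le_mul_of_nonneg_right e1 (tr_nonneg hτ (gp s).nonneg)))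
  let w : S → S → ℝ := fun s t => ∑ j ∈ Finset.Ico 1 n', tr τ (g s * (β ^ j) (g t))
  have hw : ∀ s t, 0 ≤ w s t := fun s t => Finset.sum_nonneg fun j _ =>
    tr_mul_nonneg hτ (gp s).nonneg (aut_nonneg _ (gp t).nonneg)
  have hunit1 : tr τ m.unit ≤ 1 := by
    have := tr_mono hτ m.unit_proj.le_one; rwa [tr_one hτ] at this
  have hwtot : ∑ s, ∑ t, w s t ≤ n' := by
    have e : ∑ s, ∑ t, w s t = ∑ j ∈ Finset.Ico 1 n', tr τ (m.unit * (β ^ j) m.unit) := by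
      simp only [w]
      rw [Finset.sum_congr rfl fun s _ => Finset.sum_comm, Finset.sum_comm]
      refine Finset.sum_congr rfl fun j _ => ?_
      rw [← gsum, map_sum, Finset.sum_mul, tr_sum]
      refine Finset.sum_congr rfl fun s _ => ?_
      rw [Finset.mul_sum, tr_sum]
    rw [e]
    have : ∀ j ∈ Finset.Ico 1 n', tr τ (m.unit * (β ^ j) m.unit) ≤ 1 := by
      intro j _
      have := tr_mul_mono hτ m.unit_proj.nonneg (aut_proj (β ^ j) m.unit_proj).le_one
      rw [mul_one] at this; linarith
    refine (Finset.sum_le_sum this).trans ?_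
    simp
  obtain ⟨f, hf⟩ := coloring N hN1 w hw Finset.univ
  let Gc : Fin N → A := fun c => ∑ s ∈ Finset.univ.filter (fun s => f s = c), g s
  have hGp : ∀ c, IsProjection (Gc c) := fun c => proj_sum _ _ (fun s _ => gp s) (fun s _ t _ h => go s t h)
  let bad : Fin N → ℝ := fun c => ∑ j ∈ Finset.Ico 1 n', tr τ (Gc c * (β ^ j) (Gc c))
  have hbad : ∀ c, bad c = ∑ s, ∑ t, if f s = c ∧ f t = c then w s t else 0 := by
    intro c
    have : ∀ j, tr τ (Gc c * (β ^ j) (Gc c)) = ∑ s, ∑ t, if f s = c ∧ f t = c then tr τ (g s * (β ^ j) (g t)) else 0 := by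
      intro j
      simp only [Gc]
      rw [map_sum, Finset.sum_mul, tr_sum, Finset.sum_filter]
      refine Finset.sum_congr rfl fun s _ => ?_
      by_cases hs : f s = c
      · simp only [hs, if_true, true_and]
        rw [Finset.mul_sum, tr_sum, Finset.sum_filter]
      · simp [hs]
    simp only [bad, this, w]
    rw [Finset.sum_comm]
    refine Finset.sum_congr rfl fun s _ => ?_
    rw [Finset.sum_comm]
    refine Finset.sum_congr rfl fun t _ => ?_
    split_ifs <;> simp
  have hbadsum : ∑ c, bad c = ∑ s, ∑ t, if f s = f t then w s t else 0 := by
    simp only [hbad]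
    rw [Finset.sum_comm]
    refine Finset.sum_congr rfl fun s _ => ?_
    rw [Finset.sum_comm]
    refine Finset.sum_congr rfl fun t _ => ?_
    by_cases h : f s = f t
    · rw [if_pos h, Finset.sum_eq_single (f t)]
      · simp [h]
      · intro c _ hc; rw [if_neg]; rintro ⟨-, h2⟩; exact hc h2.symm
      · simp
    · rw [if_neg h]; refine Finset.sum_eq_zero fun c _ => if_neg ?_
      rintro ⟨h1, h2⟩; exact h (h1.trans h2.symm)
  have hdsum : ∑ s, w s s ≤ n' * (n * n * η) := by
    have : ∀ s, w s s ≤ n' * (n * n * η) * tr τ (g s) := by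
      intro s
      refine (Finset.sum_le_sum (gdiag s)).trans ?_
      rw [Finset.sum_const, nsmul_eq_mul, Nat.card_Ico, mul_assoc (n':ℝ)]
      apply mul_le_mul_of_nonneg_right
      · exact_mod_cast Nat.sub_le _ _
      · have := tr_nonneg hτ (gp s).nonneg; positivity
    refine (Finset.sum_le_sum fun s _ => this s).trans ?_
    rw [← Finset.mul_sum, ← tr_sum, gsum]
    exact mul_le_of_le_one_right (by positivity) hunit1
  have hnn : (n:ℝ) * n * η ≤ 1/N := by
    rw [hη, mul_one_div, div_le_div_iff₀ (by positivity) hNp]; nlinarith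
  have hbadtot : ∑ c, bad c ≤ 2 * n' / N := by
    rw [hbadsum]
    have : ∑ s, ∑ t, (if f s = f t then w s t else 0) = ∑ s, ∑ t, (if s ≠ t ∧ f s = f t then w s t else 0) + ∑ s, w s s := by
      rw [← Finset.sum_add_distrib]
      refine Finset.sum_congr rfl fun s _ => ?_
      have : w s s = ∑ t, if s = t then w s t else 0 := by rw [Finset.sum_ite_eq]; simp
      rw [this, ← Finset.sum_add_distrib]
      refine Finset.sum_congr rfl fun t _ => ?_
      by_cases h : s = t
      · subst h; simp
      · simp [h]
    rw [this]
    have h1 : ∑ s, ∑ t, (if s ≠ t ∧ f s = f t then w s t else 0) ≤ n' / N := by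
      rw [le_div_iff₀ hNp, mul_comm]; exact hf.trans hwtot
    have h2 : (n':ℝ) * (n * n * η) ≤ n' / N := by
      rw [div_eq_mul_one_div]; exact mul_le_mul_of_nonneg_left hnn (by positivity)
    have : (2 * n' / N : ℝ) = n'/N + n'/N := by ring
    linarith
  have hGsum : ∑ c, tr τ (Gc c) = tr τ m.unit := by
    rw [← tr_sum, ← gsum]; simp only [Gc]
    rw [Finset.sum_fiberwise]
  set l : ℝ := N / (8 * (n' + 1)) with hl
  have hl0 : 0 < l := by positivity
  obtain ⟨c, -, hc⟩ : ∃ c ∈ (Finset.univ : Finset (Fin N)), 1/(4*N:ℝ) ≤ tr τ (Gc c) - l * bad c := by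
    apply Finset.exists_le_of_sum_le ⟨⟨0, hN1⟩, Finset.mem_univ _⟩
    rw [Finset.sum_sub_distrib, hGsum, ← Finset.mul_sum]
    have h1 : ∑ i : Fin N, 1/(4*N:ℝ) = 1/4 := by simp; field_simp
    rw [h1]
    have h2 : l * ∑ c, bad c ≤ 1/4 := by
      calc l * ∑ c, bad c ≤ l * (2 * n' / N) := mul_le_mul_of_nonneg_left hbadtot hl0.le
        _ = (n':ℝ)/(n'+1) * (1/4) := by rw [hl]; field_simp; ring
        _ ≤ 1 * (1/4) := by
          apply mul_le_mul_of_nonneg_right _ (by norm_num)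
          rw [div_le_one (by positivity)]; linarith
        _ = 1/4 := by norm_num
    linarith
  have hb0 : 0 ≤ bad c := Finset.sum_nonneg fun j _ => tr_mul_nonneg hτ (hGp c).nonneg (aut_nonneg _ (hGp c).nonneg)
  refine ⟨Gc c, hGp c, fun y hy => ?_, ?_, ?_⟩
  · obtain ⟨b', hb', hbd⟩ := m2 y hy
    have e : Gc c = m.amp fun x => ∑ s ∈ Finset.univ.filter (fun s => f s = c), Q s x := by
      simp only [Gc, g]; rw [m.amp_sum]
    have := comm_norm (G := Gc c) (by rw [e]; exact m.unit_amp _) (by rw [e]; exact m.amp_unit _)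
      (by
        rw [e]; refine m.amp_comm (fun x => ?_) (fun x => ?_) hb'
        · rw [Finset.mul_sum]; exact Finset.sum_congr rfl fun s _ => hQl s x
        · rw [Finset.sum_mul]; exact Finset.sum_congr rfl fun s _ => hQr s x) (hGp c).norm_le (m1 y hy) hbd
    linarith
  · have : 0 ≤ l * bad c := by positivity
    linarith
  · have h3 : l * bad c ≤ tr τ (Gc c) := by
      have : (0:ℝ) < 1/(4*N) := by positivity
      linarith
    have h4 : 1 ≤ ρ * l := by
      rw [hl, mul_div_assoc', one_le_div (by positivity)]
      rw [div_lt_iff₀ hρ] at hN; linarith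
    have : bad c ≤ (ρ * l) * bad c := le_mul_of_one_le_left hb0 h4
    show bad c ≤ _
    nlinarith
end
end RK

namespace RK
set_option linter.all false

section
variable {A : Type*} [CStarAlgebra A] [PartialOrder A] [StarOrderedRing A] {τ : A →ₗ[ℂ] ℂ}

/-- commutator bound -/
def Cm (y : A) (δ : ℝ) (x : A) : Prop := ‖y * x - x * y‖ ≤ δ

theorem Cm.mono {y x : A} {δ δ' : ℝ} (h : Cm y δ x) (hd : δ ≤ δ') : Cm y δ' x := le_trans (h : ‖_‖ ≤ δ) hd
theorem Cm.mul {y x x' : A} {δ δ' : ℝ} (h : Cm y δ x) (h' : Cm y δ' x') (hx : ‖x‖ ≤ 1) (hx' : ‖x'‖ ≤ 1) :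
    Cm y (δ + δ') (x * x') := by
  unfold Cm at *
  have e : y * (x * x') - x * x' * y = (y * x - x * y) * x' + x * (y * x' - x' * y) := by
    simp only [sub_mul, mul_sub, mul_assoc]; abel
  rw [e]
  have h1 := nmul_le h hx'
  have h2 := nmul_le hx h'
  have := norm_add_le ((y * x - x * y) * x') (x * (y * x' - x' * y))
  linarith
theorem Cm.add {y x x' : A} {δ δ' : ℝ} (h : Cm y δ x) (h' : Cm y δ' x') : Cm y (δ + δ') (x + x') := by
  unfold Cm at *
  have e : y * (x + x') - (x + x') * y = (y * x - x * y) + (y * x' - x' * y) := by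
    rw [mul_add, add_mul]; abel
  rw [e]; exact (norm_add_le _ _).trans (add_le_add h h')
theorem Cm.one (y : A) : Cm y 0 1 := by unfold Cm; simp
theorem Cm.zero (y : A) : Cm y 0 0 := by unfold Cm; simp
theorem Cm.one_sub {y x : A} {δ : ℝ} (h : Cm y δ x) : Cm y δ (1 - x) := by
  unfold Cm at *
  have e : y * (1 - x) - (1 - x) * y = -(y * x - x * y) := by rw [mul_sub, sub_mul, mul_one, one_mul]; abel
  rw [e, norm_neg]; exact h
theorem Cm.sum {y : A} {ι : Type*} (s : Finset ι) (f : ι → A) {δ : ℝ} (h : ∀ i ∈ s, Cm y δ (f i)) :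
    Cm y (s.card * δ) (∑ i ∈ s, f i) := by
  unfold Cm at *
  rw [Finset.mul_sum, Finset.sum_mul, ← Finset.sum_sub_distrib]
  refine (norm_sum_le _ _).trans ?_
  have := Finset.sum_le_sum h
  simpa using this
theorem Cm.aut {y x : A} {δ : ℝ} (β : A ≃⋆ₐ[ℂ] A) (h : Cm (β.symm y) δ x) : Cm y δ (β x) := by
  unfold Cm at *
  have : y * β x - β x * y = β (β.symm y * x - x * β.symm y) := by
    rw [map_sub, map_mul, map_mul, StarAlgEquiv.apply_symm_apply]
  rw [this, nA]; exact h

/-- ordered products -/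
noncomputable def Rp (F : ℕ → A) : ℕ → A
  | 0 => 1
  | k + 1 => Rp F k * (1 - F k)

theorem Rp_norm {F : ℕ → A} (hF : ∀ i, IsProjection (F i)) (k : ℕ) : ‖Rp F k‖ ≤ 1 := by
  induction k with
  | zero => exact proj_one.norm_le
  | succ k ih => have := nmul_le ih (hF k).one_sub.norm_le; simpa [Rp] using this

theorem Rp_cm {F : ℕ → A} (hF : ∀ i, IsProjection (F i)) {y : A} {δ : ℝ} {n : ℕ} (h : ∀ i < n, Cm y δ (F i)) :
    ∀ k ≤ n, Cm y (k * δ) (Rp F k) ∧ Cm y (k * δ) (star (Rp F k)) := by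
  intro k
  induction k with
  | zero => intro _; simpa [Rp] using Cm.one y
  | succ k ih =>
    intro hk
    obtain ⟨h1, h2⟩ := ih (by omega)
    have h3 := (h k (by omega)).one_sub
    refine ⟨?_, ?_⟩
    · exact (h1.mul h3 (Rp_norm hF k) (hF k).one_sub.norm_le).mono (by push_cast; linarith)
    · have : star (Rp F (k+1)) = (1 - F k) * star (Rp F k) := by
        show star (Rp F k * (1 - F k)) = _
        rw [star_mul, (hF k).one_sub.st]
      rw [this]
      exact (h3.mul h2 (hF k).one_sub.norm_le (by rw [norm_star]; exact Rp_norm hF k)).mono (by push_cast; linarith)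

theorem Rp_sum {F : ℕ → A} (hF : ∀ i, IsProjection (F i)) (k : ℕ) :
    ∑ i ∈ Finset.range k, Rp F i * F i * star (Rp F i) + Rp F k * star (Rp F k) = 1 := by
  induction k with
  | zero => simp [Rp]
  | succ k ih =>
    have : Rp F (k+1) * star (Rp F (k+1)) = Rp F k * star (Rp F k) - Rp F k * F k * star (Rp F k) := by
      show Rp F k * (1 - F k) * star (Rp F k * (1 - F k)) = _
      rw [star_mul, (hF k).one_sub.st, mul_assoc, ← mul_assoc (1 - F k), (hF k).one_sub.mm, sub_mul, mul_sub, one_mul, mul_assoc]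
    rw [Finset.sum_range_succ, this, ← ih]; abel

theorem Rp_n2 (hτ : IsTracialState τ) {F : ℕ → A} (hF : ∀ i, IsProjection (F i)) {s : ℝ} {i : ℕ}
    (h : ∀ k < i, n2 τ (F k * F i) ≤ s) : ∀ k ≤ i, n2 τ (Rp F k * F i - F i) ≤ k * s := by
  intro k
  induction k with
  | zero => intro _; simp [Rp, n2]
  | succ k ih =>
    intro hk
    have h1 := ih (by omega)
    have h2 := h k (by omega)
    have e : Rp F (k+1) * F i - F i = (Rp F k * F i - F i) - Rp F k * (F k * F i) := by
      show Rp F k * (1 - F k) * F i - F i = _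
      rw [mul_sub, mul_one, sub_mul, mul_assoc (Rp F k) (F k)]; abel
    rw [e]
    have h3 := n2_sub hτ (Rp F k * F i - F i) (Rp F k * (F k * F i))
    have h4 := n2_mul_left hτ (Rp F k) (F k * F i)
    have h5 : ‖Rp F k‖ * n2 τ (F k * F i) ≤ 1 * s := mul_le_mul (Rp_norm hF k) h2 (n2_nonneg _) (by norm_num)
    push_cast; linarith

theorem n2_proj (hτ : IsTracialState τ) {p : A} (hp : IsProjection p) : n2 τ p ^ 2 = tr τ p := by
  rw [n2_sq hτ, hp.ss]

/-- key two-norm estimate -/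
theorem err_est (hτ : IsTracialState τ) {F S R : A} (hF : IsProjection F) (hS : ‖S‖ ≤ 1) (hR : ‖R‖ ≤ 1) {ε : ℝ}
    (hε : 0 ≤ ε) (hε1 : ε ≤ 1)
    (h1 : n2 τ (S * F - F) ≤ ε * n2 τ F) (h2 : n2 τ (R * F - F) ≤ ε * n2 τ F) :
    tr τ (S * F * star S * (1 - R * F * star R)) ≤ 7 * ε * tr τ F := by
  have hT := n2_proj hτ hF
  set t := n2 τ F with ht
  have ht0 : 0 ≤ t := n2_nonneg _
  have key : ∀ S : A, ‖S‖ ≤ 1 → n2 τ (S * F - F) ≤ ε * t → n2 τ (S * F * star S - F) ≤ 2 * ε * t := by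
    intro S hS h
    have e : S * F * star S - F = (S * F - F) * star S + star (S * F - F) := by
      rw [star_sub, star_mul, hF.st, sub_mul]; abel
    rw [e]
    have a1 := n2_add hτ ((S * F - F) * star S) (star (S * F - F))
    have a2 := n2_mul_right hτ (S * F - F) (star S)
    rw [n2_star hτ] at a1
    rw [norm_star] at a2
    have : n2 τ (S * F - F) * ‖S‖ ≤ (ε * t) * 1 := mul_le_mul h hS (norm_nonneg _) (by positivity)
    linarith
  have kS := key S hS h1
  have kR := key R hR h2
  set x := S * F * star S - F with hx
  set y := R * F * star R - F with hy
  have e : S * F * star S * (1 - R * F * star R) = S * F * star S * (1 - F) - F * y - x * y := by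
    rw [hx, hy]; noncomm_ring
  rw [e, tr_sub, tr_sub]
  have b1 : tr τ (S * F * star S * (1 - F)) ≤ (ε * t) ^ 2 := by
    have e1 : tr τ (S * F * star S * (1 - F)) = n2 τ ((1 - F) * (S * F - F)) ^ 2 := by
      have e2 : (1 - F) * (S * F - F) = (1 - F) * S * F := by
        have : (1 - F) * F = 0 := by rw [sub_mul, one_mul, hF.mm, sub_self]
        rw [mul_sub, this, sub_zero, mul_assoc]
      have e3 : (1 - F) * S * F * star ((1 - F) * S * F) = (1 - F) * (S * F * star S * (1 - F)) := by
        rw [star_mul, star_mul, hF.st, hF.one_sub.st]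
        have : (1 - F) * S * F * (F * (star S * (1 - F))) = (1 - F) * S * (F * F) * (star S * (1 - F)) := by simp only [mul_assoc]
        rw [this, hF.mm]; simp only [mul_assoc]
      rw [e2, n2_sq hτ, tr_comm hτ (star _), e3, tr_comm hτ (1 - F), mul_assoc _ (1 - F) (1 - F), hF.one_sub.mm]
    rw [e1]
    have := n2_mul_left hτ (1 - F) (S * F - F)
    have h3 : ‖1 - F‖ * n2 τ (S * F - F) ≤ 1 * (ε * t) := mul_le_mul hF.one_sub.norm_le h1 (n2_nonneg _) (by norm_num)
    exact pow_le_pow_left₀ (n2_nonneg _) (by linarith) 2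
  have b2 := (abs_le.1 ((cs' hτ F y).trans (mul_le_mul_of_nonneg_left kR ht0))).1
  have b3 := (abs_le.1 ((cs' hτ x y).trans (mul_le_mul kS kR (n2_nonneg _) (by positivity)))).1
  have : ε ^ 2 ≤ ε := by nlinarith
  have ht2 : 0 ≤ t ^ 2 := by positivity
  rw [← hT]
  nlinarith

theorem n2_FF (hτ : IsTracialState τ) {p q : A} (hp : IsProjection p) (hq : IsProjection q) :
    n2 τ (p * q) ^ 2 = tr τ (p * q) := by
  rw [n2_sq hτ, star_mul, hp.st, hq.st, mul_assoc, ← mul_assoc p p q, hp.mm, tr_comm hτ, mul_assoc, hq.mm]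

theorem conj_nonneg' (x : A) {a : A} (ha : 0 ≤ a) : 0 ≤ x * a * star x := by
  have := conj_mono (star x) ha
  simpa using this

theorem LL (G : Good τ) {β : A ≃⋆ₐ[ℂ] A} (hU : PUO β) (n : ℕ) [NeZero n] {κ : ℝ} (hκ : 0 < κ) :
    ∃ c > 0, ∀ (Y : Finset A) (δ : ℝ), 0 < δ → ∃ (R : A) (K : ZMod n → A), (∀ j, 0 ≤ K j) ∧ ∑ j, K j + R * star R = 1 ∧
      ‖R‖ ≤ 1 ∧ (∀ y ∈ Y, Cm y δ R ∧ Cm y δ (star R) ∧ ∀ j, Cm y δ (K j)) ∧ c ≤ tr τ (∑ j, K j) ∧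
      ∑ j, tr τ (β (K j) * (1 - K (j + 1))) ≤ κ * tr τ (∑ j, K j) := by
  classical
  have hτ := G.htr
  obtain ⟨N, hN⟩ := exists_nat_gt (4 / κ)
  have hN0 : (0:ℝ) < N := lt_trans (by positivity) hN
  have hNκ : 4 ≤ κ * N := by rw [div_lt_iff₀ hκ] at hN; linarith
  have hN1 : 1 ≤ N := by exact_mod_cast hN0
  set ε : ℝ := 1 / (7 * N) with hε
  have hε0 : 0 < ε := by positivity
  have hN1' : (1:ℝ) ≤ N := by exact_mod_cast hN1
  have hε4 : ε ≤ 1/4 := by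
    rw [hε, div_le_div_iff₀ (by positivity) (by norm_num)]; linarith
  obtain ⟨c, hc, H⟩ := two_norm_G G hU (ρ := (ε / N)^2) (by positivity) N
  refine ⟨N * c / 2, by positivity, fun Y δ hδ => ?_⟩
  set δ' : ℝ := δ / (N * (2 * N + 1)) with hδ'
  have hδ'0 : 0 < δ' := by positivity
  obtain ⟨g, hg, g1, g2, g3⟩ := H ((Finset.range N ×ˢ Y).image fun z => (β ^ z.1).symm z.2) δ' hδ'0
  set F : ℕ → A := fun i => (β ^ i) g with hFdef
  have hF : ∀ i, IsProjection (F i) := fun i => aut_proj _ hg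
  have hFc : ∀ y ∈ Y, ∀ i < N, Cm y δ' (F i) := fun y hy i hi => Cm.aut _ (le_of_lt (g1 _ (by
    rw [Finset.mem_image]; exact ⟨(i, y), by simp [hi, hy], rfl⟩)))
  have hFt : ∀ i, tr τ (F i) = tr τ g := fun i => G.inv _ _
  have hn2F : ∀ i, n2 τ (F i) = n2 τ g := fun i => G.n2inv _ _
  have hFF : ∀ i < N, ∀ k < i, n2 τ (F k * F i) ≤ ε / N * n2 τ (F i) := by
    intro i hi k hk
    have h1 : n2 τ (F k * F i) ^ 2 ≤ (ε / N * n2 τ (F i)) ^ 2 := by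
      rw [n2_FF hτ (hF k) (hF i), mul_pow, n2_proj hτ (hF i), hFt]
      have e : F i = (β ^ k) ((β ^ (i - k)) g) := by rw [← pow_add_apply]; congr 2; omega
      rw [e, ← map_mul (β ^ k), G.inv]
      refine le_trans ?_ g3
      exact Finset.single_le_sum (f := fun j => tr τ (g * (β ^ j) g)) (fun j _ => tr_mul_nonneg hτ hg.nonneg (aut_nonneg _ hg.nonneg))
        (Finset.mem_Ico.2 ⟨by omega, by omega⟩)
    exact le_of_sq_le_sq h1 (mul_nonneg (by positivity) (n2_nonneg _))
  have hRF : ∀ i < N, n2 τ (Rp F i * F i - F i) ≤ ε * n2 τ (F i) := by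
    intro i hi
    refine (Rp_n2 hτ hF (hFF i hi) i le_rfl).trans ?_
    have : (i:ℝ) * (ε / N) ≤ ε := by
      have : (i:ℝ) ≤ N := by exact_mod_cast hi.le
      rw [mul_div_assoc', div_le_iff₀ hN0]; nlinarith
    nlinarith [n2_nonneg (τ := τ) (F i)]
  set F' : ℕ → A := fun i => Rp F i * F i * star (Rp F i) with hF'
  have hF'0 : ∀ i, 0 ≤ F' i := fun i => conj_nonneg' _ (hF i).nonneg
  have hF'n2 : ∀ i, tr τ (F' i) = n2 τ (Rp F i * F i) ^ 2 := by
    intro i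
    rw [n2_sq hτ, tr_comm hτ (star _), star_mul, (hF i).st]
    have : Rp F i * F i * (F i * star (Rp F i)) = Rp F i * (F i * F i) * star (Rp F i) := by simp only [mul_assoc]
    rw [this, (hF i).mm]
  have hF't : ∀ i, tr τ (F' i) ≤ tr τ g := by
    intro i
    rw [hF'n2, ← hFt i, ← n2_proj hτ (hF i)]
    apply pow_le_pow_left₀ (n2_nonneg _)
    refine (n2_mul_left hτ _ _).trans ?_
    have := mul_le_mul_of_nonneg_right (Rp_norm hF i) (n2_nonneg (τ := τ) (F i))
    linarith
  have hF'l : ∀ i < N, tr τ g / 2 ≤ tr τ (F' i) := by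
    intro i hi
    rw [hF'n2, ← hFt i, ← n2_proj hτ (hF i)]
    have h1 := hRF i hi
    have h2 := n2_sub hτ (Rp F i * F i) (Rp F i * F i - F i)
    rw [sub_sub_cancel] at h2
    have h3 := n2_nonneg (τ := τ) (F i)
    have h4 : 3/4 * n2 τ (F i) ≤ n2 τ (Rp F i * F i) := by nlinarith
    have h5 := pow_le_pow_left₀ (by positivity) h4 2
    nlinarith
  set R := Rp F N with hR
  set K : ZMod n → A := fun j => ∑ i ∈ Finset.range N with ((i : ℕ) : ZMod n) = j, F' i with hK
  have hKs : ∑ j, K j = ∑ i ∈ Finset.range N, F' i := Finset.sum_fiberwise _ _ _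
  have hK0 : ∀ j, 0 ≤ K j := fun j => Finset.sum_nonneg fun i _ => hF'0 i
  have hone : ∑ j, K j + R * star R = 1 := by rw [hKs]; exact Rp_sum hF N
  have hKle : ∀ j, K j ≤ 1 := by
    intro j
    have h1 : K j ≤ ∑ j, K j := Finset.single_le_sum (fun j _ => hK0 j) (Finset.mem_univ j)
    refine h1.trans ?_
    rw [← hone]; exact le_add_of_nonneg_right (mul_star_self_nonneg R)
  have htot : N * tr τ g / 2 ≤ tr τ (∑ j, K j) := by
    rw [hKs, tr_sum]
    have := Finset.sum_le_sum fun i hi => hF'l i (Finset.mem_range.1 hi)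
    simp at this; linarith
  refine ⟨R, K, hK0, hone, Rp_norm hF N, fun y hy => ?_, ?_, ?_⟩
  · have hh := Rp_cm hF (hFc y hy)
    have hδN : N * (2 * N + 1) * δ' = δ := by rw [hδ']; field_simp
    have hNN : (N:ℝ) * δ' ≤ δ := by rw [← hδN]; nlinarith [mul_pos hN0 hδ'0]
    refine ⟨(hh N le_rfl).1.mono hNN, (hh N le_rfl).2.mono hNN, fun j => ?_⟩
    have h1 : ∀ i ∈ (Finset.range N).filter (fun i : ℕ => (i : ZMod n) = j), Cm y ((2 * N + 1) * δ') (F' i) := by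
      intro i hi
      have hi' : i < N := Finset.mem_range.1 (Finset.mem_filter.1 hi).1
      have h2 := hh i hi'.le
      have hr := Rp_norm hF i
      refine ((h2.1.mul (hFc y hy i hi') hr (hF i).norm_le).mul h2.2 ?_ (by rwa [norm_star])).mono ?_
      · simpa using nmul_le hr (hF i).norm_le
      · have : (i:ℝ) ≤ N := by exact_mod_cast hi'.le
        nlinarith
    refine (Cm.sum _ _ h1).mono ?_
    rw [← hδN, mul_assoc]
    apply mul_le_mul_of_nonneg_right _ (by positivity)
    have := Finset.card_filter_le (Finset.range N) fun i => ((i : ℕ) : ZMod n) = j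
    rw [Finset.card_range] at this
    exact_mod_cast this
  · refine le_trans ?_ htot
    have := mul_le_mul_of_nonneg_left g2 hN0.le
    linarith
  · have e1 : ∑ j, tr τ (β (K j) * (1 - K (j + 1))) = ∑ i ∈ Finset.range N, tr τ (β (F' i) * (1 - K ((i:ZMod n) + 1))) := by
      rw [← Finset.sum_fiberwise (Finset.range N) (fun i => ((i:ℕ):ZMod n))]
      refine Finset.sum_congr rfl fun j _ => ?_
      rw [hK]; simp only []
      rw [map_sum, Finset.sum_mul, tr_sum]
      refine Finset.sum_congr rfl fun i hi => ?_
      rw [(Finset.mem_filter.1 hi).2]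
    have e2 : ∀ i ∈ Finset.range N, tr τ (β (F' i) * (1 - K ((i:ZMod n) + 1))) ≤ 7 * ε * tr τ g + if i = N - 1 then tr τ g else 0 := by
      intro i hi
      have hg0 := tr_nonneg hτ hg.nonneg
      split_ifs with hiN
      · have : tr τ (β (F' i) * (1 - K ((i:ZMod n) + 1))) ≤ tr τ (β (F' i) * 1) :=
          tr_mul_mono hτ (aut_nonneg _ (hF'0 i)) (sub_le_self _ (hK0 _))
        rw [mul_one, G.inv] at this
        have := hF't i
        nlinarith
      · have hi2 : i + 1 < N := by have := Finset.mem_range.1 hi; omega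
        have h1 : F' (i+1) ≤ K ((i:ZMod n) + 1) := by
          rw [hK]; simp only []
          apply Finset.single_le_sum (f := F') (fun j _ => hF'0 j)
          simp [hi2]
        have h2 := tr_mul_mono hτ (aut_nonneg β (hF'0 i)) (sub_le_sub_left h1 1)
        have hβF : β (F i) = F (i+1) := (pow_succ_apply _ _ _).symm
        have h3 := err_est hτ (hF (i+1)) (S := β (Rp F i)) (R := Rp F (i+1)) (by rw [nA]; exact Rp_norm hF i) (Rp_norm hF _) hε0.le (by linarith)
          (by
            have := hRF i (by omega)
            rw [← hβF, ← map_mul, ← map_sub, G.n2inv, G.n2inv]; exact this) (hRF _ hi2)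
        rw [hFt] at h3
        have h4 : β (F' i) = β (Rp F i) * F (i+1) * star (β (Rp F i)) := by
          rw [← hβF, ← map_star, ← map_mul, ← map_mul]
        rw [h4] at h2 ⊢
        rw [add_zero]
        exact h2.trans h3
    rw [e1]
    refine (Finset.sum_le_sum e2).trans ?_
    rw [Finset.sum_add_distrib, Finset.sum_ite_eq' , if_pos (Finset.mem_range.2 (by omega)), Finset.sum_const, Finset.card_range, nsmul_eq_mul]
    have h5 : (N:ℝ) * (7 * ε * tr τ g) = tr τ g := by rw [hε]; field_simp
    rw [h5]
    have hg0 := tr_nonneg hτ hg.nonneg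
    have := mul_le_mul_of_nonneg_left htot hκ.le
    nlinarith
end
end RK

namespace RK
set_option linter.all false

section
variable {A : Type*} [CStarAlgebra A] [PartialOrder A] [StarOrderedRing A] {τ : A →ₗ[ℂ] ℂ}

theorem norm_le_one' {x : A} (h0 : 0 ≤ x) (h1 : x ≤ 1) : ‖x‖ ≤ 1 :=
  (CStarAlgebra.norm_le_norm_of_nonneg_of_le h0 h1).trans proj_one.norm_le

noncomputable def err (τ : A →ₗ[ℂ] ℂ) (β : A ≃⋆ₐ[ℂ] A) {n : ℕ} [NeZero n] (E : ZMod n → A) : ℝ := ∑ j, tr τ (β (E j) * (1 - E (j + 1)))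

def NRs (τ : A →ₗ[ℂ] ℂ) (β : A ≃⋆ₐ[ℂ] A) (n : ℕ) [NeZero n] (κ s : ℝ) : Prop :=
  ∀ (Y : Finset A) (δ : ℝ), 0 < δ → ∃ E : ZMod n → A, (∀ j, 0 ≤ E j) ∧ ∑ j, E j ≤ 1 ∧ (∀ y ∈ Y, ∀ j, Cm y δ (E j)) ∧
    err τ β E ≤ 2 * κ + δ ∧ s ≤ tr τ (∑ j, E j)

theorem NR_step (G : Good τ) {β : A ≃⋆ₐ[ℂ] A} {n : ℕ} [NeZero n] {κ c s : ℝ} (hκ : 0 < κ) (hc : 0 < c) (hs : s < 1)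
    (H : ∀ (Y : Finset A) (δ : ℝ), 0 < δ → ∃ (R : A) (K : ZMod n → A), (∀ j, 0 ≤ K j) ∧ ∑ j, K j + R * star R = 1 ∧
      ‖R‖ ≤ 1 ∧ (∀ y ∈ Y, Cm y δ R ∧ Cm y δ (star R) ∧ ∀ j, Cm y δ (K j)) ∧ c ≤ tr τ (∑ j, K j) ∧
      ∑ j, tr τ (β (K j) * (1 - K (j + 1))) ≤ κ * tr τ (∑ j, K j))
    (h : NRs τ β n κ s) : NRs τ β n κ (s + (1 - s) * c / 2) := by
  classical
  have hτ := G.htr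
  intro Y δ hδ
  obtain ⟨E, E0, E1, Ec, Ee, Es⟩ := h Y (δ/2) (by positivity)
  have hEle : ∀ j, E j ≤ 1 := fun j => (Finset.single_le_sum (fun j _ => E0 j) (Finset.mem_univ j)).trans E1
  set e := ∑ j, E j with he
  have he0 : 0 ≤ e := Finset.sum_nonneg fun j _ => E0 j
  have hn : (0:ℝ) < n := by exact_mod_cast NeZero.pos n
  obtain ⟨Y1, δ1, hδ1, m1⟩ := mix G e (ε := (1 - s) * c / 2) (by have := sub_pos.2 hs; positivity)
  choose Y2 δ2 hδ2 m2 using fun j => mix G (β (E j) * (1 - E (j+1))) (ε := δ / (4 * n)) (by positivity)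
  obtain ⟨d2, hd2, hd2'⟩ : ∃ d > 0, ∀ j, d ≤ δ2 j := by
    obtain ⟨j0, -, hj0⟩ := Finset.exists_min_image Finset.univ δ2 ⟨0, Finset.mem_univ _⟩
    exact ⟨δ2 j0, hδ2 j0, fun j => hj0 j (Finset.mem_univ _)⟩
  set Z : Finset A := Y ∪ Y1 ∪ Finset.univ.biUnion Y2 ∪ Finset.univ.image E with hZ
  set η : ℝ := min (min (δ/6) (δ1/4)) (min (d2/8) (δ/(8*n))) with hη
  have hη0 : 0 < η := by simp only [hη, lt_min_iff]; refine ⟨⟨?_, ?_⟩, ?_, ?_⟩ <;> positivity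
  have η1 : η ≤ δ/6 := (min_le_left _ _).trans (min_le_left _ _)
  have η2 : η ≤ δ1/4 := (min_le_left _ _).trans (min_le_right _ _)
  have η3 : η ≤ d2/8 := (min_le_right _ _).trans (min_le_left _ _)
  have η4 : η ≤ δ/(8*n) := (min_le_right _ _).trans (min_le_right _ _)
  obtain ⟨R, K, K0, K1, hR, Kc, Kt, Ke⟩ := H (Z ∪ Z.image β.symm) η hη0
  have Kc1 : ∀ y ∈ Z, Cm y η R ∧ Cm y η (star R) ∧ ∀ j, Cm y η (K j) := fun y hy => Kc y (by simp [hy])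
  have Kc2 : ∀ y ∈ Z, Cm y η (β R) ∧ Cm y η (β (star R)) := fun y hy =>
    have := Kc (β.symm y) (Finset.mem_union_right _ (Finset.mem_image_of_mem _ hy))
    ⟨this.1.aut β, this.2.1.aut β⟩
  have hRs : ‖star R‖ ≤ 1 := by rwa [norm_star]
  have hRb : ‖β R‖ ≤ 1 := by rwa [nA]
  have hRsb : ‖β (star R)‖ ≤ 1 := by rwa [nA]
  set Fb := ∑ j, K j with hFb
  have hFb0 : 0 ≤ Fb := Finset.sum_nonneg fun j _ => K0 j
  have hKF : ∀ j, K j ≤ Fb := fun j => Finset.single_le_sum (fun j _ => K0 j) (Finset.mem_univ j)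
  have hRR : R * star R = 1 - Fb := by rw [← K1]; abel
  set f := tr τ Fb with hf
  have hf0 : 0 ≤ f := tr_nonneg hτ hFb0
  have hRRt : tr τ (R * star R) = 1 - f := by rw [hRR, tr_sub, tr_one hτ]
  have hf1 : f ≤ 1 := by
    have := tr_nonneg hτ (mul_star_self_nonneg R); linarith
  have cle : ∀ x : A, ‖x‖ ≤ 1 → star x * x ≤ 1 := by
    intro x hx
    have h0 : 0 ≤ star x * x := star_mul_self_nonneg x
    have h1 : ‖star x * x‖ ≤ 1 := by rw [CStarRing.norm_star_mul_self]; nlinarith [norm_nonneg x]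
    exact CStarAlgebra.norm_le_one_iff_of_nonneg _ |>.1 h1
  set E' : ZMod n → A := fun j => R * E j * star R + K j with hE'
  have hE'0 : ∀ j, 0 ≤ E' j := fun j => add_nonneg (conj_nonneg' _ (E0 j)) (K0 j)
  have hE's : ∑ j, E' j = R * e * star R + Fb := by
    simp only [hE', Finset.sum_add_distrib]; rw [he, Finset.mul_sum, Finset.sum_mul]
  refine ⟨E', hE'0, ?_, fun y hy j => ?_, ?_, ?_⟩
  · rw [hE's, ← K1, add_comm]
    have := conj_nonneg' R (sub_nonneg.2 E1)
    rw [mul_sub, mul_one, sub_mul, sub_nonneg] at this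
    exact add_le_add_right this _
  · have hyZ : y ∈ Z := by simp [hZ, hy]
    obtain ⟨a1, a2, a3⟩ := Kc1 y hyZ
    have hEn := norm_le_one' (E0 j) (hEle j)
    refine (((a1.mul (Ec y hy j) hR hEn).mul a2 ?_ hRs).add (a3 j)).mono (by linarith)
    simpa using nmul_le hR hEn
  · -- error
    set S := β (star R) * R with hS
    have hSs : star S = star R * β R := by rw [hS, star_mul, ← map_star, star_star]
    have hSn : ‖S‖ ≤ 1 := by simpa using nmul_le hRsb hR
    have Sc : ∀ y ∈ Z, Cm y (2 * η) S ∧ Cm y (2 * η) (star S) := fun y hy => by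
      obtain ⟨a1, a2, -⟩ := Kc1 y hy
      obtain ⟨b1, b2⟩ := Kc2 y hy
      refine ⟨(b2.mul a1 hRsb hR).mono (by linarith), ?_⟩
      rw [hSs]; exact (a2.mul b1 hRs hRb).mono (by linarith)
    set X := S * star S with hX
    have hX0 : 0 ≤ X := mul_star_self_nonneg S
    have hX1 : X ≤ 1 := by have := cle (star S) (by rwa [norm_star]); rwa [star_star] at this
    have hXt : tr τ X ≤ 1 - f := by
      have e1 : X = β (star R) * (R * star R) * star (β (star R)) := by
        rw [hX, hSs, hS, ← map_star, star_star]; simp only [mul_assoc]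
      have h1 : R * star R ≤ 1 := by rw [hRR]; exact sub_le_self _ hFb0
      have h2 := conj_mono (star (β (star R))) h1
      rw [star_star, mul_one, ← map_star, star_star, ← map_mul] at h2
      have := tr_mono hτ h2
      rw [G.inv, tr_comm hτ (star R) R, hRRt] at this
      rw [e1, ← map_star, star_star]; exact this
    have T1 : ∀ j, tr τ (β (R * E j * star R) * (R * (1 - E (j+1)) * star R)) ≤
        tr τ (β (E j) * (1 - E (j+1))) * (1 - f) + δ / (2 * n) := by
      intro j
      have e1 : tr τ (β (R * E j * star R) * (R * (1 - E (j+1)) * star R)) = tr τ (β (E j) * S * (1 - E (j+1)) * star S) := by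
        rw [hSs, hS, map_mul, map_mul]
        have : β R * β (E j) * β (star R) * (R * (1 - E (j+1)) * star R) = β R * (β (E j) * β (star R) * (R * (1 - E (j+1)) * star R)) := by
          simp only [mul_assoc]
        rw [this, tr_comm hτ]; simp only [mul_assoc]
      have e2 : β (E j) * S * (1 - E (j+1)) * star S - β (E j) * (1 - E (j+1)) * X =
          β (E j) * (E (j+1) * S - S * E (j+1)) * star S := by
        rw [hX]; noncomm_ring
      have e3 : ‖β (E j) * (E (j+1) * S - S * E (j+1)) * star S‖ ≤ 2 * η := by
        have h1 : ‖E (j+1) * S - S * E (j+1)‖ ≤ 2 * η := (Sc (E (j+1)) (by simp [hZ])).1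
        have := nmul_le (nmul_le (by rw [nA]; exact norm_le_one' (E0 j) (hEle j) : ‖β (E j)‖ ≤ 1) h1) (by rwa [norm_star] : ‖star S‖ ≤ 1)
        linarith
      have e4 := m2 j X hX0 hX1 (fun b hb => by
        have hbZ : b ∈ Z := by
          simp only [hZ, Finset.mem_union, Finset.mem_biUnion]; exact Or.inl (Or.inr ⟨j, Finset.mem_univ _, hb⟩)
        have h1 : Cm b (2 * η + 2 * η) X := (Sc b hbZ).1.mul (Sc b hbZ).2 hSn (by rwa [norm_star])
        have h2 := hd2' j
        have : 2 * η + 2 * η < δ2 j := by linarith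
        exact lt_of_le_of_lt h1 this)
      have e5 : |tr τ (β (E j) * S * (1 - E (j+1)) * star S) - tr τ (β (E j) * (1 - E (j+1)) * X)| ≤ 2 * η :=
        (tr_diff hτ _ _).trans (by rw [e2]; exact e3)
      have e6 : 0 ≤ tr τ (β (E j) * (1 - E (j+1))) := tr_mul_nonneg hτ (aut_nonneg _ (E0 j)) (sub_nonneg.2 (hEle _))
      have e7 := mul_le_mul_of_nonneg_left hXt e6
      have e8 : δ / (2 * n) = δ / (4 * n) + 2 * (δ / (8 * n)) := by field_simp; ring
      rw [e1]
      have := abs_le.1 e4; have := abs_le.1 e5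
      rw [e8]; linarith
    have T2 : ∑ j, tr τ (β (R * E j * star R) * (Fb - K (j+1))) ≤ κ * f := by
      have h1 : ∀ j, tr τ (β (R * E j * star R) * (Fb - K (j+1))) ≤ tr τ (β (R * E j * star R) * Fb) := fun j =>
        tr_mul_mono hτ (aut_nonneg _ (conj_nonneg' _ (E0 j))) (sub_le_self _ (K0 _))
      have h2 : ∑ j, tr τ (β (R * E j * star R) * Fb) = tr τ (Fb * β (R * e * star R)) := by
        rw [← tr_sum, ← Finset.sum_mul, ← map_sum, ← Finset.sum_mul, ← Finset.mul_sum, tr_comm hτ]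
      have h3 : R * e * star R ≤ R * star R := by
        have := conj_nonneg' R (sub_nonneg.2 E1)
        rw [mul_sub, mul_one, sub_mul, sub_nonneg] at this
        exact this
      have h4 := tr_mul_mono hτ hFb0 (aut_mono β h3)
      have h5 : tr τ (Fb * β (R * star R)) = tr τ (β Fb * (1 - Fb)) := by
        rw [hRR, map_sub, map_one, mul_sub, mul_sub, mul_one, mul_one, tr_sub, tr_sub, G.inv, tr_comm hτ]
      have h6 : tr τ (β Fb * (1 - Fb)) = ∑ j, tr τ (β (K j) * (1 - Fb)) := by
        rw [← tr_sum, ← Finset.sum_mul, ← map_sum]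
      have h7 : ∀ j, tr τ (β (K j) * (1 - Fb)) ≤ tr τ (β (K j) * (1 - K (j+1))) := fun j =>
        tr_mul_mono hτ (aut_nonneg _ (K0 j)) (sub_le_sub_left (hKF _) _)
      calc _ ≤ _ := Finset.sum_le_sum fun j _ => h1 j
        _ ≤ tr τ (Fb * β (R * star R)) := by rw [h2]; exact h4
        _ ≤ _ := by rw [h5, h6]; exact (Finset.sum_le_sum fun j _ => h7 j).trans Ke
    have T3 : ∀ j, tr τ (β (K j) * (1 - E' (j+1))) ≤ tr τ (β (K j) * (1 - K (j+1))) := fun j =>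
      tr_mul_mono hτ (aut_nonneg _ (K0 j)) (sub_le_sub_left (le_add_of_nonneg_left (conj_nonneg' _ (E0 _))) _)
    have dec : ∀ j, tr τ (β (E' j) * (1 - E' (j+1))) = tr τ (β (R * E j * star R) * (R * (1 - E (j+1)) * star R)) +
        tr τ (β (R * E j * star R) * (Fb - K (j+1))) + tr τ (β (K j) * (1 - E' (j+1))) := by
      intro j
      have a1 : 1 - E' (j+1) = R * (1 - E (j+1)) * star R + (Fb - K (j+1)) := by
        show 1 - (R * E (j+1) * star R + K (j+1)) = _
        rw [mul_sub, mul_one, sub_mul, hRR]; abel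
      have a2 : β (E' j) = β (R * E j * star R) + β (K j) := map_add _ _ _
      rw [a2, add_mul, tr_add]
      nth_rewrite 1 [a1]
      rw [mul_add, tr_add]
    unfold err at Ee ⊢
    calc ∑ j, tr τ (β (E' j) * (1 - E' (j+1))) = _ := Finset.sum_congr rfl fun j _ => dec j
      _ ≤ (∑ j : ZMod n, (tr τ (β (E j) * (1 - E (j+1))) * (1 - f) + δ / (2 * n))) + κ * f + κ * f := by
        rw [Finset.sum_add_distrib, Finset.sum_add_distrib]
        exact add_le_add (add_le_add (Finset.sum_le_sum fun j _ => T1 j) T2) ((Finset.sum_le_sum fun j _ => T3 j).trans Ke)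
      _ = (∑ j : ZMod n, tr τ (β (E j) * (1 - E (j+1)))) * (1 - f) + δ / 2 + 2 * κ * f := by
        rw [Finset.sum_add_distrib, ← Finset.sum_mul, Finset.sum_const, Finset.card_univ, ZMod.card, nsmul_eq_mul]
        field_simp; ring
      _ ≤ (2 * κ + δ/2) * (1 - f) + δ / 2 + 2 * κ * f := by
        have := mul_le_mul_of_nonneg_right Ee (sub_nonneg.2 hf1); linarith
      _ ≤ _ := by nlinarith
  · have hX0 : 0 ≤ star R * R := star_mul_self_nonneg R
    have e4 := m1 (star R * R) hX0 (cle R hR) (fun b hb => by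
      have hbZ : b ∈ Z := by simp [hZ, hb]
      have h1 : Cm b (η + η) (star R * R) := (Kc1 b hbZ).2.1.mul (Kc1 b hbZ).1 hRs hR
      have : η + η < δ1 := by linarith
      exact lt_of_le_of_lt h1 this)
    rw [hE's, tr_add, mul_assoc, tr_comm hτ, mul_assoc]
    rw [tr_comm hτ (star R) R, hRRt] at e4
    have := abs_le.1 e4
    have h1 := mul_le_mul_of_nonneg_right Es (sub_nonneg.2 hf1)
    have h2 : (1 - s) * c ≤ (1 - s) * f := mul_le_mul_of_nonneg_left Kt (by linarith)
    show _ ≤ _ + f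
    nlinarith

theorem NR (G : Good τ) {β : A ≃⋆ₐ[ℂ] A} (hU : PUO β) (n : ℕ) [NeZero n] {κ : ℝ} (hκ : 0 < κ) (Y : Finset A) {δ : ℝ} (hδ : 0 < δ) :
    ∃ E : ZMod n → A, (∀ j, 0 ≤ E j) ∧ ∑ j, E j ≤ 1 ∧ (∀ y ∈ Y, ∀ j, Cm y δ (E j)) ∧
    err τ β E ≤ κ ∧ 1 - κ ≤ tr τ (∑ j, E j) := by
  have hτ := G.htr
  obtain ⟨c, hc, H⟩ := LL G hU n (κ := κ/4) (by positivity)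
  have hc1 : c ≤ 1 := by
    obtain ⟨R, K, K0, K1, hR, Kc, Kt, Ke⟩ := H ∅ 1 one_pos
    have := tr_nonneg hτ (mul_star_self_nonneg R)
    have h2 := congrArg (tr τ) K1
    rw [tr_add, tr_one hτ] at h2
    linarith
  have hk : ∀ k : ℕ, NRs τ β n (κ/4) (1 - (1 - c/2)^k) := by
    intro k
    induction k with
    | zero =>
      intro Y δ hδ
      refine ⟨fun _ => 0, fun _ => le_rfl, by simp, fun y _ _ => (Cm.zero y).mono hδ.le, ?_, by simp⟩
      simp [err]; positivity
    | succ k ih =>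
      have hp : 0 < (1 - c/2)^k := pow_pos (by linarith) k
      have := NR_step G (by positivity) hc (by linarith) H ih
      convert this using 1
      rw [pow_succ]; ring
  obtain ⟨k, hk'⟩ := exists_pow_lt_of_lt_one hκ (show 1 - c/2 < 1 by linarith)
  obtain ⟨E, E0, E1, E2, E3, E4⟩ := hk k Y (min δ (κ/2)) (by positivity)
  exact ⟨E, E0, E1, fun y hy j => (E2 y hy j).mono (min_le_left _ _), by have := min_le_right δ (κ/2); linarith, by linarith⟩

theorem sq_le_self' {x : A} (h0 : 0 ≤ x) (h1 : x ≤ 1) : x * x ≤ x := by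
  have hs : star x = x := (IsSelfAdjoint.of_nonneg h0).star_eq
  obtain ⟨y, hy⟩ := CStarAlgebra.nonneg_iff_eq_star_mul_self.1 h0
  have := CStarAlgebra.pow_antitone h0 h1 (show 1 ≤ 2 by norm_num)
  simpa [pow_two] using this

theorem two_norm_R (G : Good τ) {β : A ≃⋆ₐ[ℂ] A} (hU : PUO β) (N : ℕ) (Y : Finset A) {δ : ℝ} (hδ : 0 < δ) :
    ∃ E : A, 0 ≤ E ∧ E ≤ 1 ∧ (∀ y ∈ Y, Cm y δ E) ∧ tr τ (E - E * E) < δ ∧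
      (∀ j, 1 ≤ j → j ≤ N → tr τ (E * (β ^ j) E) < δ) ∧ 1 - δ < (N + 1) * tr τ E := by
  classical
  have hτ := G.htr
  set η : ℝ := min 1 (δ / (2 * ((N + 1)^2 + 1))) with hη
  have hη0 : 0 < η := by positivity
  have hη1 : η ≤ 1 := min_le_left _ _
  have hη2 : η * ((N + 1)^2 + 1) ≤ δ / 2 := by
    have := min_le_right 1 (δ / (2 * ((N + 1:ℝ)^2 + 1)))
    rw [← hη, le_div_iff₀ (by positivity)] at this; linarith
  obtain ⟨E, E0, E1, Ec, Ee, Es⟩ := NR G hU (N + 1) (κ := η^2/2) (by positivity) Y hδ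
  have hEle : ∀ j, E j ≤ 1 := fun j => (Finset.single_le_sum (fun j _ => E0 j) (Finset.mem_univ j)).trans E1
  have hsa : ∀ j, star (E j) = E j := fun j => (IsSelfAdjoint.of_nonneg (E0 j)).star_eq
  have hbsa : ∀ j, star (β (E j)) = β (E j) := fun j => by rw [← map_star, hsa]
  have hn2 : ∀ j, n2 τ (β (E j) - E (j+1)) ^ 2 = tr τ (E j * E j) + tr τ (E (j+1) * E (j+1)) - 2 * tr τ (β (E j) * E (j+1)) := by
    intro j
    rw [n2_sq hτ, star_sub, hbsa, hsa, sub_mul, mul_sub, mul_sub, tr_sub, tr_sub, tr_sub, ← map_mul, G.inv, tr_comm hτ (E (j+1)) (β (E j))]; ring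
  have hsum : ∑ j, n2 τ (β (E j) - E (j+1)) ^ 2 = 2 * ∑ j, tr τ (E j * E j) - 2 * ∑ j, tr τ (β (E j) * E (j+1)) := by
    simp only [hn2]
    rw [Finset.sum_sub_distrib, Finset.sum_add_distrib, ← Finset.mul_sum]
    have hsh : ∑ j, tr τ (E (j+1) * E (j+1)) = ∑ j, tr τ (E j * E j) :=
      Equiv.sum_comp (Equiv.addRight (1 : ZMod (N+1))) (fun j => tr τ (E j * E j))
    rw [hsh]
    ring
  have herr : err τ β E = ∑ j, tr τ (E j) - ∑ j, tr τ (β (E j) * E (j+1)) := by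
    unfold err
    rw [← Finset.sum_sub_distrib]
    exact Finset.sum_congr rfl fun j _ => by rw [mul_sub, mul_one, tr_sub, G.inv]
  have hD : ∀ j, 0 ≤ tr τ (E j - E j * E j) := fun j => tr_nonneg hτ (sub_nonneg.2 (sq_le_self' (E0 j) (hEle j)))
  have hDs : ∑ j, tr τ (E j - E j * E j) = ∑ j, tr τ (E j) - ∑ j, tr τ (E j * E j) := by
    simp only [tr_sub, Finset.sum_sub_distrib]
  have hpos : 0 ≤ ∑ j, n2 τ (β (E j) - E (j+1)) ^ 2 := Finset.sum_nonneg fun j _ => sq_nonneg _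
  have hDs0 : 0 ≤ ∑ j, tr τ (E j - E j * E j) := Finset.sum_nonneg fun j _ => hD j
  have D1 : tr τ (E 0 - E 0 * E 0) ≤ η^2/2 := by
    have := Finset.single_le_sum (f := fun j => tr τ (E j - E j * E j)) (fun j _ => hD j) (Finset.mem_univ 0)
    linarith
  have D2 : ∀ j, n2 τ (β (E j) - E (j+1)) ≤ η := by
    intro j
    have := Finset.single_le_sum (f := fun j => n2 τ (β (E j) - E (j+1)) ^ 2) (fun j _ => sq_nonneg _) (Finset.mem_univ j)
    apply le_of_sq_le_sq _ hη0.le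
    linarith
  have D3 : ∀ j : ℕ, n2 τ ((β ^ j) (E 0) - E j) ≤ j * η := by
    intro j
    induction j with
    | zero => simp [n2]
    | succ j ih =>
      have h1 := n2_tri hτ ((β ^ (j+1)) (E 0)) (β (E j)) (E ((j+1 : ℕ)))
      rw [pow_succ_apply, ← map_sub, G.n2inv, ← pow_succ_apply] at h1
      have := D2 j
      push_cast at h1 ⊢; linarith
  have ηη : η^2/2 ≤ η := by nlinarith
  have hE0n : n2 τ (E 0) ≤ 1 := (n2_le_norm hτ _).trans (norm_le_one' (E0 0) (hEle 0))
  refine ⟨E 0, E0 0, hEle 0, fun y hy => Ec y hy 0, ?_, fun j hj hjN => ?_, ?_⟩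
  · nlinarith
  · have hj0 : (j : ZMod (N+1)) ≠ 0 := by
      intro h; rw [ZMod.natCast_eq_zero_iff] at h
      have := Nat.le_of_dvd (by omega) h; omega
    have h1 : E 0 + E j ≤ 1 := by
      refine le_trans ?_ E1
      rw [← Finset.sum_pair hj0.symm]
      exact Finset.sum_le_sum_of_subset_of_nonneg (Finset.subset_univ _) fun i _ _ => E0 i
    have h2 : tr τ (E 0 * E j) ≤ tr τ (E 0 - E 0 * E 0) := by
      have := tr_mul_mono hτ (E0 0) (show E j ≤ 1 - E 0 from by rw [le_sub_iff_add_le, add_comm]; exact h1)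
      rwa [mul_sub, mul_one] at this
    have h3 : tr τ (E 0 * (β ^ j) (E 0)) = tr τ (E 0 * E j) + tr τ (E 0 * ((β ^ j) (E 0) - E j)) := by
      rw [mul_sub, tr_sub]; ring
    have h4 := le_trans (le_abs_self _) (cs' hτ (E 0) ((β ^ j) (E 0) - E j))
    have h5 : n2 τ (E 0) * n2 τ ((β ^ j) (E 0) - E j) ≤ 1 * (N * η) := by
      apply mul_le_mul hE0n ((D3 j).trans _) (n2_nonneg _) (by norm_num)
      apply mul_le_mul_of_nonneg_right _ hη0.le; exact_mod_cast hjN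
    have : (N:ℝ) * η ≤ (N+1)^2 * η := mul_le_mul_of_nonneg_right (by nlinarith [show (0:ℝ) ≤ N by positivity]) hη0.le
    rw [h3]; nlinarith
  · have h1 : ∀ j : ZMod (N+1), tr τ (E j) ≤ tr τ (E 0) + N * η := by
      intro j
      have hj : ((j.val : ℕ) : ZMod (N+1)) = j := ZMod.natCast_zmod_val j
      have h2 := D3 j.val
      rw [hj] at h2
      have h3 := abs_tr_le_n2 hτ ((β ^ j.val) (E 0) - E j)
      rw [tr_sub, G.inv] at h3
      have h4 : (j.val : ℝ) ≤ N := by have := ZMod.val_lt j; exact_mod_cast Nat.lt_succ_iff.1 this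
      have := abs_le.1 h3
      nlinarith
    have h2 := Finset.sum_le_sum fun j (_ : j ∈ Finset.univ) => h1 j
    rw [← tr_sum, Finset.sum_const, Finset.card_univ, ZMod.card, nsmul_eq_mul] at h2
    push_cast at h2
    have : ((N:ℝ)+1) * (N * η) ≤ (N+1)^2 * η := by nlinarith [show (0:ℝ) ≤ N by positivity]
    nlinarith
end
end RK

namespace RK
set_option linter.all false

section
variable {A : Type*} [CStarAlgebra A] [PartialOrder A] [StarOrderedRing A] {τ : A →ₗ[ℂ] ℂ}

theorem tr_conj (hτ : IsTracialState τ) {U x : A} (hU : U ∈ unitary A) : tr τ (U * x * star U) = tr τ x := by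
  rw [tr_comm hτ, ← mul_assoc, (Unitary.mem_iff.1 hU).1, one_mul]

theorem tr_algMap (hτ : IsTracialState τ) (c : ℝ) : tr τ (algebraMap ℝ A c) = c := by
  rw [Algebra.algebraMap_eq_smul_one, tr_smul, tr_one hτ, mul_one]

theorem tr_proj_le (hτ : IsTracialState τ) {P x : A} (hP : IsProjection P) (hx : 0 ≤ x) : tr τ (P * x * P) ≤ tr τ x := by
  rw [tr_comm hτ, ← mul_assoc, hP.mm, tr_comm hτ]
  have := tr_mul_mono hτ hx hP.le_one
  rwa [mul_one] at this

set_option maxHeartbeats 2000000 in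
theorem scut (G : Good τ) {β : A ≃⋆ₐ[ℂ] A} (hU : PUO β) {μ : ℝ} (hμ : 0 < μ) :
    ∃ D > 0, ∀ (q X : A), IsProjection q → 0 ≤ X → X ≤ q → ∀ η > 0, ∃ b, IsProjection b ∧ b * q = b ∧ q * b = b ∧
      ‖b * X * b‖ ≤ μ ∧ tr τ q - tr τ X - D * tr τ (X - X * X) - η ≤ tr τ b := by
  classical
  have hτ := G.htr
  set s : ℝ := min (μ/10) (1/48) with hs
  have hs0 : 0 < s := by positivity
  have hs1 : s ≤ μ/10 := min_le_left _ _
  have hs2 : s ≤ 1/48 := min_le_right _ _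
  set δ : ℝ := s^2/2 with hδ
  have hδ0 : 0 < δ := by positivity
  have hδ1 : δ ≤ 1 := by nlinarith
  refine ⟨1/δ, by positivity, fun q X hq hX0 hXq η hη => ?_⟩
  set D := 1/δ with hD
  have hD0 : 0 < D := by positivity
  have hDδ : D * δ = 1 := by rw [hD]; field_simp
  set ε : ℝ := min (δ/2) (η / (4 + 8 * D) / 2) with hε
  have hε0 : 0 < ε := by positivity
  have hε1 : ε ≤ δ/2 := min_le_left _ _
  have hε2 : ε * (4 + 8 * D) ≤ η/2 := by
    have := min_le_right (δ/2) (η / (4 + 8 * D) / 2)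
    rw [← hε] at this
    calc ε * (4 + 8 * D) ≤ (η / (4 + 8 * D) / 2) * (4 + 8 * D) := mul_le_mul_of_nonneg_right this (by positivity)
      _ = η/2 := by field_simp
  have hXs : star X = X := (IsSelfAdjoint.of_nonneg hX0).star_eq
  have hX1 : X ≤ 1 := hXq.trans hq.le_one
  obtain ⟨hqX, hXq'⟩ : q * X = X ∧ X * q = X := by
    exact hered hq hX0 (c := 1) (by simpa using hXq)
  set Z := X + (1 - q) with hZ
  have hZs : star Z = Z := by rw [hZ, star_add, hXs, hq.one_sub.st]
  have hZ0 : 0 ≤ Z := add_nonneg hX0 hq.one_sub.nonneg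
  have hZ1 : Z ≤ 1 := by rw [hZ]; have := add_le_add_left hXq (1 - q); rwa [add_sub_cancel] at this
  have hZZ : Z - Z * Z = X - X * X := by
    have a1 : X * (1 - q) = 0 := by rw [mul_sub, mul_one, hXq', sub_self]
    have a2 : (1 - q) * X = 0 := by rw [sub_mul, one_mul, hqX, sub_self]
    rw [hZ, add_mul, mul_add, mul_add, a1, a2, hq.one_sub.mm]; abel
  have hZn : ‖Z‖ ≤ 1 := norm_le_one' hZ0 hZ1
  obtain ⟨n, m, m1, m2, m3, -, -, -, -⟩ := tr0_mus G hU {Z} (ε := ε) (δ := η/2) hε0 (by positivity) proj_one (proj_ne G)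
  have hP := m.unit_proj
  set P := m.unit
  have m1' := m1 Z (by simp)
  obtain ⟨b0, hb0, hb1⟩ := m2 Z (by simp)
  obtain ⟨b, hb, hbs, hbd⟩ := sym_mem m.alg (b := b0) hb0 (h := P * Z * P) (by simp [hP.st, hZs, mul_assoc]) hb1
  haveI := m.fd
  haveI : Nontrivial A := ⟨1, 0, proj_ne G⟩
  have cont : ∀ f : ℝ → ℝ, ContinuousOn f (spectrum ℝ b) := fd_cont m.alg hb
  have hPb : P * b = b := m.unit_mul hb
  have hbP : b * P = b := m.mul_unit hb
  have hPZs : IsSelfAdjoint (P * Z * P - b) := by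
    refine IsSelfAdjoint.sub ?_ hbs
    rw [IsSelfAdjoint, star_mul, star_mul, hP.st, hZs, mul_assoc]
  obtain ⟨s2, s1⟩ := sa_bounds hPZs hbd.le
  have hPZ0 : 0 ≤ P * Z * P := by have := conj_nonneg' P hZ0; rwa [hP.st] at this
  have hPZn : ‖P * Z * P‖ ≤ 1 := by simpa using nmul_le (nmul_le hP.norm_le hZn) hP.norm_le
  have hPZ1 : P * Z * P ≤ 1 := (CStarAlgebra.norm_le_one_iff_of_nonneg _ hPZ0).1 hPZn
  have sp : ∀ t ∈ spectrum ℝ b, -ε ≤ t ∧ t ≤ 1 + ε := by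
    intro t ht
    constructor
    · have : algebraMap ℝ A (-ε) ≤ b := by
        rw [map_neg]
        have h1 : P * Z * P - b ≤ algebraMap ℝ A ε := s2
        have h2 : P * Z * P - algebraMap ℝ A ε ≤ b := by
          rw [sub_le_comm]; exact h1
        refine le_trans ?_ h2
        rw [sub_eq_add_neg]; exact le_add_of_nonneg_left hPZ0
      exact (algebraMap_le_iff_le_spectrum (a := b) (ha := hbs)).1 this t ht
    · have : b ≤ algebraMap ℝ A (1 + ε) := by
        rw [map_add, map_one]
        have h1 : b ≤ P * Z * P + algebraMap ℝ A ε := by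
          have := neg_le_neg s1
          rw [neg_neg, neg_sub] at this
          rw [add_comm]; exact sub_le_iff_le_add.1 this
        exact h1.trans (add_le_add_left hPZ1 _)
      exact (le_algebraMap_iff_spectrum_le (a := b) (ha := hbs)).1 this t ht
  set f : ℝ → ℝ := fun t => if t ∈ Set.Ioi δ then (1:ℝ) else 0 with hf
  set g := cfc f b with hg
  have hgp : IsProjection g := fd_specproj m.alg hb hbs (Set.Ioi δ)
  have hgm : g ∈ m.alg := fd_cfc_mem m.alg hb (by simp [hf]; linarith)
  have hPg : P * g = g := m.unit_mul hgm
  have hgP : g * P = g := m.mul_unit hgm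
  have hgle : g ≤ b + D • (b - b * b) + algebraMap ℝ A (ε + 3 * D * ε) := by
    have e1 : b + D • (b - b * b) + algebraMap ℝ A (ε + 3 * D * ε) = cfc (fun t : ℝ => t + D • (t - t * t) + (ε + 3 * D * ε)) b := by
      rw [cfc_add b (fun t : ℝ => t + D • (t - t * t)) (fun _ => ε + 3 * D * ε) (cont _) (cont _), cfc_add b (fun t : ℝ => t) (fun t => D • (t - t * t)) (cont _) (cont _), cfc_smul D (fun t : ℝ => t - t * t) b (cont _), cfc_sub (fun t : ℝ => t) (fun t => t * t) b (cont _) (cont _), cfc_mul (fun t : ℝ => t) (fun t => t) b (cont _) (cont _), cfc_id' ℝ b, cfc_const _ b]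
    rw [e1]
    apply cfc_mono _ (cont _) (cont _)
    intro t ht
    obtain ⟨t1, t2⟩ := sp t ht
    simp only [hf, Set.mem_Ioi, smul_eq_mul]
    have hDε : 0 < D * ε := by positivity
    split_ifs with h
    · rcases le_total t 1 with h1 | h1
      · have a1 : 1 ≤ D * t := by nlinarith
        nlinarith
      · have a1 : t * (t - 1) ≤ 2 * ε := by nlinarith
        nlinarith
    · rcases le_total 0 t with h1 | h1
      · nlinarith [mul_nonneg hD0.le (mul_nonneg h1 (by linarith : 0 ≤ 1 - t))]
      · have a1 : -(3 * ε) ≤ t - t * t := by nlinarith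
        nlinarith
  -- trace estimates
  have tb : tr τ b ≤ tr τ Z + ε := by
    have h1 := abs_le.1 ((tr_diff hτ (P * Z * P) b).trans hbd.le)
    have h2 := tr_proj_le hτ hP hZ0
    linarith
  have tbb : tr τ (b - b * b) ≤ tr τ (X - X * X) + 5 * ε := by
    have e1 : P * (Z - Z * Z) * P - (b - b * b) = (P * Z * P - b) - (P * Z * P - b) * (P * Z * P) - b * (P * Z * P - b)
        + P * (Z * P - P * Z) * (Z * P) := by
      have : P * (Z * P - P * Z) * (Z * P) = P * Z * P * (Z * P) - P * Z * (Z * P) := by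
        rw [mul_sub, sub_mul, ← mul_assoc P P Z, hP.mm]; simp only [mul_assoc]
      have h3 : P * Z * P * (P * Z * P) = P * Z * P * (Z * P) := by
        rw [mul_assoc (P * Z) P, ← mul_assoc P (P * Z) P, ← mul_assoc P P Z, hP.mm]; simp only [mul_assoc]
      rw [this]
      simp only [mul_sub, sub_mul]
      rw [h3]; simp only [mul_assoc]; abel
    have hbn : ‖b‖ ≤ 1 + ε := by
      have := norm_sub_le (P * Z * P) (P * Z * P - b)
      rw [sub_sub_cancel] at this; linarith
    have e2 : ‖P * (Z - Z * Z) * P - (b - b * b)‖ ≤ 4 * ε + ε * ε := by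
      rw [e1]
      have n1 := nmul_le hbd.le hPZn
      have n2 := nmul_le hbn hbd.le
      have n3 := nmul_le (nmul_le hP.norm_le m1'.le) (nmul_le hZn hP.norm_le)
      have a1 := norm_add_le ((P * Z * P - b) - (P * Z * P - b) * (P * Z * P) - b * (P * Z * P - b)) (P * (Z * P - P * Z) * (Z * P))
      have a2 := norm_sub_le ((P * Z * P - b) - (P * Z * P - b) * (P * Z * P)) (b * (P * Z * P - b))
      have a3 := norm_sub_le (P * Z * P - b) ((P * Z * P - b) * (P * Z * P))
      linarith
    have h1 := abs_le.1 ((tr_diff hτ _ _).trans e2)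
    have h2 := tr_proj_le hτ hP (sub_nonneg.2 (sq_le_self' hZ0 hZ1))
    rw [hZZ] at h1 h2
    have : ε * ε ≤ ε := by nlinarith
    linarith
  have tg : tr τ g ≤ tr τ Z + D * tr τ (X - X * X) + η / 2 := by
    have h1 := tr_mono hτ hgle
    rw [tr_add, tr_add, tr_smul, tr_algMap hτ] at h1
    have h3 := mul_le_mul_of_nonneg_left tbb hD0.le
    linarith
  set h := P - g with hh
  have hhp : IsProjection h := proj_sub hgp hP hgP
  have hPh : P * h = h := by rw [hh, mul_sub, hP.mm, hPg]
  have hhP : h * P = h := by rw [hh, sub_mul, hP.mm, hgP]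
  have hhb : ‖h * b * h‖ ≤ δ := by
    have c1 : g * b = cfc (fun t => f t * t) b := by
      rw [cfc_mul f (fun t => t) b (cont _) (cont _), cfc_id' ℝ b]
    have c2 : b * g = cfc (fun t => f t * t) b := by
      have : (fun t => f t * t) = fun t => t * f t := by funext t; ring
      rw [this, cfc_mul (fun t => t) f b (cont _) (cont _), cfc_id' ℝ b]
    have c3 : b * g = g * b := by rw [c1, c2]
    have c4 : h * b * h = b - g * b := by
      rw [hh, sub_mul, hPb, sub_mul, mul_sub, hbP, c3, mul_sub, mul_assoc g b P, hbP, mul_assoc g b g, c3, ← mul_assoc, hgp.mm]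
      abel
    have c5 : b - g * b = cfc (fun t => t - f t * t) b := by
      rw [cfc_sub (fun t => t) (fun t => f t * t) b (cont _) (cont _), cfc_id' ℝ b, c1]
    rw [c4, c5]
    refine norm_cfc_le hδ0.le fun t ht => ?_
    obtain ⟨t1, t2⟩ := sp t ht
    simp only [hf, Set.mem_Ioi, Real.norm_eq_abs]
    split_ifs with h
    · simp [hδ0.le]
    · rw [abs_le]; constructor <;> linarith
  have hhZ : ‖h * Z * h‖ ≤ s ^ 2 := by
    have e1 : h * Z * h = h * b * h + h * (P * Z * P - b) * h := by
      have : h * (P * Z * P) * h = h * Z * h := by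
        rw [← mul_assoc, ← mul_assoc, hhP, mul_assoc (h * Z), hPh]
      rw [mul_sub h (P * Z * P) b, sub_mul (h * (P * Z * P)) (h * b) h, this]; abel
    rw [e1]
    have n1 := nmul_le (nmul_le hhp.norm_le hbd.le) hhp.norm_le
    have n2 := norm_add_le (h * b * h) (h * (P * Z * P - b) * h)
    linarith
  have hqh : ‖h - q * h‖ ≤ s := by
    have e0 : (1 - q) * h = h - q * h := by rw [sub_mul, one_mul]
    rw [← e0]
    have e1 : ‖(1 - q) * h‖ * ‖(1 - q) * h‖ = ‖h * (1 - q) * h‖ := by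
      rw [← CStarRing.norm_star_mul_self, star_mul, hq.one_sub.st, hhp.st, mul_assoc, ← mul_assoc (1 - q), hq.one_sub.mm, mul_assoc]
    have e2 : ‖h * (1 - q) * h‖ ≤ ‖h * Z * h‖ := by
      refine CStarAlgebra.norm_le_norm_of_nonneg_of_le ?_ ?_
      · have := conj_nonneg' h hq.one_sub.nonneg; rwa [hhp.st] at this
      · have : (1 - q) ≤ Z := by rw [hZ]; exact le_add_of_nonneg_left hX0
        have := conj_mono h this; rwa [hhp.st] at this
    nlinarith [norm_nonneg ((1 - q) * h)]
  obtain ⟨b', hb', hb'1, hb'2, hb'3⟩ := near_sub hq hhp (by linarith) hqh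
  have hbs4 : 4 * s ≤ 1/12 := by linarith
  obtain ⟨U, hUu, -, hUb⟩ := close_unitary hb' hhp hbs4 hb'3
  have tb' : tr τ b' = tr τ h := by
    rw [← tr_conj hτ hUu (x := b'), hUb, mul_assoc, (Unitary.mem_iff.1 hUu).2, mul_one]
  refine ⟨b', hb', hb'1, hb'2, ?_, ?_⟩
  · have e1 : ‖b' * X * b'‖ ≤ ‖b' * Z * b'‖ := by
      refine CStarAlgebra.norm_le_norm_of_nonneg_of_le ?_ ?_
      · have := conj_nonneg' b' hX0; rwa [hb'.st] at this
      · have : X ≤ Z := by rw [hZ]; exact le_add_of_nonneg_right hq.one_sub.nonneg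
        have := conj_mono b' this; rwa [hb'.st] at this
    have e2 : b' * Z * b' = h * Z * h + (b' - h) * Z * b' + h * Z * (b' - h) := by
      simp only [sub_mul, mul_sub]; abel
    have n1 := nmul_le (nmul_le hb'3 hZn) hb'.norm_le
    have n2 := nmul_le (nmul_le hhp.norm_le hZn) hb'3
    have n3 := norm_add_le (h * Z * h + (b' - h) * Z * b') (h * Z * (b' - h))
    have n4 := norm_add_le (h * Z * h) ((b' - h) * Z * b')
    rw [← e2] at n3
    nlinarith
  · have th : tr τ h = tr τ P - tr τ g := by rw [hh, tr_sub]
    have tz : tr τ Z = tr τ X + (1 - tr τ q) := by rw [hZ, tr_add, tr_sub, tr_one hτ]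
    linarith
end
end RK

namespace RK
set_option linter.all false

section
variable {A : Type*} [CStarAlgebra A] [PartialOrder A] [StarOrderedRing A] {τ : A →ₗ[ℂ] ℂ}

theorem norm_sq_le {x : A} {t : ℝ} (ht : 0 ≤ t) (h : ‖star x * x‖ ≤ t ^ 2) : ‖x‖ ≤ t := by
  rw [CStarRing.norm_star_mul_self] at h
  nlinarith [norm_nonneg x]

theorem nn_sa {x : A} (h : 0 ≤ x) : star x = x := (IsSelfAdjoint.of_nonneg h).star_eq

theorem norm_mono {x y : A} (h0 : 0 ≤ x) (h : x ≤ y) : ‖x‖ ≤ ‖y‖ := CStarAlgebra.norm_le_norm_of_nonneg_of_le h0 h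

theorem blockcut (G : Good τ) {β : A ≃⋆ₐ[ℂ] A} (hU : PUO β) {t c : ℝ} (ht : 0 < t) (hc : 0 < c) (hc1 : c ≤ 1) :
    ∃ D0 > 0, ∀ (p E D : A), IsProjection p → 0 ≤ E → E ≤ p → 0 ≤ D → D ≤ E * E → ∀ η > 0, ∃ b, IsProjection b ∧
      b * p = b ∧ p * b = b ∧ ‖(p - E) * b‖ ≤ t ∧ (∀ z, c • (star z * z) ≤ D → ‖z * b‖ ≤ t) ∧
      tr τ (E * E) - tr τ D - D0 * (2 * tr τ (E - E * E) + tr τ D) - η ≤ tr τ b := by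
  have hτ := G.htr
  obtain ⟨D0, hD0, h⟩ := scut G hU (μ := c * t ^ 2) (by positivity)
  refine ⟨D0, hD0, fun p E D hp hE0 hEp hD0' hDE η hη => ?_⟩
  obtain ⟨hpE, hEp'⟩ : p * E = E ∧ E * p = E := hered hp hE0 (c := 1) (by simpa using hEp)
  have hE1 : E ≤ 1 := hEp.trans hp.le_one
  have hEE := sq_le_self' hE0 hE1
  have hEs := nn_sa hE0
  have hEE0 : 0 ≤ E * E := by have := star_mul_self_nonneg E; rwa [hEs] at this
  have hEEp : E * E ≤ p := hEE.trans hEp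
  set Q := p - E * E with hQ
  have hQ0 : 0 ≤ Q := sub_nonneg.2 hEEp
  have hX0 : 0 ≤ Q + D := add_nonneg hQ0 hD0'
  have hXp : Q + D ≤ p := by
    have := add_le_add_right hDE Q
    have e : Q + E * E = p := by rw [hQ, sub_add_cancel]
    rwa [e] at this
  obtain ⟨b, b1, b2, b3, b4, b5⟩ := h p (Q + D) hp hX0 hXp η hη
  have hbX : ∀ y, 0 ≤ y → y ≤ Q + D → ‖star b * y * b‖ ≤ c * t ^ 2 := fun y h0 hy => by
    refine (norm_mono ?_ (conj_mono b hy)).trans ?_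
    · have := conj_nonneg' (star b) h0; rwa [star_star] at this
    · rwa [b1.st]
  refine ⟨b, b1, b2, b3, ?_, ?_, ?_⟩
  · refine norm_sq_le ht.le ?_
    have hs : star (p - E) = p - E := by rw [star_sub, hp.st, hEs]
    have e1 : star ((p - E) * b) * ((p - E) * b) = star b * ((p - E) * (p - E)) * b := by
      rw [star_mul, hs]; simp only [mul_assoc]
    rw [e1]
    refine (hbX _ ?_ ?_).trans ?_
    · have := star_mul_self_nonneg (p - E); rwa [hs] at this
    · refine le_trans ?_ (le_add_of_nonneg_right hD0')
      rw [← sub_nonneg]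
      have : Q - (p - E) * (p - E) = (E - E * E) + (E - E * E) := by
        rw [hQ, mul_sub, sub_mul, sub_mul, hp.mm, hpE, hEp']; abel
      rw [this]
      exact add_nonneg (sub_nonneg.2 hEE) (sub_nonneg.2 hEE)
    · nlinarith [sq_nonneg t]
  · intro z hz
    refine norm_sq_le ht.le ?_
    have e1 : star (z * b) * (z * b) = star b * (star z * z) * b := by
      rw [star_mul]; simp only [mul_assoc]
    rw [e1]
    have h1 := hbX (c • (star z * z)) (smul_nonneg hc.le (star_mul_self_nonneg z)) (hz.trans (le_add_of_nonneg_left hQ0))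
    rw [mul_smul_comm, smul_mul_assoc, norm_smul, Real.norm_eq_abs, abs_of_pos hc] at h1
    exact le_of_mul_le_mul_left h1 hc
  · refine le_trans ?_ b5
    have t1 : tr τ p - tr τ (Q + D) = tr τ (E * E) - tr τ D := by
      rw [tr_add, hQ, tr_sub]; ring
    have t2 : tr τ (Q + D - (Q + D) * (Q + D)) ≤ 2 * tr τ (E - E * E) + tr τ D := by
      have e1 : Q - Q * Q = (E - E * E) * (E + E * E) := by
        have a1 : p * (E * E) = E * E := by rw [← mul_assoc, hpE]
        have a2 : (E * E) * p = E * E := by rw [mul_assoc, hEp']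
        have a3 : Q * Q = p - E * E - (E * E - E * E * (E * E)) := by
          rw [hQ, mul_sub, sub_mul, sub_mul, hp.mm, a1, a2]
        rw [a3, hQ, sub_mul, mul_add, mul_add]; simp only [mul_assoc]; abel
      have h1 : tr τ (Q - Q * Q) ≤ 2 * tr τ (E - E * E) := by
        rw [e1, tr_comm hτ (E - E * E)]
        refine (le_abs_self _).trans ((abs_tr_mul_le hτ _ _ (sub_nonneg.2 hEE)).trans ?_)
        refine mul_le_mul_of_nonneg_right ?_ (tr_nonneg hτ (sub_nonneg.2 hEE))
        have := norm_add_le E (E * E)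
        have n1 := norm_le_one' hE0 hE1
        have n2 := nmul_le n1 n1
        linarith
      have e2 : Q + D - (Q + D) * (Q + D) = (Q - Q * Q) + D - Q * D - D * Q - D * D := by
        rw [add_mul, mul_add, mul_add]; abel
      rw [e2, tr_sub, tr_sub, tr_sub, tr_add]
      have := tr_mul_nonneg hτ hQ0 hD0'
      have := tr_mul_nonneg hτ hD0' hQ0
      have := tr_mul_nonneg hτ hD0' hD0'
      linarith
    have := mul_le_mul_of_nonneg_left t2 hD0.le
    rw [t1]; linarith

theorem Ffacts (hτ : IsTracialState τ) {P E F : A} (hP : IsProjection P) (hE0 : 0 ≤ E) (hE1 : E ≤ 1) (hF0 : 0 ≤ F) (hF1 : F ≤ 1)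
    {s : ℝ} (h : ‖F - P * E‖ ≤ s) :
    tr τ (F - F * F) ≤ tr τ (E - E * E) + 3 * s ∧ tr τ E - (1 - tr τ P) - s ≤ tr τ F := by
  have hs := (norm_nonneg _).trans h
  have hEs := nn_sa hE0
  have hFs := nn_sa hF0
  have h' : ‖F - E * P‖ ≤ s := by
    rw [← norm_star]; simpa [hP.st, hEs, hFs] using h
  have nE := norm_le_one' hE0 hE1
  have nF := norm_le_one' hF0 hF1
  have a1 := abs_le.1 ((tr_diff hτ _ _).trans h)
  have e1 : F * F - E * P * E = F * (F - P * E) + (F - E * P) * (P * E) := by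
    have : E * P * (P * E) = E * P * E := by rw [← mul_assoc, mul_assoc E P P, hP.mm]
    rw [mul_sub, sub_mul, this]; abel
  have e2 : ‖F * F - E * P * E‖ ≤ 2 * s := by
    rw [e1]
    have := norm_add_le (F * (F - P * E)) ((F - E * P) * (P * E))
    have := nmul_le nF h
    have := nmul_le h' (nmul_le hP.norm_le nE)
    linarith
  have a2 := abs_le.1 ((tr_diff hτ _ _).trans e2)
  have a3 : tr τ (P * (E - E * E)) ≤ tr τ (E - E * E) := by
    have := tr_mul_mono hτ (sub_nonneg.2 (sq_le_self' hE0 hE1)) hP.le_one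
    rwa [mul_one, tr_comm hτ] at this
  have a4 : tr τ (E * P * E) = tr τ (P * (E * E)) := by rw [mul_assoc, tr_comm hτ, mul_assoc]
  rw [mul_sub, tr_sub] at a3
  have a5 : tr τ ((1 - P) * E) ≤ 1 - tr τ P := by
    have := tr_mul_mono hτ hP.one_sub.nonneg hE1
    rwa [mul_one, tr_sub, tr_one hτ] at this
  rw [sub_mul, one_mul, tr_sub] at a5
  constructor
  · rw [tr_sub]; linarith
  · linarith

theorem Foverlap (G : Good τ) (γ : A ≃⋆ₐ[ℂ] A) {P E F : A} (hP : IsProjection P) (hE0 : 0 ≤ E) (hE1 : E ≤ 1) (hF0 : 0 ≤ F) (hF1 : F ≤ 1)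
    {s : ℝ} (h : ‖F - P * E‖ ≤ s) : n2 τ (γ F * F) ≤ 2 * s + Real.sqrt (tr τ (E * γ E)) := by
  have hτ := G.htr
  have hEs := nn_sa hE0
  have hFs := nn_sa hF0
  have h' : ‖F - E * P‖ ≤ s := by
    rw [← norm_star]; simpa [hP.st, hEs, hFs] using h
  have nE := norm_le_one' hE0 hE1
  have nF := norm_le_one' hF0 hF1
  have e1 : γ F * F = (γ F * (F - E * P) + γ (F - P * E) * (E * P)) + γ P * (γ E * E) * P := by
    rw [map_sub, map_mul, mul_sub, sub_mul]; simp only [mul_assoc]; abel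
  have n1 : n2 τ (γ F * (F - E * P) + γ (F - P * E) * (E * P)) ≤ 2 * s := by
    refine (n2_le_norm hτ _).trans ?_
    have a1 : ‖γ F‖ ≤ 1 := by rw [nA]; exact nF
    have a2 : ‖γ (F - P * E)‖ ≤ s := by rw [nA]; exact h
    have := norm_add_le (γ F * (F - E * P)) (γ (F - P * E) * (E * P))
    have := nmul_le a1 h'
    have := nmul_le a2 (nmul_le nE hP.norm_le)
    linarith
  have n3 : n2 τ (γ P * (γ E * E) * P) ≤ n2 τ (γ E * E) := by
    refine (n2_mul_right hτ _ _).trans ((mul_le_of_le_one_right (n2_nonneg _) hP.norm_le).trans ?_)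
    refine (n2_mul_left hτ _ _).trans (mul_le_of_le_one_left (n2_nonneg _) ?_)
    rw [nA]; exact hP.norm_le
  have n4 : n2 τ (γ E * E) ≤ Real.sqrt (tr τ (E * γ E)) := by
    refine Real.sqrt_le_sqrt ?_
    have hγs : star (γ E) = γ E := by rw [← map_star, hEs]
    have hγE := aut_nonneg γ hE0
    have hγE1 : γ E ≤ 1 := by have := aut_mono γ hE1; rwa [map_one] at this
    have e2 : tr τ (star (γ E * E) * (γ E * E)) = tr τ (E * E * (γ E * γ E)) := by
      rw [star_mul, hEs, hγs, tr_comm hτ, tr_comm hτ (E * E)]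
      rw [tr_comm hτ, mul_assoc, tr_comm hτ]; simp only [mul_assoc]
    have hEE0 : 0 ≤ E * E := by have := star_mul_self_nonneg E; rwa [hEs] at this
    rw [e2]
    refine (tr_mul_mono hτ hEE0 (sq_le_self' hγE hγE1)).trans ?_
    rw [tr_comm hτ, tr_comm hτ E]
    exact tr_mul_mono hτ hγE (sq_le_self' hE0 hE1)
  rw [e1]
  have := n2_add hτ (γ F * (F - E * P) + γ (F - P * E) * (E * P)) (γ P * (γ E * E) * P)
  linarith
end

namespace MUS
section
variable {A : Type*} [CStarAlgebra A] [PartialOrder A] [StarOrderedRing A] {ι : Type} [Fintype ι] [DecidableEq ι] (m : MUS A ι)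
/-- restrict a system of matrix units to subprojections -/
noncomputable def sub (b : ι → A) (hb : ∀ k, IsProjection (b k)) (h : ∀ k, m.π k * b k = b k) : MUS A ι where
  v := fun x => m.v x * b (m.r x)
  r := m.r
  π := b
  pp := hb
  h1 := fun x => by
    rw [star_mul, (hb _).st, mul_assoc, ← mul_assoc (star (m.v x)), m.h1, h, (hb _).mm]
  h2 := fun x y hxy => by
    rw [star_mul, mul_assoc, ← mul_assoc (star (m.v x)), m.h2 x y hxy, zero_mul, mul_zero]
end
section
variable {A : Type*} [CStarAlgebra A] [PartialOrder A] [StarOrderedRing A] {ι : Type} [Fintype ι] [DecidableEq ι] (m : MUS A ι)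
theorem sub_unit {b : ι → A} (hb : ∀ k, IsProjection (b k)) (h : ∀ k, m.π k * b k = b k) : (m.sub b hb h).unit = m.amp b := by
  simp only [unit, amp, sub]
  refine Finset.sum_congr rfl fun x _ => ?_
  rw [star_mul, (hb _).st, mul_assoc, ← mul_assoc (b _) (b _), (hb _).mm, mul_assoc]
theorem sub_mem {b : ι → A} (hb : ∀ k, IsProjection (b k)) (h : ∀ k, m.π k * b k = b k) {x : A} (hx : x ∈ m.Sp) :
    m.amp b * x * m.amp b ∈ (m.sub b hb h).Sp := by
  have h2 : ∀ k, b k * m.π k = b k := fun k => by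
    have := congrArg star (h k); rwa [star_mul, (hb k).st, (m.pp k).st] at this
  induction hx using Submodule.span_induction with
  | mem z hz =>
    obtain ⟨x, y, hxy, rfl⟩ := hz
    have : m.amp b * (m.v x * star (m.v y)) * m.amp b = (m.sub b hb h).v x * star ((m.sub b hb h).v y) := by
      rw [← mul_assoc, m.amp_v h h2, mul_assoc (m.v x * _), m.v_amp h]
      simp only [sub, star_mul, (hb _).st]
    rw [this]; exact vv_mem _ hxy
  | zero => simp
  | add a b _ _ ha hb => rw [mul_add, add_mul]; exact add_mem ha hb
  | smul c a _ ha => rw [mul_smul_comm, smul_mul_assoc]; exact Submodule.smul_mem _ _ ha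
theorem tr_v {τ : A →ₗ[ℂ] ℂ} (hτ : IsTracialState τ) {x : ι} {y : A} (h : m.π (m.r x) * y = y) : tr τ (m.v x * y * star (m.v x)) = tr τ y := by
  rw [tr_comm hτ, ← mul_assoc, m.h1, h]
theorem tr_amp {τ : A →ₗ[ℂ] ℂ} (hτ : IsTracialState τ) {Q : ι → A} (h : ∀ k, m.π k * Q k = Q k) :
    tr τ (m.amp Q) = ∑ x, tr τ (Q (m.r x)) := by
  rw [amp, tr_sum]; exact Finset.sum_congr rfl fun x _ => m.tr_v hτ (h _)
end
end MUS
end RK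

namespace RK
set_option linter.all false

section
variable {A : Type*} [CStarAlgebra A] [PartialOrder A] [StarOrderedRing A] {τ : A →ₗ[ℂ] ℂ} {ι : Type} [Fintype ι] [DecidableEq ι]

theorem MUS.amp_norm (m : MUS A ι) {Q : ι → A} (x : A) {t : ℝ} (h : ∀ a, ‖x * (m.v a * Q (m.r a))‖ ≤ t) : ‖x * m.amp Q‖ ≤ Fintype.card ι * t := by
  rw [MUS.amp, Finset.mul_sum]
  refine (norm_sum_le _ _).trans ?_
  have : ∀ a ∈ (Finset.univ : Finset ι), ‖x * (m.v a * Q (m.r a) * star (m.v a))‖ ≤ t := fun a _ => by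
    rw [← mul_assoc]
    have := nmul_le (h a) (by rw [norm_star]; exact m.v_norm a : ‖star (m.v a)‖ ≤ 1)
    rwa [mul_one] at this
  have := Finset.sum_le_card_nsmul _ _ _ this
  simpa using this

set_option maxHeartbeats 1000000 in
theorem OTm (G : Good τ) {β : A ≃⋆ₐ[ℂ] A} (hU : PUO β) (N : ℕ) (m : MUS A ι) {t η : ℝ} (ht : 0 < t) (hη : 0 < η) :
    ∃ b : ι → A, (∀ k, IsProjection (b k)) ∧ (∀ k, m.π k * b k = b k) ∧
      (∀ j, 1 ≤ j → j ≤ N → ‖(β ^ j) (m.amp b) * m.amp b‖ ≤ 3 * Fintype.card ι * t) ∧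
      1 - (N + 1) * (1 - tr τ m.unit) - η ≤ (N + 1) * tr τ (m.amp b) := by
  classical
  have hτ := G.htr
  set n : ℝ := (Fintype.card ι : ℝ) with hn
  have hn0 : 0 ≤ n := by positivity
  set c : ℝ := 1 / (n * N + 1) with hc
  have hc0 : 0 < c := by positivity
  have hc1 : c ≤ 1 := by rw [hc, div_le_one (by positivity)]; nlinarith [mul_nonneg hn0 (Nat.cast_nonneg (α := ℝ) N)]
  have hcn : c * (n * N) ≤ 1 := by rw [hc, div_mul_eq_mul_div, div_le_one (by positivity)]; linarith
  obtain ⟨D0, hD0, hbc⟩ := blockcut G hU ht hc0 hc1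
  set K : ℝ := 1 + (N + 1) * (4 * n + 1 + n * ((2 * n + 1) ^ 2 + D0 * (2 + 6 * n + (2 * n + 1) ^ 2) + 1)) with hK
  have hK0 : 0 < K := by positivity
  set δ : ℝ := min 1 (η / K) with hδ
  have hδ0 : 0 < δ := by positivity
  have hδ1 : δ ≤ 1 := min_le_left _ _
  have hδK : δ * K ≤ η := by
    have := min_le_right 1 (η / K)
    rw [← hδ, le_div_iff₀ hK0] at this; exact this
  obtain ⟨E, hE0, hE1, hEc, hE2, hE3, hE4⟩ := two_norm_R G hU N
    (Finset.univ.image m.v ∪ Finset.univ.image (fun x => star (m.v x))) hδ0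
  have hEs := nn_sa hE0
  set e : ι → A := fun k => m.π k * E * m.π k with he
  have he0 : ∀ k, 0 ≤ e k := fun k => by
    have := conj_nonneg' (m.π k) hE0; rwa [(m.pp k).st] at this
  have hep : ∀ k, e k ≤ m.π k := fun k => by
    have := conj_mono (m.π k) hE1; rwa [(m.pp k).st, mul_one, (m.pp k).mm] at this
  have hes : ∀ k, star (e k) = e k := fun k => nn_sa (he0 k)
  have pe : ∀ k, m.π k * e k = e k := fun k => by simp only [he]; rw [← mul_assoc, ← mul_assoc, (m.pp k).mm]
  have ep : ∀ k, e k * m.π k = e k := fun k => by simp only [he]; rw [mul_assoc, (m.pp k).mm]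
  have hee0 : ∀ k, 0 ≤ e k * e k := fun k => by have := star_mul_self_nonneg (e k); rwa [hes] at this
  have pee : ∀ k, m.π k * (e k * e k) = e k * e k := fun k => by rw [← mul_assoc, pe]
  set F := m.amp e with hF
  have hFv : ∀ x, F * m.v x = m.v x * e (m.r x) := fun x => m.amp_v pe ep x
  have hFe : F = ∑ x, m.v x * E * star (m.v x) := by
    rw [hF, MUS.amp]; refine Finset.sum_congr rfl fun x _ => ?_
    simp only [he]; rw [← mul_assoc, ← mul_assoc, m.vpi, mul_assoc (m.v x * E), m.pivs]
  have hF0 : 0 ≤ F := by rw [hFe]; exact Finset.sum_nonneg fun x _ => conj_nonneg' _ hE0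
  have hFs := nn_sa hF0
  have hF1 : F ≤ 1 := by
    refine le_trans ?_ m.unit_proj.le_one
    rw [hFe, MUS.unit]
    refine Finset.sum_le_sum fun x _ => ?_
    have := conj_mono (star (m.v x)) hE1
    rwa [star_star, mul_one] at this
  have hFP : ‖F - m.unit * E‖ ≤ n * δ := by
    have : F - m.unit * E = ∑ x, m.v x * (E * star (m.v x) - star (m.v x) * E) := by
      rw [hFe, MUS.unit, Finset.sum_mul, ← Finset.sum_sub_distrib]
      refine Finset.sum_congr rfl fun x _ => ?_
      rw [mul_sub]; simp only [mul_assoc]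
    rw [this]
    refine (norm_sum_le _ _).trans ?_
    have h1 : ∀ x ∈ (Finset.univ : Finset ι), ‖m.v x * (E * star (m.v x) - star (m.v x) * E)‖ ≤ δ := fun x _ => by
      have := hEc (star (m.v x)) (by simp)
      have h2 : ‖E * star (m.v x) - star (m.v x) * E‖ ≤ δ := by rw [norm_sub_rev]; exact this
      have := nmul_le (m.v_norm x) h2
      rwa [one_mul] at this
    have := Finset.sum_le_card_nsmul _ _ _ h1
    simpa using this
  obtain ⟨f1, f2⟩ := Ffacts hτ m.unit_proj hE0 hE1 hF0 hF1 hFP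
  set s := n * δ with hs
  have hs0 : 0 ≤ s := by positivity
  set κ : ℝ := (2 * n + 1) ^ 2 * δ with hκ
  have hov : ∀ j, 1 ≤ j → j ≤ N → n2 τ ((β ^ j) F * F) ^ 2 ≤ κ := fun j h1 h2 => by
    have h3 := Foverlap G (β ^ j) m.unit_proj hE0 hE1 hF0 hF1 hFP
    have h4 : Real.sqrt (tr τ (E * (β ^ j) E)) ≤ Real.sqrt δ := Real.sqrt_le_sqrt (hE3 j h1 h2).le
    have h5 : δ ≤ Real.sqrt δ := by
      rw [Real.le_sqrt hδ0.le hδ0.le]; nlinarith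
    have h6 : n2 τ ((β ^ j) F * F) ≤ (2 * n + 1) * Real.sqrt δ := by
      have := mul_le_mul_of_nonneg_left h5 hn0
      rw [hs] at h3; linarith
    have h7 := pow_le_pow_left₀ (n2_nonneg _) h6 2
    rwa [mul_pow, Real.sq_sqrt hδ0.le] at h7
  have hκ0 : 0 ≤ κ := by positivity
  let z : ι → ℕ → A := fun x j => (β ^ j) F * (m.v x * e (m.r x))
  have hz1 : ∀ x j, star (z x j) * z x j ≤ e (m.r x) * e (m.r x) := fun x j => by
    have h1 : (β ^ j) F * (β ^ j) F ≤ 1 := by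
      have := (sq_le_self' hF0 hF1).trans hF1
      have := aut_mono (β ^ j) this
      rwa [map_mul, map_one] at this
    have h2 := conj_mono (m.v x * e (m.r x)) h1
    have h3 : star (z x j) * z x j = star (m.v x * e (m.r x)) * ((β ^ j) F * (β ^ j) F) * (m.v x * e (m.r x)) := by
      simp only [z]; rw [star_mul, ← map_star, hFs]; simp only [mul_assoc]
    rw [h3]
    refine h2.trans (le_of_eq ?_)
    rw [mul_one, star_mul, hes, mul_assoc, ← mul_assoc (star (m.v x)), m.h1, pe]
  have hz2 : ∀ x j, 1 ≤ j → j ≤ N → tr τ (star (z x j) * z x j) ≤ κ := fun x j h1 h2 => by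
    rw [← n2_sq hτ]
    refine le_trans (pow_le_pow_left₀ (n2_nonneg _) ?_ 2) (hov j h1 h2)
    simp only [z]; rw [← hFv, ← mul_assoc]
    exact (n2_mul_right hτ _ _).trans (mul_le_of_le_one_right (n2_nonneg _) (m.v_norm x))
  let D : ι → A := fun k => ∑ x ∈ Finset.univ.filter (fun x => m.r x = k), ∑ j ∈ Finset.Icc 1 N, c • (star (z x j) * z x j)
  have hterm : ∀ x j, 0 ≤ c • (star (z x j) * z x j) := fun x j => smul_nonneg hc0.le (star_mul_self_nonneg _)
  have hD0' : ∀ k, 0 ≤ D k := fun k => Finset.sum_nonneg fun x _ => Finset.sum_nonneg fun j _ => hterm x j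
  have hcard : ∀ k, c * ((Finset.univ.filter (fun x => m.r x = k)).card * N : ℝ) ≤ 1 := fun k => by
    refine le_trans ?_ hcn
    have : ((Finset.univ.filter (fun x => m.r x = k)).card : ℝ) ≤ n := by rw [hn]; exact_mod_cast Finset.card_le_univ _
    gcongr
  have hDle : ∀ k, D k ≤ e k * e k := fun k => by
    have h1 : D k ≤ ∑ x ∈ Finset.univ.filter (fun x => m.r x = k), ∑ j ∈ Finset.Icc 1 N, c • (e k * e k) := by
      refine Finset.sum_le_sum fun x hx => Finset.sum_le_sum fun j _ => ?_
      have hx' : m.r x = k := (Finset.mem_filter.1 hx).2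
      have := hz1 x j
      rw [hx'] at this
      exact smul_le_smul_of_nonneg_left this hc0.le
    refine h1.trans ?_
    rw [Finset.sum_const, Finset.sum_const, Nat.card_Icc, Nat.add_sub_cancel, ← Nat.cast_smul_eq_nsmul ℝ, ← Nat.cast_smul_eq_nsmul ℝ, smul_smul, smul_smul]
    have h2 := smul_le_smul_of_nonneg_right (hcard k) (hee0 k)
    rw [one_smul] at h2
    refine le_trans (le_of_eq ?_) h2
    congr 1; ring
  have hDtr : ∀ k, tr τ (D k) ≤ κ := fun k => by
    simp only [D]
    rw [tr_sum]
    have h1 : ∑ x ∈ Finset.univ.filter (fun x => m.r x = k), tr τ (∑ j ∈ Finset.Icc 1 N, c • (star (z x j) * z x j)) ≤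
        ∑ x ∈ Finset.univ.filter (fun x => m.r x = k), ∑ j ∈ Finset.Icc 1 N, c * κ := by
      refine Finset.sum_le_sum fun x _ => ?_
      rw [tr_sum]
      refine Finset.sum_le_sum fun j hj => ?_
      rw [tr_smul]
      exact mul_le_mul_of_nonneg_left (hz2 x j (Finset.mem_Icc.1 hj).1 (Finset.mem_Icc.1 hj).2) hc0.le
    refine h1.trans ?_
    rw [Finset.sum_const, Finset.sum_const, Nat.card_Icc, Nat.add_sub_cancel, nsmul_eq_mul, nsmul_eq_mul]
    nlinarith [hcard k]
  choose b b1 b2 b3 b4 b5 b6 using fun k => hbc (m.π k) (e k) (D k) (m.pp k) (he0 k) (hep k) (hD0' k) (hDle k) δ hδ0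
  refine ⟨b, b1, b3, ?_, ?_⟩
  · intro j h1 h2
    have hqp := m.amp_proj b3 b1
    set q := m.amp b with hq
    have n1 : ‖(1 - F) * q‖ ≤ n * t := by
      refine m.amp_norm (1 - F) fun a => ?_
      have : (1 - F) * (m.v a * b (m.r a)) = m.v a * ((m.π (m.r a) - e (m.r a)) * b (m.r a)) := by
        rw [sub_mul, one_mul, ← mul_assoc, hFv, sub_mul, b3, mul_sub, mul_assoc]
      rw [this]
      have := nmul_le (m.v_norm a) (b4 (m.r a))
      rwa [one_mul] at this
    have n2 : ‖(β ^ j) F * F * q‖ ≤ n * t := by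
      refine m.amp_norm _ fun a => ?_
      have : (β ^ j) F * F * (m.v a * b (m.r a)) = z a j * b (m.r a) := by
        simp only [z]; rw [← mul_assoc, mul_assoc _ F, hFv]
      rw [this]
      refine b5 (m.r a) (z a j) ?_
      have s1 := Finset.single_le_sum (f := fun j => c • (star (z a j) * z a j)) (fun j _ => hterm a j) (Finset.mem_Icc.2 ⟨h1, h2⟩)
      have s2 := Finset.single_le_sum (f := fun x => ∑ j ∈ Finset.Icc 1 N, c • (star (z x j) * z x j))
        (s := Finset.univ.filter (fun x => m.r x = m.r a))
        (fun x _ => Finset.sum_nonneg fun j _ => hterm x j) (Finset.mem_filter.2 ⟨Finset.mem_univ a, rfl⟩)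
      exact s1.trans s2
    have n1' : ‖(β ^ j) (q * (1 - F))‖ ≤ n * t := by
      rw [nA, ← norm_star, star_mul, hqp.st, star_sub, star_one, hFs]; exact n1
    have nq : ‖(β ^ j) q‖ ≤ 1 := by rw [nA]; exact hqp.norm_le
    have e1 : (β ^ j) q * q = (β ^ j) q * ((1 - F) * q) + (β ^ j) (q * (1 - F)) * (F * q) + (β ^ j) q * ((β ^ j) F * F * q) := by
      simp only [map_mul, map_sub, map_one, sub_mul, mul_sub, one_mul, mul_one, mul_assoc]; abel
    have a1 := norm_add_le ((β ^ j) q * ((1 - F) * q) + (β ^ j) (q * (1 - F)) * (F * q)) ((β ^ j) q * ((β ^ j) F * F * q))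
    have a2 := norm_add_le ((β ^ j) q * ((1 - F) * q)) ((β ^ j) (q * (1 - F)) * (F * q))
    have c1 := nmul_le nq n1
    have c2 := nmul_le n1' (nmul_le (norm_le_one' hF0 hF1) hqp.norm_le)
    have c3 := nmul_le nq n2
    rw [e1]; linarith
  · have t1 : tr τ (m.amp b) = ∑ x, tr τ (b (m.r x)) := m.tr_amp hτ b3
    have t2 : tr τ (F * F) = ∑ x, tr τ (e (m.r x) * e (m.r x)) := by
      rw [hF, m.amp_mul pe, m.tr_amp hτ pee]
    have t3 : tr τ (F - F * F) = ∑ x, tr τ (e (m.r x) - e (m.r x) * e (m.r x)) := by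
      simp only [tr_sub]; rw [t2, Finset.sum_sub_distrib]
      congr 1
      exact m.tr_amp hτ pe
    have t4 : ∀ x, tr τ (e (m.r x) - e (m.r x) * e (m.r x)) ≤ δ + 3 * s := fun x => by
      refine le_trans ?_ (f1.trans (by linarith))
      rw [t3]
      exact Finset.single_le_sum (f := fun x => tr τ (e (m.r x) - e (m.r x) * e (m.r x)))
        (fun x _ => tr_nonneg hτ (sub_nonneg.2 (sq_le_self' (he0 _) ((hep _).trans (m.pp _).le_one)))) (Finset.mem_univ x)
    have t5 : tr τ (F * F) - n * (κ + D0 * (2 * (δ + 3 * s) + κ) + δ) ≤ tr τ (m.amp b) := by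
      rw [t1, t2]
      have : ∑ x : ι, (tr τ (e (m.r x) * e (m.r x)) - (κ + D0 * (2 * (δ + 3 * s) + κ) + δ)) ≤ ∑ x, tr τ (b (m.r x)) := by
        refine Finset.sum_le_sum fun x _ => ?_
        have h1 := b6 (m.r x)
        have h2 := t4 x
        have h3 := hDtr (m.r x)
        have h4 := mul_le_mul_of_nonneg_left (by linarith : 2 * tr τ (e (m.r x) - e (m.r x) * e (m.r x)) + tr τ (D (m.r x)) ≤ 2 * (δ + 3 * s) + κ) hD0.le
        linarith
      rw [Finset.sum_sub_distrib, Finset.sum_const, nsmul_eq_mul, Finset.card_univ] at this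
      exact this
    have t6 : tr τ (F * F) = tr τ F - tr τ (F - F * F) := by rw [tr_sub]; ring
    have t7 : tr τ E - (1 - tr τ m.unit) - δ * (4 * n + 1 + n * ((2 * n + 1) ^ 2 + D0 * (2 + 6 * n + (2 * n + 1) ^ 2) + 1)) ≤ tr τ (m.amp b) := by
      have : s + (δ + 3 * s) + n * (κ + D0 * (2 * (δ + 3 * s) + κ) + δ) = δ * (4 * n + 1 + n * ((2 * n + 1) ^ 2 + D0 * (2 + 6 * n + (2 * n + 1) ^ 2) + 1)) := by
        rw [hs, hκ]; ring
      linarith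
    have t8 := mul_le_mul_of_nonneg_left t7 (by positivity : (0:ℝ) ≤ N + 1)
    rw [hK] at hδK
    have t9 : δ * (1 + (N + 1) * (4 * n + 1 + n * ((2 * n + 1) ^ 2 + D0 * (2 + 6 * n + (2 * n + 1) ^ 2) + 1))) = δ + (N + 1) * (δ * (4 * n + 1 + n * ((2 * n + 1) ^ 2 + D0 * (2 + 6 * n + (2 * n + 1) ^ 2) + 1))) := by ring
    rw [t9] at hδK
    rw [mul_sub, mul_sub] at t8
    linarith
end
end RK

namespace RK
set_option linter.all false

section
variable {A : Type*} [CStarAlgebra A] [PartialOrder A] [StarOrderedRing A] {τ : A →ₗ[ℂ] ℂ}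

theorem OT (G : Good τ) {β : A ≃⋆ₐ[ℂ] A} (hU : PUO β) (N : ℕ) (Y : Finset A) {ε : ℝ} (hε : 0 < ε) :
    ∃ n, ∃ m : MUS A (Fin n), ∃ W ∈ unitary A, ∃ q : ℕ → A, ‖W - 1‖ < ε ∧ (∀ y ∈ Y, ‖y * m.unit - m.unit * y‖ < ε) ∧
      (∀ y ∈ Y, ∃ b ∈ m.Sp, ‖m.unit * y * m.unit - b‖ < ε) ∧ (∀ x, m.v x ∈ m.Sp) ∧ 1 - ε < (N + 1) * tr τ m.unit ∧
      q 0 = m.unit ∧ (∀ i, IsProjection (q i)) ∧ (∀ i ≤ N, ∀ j ≤ N, i ≠ j → q i * q j = 0) ∧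
      ∀ i < N, W * β (q i) * star W = q (i + 1) := by
  classical
  have hτ := G.htr
  set ε1 : ℝ := min 1 ε / (48 * (N + 1)) with hε1
  have hε10 : 0 < ε1 := by positivity
  have hN1 : ε1 * (48 * (N + 1)) = min 1 ε := by rw [hε1]; field_simp
  have hm1 : min 1 ε ≤ 1 := min_le_left _ _
  have hm2 : min 1 ε ≤ ε := min_le_right _ _
  obtain ⟨θ, hθ, hof⟩ := orth_family (A := A) N ε1 hε10
  obtain ⟨n, m, m1, m2, m3, -, -, -, m4⟩ := tr0_mus G hU Y (ε := ε/8) (δ := ε / (4 * (N + 1))) (by positivity) (by positivity) proj_one (proj_ne G)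
  obtain ⟨b, b1, b2, b3, b4⟩ := OTm G hU N m (t := θ / (3 * n + 1)) (η := ε / 4) (by positivity) (by positivity)
  have b2' : ∀ k, b k * m.π k = b k := fun k => by
    have := congrArg star (b2 k); rwa [star_mul, (b1 k).st, (m.pp k).st] at this
  have hp := m.amp_proj b2 b1
  have hu := m.sub_unit b1 b2
  set p := m.amp b with hpdef
  have hpu : m.unit * p = p := m.unit_amp b
  have hup : p * m.unit = p := m.amp_unit b
  have hov : ∀ j, 1 ≤ j → j ≤ N → ‖(β ^ j) p * p‖ ≤ θ := fun j h1 h2 => by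
    refine (b3 j h1 h2).trans ?_
    rw [Fintype.card_fin, mul_div_assoc', div_le_iff₀ (by positivity)]
    nlinarith
  obtain ⟨q, q1, q2, q3, q4⟩ := hof (fun i => (β ^ i) p) (fun i => aut_proj _ hp) (by
    have key : ∀ i j, i < j → j ≤ N → ‖(β ^ j) p * (β ^ i) p‖ ≤ θ := fun i j h1 h2 => by
      obtain ⟨k, rfl⟩ := Nat.exists_eq_add_of_lt h1
      rw [show i + k + 1 = i + (k + 1) by ring, pow_add_apply, ← map_mul, nA]
      exact hov _ (by omega) (by omega)
    intro i hi j hj hij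
    rcases lt_or_gt_of_ne hij with h | h
    · rw [← norm_star, star_mul, (aut_proj _ hp).st, (aut_proj _ hp).st]; exact key i j h hj
    · exact key j i h hi)
  have q2' : q 0 = p := by rw [q2]; simp
  obtain ⟨W, hW, hW1, hW2⟩ := fam_unitary (Finset.range N) (p := fun i => β (q i)) (q := fun i => q (i + 1)) (δ := 2 * ε1)
    (fun i _ => aut_proj _ (q1 i)) (fun i _ => q1 _)
    (fun i hi j hj hij => by
      rw [← map_mul, q3 i (Finset.mem_range.1 hi).le j (Finset.mem_range.1 hj).le hij, map_zero])
    (fun i hi j hj hij => q3 _ (Finset.mem_range.1 hi) _ (Finset.mem_range.1 hj) (by omega))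
    (fun i hi => by
      have hi' := Finset.mem_range.1 hi
      have e : β (q i) - q (i + 1) = β (q i - (β ^ i) p) - (q (i + 1) - (β ^ (i + 1)) p) := by
        rw [map_sub, pow_succ_apply]; abel
      rw [e]
      refine (norm_sub_le _ _).trans ?_
      rw [nA]
      have := q4 i hi'.le
      have := q4 (i + 1) hi'
      linarith)
    (by rw [Finset.card_range]; nlinarith)
  refine ⟨n, m.sub b b1 b2, W, hW, q, ?_, ?_, ?_, ?_, ?_, ?_, q1, q3, ?_⟩
  · refine hW1.trans_lt ?_
    rw [Finset.card_range]; nlinarith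
  · rw [hu]
    intro y hy
    obtain ⟨b', hb', hb''⟩ := m2 y hy
    have := comm_norm hpu hup (m.amp_comm b2 b2' hb') hp.norm_le (m1 y hy) hb''
    linarith
  · rw [hu]
    intro y hy
    obtain ⟨b', hb', hb''⟩ := m2 y hy
    refine ⟨p * b' * p, m.sub_mem b1 b2 hb', ?_⟩
    have e : p * y * p - p * b' * p = p * (m.unit * y * m.unit - b') * p := by
      rw [mul_sub, sub_mul]
      congr 1
      rw [← mul_assoc, ← mul_assoc, hup, mul_assoc (p * y), hpu]
    rw [e]
    have := nmul_le (nmul_le hp.norm_le hb''.le) hp.norm_le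
    linarith
  · intro x
    have h1 : p * m.v x * p = m.v x * b (m.r x) := by
      rw [mul_assoc, m.amp_comm b2 b2' (m4 x), ← mul_assoc, hp.mm, m.amp_v b2 b2']
    have := m.sub_mem b1 b2 (m4 x)
    rw [← hpdef, h1] at this
    exact this
  · rw [hu]
    have : (N + 1) * (1 - tr τ m.unit) ≤ ε/4 := by
      have := mul_le_mul_of_nonneg_left m3.le (by positivity : (0:ℝ) ≤ N + 1)
      have e : ((N:ℝ) + 1) * (ε / (4 * (N + 1))) = ε / 4 := by field_simp
      linarith
    linarith
  · rw [hu, q2']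
  · intro i hi
    have := hW2 i (Finset.mem_range.2 hi)
    rw [this, mul_assoc, (Unitary.mem_iff.1 hW).2, mul_one]
end
end RK

namespace RK
set_option linter.all false

theorem rotation (K : ℕ) (hK : 1 ≤ K) : ∃ c s : ℕ → ℝ, (∀ i, c i ^ 2 + s i ^ 2 = 1) ∧ c 0 = 0 ∧ s 0 = 1 ∧
    (∀ i, K ≤ i → c i = 1 ∧ s i = 0) ∧ (∀ i, |c (i + 1) - c i| ≤ 2 / K) ∧ (∀ i, |s (i + 1) - s i| ≤ 2 / K) := by
  have hK0 : (0:ℝ) < K := by exact_mod_cast hK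
  let θ : ℕ → ℝ := fun i => Real.pi / 2 * ((min i K : ℕ) : ℝ) / K
  have hθ : ∀ i, |θ (i + 1) - θ i| ≤ 2 / K := by
    intro i
    simp only [θ]
    rw [← sub_div, ← mul_sub, abs_div, abs_mul, abs_of_pos hK0, abs_of_pos (by positivity)]
    gcongr
    have h1 : |((min (i+1) K : ℕ) : ℝ) - ((min i K : ℕ) : ℝ)| ≤ 1 := by
      rcases le_or_gt K i with h | h
      · rw [min_eq_right h, min_eq_right (by omega)]; simp
      · rw [min_eq_left (by omega), min_eq_left (by omega)]; push_cast; simp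
    have := Real.pi_le_four
    have := Real.pi_pos
    nlinarith [abs_nonneg (((min (i+1) K : ℕ) : ℝ) - ((min i K : ℕ) : ℝ))]
  refine ⟨fun i => Real.sin (θ i), fun i => Real.cos (θ i), fun i => Real.sin_sq_add_cos_sq _, by simp [θ], by simp [θ], ?_, ?_, ?_⟩
  · intro i hi
    have : θ i = Real.pi / 2 := by simp only [θ]; rw [min_eq_right hi]; field_simp
    simp [this]
  · intro i; exact (Real.abs_sin_sub_sin_le _ _).trans (hθ i)
  · intro i; exact (Real.abs_cos_sub_cos_le _ _).trans (hθ i)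

section
variable {A : Type*} [CStarAlgebra A] [PartialOrder A] [StarOrderedRing A] {τ : A →ₗ[ℂ] ℂ}

theorem blk {κ : Type*} [DecidableEq κ] (s : Finset κ) (x F : κ → A) {a : ℝ} (ha : 0 ≤ a)
    (ho : ∀ i ∈ s, ∀ j ∈ s, i ≠ j → star (x i) * x j = 0)
    (hF : ∀ i ∈ s, star (x i) * x i ≤ (a ^ 2) • F i) (h1 : ∑ i ∈ s, F i ≤ 1) : ‖∑ i ∈ s, x i‖ ≤ a := by
  refine norm_sq_le ha ?_
  have e : star (∑ i ∈ s, x i) * ∑ i ∈ s, x i = ∑ i ∈ s, star (x i) * x i := by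
    rw [star_sum, Finset.sum_mul]
    refine Finset.sum_congr rfl fun i hi => ?_
    rw [Finset.mul_sum]
    exact Finset.sum_eq_single_of_mem i hi fun j hj hij => ho i hi j hj hij.symm
  have h2 : star (∑ i ∈ s, x i) * ∑ i ∈ s, x i ≤ (a ^ 2) • (1 : A) := by
    rw [e]
    refine (Finset.sum_le_sum hF).trans ?_
    rw [← Finset.smul_sum]
    exact smul_le_smul_of_nonneg_left h1 (by positivity)
  refine (norm_mono (star_mul_self_nonneg _) h2).trans ?_
  rw [norm_smul, Real.norm_of_nonneg (by positivity)]
  nlinarith [norm_le_one' (A := A) zero_le_one le_rfl, sq_nonneg a]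

/-- inner perturbation of an automorphism -/
noncomputable def adj (W : A) (hW : W ∈ unitary A) (α : A ≃⋆ₐ[ℂ] A) : A ≃⋆ₐ[ℂ] A :=
  α.trans (Unitary.conjStarAlgAut ℂ A ⟨W, hW⟩)

theorem adj_apply {W : A} (hW : W ∈ unitary A) (α : A ≃⋆ₐ[ℂ] A) (x : A) : adj W hW α x = W * α x * star W := by
  simp [adj, Unitary.conjStarAlgAut_apply]

theorem un_norm {W : A} (hW : W ∈ unitary A) : ‖W‖ ≤ 1 := by
  refine norm_sq_le zero_le_one ?_
  rw [Unitary.star_mul_self_of_mem hW]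
  simpa using norm_le_one' (A := A) zero_le_one le_rfl

theorem un_norm' {W : A} (hW : W ∈ unitary A) : ‖star W‖ ≤ 1 := by rw [norm_star]; exact un_norm hW

theorem conj_near {W : A} (hW : W ∈ unitary A) (x : A) : ‖W * x * star W - x‖ ≤ 2 * ‖W - 1‖ * ‖x‖ := by
  have e : W * x * star W - x = (W - 1) * x * star W + x * star (W - 1) := by
    rw [star_sub, star_one]; noncomm_ring
  rw [e]
  have h1 := norm_add_le ((W - 1) * x * star W) (x * star (W - 1))
  have h2 : ‖(W - 1) * x * star W‖ ≤ ‖W - 1‖ * ‖x‖ * 1 :=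
    (norm_mul_le _ _).trans (mul_le_mul (norm_mul_le _ _) (un_norm' hW) (norm_nonneg _) (by positivity))
  have h3 : ‖x * star (W - 1)‖ ≤ ‖x‖ * ‖W - 1‖ := (norm_mul_le _ _).trans (by rw [norm_star])
  linarith

theorem adj_pow {α β : A ≃⋆ₐ[ℂ] A} {W : A} (hW : W ∈ unitary A) (h : ∀ x, β x = W * α x * star W) (i : ℕ) (y : A) :
    ‖(β ^ i) y - (α ^ i) y‖ ≤ 2 * i * ‖W - 1‖ * ‖y‖ := by
  induction i with
  | zero => simp
  | succ i ih =>
    rw [pow_succ_apply, pow_succ_apply]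
    have e : β ((β ^ i) y) - α ((α ^ i) y) = (W * α ((β ^ i) y) * star W - α ((β ^ i) y)) + α ((β ^ i) y - (α ^ i) y) := by
      rw [h, map_sub]; abel
    rw [e]
    have h1 := conj_near hW (α ((β ^ i) y))
    rw [nA, nA] at h1
    refine (norm_add_le _ _).trans ?_
    rw [nA]; push_cast
    linarith

theorem PUO_inner {α γ : A ≃⋆ₐ[ℂ] A} (hU : PUO α) {k : ℕ} (hk : 1 ≤ k) {V : A} (hV : V ∈ unitary A)
    (h : ∀ x, γ x = V * (α ^ k) x * star V) : PUO γ := by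
  have key : ∀ j : ℕ, ∃ Vj ∈ unitary A, ∀ x, (γ ^ j) x = Vj * (α ^ (k * j)) x * star Vj := by
    intro j
    induction j with
    | zero => exact ⟨1, one_mem _, fun x => by simp⟩
    | succ j ih =>
      obtain ⟨X, hX, hx⟩ := ih
      refine ⟨V * (α ^ k) X, mul_mem hV (by
        rw [Unitary.mem_iff] at hX ⊢
        rw [← map_star, ← map_mul, ← map_mul, hX.1, hX.2]; simp), fun x => ?_⟩
      rw [pow_succ_apply, hx, h, map_mul, map_mul, show k * (j + 1) = k + k * j by ring, pow_add_apply, star_mul, map_star]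
      noncomm_ring
  intro j hj a p hp ε hε
  obtain ⟨X, hX, hx⟩ := key j
  obtain ⟨n, q, q1, q2, q3⟩ := hU (k * j) (Nat.mul_pos hk hj) (a * X) p hp ε hε
  refine ⟨n, q, q1, q2, fun i => lt_of_le_of_lt ?_ (q3 i)⟩
  rw [hx, ← mul_assoc, ← mul_assoc, mul_assoc (q i) a X]
  refine (norm_mul_le _ _).trans ?_
  have := un_norm' hX
  nlinarith [norm_nonneg (q i * (a * X) * (α ^ (k * j)) (q i))]

theorem AI_comp {f g : A → A} (hf : ApproxInner f) (hg : ApproxInner g) : ApproxInner (f ∘ g) := by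
  classical
  intro F ε hε
  obtain ⟨v, hv, h1⟩ := hf (F.image g) (ε/2) (by positivity)
  obtain ⟨w, hw, h2⟩ := hg F (ε/2) (by positivity)
  refine ⟨w * v, mul_mem hw hv, fun a ha => ?_⟩
  have e : (f ∘ g) a - star (w * v) * a * (w * v) = (f (g a) - star v * g a * v) + star v * (g a - star w * a * w) * v := by
    simp only [Function.comp]; rw [star_mul]; noncomm_ring
  rw [e]
  have h3 : ‖star v * (g a - star w * a * w) * v‖ ≤ 1 * ‖g a - star w * a * w‖ * 1 :=
    (norm_mul_le _ _).trans (mul_le_mul ((norm_mul_le _ _).trans (mul_le_mul_of_nonneg_right (un_norm' hv) (norm_nonneg _))) (un_norm hv) (norm_nonneg _) (by positivity))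
  have := norm_add_le (f (g a) - star v * g a * v) (star v * (g a - star w * a * w) * v)
  have := h1 (g a) (Finset.mem_image_of_mem _ ha)
  have := h2 a ha
  linarith

theorem AI_pow {α : A ≃⋆ₐ[ℂ] A} {r : ℕ} (h : ApproxInner ((⇑α)^[r])) (L : ℕ) : ApproxInner (⇑(α ^ (r * L))) := by
  have key : ApproxInner ((⇑α)^[r * L]) := by
    induction L with
    | zero => intro F ε hε; exact ⟨1, one_mem _, fun a _ => by simpa using hε⟩
    | succ L ih =>
      rw [show r * (L + 1) = r + r * L by ring, Function.iterate_add]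
      exact AI_comp h ih
  convert key using 1
  exact StarAlgEquiv.coe_pow _ _

theorem PUO_of {α : A ≃⋆ₐ[ℂ] A} (h : ∀ m : ℤ, m ≠ 0 → UniformlyOuter (autZPow α m)) : PUO α := by
  intro j hj
  have := h j (by omega)
  rw [autZPow, if_pos (by positivity), Int.toNat_natCast] at this
  rwa [StarAlgEquiv.coe_pow]

end
end RK

namespace RK
set_option linter.all false

section
variable {A : Type*} [CStarAlgebra A] [PartialOrder A] [StarOrderedRing A] {τ : A →ₗ[ℂ] ℂ}

theorem un3 {U V : A} (hU : ‖U‖ ≤ 1) (hV : ‖V‖ ≤ 1) (x : A) : ‖U * x * V‖ ≤ ‖x‖ := by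
  have := norm_mul_le (U * x) V
  have := norm_mul_le U x
  nlinarith [norm_nonneg (U * x), norm_nonneg x]

theorem unl {U : A} (hU : ‖U‖ ≤ 1) (x : A) : ‖U * x‖ ≤ ‖x‖ := by
  have := norm_mul_le U x
  nlinarith [norm_nonneg x]

theorem unr {U : A} (hU : ‖U‖ ≤ 1) (x : A) : ‖x * U‖ ≤ ‖x‖ := by
  have := norm_mul_le x U
  nlinarith [norm_nonneg x]

theorem pow_symm (α : A ≃⋆ₐ[ℂ] A) (M : ℕ) (y : A) : (α ^ M) ((α ^ M).symm y) = y := (α ^ M).apply_symm_apply y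

set_option maxHeartbeats 1000000 in
theorem TW (G : Good τ) {α : A ≃⋆ₐ[ℂ] A} (hU : PUO α) {M N : ℕ} (hMN : M ≤ N) (hAI : ApproxInner (⇑(α ^ M)))
    (Y : Finset A) {η : ℝ} (hη : 0 < η) :
    ∃ v ∈ unitary A, ∃ W, ∃ hW : W ∈ unitary A, ∃ p w, ∃ V ∈ unitary A, ‖W - 1‖ < η ∧ IsProjection p ∧
      (∀ i ≤ N, ∀ j ≤ N, i ≠ j → (adj W hW α ^ i) p * (adj W hW α ^ j) p = 0) ∧
      (∀ y ∈ Y, ‖y * p - p * y‖ < η) ∧ ‖v * p - p * v‖ < η ∧ star w * w = p ∧ w * star w = (adj W hW α ^ M) p ∧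
      (∀ y ∈ Y, ‖y * w - w * y‖ < η) ∧ ‖w - star V * v * p‖ < η ∧
      (∀ y, y ∈ Y ∨ y = v ∨ y = p → ‖V * (adj W hW α ^ M) y * star V - y‖ < η) ∧
      1 - η < (N + 1) * tr τ p := by
  classical
  set R : ℝ := 1 + ∑ y ∈ Y, ‖y‖ with hR
  have hR1 : 1 ≤ R := by
    have : 0 ≤ ∑ y ∈ Y, ‖y‖ := Finset.sum_nonneg fun _ _ => norm_nonneg _
    linarith
  have hRY : ∀ y ∈ Y, ‖y‖ ≤ R := fun y hy => by
    have := Finset.single_le_sum (f := fun y : A => ‖y‖) (fun _ _ => norm_nonneg _) hy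
    linarith
  set δ : ℝ := min 1 η / (200 * (M + 1) * (R * R)) with hδ
  have hδ0 : 0 < δ := by positivity
  have hmin : 200 * (M + 1) * (R * R) * δ = min 1 η := by rw [hδ]; field_simp
  have hm1 : min 1 η ≤ 1 := min_le_left _ _
  have hm2 : min 1 η ≤ η := min_le_right _ _
  have hM0 : (0:ℝ) ≤ M := Nat.cast_nonneg M
  have hb0 : 200 * (R * (M * R * δ) + R * (R * δ)) ≤ min 1 η := by rw [← hmin]; apply le_of_eq; ring
  have hb1 : 200 * (M * R * δ + R * δ) ≤ min 1 η := by
    have : 0 ≤ M * R * δ := by positivity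
    have : 0 ≤ R * δ := by positivity
    nlinarith
  have hMR : 0 ≤ M * R * δ := by positivity
  have hMd : M * δ ≤ M * R * δ := by nlinarith [mul_nonneg hM0 hδ0.le]
  have hRd : δ ≤ R * δ := by nlinarith
  obtain ⟨v0, hv0, hv1⟩ := hAI Y δ hδ0
  set v := (α ^ M).symm v0 with hv
  have hvu : v ∈ unitary A := by
    rw [Unitary.mem_iff] at hv0 ⊢
    rw [hv, ← map_star, ← map_mul, ← map_mul, hv0.1, hv0.2]; simp
  have hv2 : ∀ y ∈ Y, ‖(α ^ M).symm y * v - v * y‖ ≤ δ := by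
    intro y hy
    have e : (α ^ M).symm y * v - v * y = v * ((α ^ M).symm (star v0 * y * v0 - (α ^ M) y)) := by
      rw [map_sub, StarAlgEquiv.symm_apply_apply, map_mul, map_mul, map_star, ← hv, mul_sub, ← mul_assoc, ← mul_assoc,
        Unitary.mul_star_self_of_mem hvu, one_mul]
    rw [e]
    refine (unl (un_norm hvu) _).trans ?_
    rw [nA, norm_sub_rev]; exact (hv1 y hy).le
  obtain ⟨n, m, W, hW, q, hW1, m1, -, -, m2, q1, q2, q3, q4⟩ := OT G hU N (insert v Y) hδ0
  set p := m.unit with hp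
  have hpp : IsProjection p := q1 ▸ q2 0
  set β := adj W hW α with hβ
  have hβa := adj_apply hW α
  rw [← hβ] at hβa
  have hq : ∀ i ≤ N, q i = (β ^ i) p := by
    intro i
    induction i with
    | zero => intro _; simpa using q1
    | succ i ih => intro hi; rw [pow_succ_apply, ← ih (by omega), hβa, q4 i (by omega)]
  obtain ⟨V, hV, hV1⟩ := hAI (insert v (insert p (Y ∪ Y.image (α ^ M).symm))) δ hδ0
  have hpow : ∀ y, ‖y‖ ≤ R → ‖(β ^ M) y - (α ^ M) y‖ ≤ 2 * (M * R * δ) := by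
    intro y hy
    refine (adj_pow hW hβa M y).trans ?_
    have : ‖W - 1‖ * ‖y‖ ≤ δ * R := mul_le_mul hW1.le hy (norm_nonneg _) hδ0.le
    nlinarith
  have hVb : ∀ y ∈ (insert v (insert p (Y ∪ Y.image (α ^ M).symm)) : Finset A), ‖y‖ ≤ R →
      ‖(β ^ M) y - star V * y * V‖ ≤ 2 * (M * R * δ) + δ := by
    intro y hy hyR
    have := norm_sub_le_norm_sub_add_norm_sub ((β ^ M) y) ((α ^ M) y) (star V * y * V)
    have := hV1 y hy
    have := hpow y hyR
    linarith
  have hmp := m1 v (by simp)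
  have hVm := Unitary.mem_iff.1 hV
  -- w0
  set w0 := star V * v * p with hw0
  have hw0n : ‖w0‖ ≤ 1 := by
    rw [hw0]
    exact (unr hpp.norm_le _).trans ((unl (un_norm' hV) _).trans (un_norm hvu))
  have hw01 : star w0 * w0 = p := by
    rw [hw0]; simp only [star_mul, star_star, hpp.st]
    rw [show p * (star v * V) * (star V * v * p) = p * (star v * (V * star V) * v) * p by noncomm_ring, hVm.2, mul_one,
      Unitary.star_mul_self_of_mem hvu, mul_one, hpp.mm]
  have hqM : (β ^ M) p = (β ^ M) p := rfl
  have hw02 : ‖w0 * star w0 - (β ^ M) p‖ ≤ 2 * (M * R * δ) + 2 * δ := by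
    have e : w0 * star w0 - (β ^ M) p = star V * ((v * p - p * v) * star v) * V - ((β ^ M) p - star V * p * V) := by
      rw [hw0]; simp only [star_mul, star_star, hpp.st]
      rw [show star V * v * p * (p * (star v * V)) = star V * (v * (p * p) * star v) * V by noncomm_ring, hpp.mm, sub_mul,
        mul_assoc p v, Unitary.mul_star_self_of_mem hvu]; noncomm_ring
    rw [e]
    refine (norm_sub_le _ _).trans ?_
    have h1 := (un3 (un_norm' hV) (un_norm hV) ((v * p - p * v) * star v)).trans (unr (un_norm' hvu) _)
    have h2 := hVb p (by simp) (hpp.norm_le.trans hR1)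
    linarith
  have hq2 : IsProjection ((β ^ M) p) := aut_proj _ hpp
  obtain ⟨U, hUu, hU1, hU2⟩ := close_unitary (pisom_proj hpp hw01) hq2 (by linarith) hw02
  have hUm := Unitary.mem_iff.1 hUu
  have hww0 : ‖U * w0 - w0‖ ≤ 12 * (2 * (M * R * δ) + 2 * δ) := by
    rw [show U * w0 - w0 = (U - 1) * w0 by noncomm_ring]
    exact (unr hw0n _).trans hU1
  refine ⟨v, hvu, W, hW, p, U * w0, V, hV, by linarith, hpp, ?_, ?_, by linarith, ?_, ?_, ?_, ?_, ?_, by linarith⟩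
  · intro i hi j hj hij
    rw [← hβ, ← hq i hi, ← hq j hj]; exact q3 i hi j hj hij
  · intro y hy; have := m1 y (by simp [hy]); linarith
  · rw [star_mul, mul_assoc, ← mul_assoc (star U), hUm.1, one_mul, hw01]
  · rw [star_mul, show U * w0 * (star w0 * star U) = U * (w0 * star w0) * star U by noncomm_ring, hU2, mul_assoc, hUm.2, mul_one]
  · intro y hy
    have hyR := hRY y hy
    have h0 : ‖y * w0 - w0 * y‖ ≤ 4 * (M * R * δ) + 4 * δ := by
      have h1 := hVb ((α ^ M).symm y) (by simp only [Finset.mem_insert, Finset.mem_union]; right; right; right; exact Finset.mem_image_of_mem _ hy) (by rw [nA]; exact hyR)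
      have h2 := hpow ((α ^ M).symm y) (by rw [nA]; exact hyR)
      rw [pow_symm] at h2
      have h3 : ‖y - star V * (α ^ M).symm y * V‖ ≤ 4 * (M * R * δ) + δ := by
        have := norm_sub_le_norm_sub_add_norm_sub y ((β ^ M) ((α ^ M).symm y)) (star V * (α ^ M).symm y * V)
        rw [norm_sub_rev y ((β ^ M) ((α ^ M).symm y))] at this
        linarith
      have e : y * w0 - w0 * y = (y - star V * (α ^ M).symm y * V) * w0 + star V * ((α ^ M).symm y * v - v * y) * p
          + star V * v * (y * p - p * y) := by
        rw [hw0]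
        rw [sub_mul y, show star V * (α ^ M).symm y * V * (star V * v * p) = star V * (α ^ M).symm y * (V * star V) * v * p by noncomm_ring, hVm.2]
        noncomm_ring
      rw [e]
      refine (norm_add₃_le).trans ?_
      have i1 := unr hw0n (y - star V * (α ^ M).symm y * V)
      have i2 := un3 (un_norm' hV) hpp.norm_le ((α ^ M).symm y * v - v * y)
      have i3 := unl (un_norm' hV) (v * (y * p - p * y))
      have i4 := unl (un_norm hvu) (y * p - p * y)
      have := m1 y (by simp [hy])
      have := hv2 y hy
      rw [mul_assoc (star V) v]
      linarith
    have e : y * (U * w0) - U * w0 * y = y * (U * w0 - w0) + (y * w0 - w0 * y) - (U * w0 - w0) * y := by noncomm_ring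
    rw [e]
    refine (norm_sub_le _ _).trans_lt ?_
    have i1 := norm_add_le (y * (U * w0 - w0)) (y * w0 - w0 * y)
    have i2 : ‖y * (U * w0 - w0)‖ ≤ R * (12 * (2 * (M * R * δ) + 2 * δ)) := (norm_mul_le _ _).trans (by gcongr)
    have i3 : ‖(U * w0 - w0) * y‖ ≤ (12 * (2 * (M * R * δ) + 2 * δ)) * R := (norm_mul_le _ _).trans (by gcongr)
    have i4 : R * δ ≤ R * (R * δ) := by nlinarith [mul_nonneg (by linarith : (0:ℝ) ≤ R) hδ0.le]
    have i5 : M * R * δ ≤ R * (M * R * δ) := by nlinarith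
    nlinarith
  · linarith
  · intro y hy
    have h1 := hVb y (by rcases hy with h | h | h <;> simp [h]) (by
      rcases hy with h | rfl | rfl
      · exact hRY y h
      · exact (un_norm hvu).trans hR1
      · exact hpp.norm_le.trans hR1)
    have e : V * (β ^ M) y * star V - y = V * ((β ^ M) y - star V * y * V) * star V := by
      rw [mul_sub, sub_mul, show V * (star V * y * V) * star V = (V * star V) * y * (V * star V) by noncomm_ring, hVm.2]; noncomm_ring
    rw [e]
    have := un3 (un_norm hV) (un_norm' hV) ((β ^ M) y - star V * y * V)
    linarith
end
end RK

namespace RK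
set_option linter.all false

section
variable {A : Type*} [CStarAlgebra A] [PartialOrder A] [StarOrderedRing A] {τ : A →ₗ[ℂ] ℂ}

theorem sq_le_proj {d e : A} {a : ℝ} (he : IsProjection e) (h : d * e = d) (hd : ‖d‖ ≤ a) : star d * d ≤ (a ^ 2) • e := by
  have h1 : star d * d ≤ (a ^ 2) • (1 : A) := by
    have h2 := CStarAlgebra.star_mul_le_algebraMap_norm_sq (a := d)
    refine h2.trans ?_
    rw [← Algebra.algebraMap_eq_smul_one]
    exact algebraMap_mono A (by have := norm_nonneg d; gcongr)
  have h3 := conj_mono e h1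
  have e1 : star e * (star d * d) * e = star d * d := by
    rw [mul_assoc, mul_assoc, h, ← mul_assoc, ← star_mul, h]
  rw [e1] at h3
  simpa [he.st, he.mm] using h3

theorem rot_pisom {p w : A} {c s : ℝ} (hp : IsProjection p) (h1 : star w * w = p) (h0 : p * w = 0) (hc : c ^ 2 + s ^ 2 = 1) :
    star (c • p + s • w) * (c • p + s • w) = p := by
  have h0' : star w * p = 0 := by have := congrArg star h0; simpa [hp.st] using this
  simp only [star_add, star_smul, star_trivial, add_mul, mul_add, smul_mul_assoc, mul_smul_comm, hp.st, hp.mm, h0, h0', h1]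
  simp only [smul_zero, add_zero, zero_add, smul_smul, ← add_smul]
  rw [show c * c + s * s = 1 by linarith, one_smul]

theorem rot_lip {p w : A} {c s c' s' κ : ℝ} (hp : ‖p‖ ≤ 1) (hw : ‖w‖ ≤ 1) (hc : |c' - c| ≤ κ) (hs : |s' - s| ≤ κ) :
    ‖(c' • p + s' • w) - (c • p + s • w)‖ ≤ 2 * κ := by
  rw [show (c' • p + s' • w) - (c • p + s • w) = (c' - c) • p + (s' - s) • w by rw [sub_smul, sub_smul]; abel]
  refine (norm_add_le _ _).trans ?_
  rw [norm_smul, norm_smul, Real.norm_eq_abs, Real.norm_eq_abs]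
  nlinarith [norm_nonneg p, norm_nonneg w, abs_nonneg (c' - c), abs_nonneg (s' - s)]

theorem pisom_norm {p w : A} (hp : IsProjection p) (h1 : star w * w = p) : ‖w‖ ≤ 1 := by
  refine norm_sq_le zero_le_one ?_
  rw [h1]; simpa using hp.norm_le

theorem berg1 (G : Good τ) (β : A ≃⋆ₐ[ℂ] A) {p w : A} {M K : ℕ} (hK : 1 ≤ K) (hKM : K < M) (hp : IsProjection p)
    (ho : ∀ i ≤ M + K, ∀ j ≤ M + K, i ≠ j → (β ^ i) p * (β ^ j) p = 0)
    (hw1 : star w * w = p) (hw2 : w * star w = (β ^ M) p) :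
    ∃ P : ℕ → A, (∀ i, IsProjection (P i)) ∧ (∀ i < M, ∀ j < M, i ≠ j → P i * P j = 0) ∧
      (∀ s : Finset ℕ, s ⊆ Finset.range M → ‖∑ i ∈ s, (β (P i) - P ((i + 1) % M))‖ ≤ 8 / K) ∧
      (∀ i, tr τ (P i) = tr τ p) ∧
      ∀ (i : ℕ) (y : A) (δ : ℝ), ‖y * p - p * y‖ ≤ δ → ‖y * w - w * y‖ ≤ δ → ‖star y * w - w * star y‖ ≤ δ →
        ‖P i * (β ^ i) y - (β ^ i) y * P i‖ ≤ 4 * δ := by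
  classical
  obtain ⟨c, s, hcs, hc0, hs0, hcK, hdc, hds⟩ := rotation K hK
  have hK0 : (0:ℝ) < K := by exact_mod_cast hK
  have hqM : IsProjection ((β ^ M) p) := aut_proj _ hp
  have hwq : (β ^ M) p * w = w := by rw [← hw2, mul_assoc, hw1, sub_pisom hp hw1]
  have hpw : p * w = 0 := by
    rw [← hwq, ← mul_assoc]
    have := ho 0 (by omega) M (by omega) (by omega)
    rw [pow_zero] at this
    change p * _ = 0 at this
    rw [this, zero_mul]
  have hwp := sub_pisom hp hw1
  have hwn := pisom_norm hp hw1
  set q : ℕ → A := fun i => (β ^ i) p with hq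
  have hqp : ∀ i, IsProjection (q i) := fun i => aut_proj _ hp
  set k : ℕ → A := fun i => c i • p + s i • w with hk
  have hkk : ∀ i, star (k i) * k i = p := fun i => rot_pisom hp hw1 hpw (hcs i)
  have hkn : ∀ i, ‖k i‖ ≤ 1 := fun i => pisom_norm hp (hkk i)
  have hkn' : ∀ i, ‖star (k i)‖ ≤ 1 := fun i => by rw [norm_star]; exact hkn i
  set e : A := p + (β ^ M) p with he
  have hpq : p * (β ^ M) p = 0 := by
    have := ho 0 (by omega) M (by omega) (by omega)
    rw [pow_zero] at this
    exact this
  have hep : IsProjection e := proj_add hp hqM hpq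
  have hek : ∀ i, e * k i = k i := fun i => by
    simp only [hk, he, add_mul, mul_add, mul_smul_comm, hp.mm, hpw, hwq, mul_swap0 hp hqM hpq]
    simp
  have hke : ∀ i, star (k i) * e = star (k i) := fun i => sub_pisom' (hek i) hep.st
  have hkK : ∀ i, K ≤ i → k i = p := fun i hi => by simp [hk, (hcK i hi).1, (hcK i hi).2]
  set d : ℕ → A := fun i => k i * star (k i) with hd
  have hdp : ∀ i, IsProjection (d i) := fun i => pisom_proj hp (hkk i)
  have hde : ∀ i, d i * e = d i := fun i => by simp only [hd]; rw [mul_assoc, hke]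
  have hdK : ∀ i, K ≤ i → d i = p := fun i hi => by simp only [hd]; rw [hkK i hi, hp.st, hp.mm]
  have hd0 : d 0 = (β ^ M) p := by simp [hd, hk, hc0, hs0, hw2]
  have hdd : ∀ i, ‖d i - d (i + 1)‖ ≤ 8 / K := fun i => by
    have h1 := rot_lip hp.norm_le hwn (hdc i) (hds i)
    have e1 : d i - d (i + 1) = -((k (i + 1) - k i) * star (k (i + 1)) + k i * star (k (i + 1) - k i)) := by
      simp only [hd]; rw [star_sub]; noncomm_ring
    rw [e1, norm_neg]
    refine (norm_add_le _ _).trans ?_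
    have h2 := unr (hkn' (i + 1)) (k (i + 1) - k i)
    have h3 := unl (hkn i) (star (k (i + 1) - k i))
    rw [norm_star] at h3
    have h4 : ‖k (i + 1) - k i‖ ≤ 2 * (2 / K) := h1
    have : 8 / (K:ℝ) = 2 * (2 * (2 / K)) := by ring
    linarith
  have hEq : ∀ i, (β ^ i) e = q i + q (i + M) := fun i => by simp only [he, hq]; rw [map_add, pow_add_apply]
  have hEE : ∀ i ≤ K, ∀ j ≤ K, i ≠ j → (β ^ i) e * (β ^ j) e = 0 := fun i hi j hj hij => by
    rw [hEq, hEq, add_mul, mul_add, mul_add]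
    simp only [hq]
    rw [ho i (by omega) j (by omega) hij, ho i (by omega) (j + M) (by omega) (by omega),
      ho (i + M) (by omega) j (by omega) (by omega), ho (i + M) (by omega) (j + M) (by omega) (by omega)]; simp
  have hqE : ∀ i < M, ∀ j < K, i ≠ j → (β ^ i) p * (β ^ j) e = 0 := fun i hi j hj hij => by
    rw [hEq, mul_add]
    simp only [hq]
    rw [ho i (by omega) j (by omega) hij, ho i (by omega) (j + M) (by omega) (by omega)]; simp
  set P : ℕ → A := fun i => (β ^ i) (d i) with hP
  have hPp : ∀ i, IsProjection (P i) := fun i => aut_proj _ (hdp i)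
  have hPE : ∀ i, P i * (β ^ i) e = P i := fun i => by simp only [hP]; rw [← map_mul, hde]
  have hPE' : ∀ i, (β ^ i) e * P i = P i := fun i => mul_swap (hPp i) (aut_proj _ hep) (hPE i)
  refine ⟨P, hPp, ?_, ?_, ?_, ?_⟩
  · intro i hi j hj hij
    by_cases h1 : i < K <;> by_cases h2 : j < K
    · rw [← hPE i, ← hPE' j, mul_assoc, ← mul_assoc ((β ^ i) e), hEE i h1.le j h2.le hij]; simp
    · rw [← hPE i, mul_assoc]
      have := mul_swap0 (hqp j) (aut_proj _ hep) (hqE j hj i h1 hij.symm)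
      have e1 : P j = q j := by simp only [hP, hq]; rw [hdK j (by omega)]
      rw [e1, this, mul_zero]
    · have e1 : P i = q i := by simp only [hP, hq]; rw [hdK i (by omega)]
      rw [← hPE' j, ← mul_assoc, e1]
      simp only [hq]; rw [hqE i hi j h2 hij, zero_mul]
    · have e1 : P j = q j := by simp only [hP, hq]; rw [hdK j (by omega)]
      have e2 : P i = q i := by simp only [hP, hq]; rw [hdK i (by omega)]
      rw [e1, e2]; exact ho i (by omega) j (by omega) hij
  · intro t ht
    have hx : ∀ i ∈ t, β (P i) - P ((i + 1) % M) = if i < K then (β ^ (i + 1)) (d i - d (i + 1)) else 0 := by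
      intro i hi
      have hiM := Finset.mem_range.1 (ht hi)
      split_ifs with h
      · rw [Nat.mod_eq_of_lt (by omega)]
        simp only [hP]; rw [map_sub, ← pow_succ_apply]
      · by_cases h2 : i + 1 = M
        · rw [h2, Nat.mod_self]
          simp only [hP]
          rw [← pow_succ_apply, hdK i (by omega), hd0, h2, pow_zero]
          exact sub_self _
        · rw [Nat.mod_eq_of_lt (by omega)]
          simp only [hP]; rw [← pow_succ_apply, hdK i (by omega), hdK (i + 1) (by omega), sub_self]
    rw [Finset.sum_congr rfl hx, ← Finset.sum_filter]
    have hmem : ∀ i ∈ (t).filter (fun i => i < K), i < K := fun i hi => (Finset.mem_filter.1 hi).2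
    have hse : ∀ i, (d i - d (i + 1)) * e = d i - d (i + 1) := fun i => by rw [sub_mul, hde, hde]
    have hss : ∀ i, star (d i - d (i + 1)) = d i - d (i + 1) := fun i => by rw [star_sub, (hdp i).st, (hdp (i + 1)).st]
    have hes : ∀ i, e * (d i - d (i + 1)) = d i - d (i + 1) := fun i => by
      have := congrArg star (hse i); rwa [star_mul, hss, hep.st] at this
    refine blk _ _ (fun i => (β ^ (i + 1)) e) (by positivity) ?_ ?_ ?_
    · intro i hi j hj hij
      rw [← map_star, hss]
      nth_rewrite 1 [← hse i]
      rw [← hes j, map_mul, map_mul, mul_assoc, ← mul_assoc ((β ^ (i + 1)) e), hEE _ (hmem i hi) _ (hmem j hj) (by omega)]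
      simp
    · intro i hi
      exact sq_le_proj (aut_proj _ hep) (by rw [← map_mul, hse]) (by rw [nA]; exact hdd i)
    · exact (proj_sum _ _ (fun i _ => aut_proj _ hep) (fun i hi j hj hij => hEE _ (hmem i hi) _ (hmem j hj) (by omega))).le_one
  · intro i
    simp only [hP, hd]; rw [G.inv, tr_comm G.htr, hkk]
  · intro i y δ h1 h2 h3
    simp only [hP]
    rw [← map_mul, ← map_mul, ← map_sub, nA]
    have hc1 : |c i| ≤ 1 := by rw [abs_le]; constructor <;> nlinarith [hcs i, sq_nonneg (s i), sq_nonneg (c i)]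
    have hs1 : |s i| ≤ 1 := by rw [abs_le]; constructor <;> nlinarith [hcs i, sq_nonneg (s i), sq_nonneg (c i)]
    have gen : ∀ z : A, ‖z * p - p * z‖ ≤ δ → ‖z * w - w * z‖ ≤ δ → ‖z * k i - k i * z‖ ≤ 2 * δ := by
      intro z g1 g2
      have e1 : z * k i - k i * z = c i • (z * p - p * z) + s i • (z * w - w * z) := by
        simp only [hk, mul_add, add_mul, mul_smul_comm, smul_mul_assoc, smul_sub]; abel
      rw [e1]
      refine (norm_add_le _ _).trans ?_
      rw [norm_smul, norm_smul, Real.norm_eq_abs, Real.norm_eq_abs]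
      nlinarith [norm_nonneg (z * p - p * z), norm_nonneg (z * w - w * z)]
    have g1 := gen y h1 h2
    have g2 := gen (star y) (by
      rw [← norm_star, star_sub, star_mul, star_mul, hp.st, star_star, norm_sub_rev]; exact h1) h3
    have g3 : ‖y * star (k i) - star (k i) * y‖ ≤ 2 * δ := by
      rw [← norm_star, star_sub, star_mul, star_mul, star_star, norm_sub_rev]; exact g2
    have e1 : d i * y - y * d i = -((y * k i - k i * y) * star (k i) + k i * (y * star (k i) - star (k i) * y)) := by
      simp only [hd]; noncomm_ring
    rw [e1, norm_neg]
    refine (norm_add_le _ _).trans ?_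
    have := unr (hkn' i) (y * k i - k i * y)
    have := unl (hkn i) (y * star (k i) - star (k i) * y)
    linarith

end
end RK

namespace RK
set_option linter.all false

section
variable {A : Type*} [CStarAlgebra A] [PartialOrder A] [StarOrderedRing A] {τ : A →ₗ[ℂ] ℂ}

theorem cyc_sum (P : ℕ → A) (M n : ℕ) (hM : (n + 1) ∣ M) (hM0 : 0 < M) (j : Fin (n + 1)) :
    ∑ i ∈ (Finset.range M).filter (fun i => i % (n + 1) = (j : ℕ)), P ((i + 1) % M) =
      ∑ i ∈ (Finset.range M).filter (fun i => i % (n + 1) = ((j + 1 : Fin (n + 1)) : ℕ)), P i := by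
  have hj : ((j + 1 : Fin (n + 1)) : ℕ) = (j + 1) % (n + 1) := by
    rw [Fin.val_add, Fin.val_one', Nat.add_mod_mod]
  have hjl := j.2
  refine Finset.sum_bij' (fun i _ => (i + 1) % M) (fun i _ => (i + (M - 1)) % M) ?_ ?_ ?_ ?_ ?_
  · intro i hi
    simp only [Finset.mem_filter, Finset.mem_range] at hi ⊢
    refine ⟨Nat.mod_lt _ hM0, ?_⟩
    rw [Nat.mod_mod_of_dvd _ hM, hj, Nat.add_mod, hi.2, Nat.add_mod_mod]
  · intro i hi
    simp only [Finset.mem_filter, Finset.mem_range] at hi ⊢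
    refine ⟨Nat.mod_lt _ hM0, ?_⟩
    rw [Nat.mod_mod_of_dvd _ hM]
    have h1 : (i + (M - 1) + 1) % (n + 1) = (j + 1) % (n + 1) := by
      obtain ⟨L, rfl⟩ := hM
      rw [show i + ((n + 1) * L - 1) + 1 = i + (n + 1) * L by omega, Nat.add_mul_mod_self_left, hi.2, hj]
    have h2 : (i + (M - 1)) ≡ j [MOD (n + 1)] := Nat.ModEq.add_right_cancel' 1 h1
    rw [h2, Nat.mod_eq_of_lt hjl]
  · intro i hi
    simp only [Finset.mem_filter, Finset.mem_range] at hi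
    rw [Nat.mod_add_mod, show i + 1 + (M - 1) = i + M by omega, Nat.add_mod_right, Nat.mod_eq_of_lt hi.1]
  · intro i hi
    simp only [Finset.mem_filter, Finset.mem_range] at hi
    rw [Nat.mod_add_mod, show i + (M - 1) + 1 = i + M by omega, Nat.add_mod_right, Nat.mod_eq_of_lt hi.1]
  · intro i hi; rfl

set_option maxHeartbeats 1000000 in
theorem part1 (G : Good τ) {α : A ≃⋆ₐ[ℂ] A} (hU : PUO α) {r : ℕ} (hr : 1 ≤ r) (hai : ApproxInner ((⇑α)^[r])) :
    TracialCyclicRokhlin α := by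
  classical
  intro F ε hε n x hx hx0
  obtain ⟨g, hg, hg0, hgx⟩ := cuntz_A G hU (isPos_iff.1 hx) hx0
  have ht : 0 < tr τ g := tr_pos G.htr G.simple hg.nonneg hg0
  set t := tr τ g with htd
  obtain ⟨K, hK⟩ := exists_nat_gt (16 / ε)
  have hK0 : (0:ℝ) < K := lt_trans (by positivity) hK
  have hK1 : 1 ≤ K := by exact_mod_cast hK0
  have hK2 : 8 / (K:ℝ) < ε / 2 := by rw [div_lt_iff₀ hε] at hK; rw [div_lt_iff₀ hK0]; linarith
  obtain ⟨L, hL⟩ := exists_nat_gt (2 * (K + 1) / t + (K + 1))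
  obtain ⟨M, hM⟩ : ∃ M, M = r * ((n + 1) * L) := ⟨_, rfl⟩
  have hLM : L ≤ M := by
    rw [hM]
    calc L = 1 * (1 * L) := by ring
      _ ≤ r * ((n + 1) * L) := by gcongr; omega
  have hLM' : (L:ℝ) ≤ M := by exact_mod_cast hLM
  have hML : 2 * (K + 1) / t < M := by have : (0:ℝ) ≤ K + 1 := by positivity
                                       linarith
  have hKM : K < M := by
    have : 0 < 2 * (K + 1) / t := by positivity
    have : (K:ℝ) < M := by linarith
    exact_mod_cast this
  have hM0 : (0:ℝ) < M := by exact_mod_cast (by omega : 0 < M)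
  have hnM : (n + 1) ∣ M := by rw [hM]; exact ⟨r * L, by ring⟩
  have hAI : ApproxInner (⇑(α ^ M)) := hM ▸ AI_pow hai _
  set R : ℝ := 1 + ∑ y ∈ F, ‖y‖ with hR
  have hR1 : 1 ≤ R := by
    have : 0 ≤ ∑ y ∈ F, ‖y‖ := Finset.sum_nonneg fun _ _ => norm_nonneg _
    linarith
  have hRY : ∀ y ∈ F, ‖y‖ ≤ R := fun y hy => by
    have := Finset.single_le_sum (f := fun y : A => ‖y‖) (fun _ _ => norm_nonneg _) hy
    linarith
  set η : ℝ := min ε t / (16 * (M + 1) ^ 2 * R) with hηd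
  have hη : 0 < η := by positivity
  have hmin : 16 * (M + 1) ^ 2 * R * η = min ε t := by rw [hηd]; field_simp
  have hm1 : min ε t ≤ ε := min_le_left _ _
  have hm2 : min ε t ≤ t := min_le_right _ _
  have hRη : η ≤ R * η := by nlinarith
  have hMR : 0 ≤ M * (R * η) := by positivity
  have hMMR : 0 ≤ M * (M * (R * η)) := by positivity
  have hb : 16 * (M * (M * (R * η)) + 2 * (M * (R * η)) + R * η) = min ε t := by rw [← hmin]; ring
  obtain ⟨v, -, W, hW, p, w, V, -, hW1, hp, ho, hy, -, hw1, hw2, hyw, -, -, htr⟩ := TW G hU (M := M) (N := M + K) (by omega) hAI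
    ((Finset.range M).biUnion fun i => F.image (fun a => (α ^ i).symm a) ∪ F.image (fun a => star ((α ^ i).symm a))) hη
  set β := adj W hW α with hβ
  have hβa := adj_apply hW α
  rw [← hβ] at hβa
  obtain ⟨P, hP, hPo, hPs, hPt, hPc⟩ := berg1 G β hK1 hKM hp ho hw1 hw2
  set S : Fin (n + 1) → Finset ℕ := fun j => (Finset.range M).filter (fun i => i % (n + 1) = (j : ℕ)) with hS
  have hSm : ∀ j, ∀ i ∈ S j, i < M ∧ i % (n + 1) = j := fun j i hi => by simpa [hS] using hi
  have hSsub : ∀ j, S j ⊆ Finset.range M := fun j => Finset.filter_subset _ _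
  have hcomm : ∀ i < M, ∀ a ∈ F, ‖P i * a - a * P i‖ ≤ 4 * η + 4 * (M * (R * η)) := by
    intro i hi a ha
    set y := (α ^ i).symm a with hyd
    have m1 : y ∈ ((Finset.range M).biUnion fun i => F.image (fun a => (α ^ i).symm a) ∪ F.image (fun a => star ((α ^ i).symm a))) := by
      rw [Finset.mem_biUnion]; exact ⟨i, Finset.mem_range.2 hi, Finset.mem_union_left _ (Finset.mem_image_of_mem _ ha)⟩
    have m2 : star y ∈ ((Finset.range M).biUnion fun i => F.image (fun a => (α ^ i).symm a) ∪ F.image (fun a => star ((α ^ i).symm a))) := by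
      rw [Finset.mem_biUnion]; exact ⟨i, Finset.mem_range.2 hi, Finset.mem_union_right _ (Finset.mem_image.2 ⟨a, ha, rfl⟩)⟩
    have h1 := hPc i y η (hy y m1).le (hyw y m1).le (hyw _ m2).le
    have h2 := adj_pow hW hβa i y
    rw [hyd, pow_symm, ← hyd] at h2
    have hyn : ‖y‖ ≤ R := by rw [hyd, nA]; exact hRY a ha
    have h3 : ‖(β ^ i) y - a‖ ≤ 2 * (M * (R * η)) := by
      refine h2.trans ?_
      have i1 : ‖W - 1‖ * ‖y‖ ≤ η * R := mul_le_mul hW1.le hyn (norm_nonneg _) hη.le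
      have i2 : (i:ℝ) ≤ M := by exact_mod_cast hi.le
      have i3 : (i:ℝ) * (‖W - 1‖ * ‖y‖) ≤ M * (η * R) := mul_le_mul i2 i1 (by positivity) hM0.le
      linarith
    have e : P i * a - a * P i = (P i * (β ^ i) y - (β ^ i) y * P i) - P i * ((β ^ i) y - a) + ((β ^ i) y - a) * P i := by noncomm_ring
    rw [e]
    refine (norm_add_le _ _).trans ?_
    have h4 := norm_sub_le (P i * (β ^ i) y - (β ^ i) y * P i) (P i * ((β ^ i) y - a))
    have h5 := unl (hP i).norm_le ((β ^ i) y - a)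
    have h6 := unr (hP i).norm_le ((β ^ i) y - a)
    linarith
  have hep : ∀ j, IsProjection (∑ i ∈ S j, P i) := fun j => proj_sum _ _ (fun i _ => hP i) (fun i hi k hk hik =>
    hPo i (hSm j i hi).1 k (hSm j k hk).1 hik)
  have hsum : ∑ j, ∑ i ∈ S j, P i = ∑ i ∈ Finset.range M, P i := by
    have := Finset.sum_fiberwise_of_maps_to (s := Finset.range M) (t := Finset.univ) (g := fun i => (⟨i % (n + 1), Nat.mod_lt _ (by omega)⟩ : Fin (n + 1)))
      (fun i _ => Finset.mem_univ _) P
    rw [← this]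
    refine Finset.sum_congr rfl fun j _ => Finset.sum_congr ?_ fun _ _ => rfl
    simp only [hS]
    refine Finset.filter_congr fun i _ => ?_
    rw [Fin.ext_iff]
  have htS : tr τ (∑ i ∈ Finset.range M, P i) = M * tr τ p := by rw [tr_sum, Finset.sum_congr rfl (fun i _ => hPt i)]; simp
  have hSp : IsProjection (∑ i ∈ Finset.range M, P i) := proj_sum _ _ (fun i _ => hP i) (fun i hi k hk hik =>
    hPo i (Finset.mem_range.1 hi) k (Finset.mem_range.1 hk) hik)
  refine ⟨fun j => ∑ i ∈ S j, P i, hep, ?_, ?_, ?_, ?_⟩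
  · intro i j hij
    rw [Finset.sum_mul]
    refine Finset.sum_eq_zero fun a ha => ?_
    rw [Finset.mul_sum]
    refine Finset.sum_eq_zero fun b hb => hPo a (hSm i a ha).1 b (hSm j b hb).1 ?_
    rintro rfl
    exact hij (Fin.ext ((hSm i a ha).2.symm.trans (hSm j a hb).2))
  · intro j
    have h1 := hPs (S j) (hSsub j)
    rw [Finset.sum_sub_distrib, ← map_sum] at h1
    have h2 := cyc_sum P M n hnM (by omega) j
    rw [h2] at h1
    have h3 := conj_near hW (α (∑ i ∈ S j, P i))
    rw [← hβa, nA] at h3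
    have h4 : ‖W - 1‖ * ‖∑ i ∈ S j, P i‖ ≤ η * 1 := mul_le_mul hW1.le (hep j).norm_le (norm_nonneg _) hη.le
    have h5 := norm_sub_le_norm_sub_add_norm_sub (α (∑ i ∈ S j, P i)) (β (∑ i ∈ S j, P i)) (∑ i ∈ S (j + 1), P i)
    rw [norm_sub_rev (α (∑ i ∈ S j, P i)) (β (∑ i ∈ S j, P i))] at h5
    have h6 : ‖β (∑ i ∈ S j, P i) - ∑ i ∈ S (j + 1), P i‖ ≤ 8 / K := h1
    show ‖α (∑ i ∈ S j, P i) - ∑ i ∈ S (j + 1), P i‖ < ε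
    linarith
  · intro j a ha
    have e : (∑ i ∈ S j, P i) * a - a * ∑ i ∈ S j, P i = ∑ i ∈ S j, (P i * a - a * P i) := by
      rw [Finset.sum_mul, Finset.mul_sum, Finset.sum_sub_distrib]
    rw [e]
    refine (norm_sum_le_of_le _ (fun i hi => hcomm i (hSm j i hi).1 a ha)).trans_lt ?_
    rw [Finset.sum_const, nsmul_eq_mul]
    have hc : ((S j).card : ℝ) ≤ M := by
      have := Finset.card_le_card (hSsub j); rw [Finset.card_range] at this; exact_mod_cast this
    have h1 : ((S j).card : ℝ) * (4 * η + 4 * (M * (R * η))) ≤ M * (4 * η + 4 * (M * (R * η))) :=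
      mul_le_mul_of_nonneg_right hc (by positivity)
    have h2 : M * η ≤ M * (R * η) := mul_le_mul_of_nonneg_left hRη hM0.le
    have h3 : 0 < R * η := by positivity
    linarith
  · rw [hsum]
    apply hgx
    refine cmp G hU hSp.one_sub hg ?_
    rw [tr_sub, tr_one G.htr, htS]
    have h1 := tr_mono G.htr hSp.le_one
    rw [htS, tr_one G.htr] at h1
    push_cast at htr
    have h2 : (K + 1) * tr τ p < t / 2 := by
      have h3 : 2 * (K + 1) < M * t := by rwa [div_lt_iff₀ ht] at hML
      have h4 : 2 * (K + 1) * (M * tr τ p) ≤ 2 * (K + 1) * 1 := mul_le_mul_of_nonneg_left h1 (by positivity)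
      by_contra hcon
      push Not at hcon
      nlinarith
    have h3 : η < t / 2 := by nlinarith
    linarith

end
end RK

namespace RK
set_option linter.all false

section
variable {A : Type*} [CStarAlgebra A] [PartialOrder A] [StarOrderedRing A] {τ : A →ₗ[ℂ] ℂ}

theorem exists_tr (G : Good τ) {α : A ≃⋆ₐ[ℂ] A} (hU : PUO α) {a b : ℝ} (ha : 0 ≤ a) (hab : a < b) (hb : b ≤ 1) :
    ∃ h : A, IsProjection h ∧ a < tr τ h ∧ tr τ h < b := by
  classical
  obtain ⟨N, hN⟩ := exists_nat_gt (1 / (b - a))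
  have hba : 0 < b - a := by linarith
  have hN1 : 1 < N * (b - a) := by rwa [div_lt_iff₀ hba] at hN
  obtain ⟨n, m, W, hW, q, -, -, -, -, m2, q1, q2, q3, q4⟩ := OT G hU N ∅ (ε := (b - a) / 2) (by linarith)
  have hq : ∀ i ≤ N, tr τ (q i) = tr τ m.unit := by
    intro i
    induction i with
    | zero => intro _; rw [q1]
    | succ i ih => intro hi; rw [← q4 i hi, tr_conj G.htr hW, G.inv, ih (by omega)]
  set s := tr τ m.unit with hs
  have hN0 : (0:ℝ) ≤ N := Nat.cast_nonneg N
  have hs0 : 0 < s := by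
    by_contra hcon
    push Not at hcon
    nlinarith
  have hpr : ∀ k ≤ N + 1, IsProjection (∑ i ∈ Finset.range k, q i) ∧ tr τ (∑ i ∈ Finset.range k, q i) = k * s := by
    intro k hk
    refine ⟨proj_sum _ _ (fun i _ => q2 i) (fun i hi j hj hij => ?_), ?_⟩
    · rw [Finset.mem_range] at hi hj; exact q3 i (by omega) j (by omega) hij
    · rw [tr_sum, Finset.sum_congr rfl (fun i hi => hq i (by rw [Finset.mem_range] at hi; omega))]; simp
  have hs1 : (N + 1) * s ≤ 1 := by
    have h1 := hpr (N + 1) le_rfl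
    have h2 := tr_mono G.htr h1.1.le_one
    rw [h1.2, tr_one G.htr] at h2; push_cast at h2; exact h2
  set k := ⌊a / s⌋₊ + 1 with hk
  have k1 : a < k * s := by
    have := Nat.lt_floor_add_one (a / s)
    rw [div_lt_iff₀ hs0] at this
    rw [hk]; push_cast; exact this
  have k2 : k * s ≤ a + s := by
    have := Nat.floor_le (a := a / s) (by positivity)
    rw [le_div_iff₀ hs0] at this
    rw [hk]; push_cast; linarith
  have k3 : k ≤ N + 1 := by
    have h1 : a / s < N + 1 := by rw [div_lt_iff₀ hs0]; linarith
    have h2 : ⌊a / s⌋₊ < N + 1 := (Nat.floor_lt (by positivity)).2 (by push_cast; exact h1)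
    omega
  refine ⟨_, (hpr k k3).1, by rw [(hpr k k3).2]; exact k1, ?_⟩
  rw [(hpr k k3).2]
  have : s < b - a := by nlinarith
  linarith

theorem divis (G : Good τ) {α : A ≃⋆ₐ[ℂ] A} (hU : PUO α) {g : A} (hg : IsProjection g) {t1 t2 : ℝ} (h1 : 0 ≤ t1) (h2 : 0 ≤ t2)
    (h : t1 + t2 < tr τ g) : ∃ g1 g2 : A, IsProjection g1 ∧ IsProjection g2 ∧ g1 * g2 = 0 ∧ g * g1 = g1 ∧ g * g2 = g2 ∧
      t1 < tr τ g1 ∧ t2 < tr τ g2 := by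
  have hle := tr_mono G.htr hg.le_one
  rw [tr_one G.htr] at hle
  obtain ⟨p, hp, p1, p2⟩ := exists_tr G hU (a := t1) (b := tr τ g - t2) h1 (by linarith) (by linarith)
  obtain ⟨w, w1, w2⟩ := cmp G hU hp hg (by linarith)
  have hw := pisom_proj hp w1
  have hgw : g * (w * star w) = w * star w := by rw [← mul_assoc, w2]
  have hwg : w * star w * g = w * star w := by have := congrArg star hgw; rwa [star_mul, hw.st, hg.st] at this
  have ht : tr τ (w * star w) = tr τ p := by rw [tr_comm G.htr, w1]
  refine ⟨w * star w, g - w * star w, hw, proj_sub hw hg hwg, ?_, hgw, ?_, by linarith, ?_⟩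
  · rw [mul_sub, hwg, hw.mm, sub_self]
  · rw [mul_sub, hg.mm, hgw]
  · rw [tr_sub]; linarith

variable {C : Type*} [CStarAlgebra C]

/-- `e` is subequivalent to every projection of `A` of trace larger than `t` -/
def Sub (ι : A →⋆ₐ[ℂ] C) (τ : A →ₗ[ℂ] ℂ) (e : C) (t : ℝ) : Prop :=
  ∀ g : A, IsProjection g → t < tr τ g → ∃ x : C, star x * x = e ∧ ι g * x = x

variable {ι : A →⋆ₐ[ℂ] C}

theorem iota_proj (ι : A →⋆ₐ[ℂ] C) {p : A} (h : IsProjection p) : IsProjection (ι p) :=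
  ⟨by rw [IsSelfAdjoint, ← map_star, h.1], by rw [IsIdempotentElem, ← map_mul, h.2]⟩

theorem Sub.mono {e : C} {t t' : ℝ} (h : Sub ι τ e t) (ht : t ≤ t') : Sub ι τ e t' :=
  fun g hg hgt => h g hg (by linarith)

theorem Sub.tra {e e' y : C} {t : ℝ} (h : Sub ι τ e' t) (h1 : star y * y = e) (h2 : e' * y = y) : Sub ι τ e t := by
  intro g hg hgt
  obtain ⟨x, x1, x2⟩ := h g hg hgt
  exact ⟨x * y, by rw [star_mul, mul_assoc, ← mul_assoc (star x), x1, h2, h1], by rw [← mul_assoc, x2]⟩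

theorem Sub.of (G : Good τ) {α : A ≃⋆ₐ[ℂ] A} (hU : PUO α) (ι : A →⋆ₐ[ℂ] C) {a : A} (ha : IsProjection a) : Sub ι τ (ι a) (tr τ a) := by
  intro g hg hgt
  obtain ⟨w, w1, w2⟩ := cmp G hU ha hg hgt
  exact ⟨ι w, by rw [← map_star, ← map_mul, w1], by rw [← map_mul, w2]⟩

theorem Sub.zero : Sub ι τ 0 0 := fun g hg hgt => ⟨0, by simp, by simp⟩

theorem Sub.add (G : Good τ) {α : A ≃⋆ₐ[ℂ] A} (hU : PUO α) {e1 e2 : C} {t1 t2 : ℝ} (s1 : Sub ι τ e1 t1) (s2 : Sub ι τ e2 t2)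
    (h1 : 0 ≤ t1) (h2 : 0 ≤ t2) : Sub ι τ (e1 + e2) (t1 + t2) := by
  intro g hg hgt
  obtain ⟨g1, g2, p1, p2, o, l1, l2, i1, i2⟩ := divis G hU hg h1 h2 hgt
  obtain ⟨x1, a1, a2⟩ := s1 g1 p1 i1
  obtain ⟨x2, b1, b2⟩ := s2 g2 p2 i2
  have hq1 := iota_proj ι p1
  have c1 : star x1 * ι g1 = star x1 := by have := congrArg star a2; rwa [star_mul, hq1.1.star_eq] at this
  have o1 : star x1 * x2 = 0 := by
    rw [← c1, ← b2, mul_assoc, ← mul_assoc (ι g1), ← map_mul, o]; simp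
  have o2 : star x2 * x1 = 0 := by have := congrArg star o1; simpa using this
  refine ⟨x1 + x2, ?_, ?_⟩
  · rw [star_add, add_mul, mul_add, mul_add, o1, o2, a1, b1]; simp
  · rw [mul_add, ← a2, ← b2, ← mul_assoc, ← mul_assoc, ← map_mul, ← map_mul, l1, l2]

theorem Sub.sum (G : Good τ) {α : A ≃⋆ₐ[ℂ] A} (hU : PUO α) {κ : Type*} [DecidableEq κ] (s : Finset κ) (e : κ → C) {t : ℝ} (ht : 0 ≤ t)
    (h : ∀ i ∈ s, Sub ι τ (e i) t) : Sub ι τ (∑ i ∈ s, e i) (s.card * t) := by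
  induction s using Finset.induction_on with
  | empty => simpa using Sub.zero
  | insert a s ha ih =>
    rw [Finset.sum_insert ha, Finset.card_insert_of_notMem ha]
    have := Sub.add G hU (h a (by simp)) (ih fun i hi => h i (by simp [hi])) ht (by positivity)
    refine this.mono ?_
    push_cast; linarith

end
end RK

namespace RK
set_option linter.all false

section
variable {C : Type*} [CStarAlgebra C] [PartialOrder C] [StarOrderedRing C]

/-- `D` is a finite dimensional algebra with unit projection `P` -/
structure FDU (D : NonUnitalStarSubalgebra ℂ C) (P : C) : Prop where
  fd : FiniteDimensional ℂ D
  pr : IsProjection P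
  mem : P ∈ D
  un : ∀ b ∈ D, P * b = b ∧ b * P = b

def Ap (D : NonUnitalStarSubalgebra ℂ C) (P x : C) (ε : ℝ) : Prop := ∃ d ∈ D, ‖x * P - d‖ ≤ ε

theorem Dalg (T : ℕ → C) (M : ℕ) {p f : C} {D0 : NonUnitalStarSubalgebra ℂ C} (hp : IsProjection p) (h0 : FDU D0 f) (hfp : f * p = f)
    (hT : ∀ i < M, ∀ j < M, star (T i) * T j = if i = j then p else 0) :
    ∃ D : NonUnitalStarSubalgebra ℂ C, FDU D (∑ i ∈ Finset.range M, T i * f * star (T i)) ∧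
      ∀ d ∈ D0, ∀ i < M, ∀ j < M, T i * d * star (T j) ∈ D := by
  classical
  have hf := h0.pr
  have hpf : p * f = f := mul_swap hf hp hfp
  set P := ∑ i ∈ Finset.range M, T i * f * star (T i) with hP
  have hPs : star P = P := by
    rw [hP, star_sum]; refine Finset.sum_congr rfl fun i _ => ?_
    rw [star_mul, star_mul, star_star, hf.st, mul_assoc]
  have hPT : ∀ j < M, P * T j = T j * f := by
    intro j hj
    rw [hP, Finset.sum_mul, Finset.sum_eq_single_of_mem j (Finset.mem_range.2 hj)]
    · rw [mul_assoc, hT j hj j hj, if_pos rfl, mul_assoc, hfp]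
    · intro i hi hij; rw [mul_assoc, hT i (Finset.mem_range.1 hi) j hj, if_neg hij, mul_zero]
  have hTP : ∀ j < M, star (T j) * P = f * star (T j) := by
    intro j hj
    have := congrArg star (hPT j hj); rwa [star_mul, star_mul, hPs, hf.st] at this
  have hPP : P * P = P := by
    nth_rewrite 2 [hP]
    rw [Finset.mul_sum]; conv_rhs => rw [hP]
    refine Finset.sum_congr rfl fun i hi => ?_
    rw [← mul_assoc, ← mul_assoc, hPT i (Finset.mem_range.1 hi), mul_assoc (T i), hf.mm]
  have hTf : ∀ i < M, star (T i) * T i * f = f := fun i hi => by rw [hT i hi i hi, if_pos rfl, hpf]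
  let D : NonUnitalStarSubalgebra ℂ C :=
    { carrier := {x | P * x = x ∧ x * P = x ∧ ∀ i < M, ∀ j < M, star (T i) * x * T j ∈ D0}
      add_mem' := fun {x y} hx hy => ⟨by rw [mul_add, hx.1, hy.1], by rw [add_mul, hx.2.1, hy.2.1], fun i hi j hj => by
        rw [mul_add, add_mul]; exact add_mem (hx.2.2 i hi j hj) (hy.2.2 i hi j hj)⟩
      zero_mem' := ⟨by simp, by simp, fun i _ j _ => by simp⟩
      mul_mem' := fun {x y} hx hy => ⟨by rw [← mul_assoc, hx.1], by rw [mul_assoc, hy.2.1], fun i hi j hj => by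
        have e : star (T i) * (x * y) * T j = ∑ k ∈ Finset.range M, (star (T i) * x * T k) * f * (star (T k) * y * T j) := by
          conv_lhs => rw [← hx.2.1, hP]
          rw [Finset.mul_sum, Finset.sum_mul, Finset.mul_sum, Finset.sum_mul]
          refine Finset.sum_congr rfl fun k _ => ?_
          simp only [mul_assoc]
        rw [e]
        refine sum_mem fun k hk => ?_
        have hk' := Finset.mem_range.1 hk
        exact mul_mem (mul_mem (hx.2.2 i hi k hk') h0.mem) (hy.2.2 k hk' j hj)⟩
      smul_mem' := fun c x hx => ⟨by rw [mul_smul_comm, hx.1], by rw [smul_mul_assoc, hx.2.1], fun i hi j hj => by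
        rw [mul_smul_comm, smul_mul_assoc]; exact SMulMemClass.smul_mem c (hx.2.2 i hi j hj)⟩
      star_mem' := fun {x} hx => ⟨by have := congrArg star hx.2.1; rwa [star_mul, hPs] at this,
        by have := congrArg star hx.1; rwa [star_mul, hPs] at this, fun i hi j hj => by
        have := star_mem (hx.2.2 j hj i hi)
        rwa [star_mul, star_mul, star_star, ← mul_assoc] at this⟩ }
  have hmem : ∀ d ∈ D0, ∀ i < M, ∀ j < M, T i * d * star (T j) ∈ D := by
    intro d hd i hi j hj
    refine ⟨?_, ?_, ?_⟩
    · rw [← mul_assoc, ← mul_assoc, hPT i hi, mul_assoc (T i), (h0.un d hd).1]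
    · rw [mul_assoc, hTP j hj, ← mul_assoc, mul_assoc (T i), (h0.un d hd).2]
    · intro a ha b hb
      rw [show star (T a) * (T i * d * star (T j)) * T b = (star (T a) * T i) * d * (star (T j) * T b) by noncomm_ring,
        hT a ha i hi, hT j hj b hb]
      split_ifs
      · have pd : p * d = d := by rw [← (h0.un d hd).1, ← mul_assoc, hpf]
        have dp : d * p = d := by rw [← (h0.un d hd).2, mul_assoc, hfp]
        rw [pd, dp]; exact hd
      all_goals simp
  refine ⟨D, ⟨?_, mkp' hPs hPP, ?_, fun b hb => ⟨hb.1, hb.2.1⟩⟩, hmem⟩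
  · haveI := h0.fd
    let φ : D →ₗ[ℂ] (Fin M → Fin M → D0) :=
      { toFun := fun x i j => ⟨star (T i) * x.1 * T j, x.2.2.2 i i.2 j j.2⟩
        map_add' := fun x y => by ext i j; simp [mul_add, add_mul]
        map_smul' := fun c x => by ext i j; simp [mul_smul_comm, smul_mul_assoc] }
    refine FiniteDimensional.of_injective φ ?_
    rw [← LinearMap.ker_eq_bot, LinearMap.ker_eq_bot']
    intro x hx
    have hx' : ∀ i < M, ∀ j < M, star (T i) * x.1 * T j = 0 := fun i hi j hj => by
      have := congrFun (congrFun hx ⟨i, hi⟩) ⟨j, hj⟩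
      exact congrArg Subtype.val this
    apply Subtype.ext
    show x.1 = 0
    rw [← x.2.1, ← x.2.2.1, hP, Finset.sum_mul]
    refine Finset.sum_eq_zero fun i hi => ?_
    rw [Finset.mul_sum, Finset.mul_sum]
    refine Finset.sum_eq_zero fun j hj => ?_
    rw [show T i * f * star (T i) * (x.1 * (T j * f * star (T j))) = T i * f * (star (T i) * x.1 * T j) * f * star (T j) by noncomm_ring,
      hx' i (Finset.mem_range.1 hi) j (Finset.mem_range.1 hj)]
    simp
  · exact sum_mem fun i hi => hmem f h0.mem i (Finset.mem_range.1 hi) i (Finset.mem_range.1 hi)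

end
end RK

namespace RK
set_option linter.all false

section
variable {A : Type*} [CStarAlgebra A] [PartialOrder A] [StarOrderedRing A] {τ : A →ₗ[ℂ] ℂ}
variable {C : Type*} [CStarAlgebra C] [PartialOrder C] [StarOrderedRing C] {ι : A →⋆ₐ[ℂ] C}

set_option maxHeartbeats 2000000 in
theorem berg2 (G : Good τ) {α : A ≃⋆ₐ[ℂ] A} (hU : PUO α) {u p w f : C} {M K : ℕ} (hu : u ∈ unitary C) (hK : 1 ≤ K) (hKM : K < M)
    (hp : IsProjection p) {D0 : NonUnitalStarSubalgebra ℂ C} (h0 : FDU D0 f) (hfp : f * p = f)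
    (ho : ∀ i ≤ M + K, ∀ j ≤ M + K, i ≠ j → (u ^ i * p * star (u ^ i)) * (u ^ j * p * star (u ^ j)) = 0)
    (hw1 : star w * w = p) (hw2 : w * star w = u ^ M * p * star (u ^ M)) {t0 t1 tp : ℝ} (ht0 : 0 ≤ t0) (ht1 : 0 ≤ t1) (htp : 0 ≤ tp)
    (s0 : Sub ι τ (p - f) t0) (s1 : Sub ι τ (1 - ∑ i ∈ Finset.range (M + K), u ^ i * p * star (u ^ i)) t1) (sp : Sub ι τ p tp) :
    ∃ (D : NonUnitalStarSubalgebra ℂ C) (P : C), FDU D P ∧ Sub ι τ (1 - P) (t1 + K * tp + M * t0) ∧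
      (∀ (x : C) (ε : ℝ), (∀ i < M, ‖(star (u ^ i) * x * u ^ i) * p - p * (star (u ^ i) * x * u ^ i)‖ ≤ ε ∧
        ‖(star (u ^ i) * x * u ^ i) * w - w * (star (u ^ i) * x * u ^ i)‖ ≤ ε ∧ Ap D0 f (star (u ^ i) * x * u ^ i) ε) → Ap D P x (M * (3 * ε))) ∧
      (∀ ε, Ap D0 f (star w * u ^ M) ε → Ap D P u (4 / K + ε)) ∧ (∀ ε, Ap D0 f (star (u ^ M) * w) ε → Ap D P (star u) (4 / K + ε)) := by
  classical
  obtain ⟨c, s, hcs, hc0, hs0, hcK, hdc, hds⟩ := rotation K hK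
  have hK0 : (0:ℝ) < K := by exact_mod_cast hK
  have hf := h0.pr
  have hpf : p * f = f := mul_swap hf hp hfp
  have hum : ∀ i, u ^ i ∈ unitary C := fun i => pow_mem hu i
  have hu1 : ∀ i, star (u ^ i) * u ^ i = 1 := fun i => (Unitary.mem_iff.1 (hum i)).1
  have hu2 : ∀ i, u ^ i * star (u ^ i) = 1 := fun i => (Unitary.mem_iff.1 (hum i)).2
  have hwp := sub_pisom hp hw1
  have hwn := pisom_norm hp hw1
  set q : ℕ → C := fun i => u ^ i * p * star (u ^ i) with hq
  have hqp : ∀ i, IsProjection (q i) := fun i => by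
    refine mkp' ?_ ?_
    · simp only [hq, star_mul, star_star, hp.st, mul_assoc]
    · simp only [hq]
      rw [show u ^ i * p * star (u ^ i) * (u ^ i * p * star (u ^ i)) = u ^ i * (p * (star (u ^ i) * u ^ i) * p) * star (u ^ i) by noncomm_ring,
        hu1, mul_one, hp.mm]
  have hq0 : q 0 = p := by simp [hq]
  have hwq : q M * w = w := by
    show (u ^ M * p * star (u ^ M)) * w = w
    rw [← hw2, mul_assoc, hw1, hwp]
  have hpq : p * q M = 0 := by have := ho 0 (by omega) M (by omega) (by omega); rwa [pow_zero, one_mul, star_one, mul_one] at this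
  have hpw : p * w = 0 := by rw [← hwq, ← mul_assoc, hpq, zero_mul]
  have hwp0 : star w * p = 0 := by have := congrArg star hpw; simpa [hp.st] using this
  set k : ℕ → C := fun i => c i • p + s i • w with hk
  have hkk : ∀ i, star (k i) * k i = p := fun i => rot_pisom hp hw1 hpw (hcs i)
  have hkn : ∀ i, ‖k i‖ ≤ 1 := fun i => pisom_norm hp (hkk i)
  have hkp : ∀ i, k i * p = k i := fun i => sub_pisom hp (hkk i)
  set e : C := p + q M with he
  have hep : IsProjection e := proj_add hp (hqp M) hpq
  have hek : ∀ i, e * k i = k i := fun i => by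
    simp only [hk, he, add_mul, mul_add, mul_smul_comm, hp.mm, hpw, hwq, mul_swap0 hp (hqp M) hpq]
    simp
  have hke : ∀ i, star (k i) * e = star (k i) := fun i => sub_pisom' (hek i) hep.st
  have hkK : ∀ i, K ≤ i → k i = p := fun i hi => by simp [hk, (hcK i hi).1, (hcK i hi).2]
  have hk0 : k 0 = w := by simp [hk, hc0, hs0]
  -- conjugated blocks
  set E : ℕ → C := fun i => u ^ i * e * star (u ^ i) with hE
  have hEq : ∀ i, E i = q i + q (i + M) := fun i => by
    simp only [hE, he, hq, pow_add, star_mul]; noncomm_ring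
  have hEE : ∀ i ≤ K, ∀ j ≤ K, i ≠ j → E i * E j = 0 := fun i hi j hj hij => by
    rw [hEq, hEq, add_mul, mul_add, mul_add]
    simp only [hq]
    rw [ho i (by omega) j (by omega) hij, ho i (by omega) (j + M) (by omega) (by omega),
      ho (i + M) (by omega) j (by omega) (by omega), ho (i + M) (by omega) (j + M) (by omega) (by omega)]; simp
  have hqE : ∀ i < M, ∀ j < K, i ≠ j → q i * E j = 0 := fun i hi j hj hij => by
    rw [hEq, mul_add]
    simp only [hq]
    rw [ho i (by omega) j (by omega) hij, ho i (by omega) (j + M) (by omega) (by omega)]; simp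
  have hEp : ∀ i, IsProjection (E i) := fun i => by
    refine mkp' ?_ ?_
    · simp only [hE, star_mul, star_star, hep.st, mul_assoc]
    · simp only [hE]
      rw [show u ^ i * e * star (u ^ i) * (u ^ i * e * star (u ^ i)) = u ^ i * (e * (star (u ^ i) * u ^ i) * e) * star (u ^ i) by noncomm_ring,
        hu1, mul_one, hep.mm]
  have hEx : ∀ i x, e * x = x → E i * (u ^ i * x) = u ^ i * x := fun i x hx => by
    simp only [hE]
    rw [show u ^ i * e * star (u ^ i) * (u ^ i * x) = u ^ i * (e * (star (u ^ i) * u ^ i) * x) by noncomm_ring, hu1, mul_one, hx]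
  have horth : ∀ i ≤ K, ∀ j ≤ K, i ≠ j → ∀ x y, e * x = x → e * y = y → star (u ^ i * x) * (u ^ j * y) = 0 := by
    intro i hi j hj hij x y hx hy
    rw [← hEx i x hx, ← hEx j y hy, star_mul, (hEp i).st, mul_assoc, ← mul_assoc (E i), hEE i hi j hj hij]; simp
  set T : ℕ → C := fun i => u ^ i * k i with hT
  have hTT : ∀ i, star (T i) * T i = p := fun i => by
    simp only [hT, star_mul]
    rw [show star (k i) * star (u ^ i) * (u ^ i * k i) = star (k i) * (star (u ^ i) * u ^ i) * k i by noncomm_ring, hu1, mul_one, hkk]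
  have hTp : ∀ i, T i * p = T i := fun i => sub_pisom hp (hTT i)
  have hTn : ∀ i, ‖T i‖ ≤ 1 := fun i => pisom_norm hp (hTT i)
  have hTn' : ∀ i, ‖star (T i)‖ ≤ 1 := fun i => by rw [norm_star]; exact hTn i
  have hTE : ∀ i, E i * T i = T i := fun i => hEx i _ (hek i)
  have hTq : ∀ i, K ≤ i → q i * T i = T i := fun i hi => by
    simp only [hT, hq]; rw [hkK i hi, show u ^ i * p * star (u ^ i) * (u ^ i * p) = u ^ i * (p * (star (u ^ i) * u ^ i) * p) by noncomm_ring, hu1, mul_one, hp.mm]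
  have hTo : ∀ i < M, ∀ j < M, star (T i) * T j = if i = j then p else 0 := by
    intro i hi j hj
    split_ifs with hij
    · rw [hij, hTT]
    · have key : ∀ i < M, ∀ j < M, i ≠ j → K ≤ i → star (T i) * T j = 0 := by
        intro i hi j hj hij h1
        rw [← hTq i h1, star_mul, (hqp i).st]
        by_cases h2 : j < K
        · rw [← hTE j, mul_assoc, ← mul_assoc (q i), hqE i hi j h2 hij]; simp
        · rw [← hTq j (by omega), mul_assoc, ← mul_assoc (q i)]
          have : q i * q j = 0 := ho i (by omega) j (by omega) hij
          rw [this]; simp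
      by_cases h1 : i < K <;> by_cases h2 : j < K
      · exact horth i h1.le j h2.le hij _ _ (hek i) (hek j)
      · have := congrArg star (key j hj i hi (Ne.symm hij) (by omega)); simpa using this
      · exact key i hi j hj hij (by omega)
      · exact key i hi j hj hij (by omega)
  obtain ⟨D, hD, hDm⟩ := Dalg T M hp h0 hfp hTo
  set P := ∑ i ∈ Finset.range M, T i * f * star (T i) with hP
  have hTTsum : ∑ i ∈ Finset.range M, T i * star (T i) ≤ 1 := by
    refine (proj_sum _ _ (fun i _ => pisom_proj hp (hTT i)) fun i hi j hj hij => ?_).le_one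
    rw [mul_assoc, ← mul_assoc (star (T i)), hTo i (Finset.mem_range.1 hi) j (Finset.mem_range.1 hj), if_neg hij]; simp
  -- remainder estimate
  set R : ℕ → C := fun i => u ^ (i + 1) * (k i - k (i + 1)) with hR
  have hRn : ∀ i, ‖R i‖ ≤ 4 / K := fun i => by
    have h1 := rot_lip hp.norm_le hwn (hdc i) (hds i)
    refine (unl (un_norm (hum _)) _).trans ?_
    rw [norm_sub_rev]
    refine h1.trans (le_of_eq (by ring))
  have hR0 : ∀ i, K ≤ i → R i = 0 := fun i hi => by simp only [hR]; rw [hkK i hi, hkK (i + 1) (by omega)]; simp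
  have hRo : ∀ i j, i ≠ j → star (R i) * R j = 0 := fun i j hij => by
    by_cases h1 : i < K
    · by_cases h2 : j < K
      · exact horth (i + 1) h1 (j + 1) h2 (by omega) _ _ (by rw [mul_sub, hek, hek]) (by rw [mul_sub, hek, hek])
      · rw [hR0 j (by omega), mul_zero]
    · rw [hR0 i (by omega)]; simp
  have hest : ∀ (a : ℕ → ℕ) (t : Finset ℕ), (∀ i ∈ t, a i < M) → Set.InjOn a t → ∀ V : C, V ∈ unitary C →
      ‖∑ i ∈ t, V * R i * f * star (T (a i))‖ ≤ 4 / K := by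
    intro a t ha hinj V hV
    refine blk t _ (fun i => T (a i) * star (T (a i))) (by positivity) ?_ ?_ ?_
    · intro i hi j hj hij
      simp only [star_mul, star_star]
      rw [show T (a i) * (star f * (star (R i) * star V)) * (V * R j * f * star (T (a j)))
        = T (a i) * star f * (star (R i) * (star V * V) * R j) * f * star (T (a j)) by noncomm_ring, (Unitary.mem_iff.1 hV).1, mul_one, hRo i j hij]
      simp
    · intro i hi
      refine sq_le_proj (pisom_proj hp (hTT _)) ?_ ?_
      · rw [show V * R i * f * star (T (a i)) * (T (a i) * star (T (a i))) = V * R i * f * ((star (T (a i)) * T (a i)) * star (T (a i))) by noncomm_ring,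
          hTT]
        have := congrArg star (hTp (a i)); rw [star_mul, hp.st] at this
        simp only [mul_assoc, this]
      · exact (unr (hTn' _) _).trans ((unr hf.norm_le _).trans ((unl (un_norm hV) _).trans (hRn i)))
    · refine le_trans ?_ hTTsum
      rw [← Finset.sum_image (f := fun i => T i * star (T i)) (s := t) (g := a) hinj]
      refine Finset.sum_le_sum_of_subset_of_nonneg ?_ fun i _ _ => mul_star_self_nonneg _
      intro i hi
      obtain ⟨j, hj, rfl⟩ := Finset.mem_image.1 hi
      exact Finset.mem_range.2 (ha j hj)
  have hTps : ∀ i, p * star (T i) = star (T i) := fun i => by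
    have := congrArg star (hTp i); rwa [star_mul, hp.st] at this
  obtain ⟨m, rfl⟩ : ∃ m, M = m + 1 := ⟨M - 1, by omega⟩
  have hT0 : T 0 = w := by simp only [hT]; rw [hk0, pow_zero, one_mul]
  have hTm : T m = u ^ m * p := by simp only [hT]; rw [hkK m (by omega)]
  have huR : ∀ i, u * T i = T (i + 1) + R i := fun i => by simp only [hT, hR, pow_succ']; noncomm_ring
  have hsu : star u * u = 1 := (Unitary.mem_iff.1 hu).1
  have hus : u * star u = 1 := (Unitary.mem_iff.1 hu).2
  have huR' : ∀ i, star u * T (i + 1) = T i - star u * R i := fun i => by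
    have : T (i + 1) = u * T i - R i := by rw [huR]; abel
    rw [this, mul_sub, ← mul_assoc, hsu, one_mul]
  refine ⟨D, P, hD, ?_, ?_, ?_, ?_⟩
  · set l : ℕ → C := fun i => (- s i) • p + c i • w with hl
    have hll : ∀ i, star (l i) * l i = p := fun i => rot_pisom hp hw1 hpw (by have := hcs i; nlinarith)
    have hlp : ∀ i, l i * p = l i := fun i => sub_pisom hp (hll i)
    have hpl : ∀ i, p * star (l i) = star (l i) := fun i => by
      have := congrArg star (hlp i); rwa [star_mul, hp.st] at this
    have hpsw : p * star w = star w := by have := congrArg star hwp; rwa [star_mul, hp.st] at this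
    have hkl : ∀ i, k i * star (k i) + l i * star (l i) = e := fun i => by
      have h1 := hcs i
      simp only [hk, hl, star_add, star_smul, hp.st, star_trivial, add_mul, mul_add, smul_mul_smul_comm, hp.mm, hwp, hpsw, he, hw2, hq]
      have h2 : ∀ x : C, x = (c i * c i) • x + (s i * s i) • x := fun x => by
        rw [← add_smul, show c i * c i + s i * s i = 1 by nlinarith, one_smul]
      generalize u ^ (m + 1) * p * star (u ^ (m + 1)) = Q
      conv_rhs => rw [h2 p, h2 Q]
      module
    have hsum : ∑ i ∈ Finset.range (m + 1), T i * star (T i) + ∑ i ∈ Finset.range K, (u ^ i * l i) * star (u ^ i * l i)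
        = ∑ i ∈ Finset.range (m + 1 + K), q i := by
      have h1 : ∀ i, T i * star (T i) + (u ^ i * l i) * star (u ^ i * l i) = q i + q (m + 1 + i) := fun i => by
        rw [add_comm (m + 1) i, ← hEq, hE]
        simp only [hT]
        rw [← hkl i, star_mul, star_mul]; noncomm_ring
      have h2 : ∑ i ∈ Finset.range K, (q i - T i * star (T i)) = ∑ i ∈ Finset.range (m + 1), (q i - T i * star (T i)) := by
        refine Finset.sum_subset (fun i hi => by simp at hi ⊢; omega) fun i _ hi => ?_
        simp only [hT, hq]
        rw [hkK i (by simpa using hi), star_mul, hp.st, show u ^ i * p * (p * star (u ^ i)) = u ^ i * (p * p) * star (u ^ i) by noncomm_ring, hp.mm, sub_self]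
      have h3 : ∑ i ∈ Finset.range K, (u ^ i * l i) * star (u ^ i * l i) = ∑ i ∈ Finset.range K, (q i - T i * star (T i)) + ∑ i ∈ Finset.range K, q (m + 1 + i) := by
        rw [← Finset.sum_add_distrib]
        refine Finset.sum_congr rfl fun i _ => ?_
        have := h1 i
        rw [eq_comm, ← sub_eq_zero] at this ⊢
        rw [← this]; abel
      rw [h3, h2, Finset.sum_sub_distrib, Finset.sum_range_add q (m + 1) K]
      abel
    have h4 : 1 - P = ((1 - ∑ i ∈ Finset.range (m + 1 + K), q i) + ∑ i ∈ Finset.range K, (u ^ i * l i) * star (u ^ i * l i))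
        + ∑ i ∈ Finset.range (m + 1), T i * (p - f) * star (T i) := by
      rw [← hsum]
      simp only [mul_sub, sub_mul, Finset.sum_sub_distrib, hTp, hP]
      abel
    rw [h4]
    have a1 := Sub.sum G hU (Finset.range K) (fun i => (u ^ i * l i) * star (u ^ i * l i)) htp (fun i _ =>
      sp.tra (y := star (u ^ i * l i)) (by rw [star_star]) (by rw [star_mul, ← mul_assoc, hpl]))
    have hpfp : IsProjection (p - f) := proj_sub hf hp hfp
    have a2 := Sub.sum G hU (Finset.range (m + 1)) (fun i => T i * (p - f) * star (T i)) ht0 (fun i _ =>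
      s0.tra (y := (p - f) * star (T i)) (by
        rw [star_mul, star_star, hpfp.st, mul_assoc (T i), ← mul_assoc (p - f), hpfp.mm, ← mul_assoc (T i)]) (by rw [← mul_assoc, hpfp.mm]))
    rw [Finset.card_range] at a1 a2
    exact Sub.add G hU (Sub.add G hU s1 a1 ht1 (by positivity)) a2 (by positivity) (by positivity)
  · intro x ε h
    have hx : ∀ i < m + 1, ∃ d ∈ D0, ‖(star (u ^ i) * x * u ^ i) * f - d‖ ≤ ε := fun i hi => (h i hi).2.2
    choose! d hd1 hd2 using hx
    refine ⟨∑ i ∈ Finset.range (m + 1), T i * d i * star (T i), sum_mem fun i hi => ?_, ?_⟩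
    · have := Finset.mem_range.1 hi
      exact hDm _ (hd1 i this) i this i this
    · rw [hP, Finset.mul_sum, ← Finset.sum_sub_distrib]
      refine (norm_sum_le_of_le (Finset.range (m + 1)) (f := fun i => x * (T i * f * star (T i)) - T i * d i * star (T i)) (n := fun _ => 3 * ε) fun i hi => ?_).trans
        (by rw [Finset.sum_const, Finset.card_range, nsmul_eq_mul])
      have hi' := Finset.mem_range.1 hi
      obtain ⟨b1, b2, -⟩ := h i hi'
      set y := star (u ^ i) * x * u ^ i with hy
      have e1 : x * u ^ i = u ^ i * y := by rw [hy, ← mul_assoc, ← mul_assoc, hu2, one_mul]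
      have e2 : x * (T i * f * star (T i)) - T i * d i * star (T i) = (u ^ i * ((y * k i - k i * y) * f + k i * (y * f - d i))) * star (T i) := by
        have : x * (T i * f * star (T i)) = (x * u ^ i) * k i * f * star (T i) := by simp only [hT]; noncomm_ring
        rw [this, e1]; simp only [hT]; noncomm_ring
      have e3 : y * k i - k i * y = c i • (y * p - p * y) + s i • (y * w - w * y) := by
        simp only [hk, mul_add, add_mul, mul_smul_comm, smul_mul_assoc]; module
      have hε : 0 ≤ ε := (norm_nonneg _).trans b1
      have hc1 : |c i| ≤ 1 := abs_le_one_iff_mul_self_le_one.2 (by nlinarith [hcs i, sq_nonneg (s i)])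
      have hs1 : |s i| ≤ 1 := abs_le_one_iff_mul_self_le_one.2 (by nlinarith [hcs i, sq_nonneg (c i)])
      have n1 : ‖y * k i - k i * y‖ ≤ 2 * ε := by
        rw [e3]; refine (norm_add_le _ _).trans ?_
        rw [norm_smul, norm_smul, Real.norm_eq_abs, Real.norm_eq_abs]
        have := mul_le_mul hc1 b1 (norm_nonneg _) zero_le_one
        have := mul_le_mul hs1 b2 (norm_nonneg _) zero_le_one
        linarith
      show ‖x * (T i * f * star (T i)) - T i * d i * star (T i)‖ ≤ 3 * ε
      rw [e2]
      refine (unr (hTn' i) _).trans ((unl (un_norm (hum i)) _).trans ((norm_add_le _ _).trans ?_))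
      have := (unr hf.norm_le (y * k i - k i * y)).trans n1
      have := (unl (hkn i) (y * f - d i)).trans (hd2 i hi')
      linarith
  · rintro ε ⟨d, hd1, hd2⟩
    refine ⟨∑ i ∈ Finset.range m, T (i + 1) * f * star (T i) + T 0 * d * star (T m), add_mem (sum_mem fun i hi => ?_) ?_, ?_⟩
    · have := Finset.mem_range.1 hi
      exact hDm _ h0.mem _ (by omega) _ (by omega)
    · exact hDm _ hd1 _ (by omega) _ (by omega)
    · have e1 : u * (T m * f * star (T m)) = T 0 * (star w * u ^ (m + 1) * f) * star (T m) := by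
        have : w * star w * u ^ (m + 1) = u ^ (m + 1) * p := by rw [hw2, mul_assoc, hu1, mul_one]
        rw [hT0, show w * (star w * u ^ (m + 1) * f) * star (T m) = (w * star w * u ^ (m + 1)) * f * star (T m) by noncomm_ring, this, mul_assoc _ p f, hpf,
          ← mul_assoc, ← mul_assoc]
        congr 1
        rw [hTm, pow_succ', mul_assoc, mul_assoc, mul_assoc, hpf]
      have e2 : u * P - (∑ i ∈ Finset.range m, T (i + 1) * f * star (T i) + T 0 * d * star (T m))
          = ∑ i ∈ Finset.range m, 1 * R i * f * star (T i) + T 0 * (star w * u ^ (m + 1) * f - d) * star (T m) := by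
        rw [hP, Finset.sum_range_succ, mul_add, e1, Finset.mul_sum]
        have : ∑ i ∈ Finset.range m, u * (T i * f * star (T i)) = ∑ i ∈ Finset.range m, T (i + 1) * f * star (T i) + ∑ i ∈ Finset.range m, 1 * R i * f * star (T i) := by
          rw [← Finset.sum_add_distrib]
          refine Finset.sum_congr rfl fun i _ => ?_
          rw [← mul_assoc, ← mul_assoc, huR]; noncomm_ring
        rw [this]; noncomm_ring
      rw [e2]
      refine (norm_add_le _ _).trans (add_le_add (hest (fun i => i) _ (fun i hi => by have := Finset.mem_range.1 hi; omega) (fun i _ j _ h => h) 1 (one_mem _)) ?_)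
      exact (unr (hTn' m) _).trans ((unl (hTn 0) _).trans hd2)
  · rintro ε ⟨d, hd1, hd2⟩
    refine ⟨∑ i ∈ Finset.range m, T i * f * star (T (i + 1)) + T m * d * star (T 0), add_mem (sum_mem fun i hi => ?_) ?_, ?_⟩
    · have := Finset.mem_range.1 hi
      exact hDm _ h0.mem _ (by omega) _ (by omega)
    · exact hDm _ hd1 _ (by omega) _ (by omega)
    · have e1 : star u * (T 0 * f * star (T 0)) = T m * (star (u ^ (m + 1)) * w * f) * star (T 0) := by
        have : star u * w = u ^ m * p * star (u ^ (m + 1)) * w := by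
          conv_lhs => rw [← hwq]
          simp only [hq]
          rw [show star u * (u ^ (m + 1) * p * star (u ^ (m + 1)) * w) = (star u * u ^ (m + 1)) * p * star (u ^ (m + 1)) * w by noncomm_ring,
            show star u * u ^ (m + 1) = u ^ m by rw [pow_succ', ← mul_assoc, hsu, one_mul]]
        rw [hTm, hT0, show star u * (w * f * star w) = (star u * w) * f * star w by noncomm_ring, this]; noncomm_ring
      have e2 : star u * P - (∑ i ∈ Finset.range m, T i * f * star (T (i + 1)) + T m * d * star (T 0))
          = -(∑ i ∈ Finset.range m, star u * R i * f * star (T (i + 1))) + T m * (star (u ^ (m + 1)) * w * f - d) * star (T 0) := by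
        rw [hP, Finset.sum_range_succ', mul_add, e1, Finset.mul_sum]
        have : ∑ i ∈ Finset.range m, star u * (T (i + 1) * f * star (T (i + 1))) = ∑ i ∈ Finset.range m, T i * f * star (T (i + 1)) - ∑ i ∈ Finset.range m, star u * R i * f * star (T (i + 1)) := by
          rw [← Finset.sum_sub_distrib]
          refine Finset.sum_congr rfl fun i _ => ?_
          rw [← mul_assoc, ← mul_assoc, huR']; noncomm_ring
        rw [this]; noncomm_ring
      rw [e2]
      refine (norm_add_le _ _).trans ?_
      rw [norm_neg]
      refine add_le_add (hest (fun i => i + 1) _ (fun i hi => by have := Finset.mem_range.1 hi; omega) (fun i _ j _ h => by simpa using h) (star u) (Unitary.star_mem hu)) ?_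
      exact (unr (hTn' 0) _).trans ((unl (hTn m) _).trans hd2)

end
end RK

namespace RK
set_option linter.all false

section
variable {A : Type*} [CStarAlgebra A] [PartialOrder A] [StarOrderedRing A] {τ : A →ₗ[ℂ] ℂ}
variable {C : Type*} [CStarAlgebra C] [PartialOrder C] [StarOrderedRing C] {ι : A →⋆ₐ[ℂ] C}

theorem FDU.closed {D : NonUnitalStarSubalgebra ℂ C} {P : C} (h : FDU D P) : IsClosed (D : Set C) := by
  haveI := h.fd
  exact Submodule.closed_of_finiteDimensional D.toNonUnitalSubalgebra.toSubmodule

theorem corner {D1 : NonUnitalStarSubalgebra ℂ C} {P e : C} (h : FDU D1 P) (he : IsProjection e) (hm : e ∈ D1) :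
    ∃ D : NonUnitalStarSubalgebra ℂ C, FDU D e ∧ ∀ d ∈ D1, e * d * e ∈ D := by
  let D : NonUnitalStarSubalgebra ℂ C :=
    { carrier := {x | e * x = x ∧ x * e = x ∧ x ∈ D1}
      add_mem' := fun {x y} hx hy => ⟨by rw [mul_add, hx.1, hy.1], by rw [add_mul, hx.2.1, hy.2.1], add_mem hx.2.2 hy.2.2⟩
      zero_mem' := ⟨by simp, by simp, zero_mem _⟩
      mul_mem' := fun {x y} hx hy => ⟨by rw [← mul_assoc, hx.1], by rw [mul_assoc, hy.2.1], mul_mem hx.2.2 hy.2.2⟩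
      smul_mem' := fun c x hx => ⟨by rw [mul_smul_comm, hx.1], by rw [smul_mul_assoc, hx.2.1], SMulMemClass.smul_mem c hx.2.2⟩
      star_mem' := fun {x} hx => ⟨by have := congrArg star hx.2.1; rwa [star_mul, he.st] at this,
        by have := congrArg star hx.1; rwa [star_mul, he.st] at this, star_mem hx.2.2⟩ }
  refine ⟨D, ⟨?_, he, ⟨he.mm, he.mm, hm⟩, fun b hb => ⟨hb.1, hb.2.1⟩⟩, fun d hd => ⟨?_, ?_, mul_mem (mul_mem hm hd) hm⟩⟩
  · haveI : FiniteDimensional ℂ D1.toNonUnitalSubalgebra.toSubmodule := h.fd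
    exact Submodule.finiteDimensional_of_le (S₁ := D.toNonUnitalSubalgebra.toSubmodule) (S₂ := D1.toNonUnitalSubalgebra.toSubmodule) fun x hx => hx.2.2
  · rw [← mul_assoc, ← mul_assoc, he.mm]
  · rw [mul_assoc, he.mm]

theorem cutdown {D1 : NonUnitalStarSubalgebra ℂ C} {P p : C} (h1 : FDU D1 P) (hp : IsProjection p) {δ t : ℝ} (hδ : 0 < δ) (hδ1 : δ ≤ 1 / 1200)
    (hA : Ap D1 P p δ) (s : Sub ι τ (1 - P) t) :
    ∃ (D0 : NonUnitalStarSubalgebra ℂ C) (f : C), FDU D0 f ∧ f * p = f ∧ Sub ι τ (p - f) t ∧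
      ∀ x, ‖x‖ ≤ 1 → Ap D1 P x δ → ‖x * p - p * x‖ ≤ δ → Ap D0 f x (3000 * δ) := by
  have hP := h1.pr
  obtain ⟨d, hd1, hd2⟩ := hA
  have b1 : ‖P * p * P - d‖ ≤ δ := by
    rw [show P * p * P - d = P * (p * P - d) by rw [mul_sub, (h1.un d hd1).1]; noncomm_ring]
    exact (unl hP.norm_le _).trans hd2
  have b2 : ‖p * P - P * p * P‖ ≤ 2 * δ := by
    rw [show p * P - P * p * P = (p * P - d) - (P * p * P - d) by abel]
    exact (norm_sub_le _ _).trans (by linarith)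
  have b3 : ‖P * p - P * p * P‖ ≤ 2 * δ := by
    rw [← norm_star, star_sub]; simpa [hP.st, hp.st, mul_assoc] using b2
  have b4 : ‖p * P - P * p‖ < 5 * δ := by
    rw [show p * P - P * p = (p * P - P * p * P) - (P * p - P * p * P) by abel]
    exact (norm_sub_le _ _).trans_lt (by linarith)
  obtain ⟨p1, p2, pa, pb, pc, pd, pe, -, pg⟩ := split_proj hP hp D1 h1.closed h1.un (ε := 5 * δ) (by linarith) b4 hd1 (by linarith)
  have hpp : IsProjection (p1 + p2) := proj_add pa pb pd
  obtain ⟨U, U1, U2, U3⟩ := close_unitary hpp hp (δ := 100 * δ) (by linarith) (by rw [norm_sub_rev]; linarith)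
  have hU1 := (Unitary.mem_iff.1 U1).1
  have hU2 := (Unitary.mem_iff.1 U1).2
  have hpU : p = U * (p1 + p2) * star U := by rw [U3, mul_assoc, hU2, mul_one]
  obtain ⟨D', hD', hm'⟩ := corner h1 pa pc
  obtain ⟨D0, hD0, hm0⟩ := Dalg (fun _ => U) 1 proj_one hD' (mul_one _) (fun i hi j hj => by
    rw [hU1, if_pos (by omega)])
  rw [Finset.sum_range_one] at hD0
  have pd' := mul_swap0 pa pb pd
  have hp2P : p2 * P = 0 := by
    have := congrArg star pe
    rw [star_mul, pb.st, star_sub, star_one, hP.st, mul_sub, mul_one] at this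
    simpa using this
  refine ⟨D0, U * p1 * star U, hD0, ?_, ?_, ?_⟩
  · rw [hpU, show U * p1 * star U * (U * (p1 + p2) * star U) = U * (p1 * (star U * U) * (p1 + p2)) * star U by noncomm_ring, hU1, mul_one, mul_add, pa.mm, pd, add_zero]
  · refine s.tra (y := p2 * star U) ?_ (by rw [← mul_assoc, pe])
    conv_rhs => rw [hpU]
    rw [star_mul, star_star, pb.st, show U * p2 * (p2 * star U) = U * (p2 * p2) * star U by noncomm_ring, pb.mm]; noncomm_ring
  · rintro x hx ⟨a, ha1, ha2⟩ hxp
    refine ⟨U * (p1 * a * p1) * star U, hm0 _ (hm' _ ha1) 0 (by omega) 0 (by omega), ?_⟩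
    have n1 := pa.norm_le
    have hP1 : P * p1 = p1 := (h1.un _ pc).1
    have c1 : ‖(x * P - a) * p1‖ ≤ δ := (unr n1 _).trans ha2
    have c1' : ‖(p1 + p2) * ((x * P - a) * p1)‖ ≤ δ := (unl hpp.norm_le _).trans c1
    have c2 : ‖x * ((p1 + p2 - p) * p1)‖ ≤ 100 * δ := (unl hx _).trans ((unr n1 _).trans (by rw [norm_sub_rev]; linarith))
    have c3 : ‖(x * p - p * x) * p1‖ ≤ δ := (unr n1 _).trans hxp
    have c4 : ‖(p - (p1 + p2)) * (x * p1)‖ ≤ 100 * δ := (norm_mul_le _ _).trans (by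
      have : ‖x * p1‖ ≤ 1 := (unr n1 _).trans hx
      have := mul_le_mul pg this (norm_nonneg _) (by linarith)
      linarith)
    have c5 : x * p1 - p1 * a * p1 = x * ((p1 + p2 - p) * p1) + (x * p - p * x) * p1 + (p - (p1 + p2)) * (x * p1) + (p1 + p2) * ((x * P - a) * p1) := by
      have e1 : (p1 + p2) * p1 = p1 := by rw [add_mul, pa.mm, pd', add_zero]
      have e2 : (p1 + p2) * ((x * P - a) * p1) = (p1 + p2) * x * p1 - p1 * a * p1 := by
        rw [sub_mul, mul_assoc x, hP1, mul_sub, ← mul_assoc, ← mul_assoc, add_mul p1 p2 a]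
        congr 2
        rw [← (h1.un a ha1).1, ← mul_assoc p2, hp2P, zero_mul, add_zero]
      rw [e2, sub_mul (p1 + p2), e1]; noncomm_ring
    have c6 : ‖x * p1 - p1 * a * p1‖ ≤ 202 * δ := by
      rw [c5]; exact (norm_add_le _ _).trans (by linarith [norm_add₃_le (a := x * ((p1 + p2 - p) * p1)) (b := (x * p - p * x) * p1) (c := (p - (p1 + p2)) * (x * p1))])
    have c7 : x * (U * p1 * star U) - U * (p1 * a * p1) * star U = ((x * (U - 1) - (U - 1) * x) * p1 + U * (x * p1 - p1 * a * p1)) * star U := by noncomm_ring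
    rw [c7]
    refine (unr (un_norm' U1) _).trans ((norm_add_le _ _).trans ?_)
    have d1 := (unr n1 (x * (U - 1) - (U - 1) * x)).trans (norm_sub_le _ _)
    have d2 := unl hx (U - 1)
    have d3 := unr hx (U - 1)
    have d4 := (unl (un_norm U1) (x * p1 - p1 * a * p1))
    linarith
end
end RK

namespace RK
set_option linter.all false

section
variable {A : Type*} [CStarAlgebra A] [PartialOrder A] [StarOrderedRing A] {τ : A →ₗ[ℂ] ℂ}
variable {C : Type*} [CStarAlgebra C] [PartialOrder C] [StarOrderedRing C] {ι : A →⋆ₐ[ℂ] C}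

theorem Ap.mono {D : NonUnitalStarSubalgebra ℂ C} {P x : C} {a b : ℝ} (h : Ap D P x a) (hab : a ≤ b) : Ap D P x b := by
  obtain ⟨d, h1, h2⟩ := h
  exact ⟨d, h1, h2.trans hab⟩

theorem Ap.near {D : NonUnitalStarSubalgebra ℂ C} {P x y : C} {a b : ℝ} (h : Ap D P x a) (hD : FDU D P) (hxy : ‖y - x‖ ≤ b) : Ap D P y (a + b) := by
  obtain ⟨d, h1, h2⟩ := h
  refine ⟨d, h1, ?_⟩
  rw [show y * P - d = (x * P - d) + (y - x) * P by noncomm_ring]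
  exact (norm_add_le _ _).trans (add_le_add h2 ((unr hD.pr.norm_le _).trans hxy))

theorem iota_le (ι : A →⋆ₐ[ℂ] C) (x : A) : ‖ι x‖ ≤ ‖x‖ := NonUnitalStarAlgHom.norm_apply_le ι x

theorem iota_un (ι : A →⋆ₐ[ℂ] C) {U : A} (h : U ∈ unitary A) : ι U ∈ unitary C := by
  obtain ⟨h1, h2⟩ := Unitary.mem_iff.1 h
  exact Unitary.mem_iff.2 ⟨by rw [← map_star, ← map_mul, h1, map_one], by rw [← map_star, ← map_mul, h2, map_one]⟩

theorem cov_pow {γ : A ≃⋆ₐ[ℂ] A} {z : C} (h : ∀ a, z * ι a * star z = ι (γ a)) (i : ℕ) (a : A) :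
    z ^ i * ι a * star (z ^ i) = ι ((γ ^ i) a) := by
  induction i generalizing a with
  | zero => simp
  | succ i ih =>
    rw [pow_succ', star_mul, show z * z ^ i * ι a * (star (z ^ i) * star z) = z * (z ^ i * ι a * star (z ^ i)) * star z by noncomm_ring, ih, h, pow_succ_apply]

theorem cov_inv {γ : A ≃⋆ₐ[ℂ] A} {z : C} (hz : z ∈ unitary C) (h : ∀ a, z * ι a * star z = ι (γ a)) (i : ℕ) (a : A) :
    star (z ^ i) * ι ((γ ^ i) a) * z ^ i = ι a := by
  have h1 : star (z ^ i) * z ^ i = 1 := (Unitary.mem_iff.1 (pow_mem hz i)).1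
  rw [← cov_pow h, show star (z ^ i) * (z ^ i * ι a * star (z ^ i)) * z ^ i = (star (z ^ i) * z ^ i) * ι a * (star (z ^ i) * z ^ i) by noncomm_ring, h1]; simp

theorem cov_adj {γ : A ≃⋆ₐ[ℂ] A} {z : C} (h : ∀ a, z * ι a * star z = ι (γ a)) {W : A} (hW : W ∈ unitary A) (a : A) :
    (ι W * z) * ι a * star (ι W * z) = ι (adj W hW γ a) := by
  rw [adj_apply, star_mul, show ι W * z * ι a * (star z * star (ι W)) = ι W * (z * ι a * star z) * star (ι W) by noncomm_ring, h, map_mul, map_mul, map_star]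

theorem tower (G : Good τ) {α : A ≃⋆ₐ[ℂ] A} (hU : PUO α) (ι : A →⋆ₐ[ℂ] C) {γ : A ≃⋆ₐ[ℂ] A} {g : A} (hg : IsProjection g) {N : ℕ}
    (ho : ∀ i ≤ N, ∀ j ≤ N, i ≠ j → (γ ^ i) g * (γ ^ j) g = 0) :
    (N + 1) * tr τ g ≤ 1 ∧ Sub ι τ (1 - ∑ i ∈ Finset.range N, ι ((γ ^ i) g)) (1 - N * tr τ g) := by
  have hp : ∀ i, IsProjection ((γ ^ i) g) := fun i => aut_proj _ hg
  have key : ∀ n ≤ N + 1, IsProjection (∑ i ∈ Finset.range n, (γ ^ i) g) ∧ tr τ (∑ i ∈ Finset.range n, (γ ^ i) g) = n * tr τ g := by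
    intro n hn
    refine ⟨proj_sum _ _ (fun i _ => hp i) fun i hi j hj hij => ?_, ?_⟩
    · have := Finset.mem_range.1 hi; have := Finset.mem_range.1 hj
      exact ho i (by omega) j (by omega) hij
    · rw [tr_sum, Finset.sum_congr rfl fun i _ => G.inv (γ ^ i) g, Finset.sum_const, Finset.card_range, nsmul_eq_mul]
  constructor
  · have := tr_mono G.htr (key (N + 1) le_rfl).1.le_one
    rw [(key _ le_rfl).2, tr_one G.htr] at this
    exact_mod_cast this
  · have := Sub.of G hU ι (key N (by omega)).1.one_sub
    rwa [tr_sub, tr_one G.htr, (key N (by omega)).2, map_sub, map_one, map_sum] at this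

theorem FDU_map (ι : A →⋆ₐ[ℂ] C) {n : ℕ} (m : MUS A (Fin n)) : ∃ D : NonUnitalStarSubalgebra ℂ C, FDU D (ι m.unit) ∧ ∀ b ∈ m.Sp, ι b ∈ D := by
  refine ⟨m.alg.map (ι : A →⋆ₙₐ[ℂ] C), ⟨?_, iota_proj ι m.unit_proj, ⟨m.unit, m.unit_mem, rfl⟩, ?_⟩, fun b hb => ⟨b, hb, rfl⟩⟩
  · haveI : FiniteDimensional ℂ m.alg.toNonUnitalSubalgebra.toSubmodule := m.fd
    have : FiniteDimensional ℂ (m.alg.toNonUnitalSubalgebra.toSubmodule.map (ι : A →ₗ[ℂ] C)) := inferInstance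
    exact this
  · rintro _ ⟨b, hb, rfl⟩
    constructor
    · show ι m.unit * ι b = ι b
      rw [← map_mul, m.unit_mul hb]
    · show ι b * ι m.unit = ι b
      rw [← map_mul, m.mul_unit hb]

set_option maxHeartbeats 1000000 in
theorem L2 (G : Good τ) (ι : A →⋆ₐ[ℂ] C) {δ t : ℝ} (hδ : 0 < δ) (ht : 0 < t) : ∃ κ : ℝ, 0 < κ ∧
    ∀ (γ : A ≃⋆ₐ[ℂ] A), PUO γ → ∀ z ∈ unitary C, (∀ a, z * ι a * star z = ι (γ a)) → ∀ Y : Finset A,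
      (∀ y ∈ Y, ‖y‖ ≤ 1 ∧ ‖γ y - y‖ ≤ κ) → ∃ (D : NonUnitalStarSubalgebra ℂ C) (P : C), FDU D P ∧ (∀ y ∈ Y, Ap D P (ι y) δ) ∧
        Ap D P z δ ∧ Ap D P (star z) δ ∧ Sub ι τ (1 - P) t := by
  classical
  obtain ⟨K, hK⟩ := exists_nat_gt (8 / δ)
  have hK0 : (0:ℝ) < K := lt_trans (by positivity) hK
  have hK1 : 1 ≤ K := by exact_mod_cast hK0
  have hK2 : 4 / (K:ℝ) ≤ δ / 2 := by
    rw [div_lt_iff₀ hδ] at hK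
    rw [div_le_iff₀ hK0]; linarith
  obtain ⟨M0, hM0⟩ := exists_nat_gt (2 * (K + 1) / t)
  set M := max M0 (K + 1) with hM
  have hM1 : K < M := by have := le_max_right M0 (K + 1); omega
  have hM2 : (2 * (K + 1) / t : ℝ) < M := hM0.trans_le (by exact_mod_cast le_max_left _ _)
  have hMr : (1:ℝ) ≤ M := by exact_mod_cast (show 1 ≤ M by omega)
  clear_value M
  set κ := min (t / 2) (δ / (40 * M ^ 2)) with hκ
  have hκ0 : 0 < κ := by positivity
  have hκ1 : κ ≤ t / 2 := min_le_left _ _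
  have hκ2 : 40 * M ^ 2 * κ ≤ δ := by
    have : κ ≤ δ / (40 * M ^ 2) := min_le_right _ _
    rw [le_div_iff₀ (by positivity)] at this; linarith
  have hMM : (M:ℝ) ≤ M ^ 2 := by nlinarith
  refine ⟨κ, hκ0, ?_⟩
  intro γ hU z hz hcov Y hY
  obtain ⟨n, m, W, hW, q, o1, o2, o3, -, o5, q0, -, o7, o8⟩ := OT G hU (M + K) Y hκ0
  set g := m.unit with hg
  have hgp : IsProjection g := m.unit_proj
  set γ' := adj W hW γ with hγ'
  set z' := ι W * z with hz'
  have hz'u : z' ∈ unitary C := mul_mem (iota_un ι hW) hz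
  have hcov' : ∀ a, z' * ι a * star z' = ι (γ' a) := cov_adj hcov hW
  have hq : ∀ i ≤ M + K, q i = (γ' ^ i) g := by
    intro i hi
    induction i with
    | zero => rw [q0]; simp
    | succ i ih => rw [← o8 i (by omega), ih (by omega), pow_succ_apply, ← adj_apply hW]
  have ho : ∀ i ≤ M + K, ∀ j ≤ M + K, i ≠ j → (γ' ^ i) g * (γ' ^ j) g = 0 := fun i hi j hj hij => by
    rw [← hq i hi, ← hq j hj]; exact o7 i hi j hj hij
  obtain ⟨t1, t2⟩ := tower G hU ι hgp ho
  obtain ⟨D0, hD0, hm0⟩ := FDU_map ι m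
  have htg : 0 ≤ tr τ g := tr_nonneg G.htr hgp.nonneg
  push_cast at t1 t2 o5
  have hzi : ∀ i, star (z' ^ i) * z' ^ i = 1 := fun i => (Unitary.mem_iff.1 (pow_mem hz'u i)).1
  obtain ⟨D, P, hD, hS, hx, hu1, hu2⟩ := berg2 (ι := ι) G hU (u := z') (p := ι g) (w := z' ^ M * ι g) (f := ι g) (M := M) (K := K) hz'u hK1 hM1
    (iota_proj ι hgp) hD0 (iota_proj ι hgp).mm
    (fun i hi j hj hij => by rw [cov_pow hcov', cov_pow hcov', ← map_mul, ho i hi j hj hij, map_zero])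
    (by rw [star_mul, show star (ι g) * star (z' ^ M) * (z' ^ M * ι g) = star (ι g) * (star (z' ^ M) * z' ^ M) * ι g by noncomm_ring, hzi, mul_one, (iota_proj ι hgp).st, (iota_proj ι hgp).mm])
    (by rw [star_mul, show z' ^ M * ι g * (star (ι g) * star (z' ^ M)) = z' ^ M * (ι g * star (ι g)) * star (z' ^ M) by noncomm_ring, (iota_proj ι hgp).st, (iota_proj ι hgp).mm])
    (t0 := 0) (t1 := 1 - (M + K) * tr τ g) (tp := tr τ g) le_rfl (by linarith) htg (by rw [sub_self]; exact Sub.zero)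
    (by simp only [cov_pow hcov']; exact t2) (Sub.of G hU ι hgp)
  have hwz : star (z' ^ M * ι g) * z' ^ M = ι g := by
    rw [star_mul, mul_assoc, hzi, mul_one, (iota_proj ι hgp).st]
  have hzw : star (z' ^ M) * (z' ^ M * ι g) = ι g := by rw [← mul_assoc, hzi, one_mul]
  have hAg : Ap D0 (ι g) (ι g) 0 := ⟨ι g, hm0 _ m.unit_mem, by rw [(iota_proj ι hgp).mm]; simp⟩
  have hzz : ‖z - z'‖ ≤ κ := by
    rw [hz', show z - ι W * z = -(ι (W - 1) * z) by rw [map_sub, map_one]; noncomm_ring, norm_neg]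
    exact (unr (un_norm hz) _).trans ((iota_le ι _).trans o1.le)
  have hzz' : ‖star z - star z'‖ ≤ κ := by rw [← star_sub, norm_star]; exact hzz
  have hκδ : κ ≤ δ / 2 := by nlinarith
  refine ⟨D, P, hD, ?_, ?_, ?_, ?_⟩
  · intro y hy
    obtain ⟨hy1, hy2⟩ := hY y hy
    have e1 : ‖γ' y - y‖ ≤ 3 * κ := by
      have h1 := conj_near hW (γ y)
      rw [← adj_apply hW γ y] at h1
      have h2 : ‖γ y‖ ≤ 1 := by rw [nA]; exact hy1
      have h3 : ‖γ' y - γ y‖ ≤ 2 * κ := by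
        refine h1.trans ?_
        have := mul_le_mul o1.le h2 (norm_nonneg _) hκ0.le
        linarith
      rw [show γ' y - y = (γ' y - γ y) + (γ y - y) by abel]
      exact (norm_add_le _ _).trans (by linarith)
    have e2 : ∀ i : ℕ, ‖star (z' ^ i) * ι y * z' ^ i - ι y‖ ≤ i * (3 * κ) := by
      intro i
      induction i with
      | zero => simp
      | succ i ih =>
        have : star (z' ^ (i + 1)) * ι y * z' ^ (i + 1) - ι y = (star (z' ^ i) * ι y * z' ^ i - ι y) + star (z' ^ (i + 1)) * (ι (y - γ' y)) * z' ^ (i + 1) := by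
          have h1 : star (z' ^ (i + 1)) * ι (γ' y) * z' ^ (i + 1) = star (z' ^ i) * ι y * z' ^ i := by
            rw [← hcov', pow_succ', star_mul, show star (z' ^ i) * star z' * (z' * ι y * star z') * (z' * z' ^ i) = star (z' ^ i) * ((star z' * z') * ι y * (star z' * z')) * z' ^ i by noncomm_ring, (Unitary.mem_iff.1 hz'u).1]; simp
          rw [map_sub, mul_sub, sub_mul, h1]; abel
        rw [this]
        refine (norm_add_le _ _).trans ?_
        have h2 := (unr (un_norm (pow_mem hz'u (i + 1))) (star (z' ^ (i + 1)) * (ι (y - γ' y)))).trans ((unl (un_norm' (pow_mem hz'u (i + 1))) _).trans ((iota_le ι _).trans ((norm_sub_rev _ _).trans_le e1)))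
        push_cast; linarith
    have e2' : ∀ i : ℕ, ∀ j : ℕ, i ≤ j → ‖star (z' ^ i) * ι y * z' ^ i - ι y‖ ≤ j * (3 * κ) := fun i j hij => (e2 i).trans (by gcongr)
    have e3 : ‖ι y * ι g - ι g * ι y‖ ≤ κ := by
      rw [← map_mul, ← map_mul, ← map_sub]; exact (iota_le ι _).trans (o2 y hy).le
    have ng := (iota_proj ι hgp).norm_le
    have gen : ∀ a b : C, ∀ s t' : ℝ, ‖a - ι y‖ ≤ s → ‖b - ι y‖ ≤ t' → ‖a * ι g - ι g * b‖ ≤ s + t' + κ := by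
      intro a b s t' ha hb
      rw [show a * ι g - ι g * b = (a - ι y) * ι g - ι g * (b - ι y) + (ι y * ι g - ι g * ι y) by noncomm_ring]
      refine (norm_add_le _ _).trans (add_le_add ((norm_sub_le _ _).trans (add_le_add ((unr ng _).trans ha) ((unl ng _).trans hb))) e3)
    have hMκ : κ ≤ M * κ := by nlinarith
    refine (hx (ι y) (11 * M * κ) fun i hi => ⟨?_, ?_, ?_⟩).mono (by nlinarith)
    · refine (gen _ _ _ _ (e2' i M hi.le) (e2' i M hi.le)).trans (by nlinarith)
    · set a := star (z' ^ i) * ι y * z' ^ i with ha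
      have h1 : a * (z' ^ M * ι g) - z' ^ M * ι g * a = z' ^ M * ((star (z' ^ (i + M)) * ι y * z' ^ (i + M)) * ι g - ι g * a) := by
        have h2 : z' ^ M * (star (z' ^ (i + M)) * ι y * z' ^ (i + M)) = a * z' ^ M := by
          rw [pow_add, star_mul, show z' ^ M * (star (z' ^ M) * star (z' ^ i) * ι y * (z' ^ i * z' ^ M)) = (z' ^ M * star (z' ^ M)) * (star (z' ^ i) * ι y * z' ^ i) * z' ^ M by noncomm_ring, (Unitary.mem_iff.1 (pow_mem hz'u M)).2, one_mul]
        rw [mul_sub, ← mul_assoc (z' ^ M) _ (ι g), h2]; noncomm_ring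
      rw [h1]
      refine (unl (un_norm (pow_mem hz'u M)) _).trans ((gen _ _ _ _ (e2' (i + M) (2 * M) (by omega)) (e2' i M hi.le)).trans ?_)
      push_cast; nlinarith
    · obtain ⟨b, hb1, hb2⟩ := o3 y hy
      have h1 : Ap D0 (ι g) (ι y) (2 * κ) := by
        refine ⟨ι b, hm0 _ hb1, ?_⟩
        rw [← map_mul, ← map_sub]
        refine (iota_le ι _).trans ?_
        rw [show y * g - b = (y * g - g * y) * g + (g * y * g - b) by rw [sub_mul, mul_assoc y, hgp.mm]; noncomm_ring]
        have := (unr hgp.norm_le (y * g - g * y)).trans (o2 y hy).le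
        exact (norm_add_le _ _).trans (by linarith)
      exact (h1.near hD0 (e2' i M hi.le)).mono (by nlinarith)
  · exact ((hu1 0 (by rw [hwz]; exact hAg)).near hD hzz).mono (by linarith)
  · exact ((hu2 0 (by rw [hzw]; exact hAg)).near hD hzz').mono (by linarith)
  · refine hS.mono ?_
    have h1 : (K + 1) * tr τ g ≤ t / 2 := by
      have h2 : 2 * (K + 1) < M * t := by rwa [div_lt_iff₀ ht] at hM2
      have h3 : M * tr τ g ≤ 1 := by nlinarith
      nlinarith
    nlinarith
end
end RK

namespace RK
set_option linter.all false

section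
variable {A : Type*} [CStarAlgebra A] [PartialOrder A] [StarOrderedRing A] {τ : A →ₗ[ℂ] ℂ}
variable {C : Type*} [CStarAlgebra C] [PartialOrder C] [StarOrderedRing C] {ι : A →⋆ₐ[ℂ] C}

theorem Ap.near' {D : NonUnitalStarSubalgebra ℂ C} {P x y : C} {a b : ℝ} (h : Ap D P x a) (hxy : ‖(y - x) * P‖ ≤ b) : Ap D P y (a + b) := by
  obtain ⟨d, h1, h2⟩ := h
  refine ⟨d, h1, ?_⟩
  rw [show y * P - d = (x * P - d) + (y - x) * P by noncomm_ring]
  exact (norm_add_le _ _).trans (add_le_add h2 hxy)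

theorem Ap.mul {D : NonUnitalStarSubalgebra ℂ C} {P x y : C} {a b : ℝ} (hD : FDU D P) (hx : Ap D P x a) (hy : Ap D P y b) :
    Ap D P (x * y) (‖x‖ * b + a * (‖y‖ + b)) := by
  obtain ⟨d, h1, h2⟩ := hx
  obtain ⟨e, h3, h4⟩ := hy
  refine ⟨d * e, mul_mem h1 h3, ?_⟩
  have he : ‖e‖ ≤ ‖y‖ + b := by
    rw [show e = y * P - (y * P - e) by abel]
    exact (norm_sub_le _ _).trans (add_le_add (unr hD.pr.norm_le _) h4)
  rw [show x * y * P - d * e = x * (y * P - e) + (x * P - d) * e by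
    rw [sub_mul, mul_assoc x P e, (hD.un e h3).1]; noncomm_ring]
  refine (norm_add_le _ _).trans (add_le_add ((norm_mul_le _ _).trans (by gcongr)) ((norm_mul_le _ _).trans ?_))
  exact mul_le_mul h2 he (norm_nonneg _) ((norm_nonneg _).trans h2)

set_option maxHeartbeats 2000000 in
theorem ML (G : Good τ) {α : A ≃⋆ₐ[ℂ] A} (hU : PUO α) {r : ℕ} (hr : 1 ≤ r) (hai : ApproxInner ((⇑α)^[r])) (ι : A →⋆ₐ[ℂ] C) {u : C} (hu : u ∈ unitary C)
    (hcov : ∀ a, u * ι a * star u = ι (α a)) (Y0 : Finset A) (hY0 : ∀ y ∈ Y0, ‖y‖ ≤ 1) {δ t : ℝ} (hδ : 0 < δ) (ht : 0 < t) :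
    ∃ (D : NonUnitalStarSubalgebra ℂ C) (P : C), FDU D P ∧ (∀ y ∈ Y0, Ap D P (ι y) δ) ∧ Ap D P u δ ∧ Ap D P (star u) δ ∧ Sub ι τ (1 - P) t := by
  classical
  obtain ⟨K, hK⟩ := exists_nat_gt (16 / δ)
  have hK0 : (0:ℝ) < K := lt_trans (by positivity) hK
  have hK1 : 1 ≤ K := by exact_mod_cast hK0
  have hK2 : 4 / (K:ℝ) ≤ δ / 4 := by
    rw [div_lt_iff₀ hδ] at hK
    rw [div_le_iff₀ hK0]; linarith
  obtain ⟨M0, hM0⟩ := exists_nat_gt (4 * (K + 1) / t)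
  set L := max M0 (K + 1) with hL
  obtain ⟨M, hM⟩ : ∃ M, M = r * L := ⟨_, rfl⟩
  have hLM : L ≤ M := by rw [hM]; exact Nat.le_mul_of_pos_left _ hr
  have hM1 : K < M := by have := le_max_right M0 (K + 1); omega
  have hM2 : (4 * (K + 1) / t : ℝ) < M := hM0.trans_le (by exact_mod_cast (le_max_left M0 (K + 1)).trans hLM)
  have hMr : (1:ℝ) ≤ M := by exact_mod_cast (show 1 ≤ M by omega)
  have hMM : (M:ℝ) ≤ M ^ 2 := by nlinarith
  set δ' := min (1 / 1200) (δ / (40000 * M)) with hδ'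
  have hδ0 : 0 < δ' := by positivity
  have hδ1 : δ' ≤ 1 / 1200 := min_le_left _ _
  have hδ2 : 40000 * M * δ' ≤ δ := by
    have : δ' ≤ δ / (40000 * M) := min_le_right _ _
    rw [le_div_iff₀ (by positivity)] at this; linarith
  have hδ3 : 40000 * δ' ≤ δ := by nlinarith
  set t' := t / (4 * M) with ht'
  have ht0 : 0 < t' := by positivity
  have hMt : M * t' = t / 4 := by rw [ht']; field_simp
  obtain ⟨κ, hκ0, hL2⟩ := L2 (τ := τ) G ι hδ0 ht0
  obtain ⟨η, hη0, η1, η2, η3, η4⟩ : ∃ η : ℝ, 0 < η ∧ η ≤ κ ∧ η ≤ δ' ∧ η ≤ t / 4 ∧ 100 * M ^ 2 * η ≤ δ := by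
    refine ⟨min (min κ δ') (min (t / 4) (δ / (100 * M ^ 2))), by positivity, ?_, ?_, ?_, ?_⟩
    · exact (min_le_left _ _).trans (min_le_left _ _)
    · exact (min_le_left _ _).trans (min_le_right _ _)
    · exact (min_le_right _ _).trans (min_le_left _ _)
    · have : min (min κ δ') (min (t / 4) (δ / (100 * M ^ 2))) ≤ δ / (100 * M ^ 2) := (min_le_right _ _).trans (min_le_right _ _)
      rw [le_div_iff₀ (by positivity)] at this; linarith
  have hη5 : 100 * η ≤ δ := by nlinarith
  set Y : Finset A := (Finset.range M ×ˢ Y0).image (fun z => (α ^ z.1).symm z.2) with hY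
  have hYm : ∀ i < M, ∀ y ∈ Y0, (α ^ i).symm y ∈ Y := fun i hi y hy =>
    Finset.mem_image.2 ⟨(i, y), Finset.mem_product.2 ⟨Finset.mem_range.2 hi, hy⟩, rfl⟩
  have hYn : ∀ y ∈ Y, ‖y‖ ≤ 1 := fun y hy => by
    obtain ⟨z, hz, rfl⟩ := Finset.mem_image.1 hy
    rw [nA]; exact hY0 _ (Finset.mem_product.1 hz).2
  obtain ⟨v, hv, W, hW, p, w, V, hV, a1, hp, a2, a3, a4, w1, w2, a5, a6, a7, a8⟩ := TW G hU (M := M) (N := M + K) (by omega) (by rw [hM]; exact AI_pow hai L) Y hη0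
  set β := adj W hW α with hβ
  have hβU : PUO β := PUO_inner hU (k := 1) le_rfl hW (fun x => by rw [hβ, adj_apply, pow_one])
  set γ := adj V hV (β ^ M) with hγ
  have hγU : PUO γ := PUO_inner hβU (k := M) (by omega) hV (fun x => by rw [hγ, adj_apply])
  set u' := ι W * u with hu'
  have hu'u : u' ∈ unitary C := mul_mem (iota_un ι hW) hu
  have hcov' : ∀ a, u' * ι a * star u' = ι (β a) := cov_adj hcov hW
  set z := ι V * u' ^ M with hz
  have hzu : z ∈ unitary C := mul_mem (iota_un ι hV) (pow_mem hu'u M)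
  have hcz : ∀ a, z * ι a * star z = ι (γ a) := cov_adj (γ := β ^ M) (cov_pow hcov' M) hV
  have a7' : ∀ y, y ∈ Y ∨ y = v ∨ y = p → ‖γ y - y‖ ≤ η := fun y hy => by rw [hγ, adj_apply]; exact (a7 y hy).le
  have nv := un_norm hv
  have hsv : ‖star v * p - p * star v‖ ≤ η := by
    have := a4.le
    rw [← norm_star, star_sub, star_mul, star_mul, hp.st] at this
    rwa [norm_sub_rev]
  obtain ⟨D1, P1, hD1, e1, e2, e3, e4⟩ := hL2 γ hγU z hzu hcz (insert v (insert (star v) (insert p Y))) (by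
    intro y hy
    simp only [Finset.mem_insert] at hy
    rcases hy with rfl | rfl | rfl | hy
    · exact ⟨nv, (a7' _ (Or.inr (Or.inl rfl))).trans η1⟩
    · refine ⟨by rw [norm_star]; exact nv, ?_⟩
      rw [map_star, ← star_sub, norm_star]
      exact (a7' _ (Or.inr (Or.inl rfl))).trans η1
    · exact ⟨hp.norm_le, (a7' _ (Or.inr (Or.inr rfl))).trans η1⟩
    · exact ⟨hYn y hy, (a7' _ (Or.inl hy)).trans η1⟩)
  have hip := iota_proj ι hp
  obtain ⟨D0, f, hD0, hfp, s0, hcut⟩ := cutdown (ι := ι) (τ := τ) hD1 hip hδ0 hδ1 (e1 p (by simp)) e4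
  have hpf : ι p * f = f := mul_swap hD0.pr hip hfp
  have cm : ∀ x y : A, ‖ι x * ι y - ι y * ι x‖ ≤ ‖x * y - y * x‖ := fun x y => by
    rw [← map_mul, ← map_mul, ← map_sub]; exact iota_le ι _
  have ay : ∀ y ∈ Y, Ap D0 f (ι y) (3000 * δ') := fun y hy =>
    hcut _ ((iota_le ι _).trans (hYn y hy)) (e1 y (by simp [hy])) ((cm _ _).trans ((a3 y hy).le.trans η2))
  have av : Ap D0 f (ι v) (3000 * δ') := hcut _ ((iota_le ι _).trans nv) (e1 v (by simp)) ((cm _ _).trans (a4.le.trans η2))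
  have asv : Ap D0 f (ι (star v)) (3000 * δ') := hcut _ ((iota_le ι _).trans (by rw [norm_star]; exact nv)) (e1 _ (by simp)) ((cm _ _).trans (hsv.trans η2))
  have hzs : star z * z = 1 := (Unitary.mem_iff.1 hzu).1
  have czp : ‖z * ι p - ι p * z‖ ≤ η := by
    have : z * ι p - ι p * z = ι (γ p - p) * z := by
      rw [map_sub, ← hcz, sub_mul, mul_assoc (z * ι p), hzs, mul_one]
    rw [this]
    exact (unr (un_norm hzu) _).trans ((iota_le ι _).trans (a7' p (by simp)))
  have czp' : ‖star z * ι p - ι p * star z‖ ≤ η := by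
    have := czp
    rw [← norm_star, star_sub, star_mul z, star_mul (ι p), hip.st] at this
    rwa [norm_sub_rev]
  have az : Ap D0 f z (3000 * δ') := hcut _ (un_norm hzu) e2 (czp.trans η2)
  have asz : Ap D0 f (star z) (3000 * δ') := hcut _ (un_norm' hzu) e3 (czp'.trans η2)
  have prod : ∀ x y : C, ‖x‖ ≤ 1 → ‖y‖ ≤ 1 → Ap D0 f x (3000 * δ') → Ap D0 f y (3000 * δ') → Ap D0 f (x * y) (9000 * δ' + 9000000 * δ' ^ 2) := by
    intro x y hx hy h1 h2
    refine (Ap.mul hD0 h1 h2).mono ?_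
    nlinarith [norm_nonneg x, norm_nonneg y]
  have hfin : 9000 * δ' + 9000000 * δ' ^ 2 ≤ 18000 * δ' := by nlinarith
  have hui : ∀ i, star (u' ^ i) * u' ^ i = 1 := fun i => (Unitary.mem_iff.1 (pow_mem hu'u i)).1
  have hui' : ∀ i, u' ^ i * star (u' ^ i) = 1 := fun i => (Unitary.mem_iff.1 (pow_mem hu'u i)).2
  have hVs : ι (V * star V) = 1 := by rw [(Unitary.mem_iff.1 hV).2, map_one]
  have hwv : ‖ι w - ι (star V * v * p)‖ ≤ η := by rw [← map_sub]; exact (iota_le ι _).trans a6.le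
  have z1 : Ap D0 f (star (ι w) * u' ^ M) (18000 * δ' + 3 * η) := by
    refine ((prod (ι (star v)) z ((iota_le ι _).trans (by rw [norm_star]; exact nv)) (un_norm hzu) asv az).mono hfin).near' ?_
    have h1 : (star (ι w) * u' ^ M - ι (star v) * z) * f = star (ι w - ι (star V * v * p)) * u' ^ M * f
        + (-((ι (star v) * ι p - ι p * ι (star v)) * z) - ι (star v) * (z * ι p - ι p * z)) * f := by
      have h2 : star (ι (star V * v * p)) * u' ^ M = ι p * ι (star v) * z := by
        rw [hz, ← map_star, star_mul, star_mul, star_star, hp.st, map_mul, map_mul]; noncomm_ring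
      rw [star_sub, sub_mul (star (ι w)) (star (ι (star V * v * p))), h2]
      have h3 : ι (star v) * z * f = ι (star v) * z * (ι p * f) := by rw [hpf]
      rw [sub_mul (star (ι w) * u' ^ M), h3]; noncomm_ring
    rw [h1]
    refine (norm_add_le _ _).trans ?_
    have n1 := (unr hD0.pr.norm_le (star (ι w - ι (star V * v * p)) * u' ^ M)).trans ((unr (un_norm (pow_mem hu'u M)) _).trans ((norm_star _).trans_le hwv))
    have n2 := (unr hD0.pr.norm_le (-((ι (star v) * ι p - ι p * ι (star v)) * z) - ι (star v) * (z * ι p - ι p * z))).trans (norm_sub_le _ _)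
    rw [norm_neg] at n2
    have n3 := (unr (un_norm hzu) (ι (star v) * ι p - ι p * ι (star v))).trans ((cm _ _).trans hsv)
    have n4 := (unl ((iota_le ι (star v)).trans (by rw [norm_star]; exact nv)) (z * ι p - ι p * z)).trans czp
    linarith
  have z2 : Ap D0 f (star (u' ^ M) * ι w) (18000 * δ' + 3 * η) := by
    refine ((prod (star z) (ι v) (un_norm' hzu) ((iota_le ι _).trans nv) asz av).mono hfin).near' ?_
    have h1 : (star (u' ^ M) * ι w - star z * ι v) * f = star (u' ^ M) * (ι w - ι (star V * v * p)) * f := by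
      have h2 : star z * ι v * f = star (u' ^ M) * ι (star V * v * p) * f := by
        rw [map_mul, ← mul_assoc, mul_assoc _ (ι p), hpf, hz, star_mul, map_mul, map_star]; noncomm_ring
      rw [sub_mul, h2]; noncomm_ring
    rw [h1]
    have n1 := (unr hD0.pr.norm_le (star (u' ^ M) * (ι w - ι (star V * v * p)))).trans ((unl (un_norm' (pow_mem hu'u M)) _).trans hwv)
    linarith
  have htp : 0 ≤ tr τ p := tr_nonneg G.htr hp.nonneg
  obtain ⟨t1, t2⟩ := tower G hU ι hp a2
  push_cast at t1 t2 a8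
  obtain ⟨D, P, hD, hS, hx, hu1, hu2⟩ := berg2 (ι := ι) G hU (u := u') (p := ι p) (w := ι w) (f := f) (M := M) (K := K) hu'u hK1 hM1
    hip hD0 hfp
    (fun i hi j hj hij => by rw [cov_pow hcov', cov_pow hcov', ← map_mul, a2 i hi j hj hij, map_zero])
    (by rw [← map_star, ← map_mul, w1]) (by rw [← map_star, ← map_mul, w2, cov_pow hcov'])
    (t0 := t') (t1 := 1 - (M + K) * tr τ p) (tp := tr τ p) ht0.le (by linarith) htp s0
    (by simp only [cov_pow hcov']; exact t2) (Sub.of G hU ι hp)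
  have huu : ‖u - u'‖ ≤ η := by
    rw [hu', show u - ι W * u = -(ι (W - 1) * u) by rw [map_sub, map_one]; noncomm_ring, norm_neg]
    exact (unr (un_norm hu) _).trans ((iota_le ι _).trans a1.le)
  have huu' : ‖star u - star u'‖ ≤ η := by rw [← star_sub, norm_star]; exact huu
  refine ⟨D, P, hD, ?_, ?_, ?_, ?_⟩
  · intro y hy
    have hMη : η ≤ M * η := by nlinarith
    refine (hx (ι y) (3000 * δ' + 5 * M * η) fun i hi => ?_).mono (by nlinarith)
    set y' := (α ^ i).symm y with hy'
    have hyY := hYm i hi y hy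
    have hαy : (α ^ i) y' = y := pow_symm α i y
    set x := star (u' ^ i) * ι y * u' ^ i with hxd
    have hxy : ‖x - ι y'‖ ≤ 2 * M * η := by
      have : x - ι y' = star (u' ^ i) * ι ((α ^ i) y' - (β ^ i) y') * u' ^ i := by
        rw [map_sub, mul_sub, sub_mul, cov_inv hu'u hcov', hαy]
      rw [this]
      refine (unr (un_norm (pow_mem hu'u i)) _).trans ((unl (un_norm' (pow_mem hu'u i)) _).trans ((iota_le ι _).trans ?_))
      rw [norm_sub_rev]
      refine (adj_pow hW (fun x => adj_apply hW α x) i y').trans ?_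
      have h1 := hYn _ hyY
      have h2 : (i:ℝ) ≤ M := by exact_mod_cast hi.le
      calc 2 * (i:ℝ) * ‖W - 1‖ * ‖y'‖ ≤ 2 * M * η * 1 := by gcongr
        _ = _ := mul_one _
    have gen : ∀ b : C, ‖b‖ ≤ 1 → ‖ι y' * b - b * ι y'‖ ≤ η → ‖x * b - b * x‖ ≤ 3000 * δ' + 5 * M * η := by
      intro b hb h
      rw [show x * b - b * x = (x - ι y') * b - b * (x - ι y') + (ι y' * b - b * ι y') by noncomm_ring]
      have := (norm_add_le ((x - ι y') * b - b * (x - ι y')) (ι y' * b - b * ι y'))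
      have := norm_sub_le ((x - ι y') * b) (b * (x - ι y'))
      have := unr hb (x - ι y')
      have := unl hb (x - ι y')
      linarith
    refine ⟨gen _ hip.norm_le ((cm _ _).trans (a3 _ hyY).le), gen _ ((iota_le ι _).trans (pisom_norm hp w1)) ((cm _ _).trans (a5 _ hyY).le), ?_⟩
    exact ((ay _ hyY).near hD0 hxy).mono (by nlinarith)
  · exact ((hu1 _ z1).near hD huu).mono (by linarith)
  · exact ((hu2 _ z2).near hD huu').mono (by linarith)
  · refine hS.mono ?_
    have h1 : (K + 1) * tr τ p ≤ t / 4 := by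
      have h2 : 4 * (K + 1) < M * t := by rwa [div_lt_iff₀ ht] at hM2
      have h3 : M * tr τ p ≤ 1 := by nlinarith
      nlinarith
    nlinarith
end
end RK

namespace RK
set_option linter.all false

section
variable {A : Type*} [CStarAlgebra A] [PartialOrder A] [StarOrderedRing A] {τ : A →ₗ[ℂ] ℂ}
variable {C : Type*} [CStarAlgebra C] [PartialOrder C] [StarOrderedRing C] {ι : A →⋆ₐ[ℂ] C}

/-- integer powers of a unitary -/
noncomputable def uz (U : unitary C) (k : ℤ) : C := ((U ^ k : unitary C) : C)

theorem uz_zero (U : unitary C) : uz U 0 = 1 := by simp [uz]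
theorem uz_one (U : unitary C) : uz U 1 = U := by simp [uz]
theorem uz_add (U : unitary C) (j k : ℤ) : uz U (j + k) = uz U j * uz U k := by simp [uz, zpow_add]
theorem uz_star (U : unitary C) (k : ℤ) : star (uz U k) = uz U (-k) := by
  rw [uz, uz, zpow_neg]; rfl
theorem uz_mem (U : unitary C) (k : ℤ) : uz U k ∈ unitary C := (U ^ k).2
theorem uz_neg_one (U : unitary C) : uz U (-1) = star (U : C) := by rw [← uz_star, uz_one]

theorem uz_cov {α : A ≃⋆ₐ[ℂ] A} {U : unitary C} (hcov : ∀ a, (U : C) * ι a * star (U : C) = ι (α a)) (k : ℤ) (a : A) :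
    uz U k * ι a = ι ((α ^ k) a) * uz U k := by
  have h1 : star (U : C) * U = 1 := (Unitary.mem_iff.1 U.2).1
  have c1 : ∀ a, (U : C) * ι a = ι (α a) * U := fun a => by rw [← hcov, mul_assoc, h1, mul_one]
  have c2 : ∀ a, star (U : C) * ι a = ι (α⁻¹ a) * star (U : C) := fun a => by
    have h2 : α (α⁻¹ a) = a := α.apply_symm_apply a
    conv_lhs => rw [← h2, ← hcov]
    rw [← mul_assoc, ← mul_assoc, h1, one_mul]
  induction k using Int.induction_on generalizing a with
  | zero => simp [uz_zero]
  | succ k ih =>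
    rw [uz_add, uz_one, mul_assoc, c1, ← mul_assoc, ih, zpow_add, zpow_one, mul_assoc]; rfl
  | pred k ih =>
    rw [sub_eq_add_neg, uz_add, uz_neg_one, mul_assoc, c2, ← mul_assoc, ih, zpow_add, zpow_neg_one, mul_assoc]; rfl

/-- finite Fourier sums -/
noncomputable def Phi (ι : A →⋆ₐ[ℂ] C) (U : unitary C) : (ℤ →₀ A) →ₗ[ℂ] C :=
  Finsupp.lsum ℂ (fun k => (LinearMap.mulRight ℂ (uz U k)).comp (ι : A →ₐ[ℂ] C).toLinearMap)

theorem Phi_sum (U : unitary C) (f : ℤ →₀ A) (s : Finset ℤ) (hs : f.support ⊆ s) : Phi ι U f = ∑ k ∈ s, ι (f k) * uz U k := by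
  rw [Phi, Finsupp.lsum_apply, Finsupp.sum_of_support_subset f hs _ (by simp)]
  rfl

theorem Phi_single (U : unitary C) (k : ℤ) (a : A) : Phi ι U (Finsupp.single k a) = ι a * uz U k := by
  simp [Phi]

theorem cutPhi {α : A ≃⋆ₐ[ℂ] A} (hU : PUO α) {U : unitary C} (hcov : ∀ a, (U : C) * ι a * star (U : C) = ι (α a)) (f : ℤ →₀ A) {ε : ℝ} (hε : 0 < ε)
    {p : A} (hp : IsProjection p) : ∃ (n : ℕ) (q : Fin n → A), (∀ i, IsProjection (q i)) ∧ ∑ i, q i = p ∧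
      ∀ i, ‖ι (q i) * Phi ι U f * ι (q i) - ι (q i * f 0 * q i)‖ ≤ ε := by
  classical
  set s := f.support.erase 0 with hs
  let g : ℤ → A × ℕ := fun k => if 0 < k then (f k, k.toNat) else (star ((α ^ (-k).toNat) (f k)), (-k).toNat)
  obtain ⟨n, q, q1, q2, q3⟩ := uo_star hU (s.toList.map g) (by
    intro z hz
    obtain ⟨k, hk, rfl⟩ := List.mem_map.1 hz
    have : k ≠ 0 := by rw [Finset.mem_toList] at hk; exact (Finset.mem_erase.1 hk).1
    simp only [g]; split_ifs with h <;> simp <;> omega) (ε := ε / (s.card + 1)) (by positivity) p hp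
  refine ⟨n, q, q1, q2, fun i => ?_⟩
  have key : ∀ k ∈ s, ‖q i * f k * (α ^ k) (q i)‖ ≤ ε / (s.card + 1) := by
    intro k hk
    have h := (q3 i (g k) (List.mem_map.2 ⟨k, Finset.mem_toList.2 hk, rfl⟩)).le
    simp only [g] at h
    split_ifs at h with h0
    · obtain ⟨j, rfl⟩ := Int.eq_ofNat_of_zero_le h0.le
      simpa using h
    · obtain ⟨j, hj⟩ := Int.eq_ofNat_of_zero_le (show 0 ≤ -k by omega)
      obtain rfl : k = -(j : ℤ) := by omega
      simp only [neg_neg, Int.toNat_natCast] at h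
      rw [← nA (α ^ j), map_mul, map_mul]
      have h3 : (α ^ j) ((α ^ (-(j:ℤ))) (q i)) = q i := by
        rw [zpow_neg, zpow_natCast]; exact (α ^ j).apply_symm_apply _
      rw [h3, ← norm_star, star_mul, star_mul, (q1 i).st, ← map_star (α ^ j) (q i), (q1 i).st, ← mul_assoc]
      exact h
  have e : ι (q i) * Phi ι U f * ι (q i) - ι (q i * f 0 * q i) = ∑ k ∈ s, ι (q i * f k * (α ^ k) (q i)) * uz U k := by
    rw [Phi_sum U f (insert 0 s) (by rw [hs]; exact Finset.subset_insert_iff.2 le_rfl), Finset.sum_insert (by simp [hs]), uz_zero, mul_one, mul_add, add_mul,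
      ← map_mul, ← map_mul, add_sub_cancel_left, Finset.mul_sum, Finset.sum_mul]
    refine Finset.sum_congr rfl fun k _ => ?_
    rw [mul_assoc, mul_assoc, uz_cov hcov, map_mul, map_mul]; noncomm_ring
  rw [e]
  refine (norm_sum_le_of_le s (n := fun _ => ε / (s.card + 1)) fun k hk => (unr (un_norm (uz_mem U k)) _).trans ((iota_le ι _).trans (key k hk))).trans ?_
  rw [Finset.sum_const, nsmul_eq_mul, mul_div_assoc', div_le_iff₀ (by positivity)]
  nlinarith

theorem Phi_bound (G : Good τ) {α : A ≃⋆ₐ[ℂ] A} (hU : PUO α) (hι : Isometry ι) {U : unitary C} (hcov : ∀ a, (U : C) * ι a * star (U : C) = ι (α a)) (f : ℤ →₀ A) :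
    ‖τ (f 0)‖ ≤ ‖Phi ι U f‖ := by
  have hin : ∀ x, ‖ι x‖ = ‖x‖ := fun x => by
    have := hι.dist_eq x 0; rwa [map_zero, dist_zero_right, dist_zero_right] at this
  have key : ∀ f : ℤ →₀ A, tr τ (f 0) ≤ ‖Phi ι U f‖ := by
    intro f
    refine le_of_forall_pos_le_add fun ε hε => ?_
    obtain ⟨n, q, q1, q2, q3⟩ := cutPhi (ι := ι) hU hcov f hε proj_one
    have h1 : ∀ i, ‖q i * f 0 * q i‖ ≤ ‖Phi ι U f‖ + ε := fun i => by
      rw [← hin]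
      rw [show ι (q i * f 0 * q i) = ι (q i) * Phi ι U f * ι (q i) - (ι (q i) * Phi ι U f * ι (q i) - ι (q i * f 0 * q i)) by abel]
      have hn := (iota_proj ι (q1 i)).norm_le
      exact (norm_sub_le _ _).trans (add_le_add ((unr hn _).trans (unl hn _)) (q3 i))
    have h2 : ∀ i, tr τ (q i * f 0) ≤ (‖Phi ι U f‖ + ε) * tr τ (q i) := fun i => by
      have h3 := abs_tr_mul_le G.htr (q i * f 0 * q i) (q i) (q1 i).nonneg
      rw [mul_assoc _ (q i) (q i), (q1 i).mm, tr_comm G.htr, ← mul_assoc, (q1 i).mm] at h3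
      have := mul_le_mul_of_nonneg_right (h1 i) (tr_nonneg G.htr (q1 i).nonneg)
      linarith [le_abs_self (tr τ (q i * f 0))]
    have h4 : tr τ (f 0) = ∑ i, tr τ (q i * f 0) := by rw [← tr_sum, ← Finset.sum_mul, q2, one_mul]
    have h5 : ∑ i, tr τ (q i) = 1 := by rw [← tr_sum, q2, tr_one G.htr]
    rw [h4]
    refine (Finset.sum_le_sum fun i _ => h2 i).trans ?_
    rw [← Finset.mul_sum, h5, mul_one]
  obtain ⟨c, hc, h⟩ : ∃ c : ℂ, ‖c‖ = 1 ∧ (‖τ (f 0)‖ : ℂ) = c * τ (f 0) := by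
    by_cases h0 : τ (f 0) = 0
    · exact ⟨1, by simp, by simp [h0]⟩
    · refine ⟨‖τ (f 0)‖ / τ (f 0), ?_, by field_simp⟩
      rw [norm_div]; simp [h0]
  have h1 := key (c • f)
  rw [map_smul, norm_smul, hc, one_mul] at h1
  have h2 : tr τ ((c • f) 0) = ‖τ (f 0)‖ := by
    rw [tr, Finsupp.smul_apply, map_smul, smul_eq_mul, ← h, Complex.ofReal_re]
  rwa [h2] at h1

theorem Phi_dense {α : A ≃⋆ₐ[ℂ] A} {U : unitary C} (hcov : ∀ a, (U : C) * ι a * star (U : C) = ι (α a))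
    (hgen : (StarAlgebra.adjoin ℂ (Set.range ι ∪ {(U : C)})).topologicalClosure = ⊤) (x : C) : x ∈ closure (LinearMap.range (Phi ι U) : Set C) := by
  have h1 : ∀ k a, ι a * uz U k ∈ LinearMap.range (Phi ι U) := fun k a => ⟨Finsupp.single k a, Phi_single U k a⟩
  have hind : ∀ {p : C → Prop}, (∀ k a, p (ι a * uz U k)) → (∀ x y, p x → p y → p (x + y)) → p 0 → ∀ x ∈ LinearMap.range (Phi ι U), p x := by
    rintro p hp ha h0 _ ⟨f, rfl⟩
    induction f using Finsupp.induction_linear with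
    | zero => simpa using h0
    | add f g hf hg => rw [map_add]; exact ha _ _ hf hg
    | single k a => rw [Phi_single]; exact hp k a
  let S : StarSubalgebra ℂ C :=
    { carrier := LinearMap.range (Phi ι U)
      add_mem' := fun ha hb => add_mem ha hb
      mul_mem' := fun {x y} hx hy => by
        show x * y ∈ LinearMap.range (Phi ι U)
        refine hind (p := fun x => x * y ∈ LinearMap.range (Phi ι U)) (fun k a => ?_) (fun x y hx hy => by simpa [add_mul] using add_mem hx hy) (by simp) x hx
        refine hind (p := fun y => ι a * uz U k * y ∈ LinearMap.range (Phi ι U)) (fun l b => ?_) (fun x y hx hy => by simpa [mul_add] using add_mem hx hy) (by simp) y hy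
        rw [mul_assoc, ← mul_assoc (uz U k), uz_cov hcov, mul_assoc, ← uz_add, ← mul_assoc, ← map_mul]
        exact h1 _ _
      algebraMap_mem' := fun c => by
        have := h1 0 (algebraMap ℂ A c)
        rwa [uz_zero, mul_one, AlgHomClass.commutes] at this
      star_mem' := fun {x} hx => by
        show star x ∈ LinearMap.range (Phi ι U)
        refine hind (p := fun x => star x ∈ LinearMap.range (Phi ι U)) (fun k a => ?_) (fun x y hx hy => by simpa using add_mem hx hy) (by simp) x hx
        rw [star_mul, uz_star, ← map_star, uz_cov hcov]
        exact h1 _ _ }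
  have hle : StarAlgebra.adjoin ℂ (Set.range ι ∪ {(U : C)}) ≤ S := by
    refine StarAlgebra.adjoin_le ?_
    rintro _ (⟨a, rfl⟩ | rfl)
    · have := h1 0 a; rwa [uz_zero, mul_one] at this
    · have := h1 1 1; rwa [uz_one, map_one, one_mul] at this
  have hx : x ∈ (StarAlgebra.adjoin ℂ (Set.range ι ∪ {(U : C)})).topologicalClosure := by rw [hgen]; trivial
  rw [← SetLike.mem_coe, StarSubalgebra.topologicalClosure_coe] at hx
  exact closure_mono hle hx

open scoped ComplexOrder in
theorem exT (G : Good τ) {α : A ≃⋆ₐ[ℂ] A} (hU : PUO α) (hι : Isometry ι) {U : unitary C} (hcov : ∀ a, (U : C) * ι a * star (U : C) = ι (α a))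
    (hgen : (StarAlgebra.adjoin ℂ (Set.range ι ∪ {(U : C)})).topologicalClosure = ⊤) :
    ∃ T : C →ₗ[ℂ] ℂ, IsTracialState T ∧ (∀ f, T (Phi ι U f) = τ (f 0)) := by
  classical
  set R := LinearMap.range (Phi ι U) with hR
  have hb := Phi_bound G hU hι hcov
  obtain ⟨s, hs⟩ := (Phi ι U).rangeRestrict.exists_rightInverse_of_surjective (LinearMap.range_rangeRestrict _)
  let ψ0 : R →ₗ[ℂ] ℂ := (τ.comp (Finsupp.lapply 0)).comp s
  have hs' : ∀ x : R, Phi ι U (s x) = x := fun x => congrArg Subtype.val (LinearMap.congr_fun hs x)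
  let ψ : R →L[ℂ] ℂ := ψ0.mkContinuous 1 (fun x => by
    rw [one_mul]; have := hb (s x); rw [hs'] at this; exact this)
  obtain ⟨T, hT, -⟩ := exists_extension_norm_eq R ψ
  have hTf : ∀ f, T (Phi ι U f) = τ (f 0) := fun f => by
    have h1 : T (Phi ι U f) = τ ((s ⟨Phi ι U f, ⟨f, rfl⟩⟩) 0) := hT ⟨Phi ι U f, ⟨f, rfl⟩⟩
    have h2 := hb (s ⟨Phi ι U f, ⟨f, rfl⟩⟩ - f)
    rw [map_sub, hs', sub_self, norm_zero, Finsupp.sub_apply, map_sub] at h2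
    rw [h1]; exact sub_eq_zero.1 (norm_le_zero_iff.1 h2)
  have hTs : ∀ k a, T (ι a * uz U k) = if k = 0 then τ a else 0 := fun k a => by
    rw [← Phi_single, hTf, Finsupp.single_apply]; split_ifs <;> simp
  have hden := Phi_dense hcov hgen
  have hPf : ∀ f, Phi ι U f = ∑ k ∈ f.support, ι (f k) * uz U k := fun f => Phi_sum U f _ subset_rfl
  have hmul : ∀ j k a b, T ((ι a * uz U j) * (ι b * uz U k)) = T ((ι b * uz U k) * (ι a * uz U j)) := by
    intro j k a b
    have e : ∀ j k a b, (ι a * uz U j) * (ι b * uz U k) = ι (a * (α ^ j) b) * uz U (j + k) := fun j k a b => by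
      rw [mul_assoc, ← mul_assoc (uz U j), uz_cov hcov, mul_assoc, ← uz_add, ← mul_assoc, ← map_mul]
    rw [e, e, hTs, hTs, add_comm k j]
    split_ifs with h
    · obtain rfl : k = -j := by omega
      have h1 : (α ^ j) (b * (α ^ (-j)) a) = (α ^ j) b * a := by
        rw [map_mul, zpow_neg]; congr 1; exact (α ^ j).apply_symm_apply a
      rw [← G.tau_inv (α ^ j) (b * (α ^ (-j)) a), h1]
      exact G.htr.2.2 _ _
    · rfl
  have hcomm : ∀ x y : C, T (x * y) = T (y * x) := by
    intro x y
    have h1 : ∀ f g, T (Phi ι U f * Phi ι U g) = T (Phi ι U g * Phi ι U f) := by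
      intro f g
      rw [hPf, hPf, Finset.sum_mul_sum, Finset.sum_mul_sum, Finset.sum_comm]
      simp only [map_sum]
      exact Finset.sum_congr rfl fun i _ => Finset.sum_congr rfl fun j _ => hmul _ _ _ _
    have h2 : ∀ y ∈ R, ∀ x, T (x * y) = T (y * x) := by
      rintro _ ⟨g, rfl⟩ x
      have hc : IsClosed {x | T (x * Phi ι U g) = T (Phi ι U g * x)} := isClosed_eq (by fun_prop) (by fun_prop)
      exact (hc.closure_subset_iff.2 (by rintro _ ⟨f, rfl⟩; exact h1 f g)) (hden x)
    have hc : IsClosed {y | T (x * y) = T (y * x)} := isClosed_eq (by fun_prop) (by fun_prop)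
    exact (hc.closure_subset_iff.2 (fun y hy => h2 y hy x)) (hden y)
  refine ⟨T, ⟨?_, ?_, hcomm⟩, hTf⟩
  · have h1 : ∀ x, 0 ≤ T (star x * x) := by
      intro x
      have hc : IsClosed {x | 0 ≤ T (star x * x)} := isClosed_le continuous_const (by fun_prop)
      refine (hc.closure_subset_iff.2 ?_) (hden x)
      rintro _ ⟨f, rfl⟩
      show 0 ≤ T (star (Phi ι U f) * Phi ι U f)
      have e1 : ∀ j k a b, T (star (ι a * uz U j) * (ι b * uz U k)) = if k = j then τ (star a * b) else 0 := by
        intro j k a b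
        rw [hcomm, star_mul, mul_assoc, ← mul_assoc (uz U k), uz_star, ← uz_add, ← mul_assoc, hcomm, ← mul_assoc, ← map_star, ← map_mul, hTs]
        simp only [add_neg_eq_zero]
      rw [hPf, star_sum, Finset.sum_mul_sum, map_sum]
      refine Finset.sum_nonneg fun j hj => ?_
      rw [map_sum]
      refine Finset.sum_nonneg fun k hk => ?_
      rw [e1]
      split_ifs with h
      · subst h
        obtain ⟨r, hr, h⟩ := G.htr.1 (f k)
        rw [h]; exact_mod_cast hr
      · exact le_rfl
    intro x
    have h2 := h1 x
    rw [Complex.nonneg_iff] at h2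
    exact ⟨(T (star x * x)).re, h2.1, Complex.ext rfl (by rw [Complex.ofReal_im]; exact h2.2.symm)⟩
  · have := hTs 0 1
    rw [map_one, uz_zero, mul_one, if_pos rfl, G.htr.2.1] at this
    exact this

end
end RK

namespace RK
set_option linter.all false

section
variable {A : Type*} [CStarAlgebra A] [PartialOrder A] [StarOrderedRing A] {τ : A →ₗ[ℂ] ℂ}
variable {C : Type*} [CStarAlgebra C] [PartialOrder C] [StarOrderedRing C] {ι : A →⋆ₐ[ℂ] C}

theorem iota_mono (ι : A →⋆ₐ[ℂ] C) {x y : A} (h : x ≤ y) : ι x ≤ ι y := by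
  obtain ⟨b, hb⟩ := CStarAlgebra.nonneg_iff_eq_star_mul_self.1 (sub_nonneg.2 h)
  rw [← sub_nonneg, ← map_sub, hb, map_mul, map_star]
  exact star_mul_self_nonneg _

/-- every nonzero positive element of `C` dominates a nonzero projection of `A` -/
theorem D0 (G : Good τ) {α : A ≃⋆ₐ[ℂ] A} (hU : PUO α) (hι : Isometry ι) {U : unitary C} (hcov : ∀ a, (U : C) * ι a * star (U : C) = ι (α a))
    (hgen : (StarAlgebra.adjoin ℂ (Set.range ι ∪ {(U : C)})).topologicalClosure = ⊤) (hC : IsSimpleCStar C) {a : C} (ha : 0 ≤ a) (ha0 : a ≠ 0) :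
    ∃ q : A, IsProjection q ∧ q ≠ 0 ∧ ∀ e, (∃ x, star x * x = e ∧ ι q * x = x) → CuntzLE e a := by
  obtain ⟨T, hT, hTf⟩ := exT G hU hι hcov hgen
  have hsa : star a = a := ha.isSelfAdjoint.star_eq
  have hb0 : 0 ≤ a * a := by have := star_mul_self_nonneg a; rwa [hsa] at this
  have hbne : a * a ≠ 0 := fun h => ha0 (by
    have : star a * a = 0 := by rw [hsa, h]
    exact CStarRing.star_mul_self_eq_zero_iff a |>.1 this)
  have hTb := tr_pos hT hC hb0 hbne
  obtain ⟨s, hs⟩ : ∃ s, s = tr T (a * a) / 2 := ⟨_, rfl⟩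
  have hs0 : 0 < s := by linarith
  obtain ⟨_, ⟨f, rfl⟩, hf⟩ := Metric.mem_closure_iff.1 (Phi_dense hcov hgen (a * a)) (s / 4) (by linarith)
  rw [dist_eq_norm] at hf
  obtain ⟨h, hh⟩ : ∃ h, h = (1/2 : ℝ) • (f 0 + star (f 0)) := ⟨_, rfl⟩
  have hhs : star h = h := by rw [hh, star_smul, star_add, star_star, add_comm]; simp
  have htrh : tr τ h = tr T (Phi ι U f) := by
    rw [hh, tr_smul, tr_add, tr_star G.htr]
    have : tr T (Phi ι U f) = tr τ (f 0) := by rw [tr, hTf, tr]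
    rw [this]; ring
  have h1 := tr_diff hT (a * a) (Phi ι U f)
  have h2 : 0 < tr τ (h - s • 1) := by
    rw [tr_sub, tr_smul, tr_one G.htr, htrh]
    linarith [le_abs_self (tr T (a * a) - tr T (Phi ι U f))]
  obtain ⟨g, c, hc, hg, hg0, hgc⟩ := specproj G hU (h := h - s • 1) (by rw [star_sub, star_smul, hhs]; simp) h2
  have hsg : s • g ≤ g * h * g := by
    have e : g * (h - s • 1) * g = g * h * g - s • g := by
      rw [mul_sub, sub_mul, mul_smul_comm, mul_one, smul_mul_assoc, hg.mm]
    rw [e] at hgc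
    exact sub_nonneg.1 ((smul_nonneg hc.le hg.nonneg).trans hgc)
  obtain ⟨n, q, q1, q2, q3⟩ := cutPhi (ι := ι) hU hcov f (show 0 < s / 4 by linarith) hg
  obtain ⟨i, hi⟩ : ∃ i, q i ≠ 0 := by
    by_contra hcon
    push Not at hcon
    exact hg0 (by rw [← q2]; exact Finset.sum_eq_zero fun i _ => hcon i)
  have hqg : q i * g = q i := (sum_orth hg q1 q2).1 i
  have hgq : g * q i = q i := by have := congrArg star hqg; rwa [star_mul, hg.st, (q1 i).st] at this
  refine ⟨q i, q1 i, hi, fun e he => cuntz_of (iota_proj ι (q1 i)) hsa (half_pos hs0) ?_ he⟩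
  have h3 : s • q i ≤ q i * h * q i := by
    have := conj_mono (q i) hsg
    rw [(q1 i).st] at this
    rwa [mul_smul_comm, hqg, smul_mul_assoc, (q1 i).mm, show q i * (g * h * g) * q i = (q i * g) * h * (g * q i) by noncomm_ring, hqg, hgq] at this
  have h4 := iota_mono ι h3
  obtain ⟨Q, hQ⟩ : ∃ Q, Q = ι (q i) := ⟨_, rfl⟩
  have hQp : IsProjection Q := hQ ▸ iota_proj ι (q1 i)
  obtain ⟨k, hk⟩ : ∃ k, k = Q * (a * a) * Q - ι (q i * f 0 * q i) := ⟨_, rfl⟩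
  have hkn : ‖k‖ ≤ s / 2 := by
    have e : k = Q * (a * a - Phi ι U f) * Q + (Q * Phi ι U f * Q - ι (q i * f 0 * q i)) := by rw [hk]; noncomm_ring
    have h5 : ‖Q * (a * a - Phi ι U f) * Q‖ ≤ s / 4 := (unr hQp.norm_le _).trans ((unl hQp.norm_le _).trans hf.le)
    have h6 := q3 i
    rw [← hQ] at h6
    rw [e]
    linarith [norm_add_le (Q * (a * a - Phi ι U f) * Q) (Q * Phi ι U f * Q - ι (q i * f 0 * q i))]
  have hd : Q * (a * a) * Q - ι (q i * h * q i) = (1/2 : ℝ) • (k + star k) := by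
    have e1 : star k = Q * (a * a) * Q - Q * ι (star (f 0)) * Q := by
      rw [hk, map_mul, map_mul, ← hQ]
      simp only [star_sub, star_mul, hQp.st, hsa, ← map_star, mul_assoc]
    have e2 : ι (q i * h * q i) = (1/2 : ℝ) • (Q * ι (f 0) * Q + Q * ι (star (f 0)) * Q) := by
      have e3 : (1/2 : ℝ) • (f 0 + star (f 0)) = (1/2 : ℂ) • (f 0 + star (f 0)) := by
        rw [← Complex.coe_smul]; norm_num
      have e4 : ∀ y : C, (1/2 : ℝ) • y = (1/2 : ℂ) • y := fun y => by rw [← Complex.coe_smul]; norm_num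
      rw [hh, e3, e4, mul_smul_comm, smul_mul_assoc, map_smul, mul_add, add_mul, map_add, map_mul, map_mul, map_mul, map_mul, ← hQ]
    rw [e1, e2, hk, map_mul, map_mul, ← hQ]
    module
  have hdn : ‖(1/2 : ℝ) • (k + star k)‖ ≤ s / 2 := by
    rw [norm_smul]
    have := norm_add_le k (star k)
    rw [norm_star] at this
    norm_num; linarith
  have h7 := conj_mono Q (sa_bounds (x := (1/2 : ℝ) • (k + star k)) (by rw [IsSelfAdjoint, star_smul, star_add, star_star, add_comm]; simp) hdn).2
  rw [hQp.st, ← hd, Algebra.algebraMap_eq_smul_one, mul_neg, neg_mul, mul_smul_comm, mul_one, smul_mul_assoc, hQp.mm] at h7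
  have e8 : Q * (Q * (a * a) * Q - ι (q i * h * q i)) * Q = Q * (a * a) * Q - ι (q i * h * q i) := by
    rw [map_mul, map_mul, ← hQ]
    rw [show Q * (Q * (a * a) * Q - Q * ι h * Q) * Q = (Q * Q) * (a * a) * (Q * Q) - (Q * Q) * ι h * (Q * Q) by noncomm_ring, hQp.mm]
  rw [e8] at h7
  have h9 : ι (s • q i) = s • Q := by
    rw [← Complex.coe_smul, map_smul, ← hQ, Complex.coe_smul]
  rw [h9] at h4
  rw [← hQ]
  have h10 := add_le_add h4 h7
  calc (s / 2) • Q = s • Q + -((s / 2) • Q) := by module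
    _ ≤ _ := h10
    _ = _ := by abel

/-- elements controlled by `A` and `u` -/
def Ctl (ι : A →⋆ₐ[ℂ] C) (u x : C) : Prop := ∀ ε > 0, ∃ δ > 0, ∃ Y : Finset A, (∀ y ∈ Y, ‖y‖ ≤ 1) ∧
  ∀ (D : NonUnitalStarSubalgebra ℂ C) (P : C), FDU D P → (∀ y ∈ Y, Ap D P (ι y) δ) → Ap D P u δ → Ap D P (star u) δ → Ap D P x ε

theorem Ctl.two {u x y : C} (hx : Ctl ι u x) (hy : Ctl ι u y) {ε : ℝ} (hε : 0 < ε) : ∃ δ > 0, ∃ Y : Finset A, (∀ y ∈ Y, ‖y‖ ≤ 1) ∧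
    ∀ (D : NonUnitalStarSubalgebra ℂ C) (P : C), FDU D P → (∀ y ∈ Y, Ap D P (ι y) δ) → Ap D P u δ → Ap D P (star u) δ → Ap D P x ε ∧ Ap D P y ε := by
  classical
  obtain ⟨d, d0, Y, hY, h⟩ := hx ε hε
  obtain ⟨d', d0', Y', hY', h'⟩ := hy ε hε
  refine ⟨min d d', lt_min d0 d0', Y ∪ Y', fun y hy => (Finset.mem_union.1 hy).elim (hY y) (hY' y), fun D P hD h1 h2 h3 => ?_⟩
  exact ⟨h D P hD (fun y hy => (h1 y (Finset.mem_union_left _ hy)).mono (min_le_left _ _)) (h2.mono (min_le_left _ _)) (h3.mono (min_le_left _ _)),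
    h' D P hD (fun y hy => (h1 y (Finset.mem_union_right _ hy)).mono (min_le_right _ _)) (h2.mono (min_le_right _ _)) (h3.mono (min_le_right _ _))⟩

theorem Ctl.add {u x y : C} (hx : Ctl ι u x) (hy : Ctl ι u y) : Ctl ι u (x + y) := by
  intro ε hε
  obtain ⟨d, d0, Y, hY, h⟩ := hx.two hy (half_pos hε)
  refine ⟨d, d0, Y, hY, fun D P hD h1 h2 h3 => ?_⟩
  obtain ⟨⟨p, p1, p2⟩, ⟨q, q1, q2⟩⟩ := h D P hD h1 h2 h3
  refine ⟨p + q, add_mem p1 q1, ?_⟩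
  rw [show (x + y) * P - (p + q) = (x * P - p) + (y * P - q) by noncomm_ring]
  linarith [norm_add_le (x * P - p) (y * P - q)]

theorem Ctl.mul {u x y : C} (hx : Ctl ι u x) (hy : Ctl ι u y) : Ctl ι u (x * y) := by
  intro ε hε
  have hη : 0 < min 1 (ε / (‖x‖ + ‖y‖ + 1)) := lt_min one_pos (by positivity)
  obtain ⟨d, d0, Y, hY, h⟩ := hx.two hy hη
  refine ⟨d, d0, Y, hY, fun D P hD h1 h2 h3 => ?_⟩
  obtain ⟨p, q⟩ := h D P hD h1 h2 h3
  refine (Ap.mul hD p q).mono ?_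
  have e1 := min_le_left 1 (ε / (‖x‖ + ‖y‖ + 1))
  have e2 := min_le_right 1 (ε / (‖x‖ + ‖y‖ + 1))
  rw [le_div_iff₀ (by positivity)] at e2
  nlinarith

theorem Ctl.scal (u : C) (c : ℂ) : Ctl ι u (algebraMap ℂ C c) := by
  intro ε hε
  refine ⟨1, one_pos, ∅, by simp, fun D P hD _ _ _ => ⟨c • P, D.smul_mem c hD.mem, ?_⟩⟩
  rw [Algebra.algebraMap_eq_smul_one, smul_mul_assoc, one_mul, sub_self, norm_zero]
  exact hε.le

theorem Ctl.iota (u : C) (a : A) : Ctl ι u (ι a) := by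
  have h : ι a = algebraMap ℂ C ((‖a‖ + 1 : ℝ) : ℂ) * ι (((‖a‖ + 1 : ℝ) : ℂ)⁻¹ • a) := by
    have : ((‖a‖ + 1 : ℝ) : ℂ) ≠ 0 := by exact_mod_cast (by positivity : (‖a‖ + 1 : ℝ) ≠ 0)
    rw [map_smul, Algebra.algebraMap_eq_smul_one, smul_mul_assoc, one_mul, smul_smul, mul_inv_cancel₀ this, one_smul]
  rw [h]
  refine (Ctl.scal u _).mul fun ε hε => ⟨ε, hε, {((‖a‖ + 1 : ℝ) : ℂ)⁻¹ • a}, ?_, fun D P hD h1 _ _ => h1 _ (by simp)⟩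
  intro y hy
  rw [Finset.mem_singleton.1 hy, norm_smul, norm_inv, Complex.norm_real, Real.norm_of_nonneg (by positivity), inv_mul_le_iff₀ (by positivity)]
  linarith

theorem Ctl.all {u : C} (hgen : (StarAlgebra.adjoin ℂ (Set.range ι ∪ {u})).topologicalClosure = ⊤) (x : C) : Ctl ι u x := by
  have hu : Ctl ι u u := fun ε hε => ⟨ε, hε, ∅, by simp, fun D P hD _ h _ => h⟩
  have hu' : Ctl ι u (star u) := fun ε hε => ⟨ε, hε, ∅, by simp, fun D P hD _ _ h => h⟩
  let S : StarSubalgebra ℂ C :=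
    { carrier := {x | Ctl ι u x ∧ Ctl ι u (star x)}
      add_mem' := fun {x y} ha hb => ⟨ha.1.add hb.1, by rw [star_add]; exact ha.2.add hb.2⟩
      mul_mem' := fun {x y} ha hb => ⟨ha.1.mul hb.1, by rw [star_mul]; exact hb.2.mul ha.2⟩
      algebraMap_mem' := fun c => ⟨Ctl.scal u c, by rw [← algebraMap_star_comm]; exact Ctl.scal u _⟩
      star_mem' := fun {x} ha => ⟨ha.2, by rw [star_star]; exact ha.1⟩ }
  have hle : StarAlgebra.adjoin ℂ (Set.range ι ∪ {u}) ≤ S := by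
    refine StarAlgebra.adjoin_le ?_
    rintro _ (⟨a, rfl⟩ | rfl)
    · exact ⟨Ctl.iota u a, by rw [← map_star]; exact Ctl.iota u _⟩
    · exact ⟨hu, hu'⟩
  have hx : x ∈ (StarAlgebra.adjoin ℂ (Set.range ι ∪ {u})).topologicalClosure := by rw [hgen]; trivial
  rw [← SetLike.mem_coe, StarSubalgebra.topologicalClosure_coe] at hx
  have hx' : x ∈ closure (S : Set C) := closure_mono hle hx
  intro ε hε
  obtain ⟨y, hy, hxy⟩ := Metric.mem_closure_iff.1 hx' (ε / 2) (half_pos hε)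
  rw [dist_eq_norm] at hxy
  obtain ⟨d, d0, Y, hY, h⟩ := hy.1 (ε / 2) (half_pos hε)
  exact ⟨d, d0, Y, hY, fun D P hD h1 h2 h3 => ((h D P hD h1 h2 h3).near hD hxy.le).mono (by linarith)⟩

theorem Ctl.fin {u : C} (hx : ∀ x, Ctl ι u x) (F : Finset C) {ε : ℝ} (hε : 0 < ε) : ∃ δ > 0, ∃ Y : Finset A, (∀ y ∈ Y, ‖y‖ ≤ 1) ∧
    ∀ (D : NonUnitalStarSubalgebra ℂ C) (P : C), FDU D P → (∀ y ∈ Y, Ap D P (ι y) δ) → Ap D P u δ → Ap D P (star u) δ → ∀ x ∈ F, Ap D P x ε ∧ Ap D P (star x) ε := by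
  classical
  induction F using Finset.induction_on with
  | empty => exact ⟨1, one_pos, ∅, by simp, by simp⟩
  | insert x F _ ih =>
    obtain ⟨d, d0, Y, hY, h⟩ := ih
    obtain ⟨d', d0', Y', hY', h'⟩ := (hx x).two (hx (star x)) hε
    refine ⟨min d d', lt_min d0 d0', Y ∪ Y', fun y hy => (Finset.mem_union.1 hy).elim (hY y) (hY' y), fun D P hD h1 h2 h3 z hz => ?_⟩
    rcases Finset.mem_insert.1 hz with rfl | hz
    · exact h' D P hD (fun y hy => (h1 y (Finset.mem_union_right _ hy)).mono (min_le_right _ _)) (h2.mono (min_le_right _ _)) (h3.mono (min_le_right _ _))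
    · exact h D P hD (fun y hy => (h1 y (Finset.mem_union_left _ hy)).mono (min_le_left _ _)) (h2.mono (min_le_left _ _)) (h3.mono (min_le_left _ _)) z hz

theorem Ap.cut {D : NonUnitalStarSubalgebra ℂ C} {P x : C} {ε : ℝ} (hD : FDU D P) (h : Ap D P x ε) :
    (∃ d ∈ D, ‖P * x * P - d‖ ≤ ε) ∧ ‖x * P - P * x * P‖ ≤ 2 * ε := by
  obtain ⟨d, h1, h2⟩ := h
  have e : ‖P * x * P - d‖ ≤ ε := by
    rw [show P * x * P - d = P * (x * P - d) by rw [mul_sub, (hD.un d h1).1, mul_assoc]]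
    exact (unl hD.pr.norm_le _).trans h2
  refine ⟨⟨d, h1, e⟩, ?_⟩
  rw [show x * P - P * x * P = (x * P - d) - (P * x * P - d) by abel]
  linarith [norm_sub_le (x * P - d) (P * x * P - d)]

theorem part2 (G : Good τ) {α : A ≃⋆ₐ[ℂ] A} (hU : PUO α) {r : ℕ} (hr : 1 ≤ r) (hai : ApproxInner ((⇑α)^[r])) (hι : Isometry ι) {u : C} (hu : u ∈ unitary C)
    (hcov : ∀ a, u * ι a * star u = ι (α a)) (hgen : (StarAlgebra.adjoin ℂ (Set.range ι ∪ {u})).topologicalClosure = ⊤) (hC : IsSimpleCStar C) :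
    TracialRankZero C := by
  intro F ε hε a ha ha0
  obtain ⟨q, hq, hq0, hqa⟩ := D0 G hU hι (U := ⟨u, hu⟩) hcov hgen hC (isPos_iff.1 ha) ha0
  have hq1 := tr_pos G.htr G.simple hq.nonneg hq0
  obtain ⟨δ, hδ, Y, hY, h⟩ := Ctl.fin (Ctl.all hgen) F (show 0 < ε / 8 by linarith)
  obtain ⟨D, P, hD, h1, h2, h3, h4⟩ := ML G hU hr hai ι hu hcov Y hY hδ (half_pos hq1)
  have h5 := h D P hD h1 h2 h3
  refine ⟨D, P, hD.fd, hD.pr, hD.mem, hD.un, fun x hx => ?_, fun x hx => ?_, hqa _ (h4 q hq (by linarith))⟩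
  · have e1 := ((h5 x hx).1.cut hD).2
    have e2 := ((h5 x hx).2.cut hD).2
    rw [← norm_star, show star (star x * P - P * star x * P) = P * x - P * x * P by simp [star_mul, hD.pr.st, mul_assoc]] at e2
    rw [show x * P - P * x = (x * P - P * x * P) - (P * x - P * x * P) by abel]
    linarith [norm_sub_le (x * P - P * x * P) (P * x - P * x * P)]
  · obtain ⟨d, d1, d2⟩ := ((h5 x hx).1.cut hD).1
    exact ⟨d, d1, by linarith⟩

end
end RK

/-- Let `A` be a unital separable simple C*-algebra with `TR(A) = 0` and
a unique tracial state, and let `α` be an automorphism such that `α ^ r` is approximately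
inner for some `r ≥ 1` and `α ^ m` is uniformly outer for every nonzero integer `m`. Then
`α` has the tracial cyclic Rokhlin property; moreover if `C` is a unital simple C*-algebra
with the SP-property containing `A` (via the unital isometric *-embedding `ι`) with the
same unit, and `u ∈ C` is a unitary implementing `α` on `A` such that `C` is generated as a
C*-algebra by `A ∪ {u}`, then `TR(C) = 0`. -/
theorem stmt13 {A : Type*} [CStarAlgebra A] [TopologicalSpace.SeparableSpace A]
    (hAsimple : IsSimpleCStar A) (hATR : TracialRankZero A)
    (huniq : ∃! τ : A →ₗ[ℂ] ℂ, IsTracialState τ)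
    (α : A ≃⋆ₐ[ℂ] A)
    (r : ℕ) (hr : 1 ≤ r) (hai : ApproxInner ((⇑α)^[r]))
    (hout : ∀ m : ℤ, m ≠ 0 → UniformlyOuter (autZPow α m)) :
    TracialCyclicRokhlin α ∧
    ∀ (C : Type*) (_ : CStarAlgebra C),
      IsSimpleCStar C → SPProperty C →
      ∀ (ι : A →⋆ₐ[ℂ] C), Isometry ι →
      ∀ u : C, u ∈ unitary C →
      (∀ a : A, u * ι a * star u = ι (α a)) →
      (StarAlgebra.adjoin ℂ (Set.range ι ∪ {u})).topologicalClosure = ⊤ →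
      TracialRankZero C := by
  classical
  letI := CStarAlgebra.spectralOrder A
  letI := CStarAlgebra.spectralOrderedRing A
  obtain ⟨τ, hτ, hu⟩ := huniq
  have G : RK.Good τ := ⟨hτ, hAsimple, hATR, hu⟩
  have hU := RK.PUO_of hout
  refine ⟨RK.part1 G hU hr hai, ?_⟩
  intro C _ hC _ ι hι u hu hcov hgen
  letI := CStarAlgebra.spectralOrder C
  letI := CStarAlgebra.spectralOrderedRing C
  exact RK.part2 G hU hr hai hι hu hcov hgen hC
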